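/- Let n = 2 and let D be a nonsingular 2×2 real symmetric matrix. Then for every q > 10/3 and p with 1/p + 2/q < 1, and for every bounded set B ⊂ ℂ², there is a constant C such that ‖E_γ f‖_{L^q(ℂ³)} ≤ C ‖f‖_{L^p(ℂ²)} for every f supported in B. -/

import Mathlib

open MeasureTheory ENNReal Matrix

noncomputable section

/-- The real pairing `ζ ⊙ η = Re ⟨ζ, η⟩ = Re (∑ ζⱼ conj ηⱼ)` on `ℂ^m`,
i.e. the standard inner product on `ℝ^{2m}`. -/
def odot (m : ℕ) (z w : Fin m → ℂ) : ℝ :=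
  ∑ j, ((z j).re * (w j).re + (z j).im * (w j).im)

/-- The real pairing `Re (a * conj b)` of two complex numbers. -/
def odot1 (a b : ℂ) : ℝ := a.re * b.re + a.im * b.im

/-- The complex quadratic form `z ↦ ½ zᵗ D z` on `ℂ^n` associated to a real
matrix `D`. -/
def quadD (n : ℕ) (D : Matrix (Fin n) (Fin n) ℝ) (z : Fin n → ℂ) : ℂ :=
  (1 / 2 : ℂ) * ∑ i, ∑ j, (D i j : ℂ) * z i * z j

/-- The extension operator `E_γ` for the complex quadratic surface
`γ(z) = (z, ½ zᵗ D z) ⊆ ℂ^{n+1}`, where `ℂ^{n+1}` is identified with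
`(Fin n → ℂ) × ℂ`: `E_γ f (w) = ∫_{ℂ^n} e^{2πi (w ⊙ γ(z))} f(z) dz`. -/
def extGamma (n : ℕ) (D : Matrix (Fin n) (Fin n) ℝ) (f : (Fin n → ℂ) → ℂ)
    (w : (Fin n → ℂ) × ℂ) : ℂ :=
  ∫ z : Fin n → ℂ, Complex.exp (2 * Real.pi * Complex.I *
    ((odot n w.1 z + odot1 w.2 (quadD n D z) : ℝ) : ℂ)) * f z

/-- `S` is a closed cube in `ℂ^n ≅ ℝ^{2n}`. -/
def IsClosedCubeC (n : ℕ) (S : Set (Fin n → ℂ)) : Prop :=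
  ∃ (a : Fin n → ℂ) (r : ℝ), 0 ≤ r ∧
    S = {z | ∀ j, |(z j).re - (a j).re| ≤ r ∧ |(z j).im - (a j).im| ≤ r}

open scoped FourierTransform RealInnerProductSpace SchwartzMap in
theorem Lp_fourier_toLp_ae_eq {E : Type*} [NormedAddCommGroup E] [InnerProductSpace ℝ E]
    [FiniteDimensional ℝ E] [MeasurableSpace E] [BorelSpace E] {k : E → ℂ}
    (h2 : MemLp k 2) (h1 : Integrable k) :
    (𝓕 (h2.toLp k) : Lp ℂ 2 (volume : Measure E)) =ᵐ[volume] (𝓕 k : E → ℂ) := by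
  have hcont : Continuous (𝓕 k : E → ℂ) :=
    VectorFourier.fourierIntegral_continuous Real.continuous_fourierChar
      (by exact continuous_inner) h1
  refine ae_eq_of_integral_contDiff_smul_eq
    ((Lp.memLp _).locallyIntegrable (by norm_num)) hcont.locallyIntegrable ?_
  intro g hg hgs
  have hgs' : HasCompactSupport (fun x => (g x : ℂ)) := hgs.comp_left Complex.ofReal_zero
  let G : 𝓢(E, ℂ) := hgs'.toSchwartzMap (Complex.ofRealCLM.contDiff.comp hg)
  have hG : ∀ x, G x = (g x : ℂ) := fun x => rfl
  have e1 : ∫ x, G x • (𝓕 (h2.toLp k) : Lp ℂ 2 (volume : Measure E)) x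
      = ∫ x, (𝓕 G) x • k x := by
    rw [← Lp.toTemperedDistribution_apply, ← Lp.fourier_toTemperedDistribution_eq,
      TemperedDistribution.fourier_apply, Lp.toTemperedDistribution_apply]
    refine integral_congr_ae ?_
    filter_upwards [h2.coeFn_toLp] with x hx
    rw [hx]
  have e2 : ∫ x, (𝓕 G) x • k x = ∫ x, G x • (𝓕 k : E → ℂ) x := by
    have := VectorFourier.integral_fourierIntegral_smul_eq_flip (L := innerₗ E)
      (μ := volume) (ν := volume) (f := G) (g := k)
      Real.continuous_fourierChar (by exact continuous_inner) G.integrable h1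
    rw [SchwartzMap.fourier_coe]
    simpa using! this
  have := e1.trans e2
  simp only [hG] at this
  simpa [Complex.real_smul] using this

/-- The character `t ↦ exp (2 π i t)`. -/
def ee (t : ℝ) : ℂ := Complex.exp (2 * Real.pi * Complex.I * (t : ℂ))

theorem ee_add (s t : ℝ) : ee (s + t) = ee s * ee t := by
  simp only [ee, ← Complex.exp_add]; congr 1; push_cast; ring

theorem ee_zero : ee 0 = 1 := by simp [ee]

theorem ee_neg (t : ℝ) : ee (-t) = (starRingEnd ℂ) (ee t) := by
  simp only [ee, ← Complex.exp_conj]; congr 1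
  simp [Complex.conj_ofReal, map_ofNat]

@[simp] theorem norm_ee (t : ℝ) : ‖ee t‖ = 1 := by
  rw [ee, show 2 * (Real.pi:ℂ) * Complex.I * (t:ℂ) = ((2 * Real.pi * t : ℝ):ℂ) * Complex.I by
    push_cast; ring]
  exact Complex.norm_exp_ofReal_mul_I _

@[simp] theorem enorm_ee (t : ℝ) : ‖ee t‖ₑ = 1 := by
  rw [← ofReal_norm, norm_ee]; simp

@[fun_prop] theorem continuous_ee : Continuous ee := by unfold ee; fun_prop

/-- The pairing `Re (y₁ w₁ + y₂ w₂)` on `ℂ²`. -/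
def dotc (y w : ℂ × ℂ) : ℝ := (y.1 * w.1 + y.2 * w.2).re

/-- The Fourier transform on `ℂ²` for the pairing `dotc`. -/
def FT (k : ℂ × ℂ → ℂ) (y : ℂ × ℂ) : ℂ := ∫ w, ee (dotc y w) * k w

/-- `y ↦ - conj y`, as a map from `ℂ²` to its Euclidean model. -/
def negConjE (y : ℂ × ℂ) : WithLp 2 (ℂ × ℂ) :=
  WithLp.toLp 2 (-(starRingEnd ℂ) y.1, -(starRingEnd ℂ) y.2)

theorem measurePreserving_negConj : MeasurePreserving (fun z : ℂ => -(starRingEnd ℂ) z) := by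
  have := (Complex.conjLIE.trans (LinearIsometryEquiv.neg ℝ (E := ℂ))).measurePreserving
  simpa using! this

theorem measurePreserving_negConjE : MeasurePreserving negConjE :=
  (WithLp.volume_preserving_toLp ℂ ℂ).comp
    (measurePreserving_negConj.prod measurePreserving_negConj)

open scoped FourierTransform in
theorem FT_eq_fourier (k : ℂ × ℂ → ℂ) (y : ℂ × ℂ) :
    FT k y = 𝓕 (fun w : WithLp 2 (ℂ × ℂ) => k (WithLp.ofLp w)) (negConjE y) := by
  rw [FT, Real.fourier_eq', ← (WithLp.volume_preserving_toLp ℂ ℂ).integral_comp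
    (MeasurableEquiv.toLp 2 (ℂ × ℂ)).measurableEmbedding]
  refine integral_congr_ae (Filter.Eventually.of_forall fun w => ?_)
  have : ((-2 * Real.pi * inner ℝ (WithLp.toLp 2 w) (negConjE y) : ℝ) : ℂ) * Complex.I
      = 2 * Real.pi * Complex.I * (dotc y w : ℂ) := by
    have h : inner ℝ (WithLp.toLp 2 w) (negConjE y) = - dotc y w := by
      simp [dotc, negConjE, Complex.inner]
      ring
    rw [h]; push_cast; ring
  simp only [smul_eq_mul, ee, this]

theorem surjective_compMeasurePreserving {α β : Type*} [MeasurableSpace α] [MeasurableSpace β]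
    {μ : Measure α} {ν : Measure β} {f : α → β} {g : β → α} (hf : MeasurePreserving f μ ν)
    (hg : MeasurePreserving g ν μ) (hfg : ∀ x, g (f x) = x) :
    Function.Surjective (Lp.compMeasurePreservingₗᵢ (p := 2) (E := ℂ) ℂ f hf) := by
  intro k
  refine ⟨Lp.compMeasurePreserving g hg k, Lp.ext ?_⟩
  have h1 := Lp.coeFn_compMeasurePreserving (Lp.compMeasurePreserving g hg k) hf
  have h2 := hf.quasiMeasurePreserving.ae (Lp.coeFn_compMeasurePreserving k hg)
  filter_upwards [h1, h2] with x hx1 hx2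
  have : (Lp.compMeasurePreservingₗᵢ (p := 2) (E := ℂ) ℂ f hf)
    (Lp.compMeasurePreserving g hg k) = Lp.compMeasurePreserving f hf
    (Lp.compMeasurePreserving g hg k) := rfl
  rw [this, hx1, Function.comp_apply, hx2, Function.comp_apply, hfg]

theorem measurePreserving_negConj_ofLp : MeasurePreserving
    (fun w : WithLp 2 (ℂ × ℂ) => WithLp.ofLp (negConjE (WithLp.ofLp w))) :=
  (WithLp.volume_preserving_ofLp ℂ ℂ).comp
    (measurePreserving_negConjE.comp (WithLp.volume_preserving_ofLp ℂ ℂ))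

open scoped FourierTransform in
/-- Plancherel: `FT` extends to a unitary operator of `L²(ℂ²)`. -/
theorem exists_fourier_isometry :
    ∃ S : Lp ℂ 2 (volume : Measure (ℂ × ℂ)) ≃ₗᵢ[ℂ] Lp ℂ 2 (volume : Measure (ℂ × ℂ)),
      ∀ (k : ℂ × ℂ → ℂ) (h2 : MemLp k 2) (_ : Integrable k), S (h2.toLp k) =ᵐ[volume] FT k := by
  let I1 := LinearIsometryEquiv.ofSurjective _ (surjective_compMeasurePreserving
    (WithLp.volume_preserving_ofLp ℂ ℂ) (WithLp.volume_preserving_toLp ℂ ℂ) (fun _ => rfl))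
  let I2 := LinearIsometryEquiv.ofSurjective _ (surjective_compMeasurePreserving
    measurePreserving_negConjE measurePreserving_negConj_ofLp
    (fun y => by simp [negConjE]))
  refine ⟨(I1.trans (Lp.fourierTransformₗᵢ (WithLp 2 (ℂ × ℂ)) ℂ)).trans I2, fun k h2 h1 => ?_⟩
  have m1 : MemLp (fun w : WithLp 2 (ℂ × ℂ) => k (WithLp.ofLp w)) 2 :=
    h2.comp_measurePreserving (WithLp.volume_preserving_ofLp ℂ ℂ)
  have n1 : Integrable (fun w : WithLp 2 (ℂ × ℂ) => k (WithLp.ofLp w)) :=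
    (WithLp.volume_preserving_ofLp ℂ ℂ).integrable_comp_of_integrable h1
  have e1 : I1 (h2.toLp k) = m1.toLp _ := Lp.toLp_compMeasurePreserving h2 _
  have e2 := Lp_fourier_toLp_ae_eq m1 n1
  have e3 := Lp.coeFn_compMeasurePreserving
    (𝓕 (m1.toLp _) : Lp ℂ 2 (volume : Measure (WithLp 2 (ℂ × ℂ)))) measurePreserving_negConjE
  have e4 := measurePreserving_negConjE.quasiMeasurePreserving.ae e2
  filter_upwards [e3, e4] with y h3 h4
  rw [FT_eq_fourier, ← h4]
  refine Eq.trans ?_ h3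
  rw [LinearIsometryEquiv.trans_apply, LinearIsometryEquiv.trans_apply, e1]
  rfl

theorem FT_lintegral_sq {k : ℂ × ℂ → ℂ} (h2 : MemLp k 2) (h1 : Integrable k) :
    ∫⁻ y, ‖FT k y‖ₑ ^ 2 = ∫⁻ w, ‖k w‖ₑ ^ 2 := by
  obtain ⟨S, hS⟩ := exists_fourier_isometry
  have e : ∀ g : ℂ × ℂ → ℂ, ∫⁻ y, ‖g y‖ₑ ^ 2 = (eLpNorm g 2 volume) ^ 2 := fun g => by
    rw [eLpNorm_eq_lintegral_rpow_enorm_toReal (by norm_num) (by norm_num), ← ENNReal.rpow_natCast,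
      ← ENNReal.rpow_mul]
    simp
  rw [e, e, ← eLpNorm_congr_ae (hS k h2 h1)]
  have : ‖S (h2.toLp k)‖ₑ = ‖h2.toLp k‖ₑ := by
    rw [← ofReal_norm, ← ofReal_norm, S.norm_map]
  rw [Lp.enorm_def, Lp.enorm_def, eLpNorm_congr_ae h2.coeFn_toLp] at this
  rw [this]

/-- The phase of the extension operator of the surface `(u, v, uv)`. -/
def ph (c : ℂ) (y w : ℂ × ℂ) : ℝ := (y.1 * w.1 + y.2 * w.2 + c * (w.1 * w.2)).re

theorem measurable_ph' (c : ℂ) (y : ℂ × ℂ) : Continuous fun w => ph c y w := by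
  unfold ph; fun_prop

/-- The extension operator of the surface `(u, v, uv)`, with the variable `c` dual to `uv`. -/
def EE (f : ℂ × ℂ → ℂ) (c : ℂ) (y : ℂ × ℂ) : ℂ := ∫ w, ee (ph c y w) * f w

/-- Modulation by the third coordinate. -/
def modu (c : ℂ) (f : ℂ × ℂ → ℂ) (w : ℂ × ℂ) : ℂ := ee ((c * (w.1 * w.2)).re) * f w

theorem EE_eq_FT (f : ℂ × ℂ → ℂ) (c : ℂ) (y : ℂ × ℂ) : EE f c y = FT (modu c f) y := by
  unfold EE FT modu
  refine integral_congr_ae (Filter.Eventually.of_forall fun w => ?_)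
  simp only [← mul_assoc, ← ee_add]
  congr 2
  simp [ph, dotc]; ring

theorem enorm_modu (c : ℂ) (f : ℂ × ℂ → ℂ) (w : ℂ × ℂ) : ‖modu c f w‖ₑ = ‖f w‖ₑ := by
  simp [modu, enorm_mul]

theorem aesm_modu (c : ℂ) {f : ℂ × ℂ → ℂ} (hf : AEStronglyMeasurable f) :
    AEStronglyMeasurable (modu c f) := by
  unfold modu
  exact (Continuous.aestronglyMeasurable (by fun_prop)).mul hf

theorem memLp_modu (c : ℂ) {f : ℂ × ℂ → ℂ} {p : ℝ≥0∞} (hf : MemLp f p) : MemLp (modu c f) p :=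
  hf.mono (aesm_modu c hf.1) (Filter.Eventually.of_forall fun w => by
    simp [modu])

theorem integrable_modu (c : ℂ) {f : ℂ × ℂ → ℂ} (hf : Integrable f) : Integrable (modu c f) :=
  memLp_one_iff_integrable.1 (memLp_modu c (memLp_one_iff_integrable.2 hf))

theorem EE_lintegral_sq {f : ℂ × ℂ → ℂ} (h2 : MemLp f 2) (h1 : Integrable f) (c : ℂ) :
    ∫⁻ y, ‖EE f c y‖ₑ ^ 2 = ∫⁻ w, ‖f w‖ₑ ^ 2 := by
  simp only [EE_eq_FT]
  rw [FT_lintegral_sq (memLp_modu c h2) (integrable_modu c h1)]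
  simp only [enorm_modu]

theorem enorm_EE_le (f : ℂ × ℂ → ℂ) (c : ℂ) (y : ℂ × ℂ) : ‖EE f c y‖ₑ ≤ ∫⁻ w, ‖f w‖ₑ := by
  refine (enorm_integral_le_lintegral_enorm _).trans (le_of_eq ?_)
  simp [enorm_mul]

theorem continuous_EE {f : ℂ × ℂ → ℂ} (hf : Integrable f) :
    Continuous fun p : ℂ × (ℂ × ℂ) => EE f p.1 p.2 := by
  unfold EE
  refine continuous_of_dominated (bound := fun w => ‖f w‖) ?_ ?_ hf.norm ?_
  · intro p
    exact ((continuous_ee.comp (measurable_ph' _ _)).aestronglyMeasurable).mul hf.1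
  · intro p; exact Filter.Eventually.of_forall fun w => by simp
  · refine Filter.Eventually.of_forall fun w => ?_
    have : Continuous fun p : ℂ × (ℂ × ℂ) => ph p.1 p.2 w := by unfold ph; fun_prop
    exact (continuous_ee.comp this).mul continuous_const

theorem EE_congr_ae {f g : ℂ × ℂ → ℂ} (h : f =ᵐ[volume] g) (c : ℂ) (y : ℂ × ℂ) :
    EE f c y = EE g c y := by
  unfold EE
  refine integral_congr_ae ?_
  filter_upwards [h] with w hw
  rw [hw]

theorem integrable_ee_mul {f : ℂ × ℂ → ℂ} (hf : Integrable f) (c : ℂ) (y : ℂ × ℂ) :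
    Integrable fun w => ee (ph c y w) * f w :=
  hf.bdd_mul (c := 1) ((continuous_ee.comp (measurable_ph' _ _)).aestronglyMeasurable)
    (Filter.Eventually.of_forall fun w => by simp)

theorem EE_sum {ι : Type*} (s : Finset ι) {f : ι → ℂ × ℂ → ℂ} (hf : ∀ i ∈ s, Integrable (f i))
    (c : ℂ) (y : ℂ × ℂ) : EE (fun w => ∑ i ∈ s, f i w) c y = ∑ i ∈ s, EE (f i) c y := by
  unfold EE
  simp only [Finset.mul_sum]
  exact integral_finsetSum _ fun i hi => integrable_ee_mul (hf i hi) c y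

theorem continuous_FT {k : ℂ × ℂ → ℂ} (hk : Integrable k) : Continuous (FT k) := by
  have := (continuous_EE hk).comp (Continuous.prodMk_right (0 : ℂ))
  have h0 : modu 0 k = k := by ext w; simp [modu, ee_zero]
  refine this.congr fun y => ?_
  simp [EE_eq_FT, h0]

theorem inner_eq_integral (f g : Lp ℂ 2 (volume : Measure (ℂ × ℂ))) :
    inner ℂ f g = ∫ w, (starRingEnd ℂ) (f w) * g w := by
  rw [L2.inner_def]
  simp [RCLike.inner_apply, mul_comm]

theorem conj_FT_conj (G : ℂ × ℂ → ℂ) (x : ℂ × ℂ) :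
    (starRingEnd ℂ) (FT (fun w => (starRingEnd ℂ) (G w)) x) = FT G (-x) := by
  unfold FT
  rw [← integral_conj]
  refine integral_congr_ae (Filter.Eventually.of_forall fun w => ?_)
  simp only [map_mul, Complex.conj_conj, ← ee_neg]
  congr 2
  simp [dotc]; ring

/-- Splitting a function with weights on the Fourier side. -/
theorem exists_fourier_split {ι : Type*} [Fintype ι] {k : ℂ × ℂ → ℂ} (h2 : MemLp k 2)
    (h1 : Integrable k) {w : ι → ℂ × ℂ → ℝ} (hw : ∀ B, Measurable (w B))
    (hw0 : ∀ B x, 0 ≤ w B x) (hw1 : ∀ x, ∑ B, w B x = 1) :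
    ∃ F : ι → ℂ × ℂ → ℂ, (∀ B, MemLp (F B) 2) ∧ ((fun x => ∑ B, F B x) =ᵐ[volume] k) ∧
      ∑ B, ∫⁻ x, ‖F B x‖ₑ ^ 2 ≤ ∫⁻ x, ‖k x‖ₑ ^ 2 ∧
      ∀ (B) (G : ℂ × ℂ → ℂ), MemLp G 2 → Integrable G →
        ∫ x, F B x * G x = ∫ x, w B x * FT k x * FT G (-x) := by
  obtain ⟨S, hS⟩ := exists_fourier_isometry
  have e : ∀ g : ℂ × ℂ → ℂ, ∫⁻ y, ‖g y‖ₑ ^ 2 = (eLpNorm g 2 volume) ^ 2 := fun g => by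
    rw [eLpNorm_eq_lintegral_rpow_enorm_toReal (by norm_num) (by norm_num), ← ENNReal.rpow_natCast,
      ← ENNReal.rpow_mul]
    simp
  have hwle : ∀ B x, w B x ≤ 1 := fun B x => by
    rw [← hw1 x]; exact Finset.single_le_sum (fun i _ => hw0 i x) (Finset.mem_univ B)
  have hV : MemLp (FT k) 2 := (memLp_congr_ae (hS k h2 h1)).1 (Lp.memLp _)
  have hwV : ∀ B, MemLp (fun x => (w B x : ℂ) * FT k x) 2 := fun B =>
    hV.mono (((Complex.measurable_ofReal.comp (hw B)).aestronglyMeasurable).mul hV.1)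
      (Filter.Eventually.of_forall fun x => by
        rw [norm_mul, Complex.norm_real, Real.norm_of_nonneg (hw0 B x)]
        exact mul_le_of_le_one_left (norm_nonneg _) (hwle B x))
  let F0 : ι → Lp ℂ 2 (volume : Measure (ℂ × ℂ)) := fun B => S.symm ((hwV B).toLp _)
  have hSF : ∀ B, S (F0 B) =ᵐ[volume] fun x => (w B x : ℂ) * FT k x := fun B => by
    simp only [F0, LinearIsometryEquiv.apply_symm_apply]
    exact (hwV B).coeFn_toLp
  refine ⟨fun B => F0 B, fun B => Lp.memLp _, ?_, ?_, ?_⟩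
  · have h : S (∑ B, F0 B) = S (h2.toLp k) := by
      rw [map_sum]
      refine Lp.ext ?_
      refine (Lp.coeFn_finsetSum _ _).trans ?_
      have h' : ∀ᵐ x, ∀ B, S (F0 B) x = (w B x : ℂ) * FT k x := ae_all_iff.2 hSF
      filter_upwards [h', hS k h2 h1] with x hx hx2
      rw [hx2, Finset.sum_apply, Finset.sum_congr rfl fun B _ => hx B, ← Finset.sum_mul,
        ← Complex.ofReal_sum, hw1]
      simp
    have h3 := S.injective h
    have h4 := Lp.coeFn_finsetSum (Finset.univ) F0
    rw [h3] at h4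
    filter_upwards [h4, h2.coeFn_toLp] with x hx hx2
    rw [← hx2, hx, Finset.sum_apply]
  · have hB : ∀ B, ∫⁻ x, ‖F0 B x‖ₑ ^ 2 = ∫⁻ x, ENNReal.ofReal (w B x) ^ 2 * ‖FT k x‖ₑ ^ 2 := by
      intro B
      have : ‖S (F0 B)‖ₑ = ‖F0 B‖ₑ := by
        rw [← ofReal_norm, ← ofReal_norm, S.norm_map]
      rw [Lp.enorm_def, Lp.enorm_def, eLpNorm_congr_ae (hSF B)] at this
      rw [e, ← this, ← e]
      refine lintegral_congr fun x => ?_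
      rw [enorm_mul, mul_pow, ← ofReal_norm (w B x : ℂ), Complex.norm_real,
        Real.norm_of_nonneg (hw0 B x)]
    have hm : Measurable fun x => ‖FT k x‖ₑ := (continuous_FT h1).enorm.measurable
    rw [Finset.sum_congr rfl fun B _ => hB B, ← lintegral_finsetSum _ fun B _ => by
      have := hw B; fun_prop, ← FT_lintegral_sq h2 h1]
    refine lintegral_mono fun x => ?_
    simp only
    rw [← Finset.sum_mul]
    refine mul_le_of_le_one_left' ?_
    calc ∑ B, ENNReal.ofReal (w B x) ^ 2 ≤ ∑ B, ENNReal.ofReal (w B x) := by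
          refine Finset.sum_le_sum fun B _ => ?_
          rw [sq]
          exact mul_le_of_le_one_left' (by simpa using hwle B x)
      _ = 1 := by
          rw [← ENNReal.ofReal_sum_of_nonneg fun B _ => hw0 B x, hw1]; simp
  · intro B G hG2 hG1
    have hc2 : MemLp (fun x => (starRingEnd ℂ) (G x)) 2 := hG2.star
    have hc1 : Integrable (fun x => (starRingEnd ℂ) (G x)) := by
      rw [← memLp_one_iff_integrable] at hG1 ⊢; exact hG1.star
    have h := S.inner_map_map (hc2.toLp _) (F0 B)
    rw [inner_eq_integral, inner_eq_integral] at h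
    calc ∫ x, F0 B x * G x = ∫ x, (starRingEnd ℂ) ((hc2.toLp _ : Lp ℂ 2 volume) x) * F0 B x := by
          refine integral_congr_ae ?_
          filter_upwards [hc2.coeFn_toLp] with x hx
          rw [hx, Complex.conj_conj, mul_comm]
      _ = _ := h.symm
      _ = _ := by
          refine integral_congr_ae ?_
          filter_upwards [hSF B, hS _ hc2 hc1] with x hx1 hx2
          rw [hx1, hx2, conj_FT_conj]; ring

/-- The weight `(1 + |z|)⁻¹`. -/
def wb (z : ℂ) : ℝ≥0∞ := (1 + ‖z‖ₑ)⁻¹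

@[fun_prop] theorem continuous_wb : Continuous wb := by
  unfold wb
  exact (continuous_const.add continuous_enorm).inv

@[fun_prop] theorem measurable_wb : Measurable wb := continuous_wb.measurable

theorem wb_le_one (z : ℂ) : wb z ≤ 1 := by
  rw [wb, ENNReal.inv_le_one]; exact le_self_add

theorem wb_ne_top (z : ℂ) : wb z ≠ ∞ := ne_top_of_le_ne_top one_ne_top (wb_le_one z)

theorem wb_ne_zero (z : ℂ) : wb z ≠ 0 := by
  simp [wb, ENNReal.inv_eq_zero]

theorem wb_inv (z : ℂ) : (wb z)⁻¹ = 1 + ‖z‖ₑ := by simp [wb]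

theorem wb_neg (z : ℂ) : wb (-z) = wb z := by simp [wb]

/-- Comparison of the weight with a multiple of its argument. -/
theorem wb_le_of_le {x y : ℂ} {K : ℝ≥0∞} (hK0 : K ≠ 0) (hK : K ≠ ∞)
    (h : 1 + ‖x‖ₑ ≤ K * (1 + ‖y‖ₑ)) : wb y ≤ K * wb x := by
  unfold wb
  rw [← ENNReal.inv_le_inv, ENNReal.mul_inv (Or.inl hK0) (Or.inl hK), inv_inv, inv_inv, mul_comm,
    ← div_eq_mul_inv]
  exact ENNReal.div_le_of_le_mul' h

theorem wb_mul_le (x y : ℂ) : wb x * wb y ≤ wb (x + y) := by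
  unfold wb
  rw [← ENNReal.mul_inv (by simp) (by simp), ENNReal.inv_le_inv]
  calc 1 + ‖x + y‖ₑ ≤ 1 + (‖x‖ₑ + ‖y‖ₑ) := by gcongr; exact enorm_add_le _ _
    _ ≤ 1 + (‖x‖ₑ + ‖y‖ₑ) + ‖x‖ₑ * ‖y‖ₑ := le_self_add
    _ = _ := by ring

theorem wb_le_mul_inv (x y : ℂ) : wb x ≤ wb (x + y) * (1 + ‖y‖ₑ) := by
  rw [← wb_inv y, ← div_eq_mul_inv,
    ENNReal.le_div_iff_mul_le (Or.inl (wb_ne_zero y)) (Or.inl (wb_ne_top y))]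
  exact wb_mul_le x y

theorem wb_pow_le {m n : ℕ} (h : m ≤ n) (z : ℂ) : wb z ^ n ≤ wb z ^ m :=
  pow_le_pow_right_of_le_one' (wb_le_one z) h

/-- The integral of `(1 + |z|)⁻³`. -/
def wbI : ℝ≥0∞ := ∫⁻ z, wb z ^ 3

theorem wbI_lt_top : wbI < ∞ := by
  have h := finite_integral_one_add_norm (E := ℂ) (μ := volume) (r := 3)
    (by rw [Complex.finrank_real_complex]; norm_num)
  refine lt_of_le_of_lt (lintegral_mono fun z => ?_) h
  rw [wb, ← ofReal_norm, ← ENNReal.ofReal_one, ← ENNReal.ofReal_add zero_le_one (norm_nonneg z),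
    ← ENNReal.ofReal_inv_of_pos (by positivity), ← ENNReal.ofReal_pow (by positivity)]
  apply ENNReal.ofReal_le_ofReal
  rw [Real.rpow_neg (by positivity), inv_pow]
  norm_cast

theorem lintegral_wb_le {n : ℕ} (hn : 3 ≤ n) : ∫⁻ z, wb z ^ n ≤ wbI :=
  lintegral_mono fun z => wb_pow_le hn z

theorem lintegral_comp_affine (g : ℂ → ℝ≥0∞) (hg : Measurable g) (b : ℂ) {s : ℂ} (hs : s ≠ 0) :
    ∫⁻ z, g (b + s * z) = ‖s‖ₑ⁻¹ ^ 2 * ∫⁻ z, g z := by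
  have h1 : ∫⁻ z, g (b + s * z) = ∫⁻ z, (fun x => g (b + x)) (s • z) := by simp
  let L : ℂ →ₗ[ℝ] ℂ := LinearMap.restrictScalars ℝ (LinearMap.mulLeft ℂ s)
  have hdet : LinearMap.det L = ‖s‖ ^ 2 := by
    have : L = (Algebra.lmul ℝ ℂ s) := by ext; simp [L]
    rw [this]
    change Algebra.norm ℝ s = _
    rw [Algebra.norm_complex_apply, Complex.normSq_eq_norm_sq]
  have hd0 : LinearMap.det L ≠ 0 := by rw [hdet]; positivity
  have h2 := Measure.map_linearMap_addHaar_eq_smul_addHaar (volume : Measure ℂ) hd0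
  have hLm : Measurable L := L.continuous_of_finiteDimensional.measurable
  calc ∫⁻ z, g (b + s * z) = ∫⁻ z, g (b + L z) := rfl
    _ = ∫⁻ z, g (b + z) ∂(Measure.map L volume) := by
        rw [lintegral_map (by fun_prop) hLm]
    _ = _ := by
        rw [h2, lintegral_smul_measure, lintegral_add_left_eq_self (fun z => g z) b, hdet, smul_eq_mul]
        congr 1
        rw [abs_of_pos (by positivity), ENNReal.ofReal_inv_of_pos (by positivity),
          ENNReal.ofReal_pow (norm_nonneg s), ofReal_norm, ENNReal.inv_pow]

theorem lintegral_wb_affine {n : ℕ} (hn : 3 ≤ n) (b : ℂ) {s : ℂ} (hs : s ≠ 0) :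
    ∫⁻ z, wb (b + s * z) ^ n ≤ ‖s‖ₑ⁻¹ ^ 2 * wbI := by
  rw [lintegral_comp_affine (fun z => wb z ^ n) (by fun_prop) b hs]
  gcongr; exact lintegral_wb_le hn

theorem lintegral_wb_conv {n : ℕ} (hn : 3 ≤ n) (A : ℂ) :
    ∫⁻ x, wb (A - x) ^ n * wb x ^ n ≤ 2 ^ (n + 1) * wbI * wb A ^ n := by
  have key : ∀ x, wb (A - x) ^ n * wb x ^ n
      ≤ 2 ^ n * wb A ^ n * (wb (A - x) ^ n + wb x ^ n) := by
    intro x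
    have hA : 1 + ‖A‖ₑ ≤ (1 + ‖A - x‖ₑ) + (1 + ‖x‖ₑ) := by
      calc 1 + ‖A‖ₑ = 1 + ‖(A - x) + x‖ₑ := by rw [sub_add_cancel]
        _ ≤ 1 + (‖A - x‖ₑ + ‖x‖ₑ) := by gcongr; exact enorm_add_le _ _
        _ ≤ 1 + (‖A - x‖ₑ + ‖x‖ₑ) + 1 := le_self_add
        _ = _ := by ring
    rcases le_total (‖A - x‖ₑ) ‖x‖ₑ with h | h
    · have : wb x ≤ 2 * wb A := wb_le_of_le (by norm_num) (by norm_num)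
        (hA.trans (by rw [two_mul]; gcongr))
      calc wb (A - x) ^ n * wb x ^ n ≤ wb (A - x) ^ n * (2 * wb A) ^ n := by gcongr
        _ = 2 ^ n * wb A ^ n * wb (A - x) ^ n := by rw [mul_pow]; ring
        _ ≤ _ := by gcongr; exact le_self_add
    · have : wb (A - x) ≤ 2 * wb A := wb_le_of_le (by norm_num) (by norm_num)
        (hA.trans (by rw [two_mul]; gcongr))
      calc wb (A - x) ^ n * wb x ^ n ≤ (2 * wb A) ^ n * wb x ^ n := by gcongr
        _ = 2 ^ n * wb A ^ n * wb x ^ n := by rw [mul_pow]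
        _ ≤ _ := by gcongr; exact le_add_self
  calc ∫⁻ x, wb (A - x) ^ n * wb x ^ n
      ≤ ∫⁻ x, 2 ^ n * wb A ^ n * (wb (A - x) ^ n + wb x ^ n) := lintegral_mono key
    _ = 2 ^ n * wb A ^ n * ((∫⁻ x, wb (A - x) ^ n) + ∫⁻ x, wb x ^ n) := by
        rw [lintegral_const_mul _ (by fun_prop), lintegral_add_left (by fun_prop)]
    _ ≤ 2 ^ n * wb A ^ n * (wbI + wbI) := by
        gcongr
        · rw [lintegral_sub_left_eq_self (fun x => wb x ^ n) A]; exact lintegral_wb_le hn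
        · exact lintegral_wb_le hn
    _ = _ := by rw [pow_succ]; ring

/-- The Gaussian integer with given coordinates. -/
def gi (n : ℤ × ℤ) : ℂ := ⟨n.1, n.2⟩

/-- The unit cell at a Gaussian integer. -/
def giCell (n : ℤ × ℤ) : Set ℂ := {z | ⌊z.re⌋ = n.1 ∧ ⌊z.im⌋ = n.2}

theorem measurableSet_giCell (n : ℤ × ℤ) : MeasurableSet (giCell n) :=
  ((Int.measurable_floor.comp Complex.measurable_re) (measurableSet_singleton n.1)).inter
    ((Int.measurable_floor.comp Complex.measurable_im) (measurableSet_singleton n.2))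

theorem volume_giCell (n : ℤ × ℤ) : volume (giCell n) = 1 := by
  have : giCell n = Complex.measurableEquivRealProd ⁻¹'
      (Set.Ico (n.1 : ℝ) (n.1 + 1) ×ˢ Set.Ico (n.2 : ℝ) (n.2 + 1)) := by
    ext z
    simp [giCell, Int.floor_eq_iff, Complex.measurableEquivRealProd]
  rw [this, Complex.volume_preserving_equiv_real_prod.measure_preimage
    (measurableSet_Ico.prod measurableSet_Ico).nullMeasurableSet, Measure.volume_eq_prod,
    Measure.prod_prod]
  simp

theorem norm_sub_gi_le {n : ℤ × ℤ} {z : ℂ} (hz : z ∈ giCell n) : ‖z - gi n‖ ≤ 2 := by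
  obtain ⟨h1, h2⟩ := hz
  refine (Complex.norm_le_abs_re_add_abs_im _).trans ?_
  rw [Int.floor_eq_iff] at h1 h2
  have : |(z - gi n).re| ≤ 1 := by
    rw [Complex.sub_re, gi, abs_le]; constructor <;> simp <;> linarith
  have : |(z - gi n).im| ≤ 1 := by
    rw [Complex.sub_im, gi, abs_le]; constructor <;> simp <;> linarith
  linarith

theorem tsum_gi_le (b : ℂ) {s : ℂ} (hs : s ≠ 0) :
    ∑' n : ℤ × ℤ, wb (b + s * gi n) ^ 4 ≤ (1 + 2 * ‖s‖ₑ) ^ 4 * (‖s‖ₑ⁻¹ ^ 2 * wbI) := by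
  have h1 : ∀ n, wb (b + s * gi n) ^ 4
      ≤ ∫⁻ z in giCell n, (1 + 2 * ‖s‖ₑ) ^ 4 * wb (b + s * z) ^ 4 := by
    intro n
    calc wb (b + s * gi n) ^ 4 = ∫⁻ z in giCell n, wb (b + s * gi n) ^ 4 := by
          rw [lintegral_const, Measure.restrict_apply_univ, volume_giCell, mul_one]
      _ ≤ _ := by
          refine setLIntegral_mono (by fun_prop) fun z hz => ?_
          rw [← mul_pow]
          gcongr
          have := wb_le_mul_inv (b + s * gi n) (s * (z - gi n))
          rw [show b + s * gi n + s * (z - gi n) = b + s * z by ring] at this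
          refine this.trans ?_
          rw [mul_comm]
          gcongr
          rw [enorm_mul, mul_comm]
          gcongr
          rw [← ofReal_norm]
          exact ENNReal.ofReal_le_of_le_toReal (by simpa using norm_sub_gi_le hz)
  calc _ ≤ ∑' n, ∫⁻ z in giCell n, (1 + 2 * ‖s‖ₑ) ^ 4 * wb (b + s * z) ^ 4 :=
        ENNReal.tsum_le_tsum h1
    _ = ∫⁻ z in ⋃ n, giCell n, (1 + 2 * ‖s‖ₑ) ^ 4 * wb (b + s * z) ^ 4 := by
        rw [lintegral_iUnion measurableSet_giCell]
        intro m n hmn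
        refine Set.disjoint_left.2 fun z hz1 hz2 => hmn ?_
        exact Prod.ext (hz1.1.symm.trans hz2.1) (hz1.2.symm.trans hz2.2)
    _ ≤ ∫⁻ z, (1 + 2 * ‖s‖ₑ) ^ 4 * wb (b + s * z) ^ 4 := setLIntegral_le_lintegral _ _
    _ ≤ _ := by
        rw [lintegral_const_mul _ (by fun_prop)]
        gcongr
        exact lintegral_wb_affine (by norm_num) b hs

/-- A smooth bump on `[-1, 1]` whose integer translates are square-summable to one. -/
def gr (t : ℝ) : ℝ := Real.sin (Real.pi / 2 * Real.smoothTransition (1 + t)) *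
  Real.cos (Real.pi / 2 * Real.smoothTransition t)

theorem gr_zero : gr 0 = 1 := by simp [gr, Real.smoothTransition.zero, Real.smoothTransition.one]

theorem gr_eq_zero {t : ℝ} (ht : 1 ≤ |t|) : gr t = 0 := by
  rcases le_abs.1 ht with h | h
  · simp [gr, Real.smoothTransition.one_of_one_le h]
  · simp [gr, Real.smoothTransition.zero_of_nonpos (by linarith : 1 + t ≤ 0)]

theorem gr_nonneg (t : ℝ) : 0 ≤ gr t := by
  have hp := Real.pi_pos
  have h : ∀ s, 0 ≤ Real.pi / 2 * Real.smoothTransition s ∧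
      Real.pi / 2 * Real.smoothTransition s ≤ Real.pi / 2 := fun s =>
    ⟨mul_nonneg (by positivity) (Real.smoothTransition.nonneg s),
      mul_le_of_le_one_right (by positivity) (Real.smoothTransition.le_one s)⟩
  exact mul_nonneg (Real.sin_nonneg_of_nonneg_of_le_pi (h _).1 (by linarith [(h (1 + t)).2]))
    (Real.cos_nonneg_of_neg_pi_div_two_le_of_le (by linarith [(h t).1]) (h _).2)

theorem gr_le_one (t : ℝ) : gr t ≤ 1 := by
  refine (le_abs_self _).trans ?_
  rw [gr, abs_mul]
  exact mul_le_one₀ (Real.abs_sin_le_one _) (abs_nonneg _) (Real.abs_cos_le_one _)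

theorem contDiff_gr : ContDiff ℝ (⊤ : ℕ∞) gr := by
  have h : ContDiff ℝ (⊤ : ℕ∞) Real.smoothTransition := Real.smoothTransition.contDiff
  have h1 : ContDiff ℝ (⊤ : ℕ∞) fun t : ℝ => Real.smoothTransition (1 + t) :=
    h.comp (contDiff_const.add contDiff_id)
  exact (Real.contDiff_sin.comp (contDiff_const.mul h1)).mul
    (Real.contDiff_cos.comp (contDiff_const.mul h))

theorem hasSum_gr (t : ℝ) : HasSum (fun n : ℤ => gr (t - n) ^ 2) 1 := by
  have h0 := Int.floor_le t
  have h1 := Int.lt_floor_add_one t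
  have hs : ∑ n ∈ ({⌊t⌋, ⌊t⌋ + 1} : Finset ℤ), gr (t - n) ^ 2 = 1 := by
    rw [Finset.sum_pair (by omega)]
    set x := t - ⌊t⌋ with hx
    have hx0 : 0 ≤ x := by linarith
    have e2 : t - ((⌊t⌋ + 1 : ℤ) : ℝ) = x - 1 := by push_cast; ring
    rw [e2]
    have a1 : gr x = Real.cos (Real.pi / 2 * Real.smoothTransition x) := by
      rw [gr, Real.smoothTransition.one_of_one_le (by linarith)]; simp
    have a2 : gr (x - 1) = Real.sin (Real.pi / 2 * Real.smoothTransition x) := by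
      rw [gr, Real.smoothTransition.zero_of_nonpos (by linarith : x - 1 ≤ 0)]; simp
    rw [a1, a2]; exact Real.cos_sq_add_sin_sq _
  rw [← hs]
  refine hasSum_sum_of_ne_finset_zero fun n hn => ?_
  rw [gr_eq_zero, sq, zero_mul]
  simp only [Finset.mem_insert, Finset.mem_singleton, not_or] at hn
  rcases lt_or_gt_of_ne hn.1 with h | h
  · rw [le_abs]; left
    have : (n : ℝ) + 1 ≤ ⌊t⌋ := by exact_mod_cast h
    linarith
  · rw [le_abs]; right
    have : (⌊t⌋ : ℝ) + 2 ≤ n := by exact_mod_cast (by omega : ⌊t⌋ + 2 ≤ n)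
    linarith

/-- The bump on `ℂ`. -/
def gc (z : ℂ) : ℝ := gr z.re * gr z.im

theorem gc_nonneg (z : ℂ) : 0 ≤ gc z := mul_nonneg (gr_nonneg _) (gr_nonneg _)

theorem gc_le_one (z : ℂ) : gc z ≤ 1 := mul_le_one₀ (gr_le_one _) (gr_nonneg _) (gr_le_one _)

theorem abs_re_im_of_gc_ne_zero {z : ℂ} (h : gc z ≠ 0) : |z.re| < 1 ∧ |z.im| < 1 := by
  constructor <;> by_contra! h' <;> exact h (by simp [gc, gr_eq_zero h'])

theorem norm_le_of_gc_ne_zero {z : ℂ} (h : gc z ≠ 0) : ‖z‖ ≤ 2 := by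
  have := abs_re_im_of_gc_ne_zero h
  linarith [Complex.norm_le_abs_re_add_abs_im z]

theorem contDiff_gc : ContDiff ℝ (⊤ : ℕ∞) gc :=
  (contDiff_gr.comp Complex.reCLM.contDiff).mul (contDiff_gr.comp Complex.imCLM.contDiff)

@[fun_prop] theorem continuous_gc : Continuous gc := contDiff_gc.continuous

theorem hasSum_gc (z : ℂ) : HasSum (fun n : ℤ × ℤ => gc (z - gi n) ^ 2) 1 := by
  have h := (hasSum_gr z.re).mul (hasSum_gr z.im) ((hasSum_gr z.re).summable.mul_of_nonneg
    (hasSum_gr z.im).summable (fun _ => sq_nonneg _) (fun _ => sq_nonneg _))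
  simpa [gc, gi, mul_pow] using h

/-- The translated bump as a Schwartz function. -/
def gS (U : ℂ) : SchwartzMap ℂ ℂ :=
  HasCompactSupport.toSchwartzMap (f := fun z => (gc (z - U) : ℂ))
    (HasCompactSupport.intro (isCompact_closedBall U 2) fun z hz => by
      by_contra h
      exact hz (by simpa [dist_eq_norm] using
        norm_le_of_gc_ne_zero (z := z - U) (by exact_mod_cast h)))
    (Complex.ofRealCLM.contDiff.comp (contDiff_gc.comp (contDiff_id.sub contDiff_const)))

theorem gS_apply (U z : ℂ) : gS U z = gc (z - U) := rfl

/-- The Fourier transform of the bump. -/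
def gh (a : ℂ) : ℂ := ∫ v : ℂ, ee ((a * v).re) * (gc v : ℂ)

theorem inner_neg_conj (v a : ℂ) : inner ℝ v (-(starRingEnd ℂ) a) = -(a * v).re := by
  simp [Complex.inner]

open scoped FourierTransform in
theorem ee_mul_gh (U a : ℂ) : ee ((a * U).re) * gh a = (𝓕 (gS U)) (-(starRingEnd ℂ) a) := by
  rw [SchwartzMap.fourier_coe, Real.fourier_eq']
  unfold gh
  rw [← integral_const_mul, ← integral_add_right_eq_self (μ := volume) (fun v => Complex.exp
    (((-2 * Real.pi * inner ℝ v (-(starRingEnd ℂ) a) : ℝ) : ℂ) * Complex.I) • gS U v) U]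
  refine integral_congr_ae (Filter.Eventually.of_forall fun v => ?_)
  simp only [gS_apply, smul_eq_mul, inner_neg_conj, add_sub_cancel_right, ← mul_assoc, ← ee_add]
  simp only [ee]
  congr 2
  simp; ring

open scoped FourierTransform in
theorem gh_eq_fourier (a : ℂ) : gh a = (𝓕 (gS 0)) (-(starRingEnd ℂ) a) := by
  rw [← ee_mul_gh]; simp [ee_zero]

open scoped FourierTransform in
theorem continuous_gh : Continuous gh := by
  have : gh = fun a => (𝓕 (gS 0)) (-(starRingEnd ℂ) a) := funext gh_eq_fourier
  rw [this]
  exact (𝓕 (gS 0)).continuous.comp (Complex.continuous_conj.neg)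

open scoped FourierTransform in
theorem gh_decay (n : ℕ) : ∃ C : ℝ≥0∞, C ≠ ∞ ∧ ∀ a, ‖gh a‖ₑ ≤ C * wb a ^ n := by
  obtain ⟨K, hK⟩ : ∃ K : ℝ, ∀ x, (1 + ‖x‖) ^ n * ‖(𝓕 (gS 0)) x‖ ≤ K := by
    refine ⟨2 ^ n * (Finset.Iic (n, 0)).sup (fun m => SchwartzMap.seminorm ℝ m.1 m.2)
      (𝓕 (gS 0)), fun x => ?_⟩
    have := SchwartzMap.one_add_le_sup_seminorm_apply (𝕜 := ℝ) (m := (n, 0)) (le_refl n)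
      (le_refl 0) (𝓕 (gS 0)) x
    rwa [norm_iteratedFDeriv_zero] at this
  refine ⟨ENNReal.ofReal K, ofReal_ne_top, fun a => ?_⟩
  have h := hK (-(starRingEnd ℂ) a)
  rw [← gh_eq_fourier, norm_neg, RCLike.norm_conj] at h
  have h' := ENNReal.ofReal_le_ofReal h
  rw [ENNReal.ofReal_mul (by positivity), ENNReal.ofReal_pow (by positivity),
    ENNReal.ofReal_add zero_le_one (norm_nonneg _), ENNReal.ofReal_one, ofReal_norm, ofReal_norm] at h'
  rw [wb, ← ENNReal.inv_pow, ← div_eq_mul_inv, ENNReal.le_div_iff_mul_le (by simp) (by simp), mul_comm]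
  exact h'

/-- The time cutoff profile. -/
def th (a : ℂ) : ℝ := ‖gh a‖ ^ 2

theorem th_nonneg (a : ℂ) : 0 ≤ th a := sq_nonneg _

@[fun_prop] theorem continuous_th : Continuous th := continuous_gh.norm.pow 2

theorem ofReal_th (a : ℂ) : ENNReal.ofReal (th a) = ‖gh a‖ₑ ^ 2 := by
  rw [th, ENNReal.ofReal_pow (norm_nonneg _), ofReal_norm]

theorem th_decay (n : ℕ) : ∃ C : ℝ≥0∞, C ≠ ∞ ∧ ∀ a, ENNReal.ofReal (th a) ≤ C * wb a ^ n := by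
  obtain ⟨C, hC, h⟩ := gh_decay n
  refine ⟨C ^ 2, ENNReal.pow_ne_top hC, fun a => ?_⟩
  rw [ofReal_th]
  calc ‖gh a‖ₑ ^ 2 ≤ (C * wb a ^ n) ^ 2 := by gcongr; exact h a
    _ = C ^ 2 * (wb a ^ n * wb a ^ n) := by rw [mul_pow, sq (wb a ^ n)]
    _ ≤ C ^ 2 * (wb a ^ n * 1) := by
        gcongr; exact pow_le_one₀ zero_le (wb_le_one a)
    _ = _ := by rw [mul_one]

theorem integrable_th : Integrable th := by
  refine ⟨continuous_th.aestronglyMeasurable, ?_⟩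
  obtain ⟨C, hC, h⟩ := th_decay 3
  calc ∫⁻ a, ‖th a‖ₑ ≤ ∫⁻ a, C * wb a ^ 3 := lintegral_mono fun a => by
        rw [← ofReal_norm, Real.norm_of_nonneg (th_nonneg a)]; exact h a
    _ = C * wbI := by rw [lintegral_const_mul _ (by fun_prop), wbI]
    _ < ∞ := ENNReal.mul_lt_top hC.lt_top wbI_lt_top

open scoped FourierTransform in
theorem th_fourier_eq_zero {U : ℂ} (hU : 3 ≤ ‖U‖) : ∫ a : ℂ, ee ((a * U).re) * (th a : ℂ) = 0 := by
  have h1 : ∀ a : ℂ, ee ((a * U).re) * (th a : ℂ)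
      = inner ℂ ((𝓕 (gS 0)) (-(starRingEnd ℂ) a)) ((𝓕 (gS U)) (-(starRingEnd ℂ) a)) := by
    intro a
    rw [← ee_mul_gh U a, ← gh_eq_fourier a, RCLike.inner_apply, mul_assoc, th, ← Complex.normSq_eq_norm_sq,
      Complex.normSq_eq_conj_mul_self]
    simp only [mul_comm]
  simp only [h1]
  have h2 := measurePreserving_negConj.integral_comp
    (Complex.conjLIE.trans (LinearIsometryEquiv.neg ℝ (E := ℂ))).toHomeomorph.measurableEmbedding
    (fun x => inner ℂ ((𝓕 (gS 0)) x) ((𝓕 (gS U)) x))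
  rw [h2, SchwartzMap.integral_inner_fourier_fourier]
  refine integral_eq_zero_of_ae (Filter.Eventually.of_forall fun x => ?_)
  simp only [gS_apply, RCLike.inner_apply, sub_zero, Pi.zero_apply, mul_eq_zero, map_eq_zero]
  by_contra! h
  have hx := abs_re_im_of_gc_ne_zero (z := x - U) (by exact_mod_cast h.1)
  have hy := abs_re_im_of_gc_ne_zero (z := x) (by exact_mod_cast h.2)
  have hr : |U.re| < 2 := by
    have := abs_sub x.re (x - U).re
    simp only [Complex.sub_re, _root_.sub_sub_cancel] at this hx; linarith [hx.1, hy.1]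
  have hi : |U.im| < 2 := by
    have := abs_sub x.im (x - U).im
    simp only [Complex.sub_im, _root_.sub_sub_cancel] at this hx; linarith [hx.2, hy.2]
  have h9 : ‖U‖ ^ 2 = U.re ^ 2 + U.im ^ 2 := by
    rw [← Complex.normSq_eq_norm_sq, Complex.normSq_apply]; ring
  have := sq_lt_sq' (by linarith [abs_nonneg U.re]) hr
  have := sq_lt_sq' (by linarith [abs_nonneg U.im]) hi
  rw [sq_abs] at *
  nlinarith

/-- The mass of the time cutoff profile near the origin. -/
theorem lintegral_th_ball_ne_zero : ∫⁻ a in Metric.ball (0 : ℂ) 1, ENNReal.ofReal (th a) ≠ 0 := by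
  have h0 : 0 < th 0 := by
    have : 0 < ∫ v, gc v := by
      refine continuous_gc.integral_pos_of_hasCompactSupport_nonneg_nonzero ?_ gc_nonneg (x := 0) ?_
      · exact HasCompactSupport.intro (isCompact_closedBall (0 : ℂ) 2) fun z hz => by
          by_contra h
          exact hz (by simpa using norm_le_of_gc_ne_zero h)
      · simp [gc, gr_zero]
    have e : gh 0 = ((∫ v, gc v : ℝ) : ℂ) := by
      rw [gh, ← integral_complex_ofReal]; simp [ee_zero]
    rw [th, e, Complex.norm_real]; exact pow_pos (norm_pos_iff.2 this.ne') 2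
  refine (setLIntegral_pos_iff (by fun_prop)).2 ?_ |>.ne'
  refine (IsOpen.measure_pos volume (((ENNReal.continuous_ofReal.comp continuous_th).isOpen_support).inter
    Metric.isOpen_ball) ⟨0, ?_, by simp⟩)
  simp [h0]

/-- The total mass of the time cutoff profile. -/
def thI : ℝ≥0∞ := ∫⁻ a : ℂ, ENNReal.ofReal (th a)

theorem thI_ne_top : thI ≠ ∞ := by
  have h := integrable_th.2
  rw [HasFiniteIntegral] at h
  refine (lt_of_le_of_lt (lintegral_mono fun a => ?_) h).ne
  rw [← ofReal_norm, Real.norm_of_nonneg (th_nonneg a)]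

theorem thI_ne_zero : thI ≠ 0 := fun h =>
  lintegral_th_ball_ne_zero (le_antisymm ((setLIntegral_le_lintegral _ _).trans h.le) zero_le)

/-- The bump on phase space positions. -/
def gb (p w : ℂ × ℂ) : ℂ := (gc (w.1 - p.1) : ℂ) * (gc (w.2 - p.2) : ℂ)

@[fun_prop] theorem continuous_gb (p : ℂ × ℂ) : Continuous (gb p) := by
  unfold gb; fun_prop

theorem norm_le_of_gb_ne_zero {p w : ℂ × ℂ} (h : gb p w ≠ 0) : ‖w - p‖ ≤ 2 := by
  have h1 := mul_ne_zero_iff.1 h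
  exact max_le (norm_le_of_gc_ne_zero (by exact_mod_cast h1.1))
    (norm_le_of_gc_ne_zero (by exact_mod_cast h1.2))

theorem enorm_gb_le_one (p w : ℂ × ℂ) : ‖gb p w‖ₑ ≤ 1 := by
  rw [← ofReal_norm, ← ENNReal.ofReal_one]
  refine ENNReal.ofReal_le_ofReal ?_
  rw [gb, norm_mul, Complex.norm_real, Complex.norm_real, Real.norm_of_nonneg (gc_nonneg _),
    Real.norm_of_nonneg (gc_nonneg _)]
  exact mul_le_one₀ (gc_le_one _) (gc_nonneg _) (gc_le_one _)

theorem hasCompactSupport_gb (p : ℂ × ℂ) : HasCompactSupport (gb p) :=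
  HasCompactSupport.intro (isCompact_closedBall p 2) fun w hw => by
    by_contra h
    exact hw (by simpa [dist_eq_norm] using norm_le_of_gb_ne_zero h)

theorem integrable_gb (p : ℂ × ℂ) : Integrable (gb p) :=
  (continuous_gb p).integrable_of_hasCompactSupport (hasCompactSupport_gb p)

theorem integral_ee_gc (a U : ℂ) :
    ∫ v : ℂ, ee ((a * v).re) * (gc (v - U) : ℂ) = ee ((a * U).re) * gh a := by
  rw [gh, ← integral_const_mul, ← integral_add_right_eq_self _ U]
  refine integral_congr_ae (Filter.Eventually.of_forall fun v => ?_)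
  simp only [add_sub_cancel_right, ← mul_assoc, ← ee_add]
  congr 3
  simp [mul_add, add_comm]

theorem lintegral_gc_wb_le (a c U : ℂ) (n : ℕ) :
    ∫⁻ v : ℂ, ‖(gc (v - U) : ℂ)‖ₑ * wb (a + c * v) ^ n ≤
      volume (Metric.closedBall (0 : ℂ) 2) * ((1 + 2 * ‖c‖ₑ) ^ n * wb (a + c * U) ^ n) := by
  calc ∫⁻ v : ℂ, ‖(gc (v - U) : ℂ)‖ₑ * wb (a + c * v) ^ n
      ≤ ∫⁻ v : ℂ, (Metric.closedBall U 2).indicator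
          (fun _ => (1 + 2 * ‖c‖ₑ) ^ n * wb (a + c * U) ^ n) v := by
        refine lintegral_mono fun v => ?_
        by_cases hv : gc (v - U) = 0
        · simp [hv]
        have h2 := norm_le_of_gc_ne_zero hv
        rw [Set.indicator_of_mem (by simpa [dist_eq_norm] using h2)]
        have h1 : ‖(gc (v - U) : ℂ)‖ₑ ≤ 1 := by
          rw [← ofReal_norm, ← ENNReal.ofReal_one, Complex.norm_real,
            Real.norm_of_nonneg (gc_nonneg _)]
          exact ENNReal.ofReal_le_ofReal (gc_le_one _)
        have h3 : wb (a + c * v) ≤ (1 + 2 * ‖c‖ₑ) * wb (a + c * U) := by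
          have := wb_le_mul_inv (a + c * v) (c * (U - v))
          rw [show a + c * v + c * (U - v) = a + c * U by ring] at this
          refine this.trans ?_
          rw [mul_comm]
          gcongr
          rw [enorm_mul, mul_comm, ← enorm_neg, neg_sub]
          gcongr
          rw [← ofReal_norm, show (2 : ℝ≥0∞) = ENNReal.ofReal 2 by simp]
          exact ENNReal.ofReal_le_ofReal h2
        rw [← mul_pow]
        calc _ ≤ 1 * ((1 + 2 * ‖c‖ₑ) * wb (a + c * U)) ^ n := by gcongr
          _ = _ := one_mul _
    _ = _ := by
        rw [lintegral_indicator_const measurableSet_closedBall, mul_comm]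
        congr 1
        rw [Complex.volume_closedBall, Complex.volume_closedBall]

/-- The kernel dominating the wave packets. -/
def KK (p : ℂ × ℂ) (c : ℂ) (y : ℂ × ℂ) : ℝ≥0∞ := wb (y.1 + c * p.2) ^ 8 * wb (y.2 + c * p.1) ^ 8

/-- Decay of the extension of a unit bump. -/
theorem exists_EE_gb_le : ∃ C : ℝ≥0∞, C ≠ ∞ ∧ ∀ p c y,
    ‖EE (gb p) c y‖ₑ ≤ C * (1 + 2 * ‖c‖ₑ) ^ 16 * KK p c y := by
  obtain ⟨C, hC, h⟩ := gh_decay 16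
  set V := volume (Metric.closedBall (0 : ℂ) 2) with hV
  have hVt : V ≠ ∞ := measure_closedBall_lt_top.ne
  refine ⟨C * V, ENNReal.mul_ne_top hC hVt, fun p c y => ?_⟩
  have hInt : Integrable fun w : ℂ × ℂ => ee (ph c y w) * gb p w :=
    integrable_ee_mul (integrable_gb p) c y
  have A1 : ‖EE (gb p) c y‖ₑ ≤ C * V * ((1 + 2 * ‖c‖ₑ) ^ 16 * wb (y.1 + c * p.2) ^ 16) := by
    rw [EE, Measure.volume_eq_prod, integral_prod_symm _ hInt]
    calc _ ≤ ∫⁻ v : ℂ, ‖(gc (v - p.2) : ℂ)‖ₑ * (C * wb (y.1 + c * v) ^ 16) := by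
          refine (enorm_integral_le_lintegral_enorm _).trans (lintegral_mono fun v => ?_)
          have : ∀ u : ℂ, ee (ph c y (u, v)) * gb p (u, v) = (ee ((y.2 * v).re) * (gc (v - p.2) : ℂ))
              * (ee (((y.1 + c * v) * u).re) * (gc (u - p.1) : ℂ)) := by
            intro u
            rw [show ph c y (u, v) = (y.2 * v).re + ((y.1 + c * v) * u).re by
              simp only [ph, ← Complex.add_re]; congr 1; ring, ee_add, gb]
            ring
          simp only [this]
          rw [integral_const_mul, integral_ee_gc, enorm_mul, enorm_mul, enorm_mul, enorm_ee,
            enorm_ee, one_mul, one_mul]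
          gcongr; exact h _
      _ = C * ∫⁻ v : ℂ, ‖(gc (v - p.2) : ℂ)‖ₑ * wb (y.1 + c * v) ^ 16 := by
          rw [← lintegral_const_mul' _ _ hC]
          simp only [mul_left_comm]
      _ ≤ _ := by
          rw [mul_assoc]; gcongr; exact lintegral_gc_wb_le _ _ _ _
  have A2 : ‖EE (gb p) c y‖ₑ ≤ C * V * ((1 + 2 * ‖c‖ₑ) ^ 16 * wb (y.2 + c * p.1) ^ 16) := by
    rw [EE, Measure.volume_eq_prod, integral_prod _ hInt]
    calc _ ≤ ∫⁻ u : ℂ, ‖(gc (u - p.1) : ℂ)‖ₑ * (C * wb (y.2 + c * u) ^ 16) := by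
          refine (enorm_integral_le_lintegral_enorm _).trans (lintegral_mono fun u => ?_)
          have : ∀ v : ℂ, ee (ph c y (u, v)) * gb p (u, v) = (ee ((y.1 * u).re) * (gc (u - p.1) : ℂ))
              * (ee (((y.2 + c * u) * v).re) * (gc (v - p.2) : ℂ)) := by
            intro v
            rw [show ph c y (u, v) = (y.1 * u).re + ((y.2 + c * u) * v).re by
              simp only [ph, ← Complex.add_re]; congr 1; ring, ee_add, gb]
            ring
          simp only [this]
          rw [integral_const_mul, integral_ee_gc, enorm_mul, enorm_mul, enorm_mul, enorm_ee,
            enorm_ee, one_mul, one_mul]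
          gcongr; exact h _
      _ = C * ∫⁻ u : ℂ, ‖(gc (u - p.1) : ℂ)‖ₑ * wb (y.2 + c * u) ^ 16 := by
          rw [← lintegral_const_mul' _ _ hC]
          simp only [mul_left_comm]
      _ ≤ _ := by
          rw [mul_assoc]; gcongr; exact lintegral_gc_wb_le _ _ _ _
  have key : min (wb (y.1 + c * p.2) ^ 16) (wb (y.2 + c * p.1) ^ 16) ≤ KK p c y := by
    rw [KK]
    rcases le_total (wb (y.1 + c * p.2)) (wb (y.2 + c * p.1)) with h | h
    · refine (min_le_left _ _).trans ?_
      rw [show (16 : ℕ) = 8 + 8 from rfl, pow_add]; gcongr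
    · refine (min_le_right _ _).trans ?_
      rw [show (16 : ℕ) = 8 + 8 from rfl, pow_add]; gcongr
  calc _ ≤ C * V * ((1 + 2 * ‖c‖ₑ) ^ 16 *
        min (wb (y.1 + c * p.2) ^ 16) (wb (y.2 + c * p.1) ^ 16)) := by
        rcases min_choice (wb (y.1 + c * p.2) ^ 16) (wb (y.2 + c * p.1) ^ 16) with h | h <;>
          rw [h] <;> assumption
    _ ≤ _ := by rw [mul_assoc _ _ (KK p c y)]; gcongr

instance isAddHaarMeasure_volume_prod : (volume : Measure (ℂ × ℂ)).IsAddHaarMeasure :=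
  inferInstanceAs ((volume : Measure ℂ).prod (volume : Measure ℂ)).IsAddHaarMeasure

/-- The Cauchy–Schwarz inequality for lower Lebesgue integrals with a weight. -/
theorem lintegral_mul_mul_sq_le {α : Type*} [MeasurableSpace α] {μ : Measure α} {f g k : α → ℝ≥0∞}
    (hf : Measurable f) (hg : Measurable g) (hk : Measurable k) :
    (∫⁻ x, f x * g x * k x ∂μ) ^ 2 ≤ (∫⁻ x, f x ^ 2 * k x ∂μ) * ∫⁻ x, g x ^ 2 * k x ∂μ := by
  have e : ∀ F : α → ℝ≥0∞, Measurable F → ∫⁻ x, F x * k x ∂μ = ∫⁻ x, F x ∂(μ.withDensity k) := by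
    intro F hF
    rw [lintegral_withDensity_eq_lintegral_mul _ hk hF]
    simp [mul_comm]
  rw [e (fun x => f x * g x) (hf.mul hg), e (fun x => f x ^ 2) (hf.pow_const 2),
    e (fun x => g x ^ 2) (hg.pow_const 2)]
  have h := ENNReal.lintegral_mul_le_Lp_mul_Lq (μ.withDensity k)
    (Real.HolderConjugate.two_two) hf.aemeasurable hg.aemeasurable
  simp only [Pi.mul_apply, ENNReal.rpow_two] at h
  calc _ ≤ _ := pow_le_pow_left₀ zero_le h 2
    _ = _ := by
      rw [mul_pow, ← ENNReal.rpow_two, ← ENNReal.rpow_two, ← ENNReal.rpow_mul, ← ENNReal.rpow_mul]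
      norm_num

theorem wb_le_mul_wb {K : ℝ≥0∞} (hK : K ≠ ∞) (h1 : 1 ≤ K) {d : ℂ} (hd : ‖d‖ₑ ≤ K) (A : ℂ) :
    wb A ≤ K * wb (d * A) := by
  refine wb_le_of_le (fun h => by simp [h] at h1) hK ?_
  rw [enorm_mul, mul_add, mul_one]
  gcongr

theorem wb_mul_mul_le {K : ℝ≥0∞} (hK : K ≠ ∞) (h1 : 1 ≤ K) {d e f : ℂ} (hd : ‖d‖ₑ ≤ K)
    (he : ‖e‖ₑ ≤ K) (hf : ‖f‖ₑ ≤ K) (A B C : ℂ) :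
    wb A * wb B * wb C ≤ K ^ 3 * wb (d * A + e * B + f * C) := by
  calc wb A * wb B * wb C ≤ (K * wb (d * A)) * (K * wb (e * B)) * (K * wb (f * C)) := by
        gcongr <;> exact wb_le_mul_wb hK h1 (by assumption) _
    _ = K ^ 3 * (wb (d * A) * wb (e * B) * wb (f * C)) := by ring
    _ ≤ _ := by
        gcongr
        refine le_trans ?_ (wb_mul_le _ _)
        gcongr; exact wb_mul_le _ _

theorem KK_le_one (p : ℂ × ℂ) (c : ℂ) (y : ℂ × ℂ) : KK p c y ≤ 1 :=
  mul_le_one' (pow_le_one₀ zero_le (wb_le_one _)) (pow_le_one₀ zero_le (wb_le_one _))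

theorem KK_ne_zero (p : ℂ × ℂ) (c : ℂ) (y : ℂ × ℂ) : KK p c y ≠ 0 :=
  mul_ne_zero (pow_ne_zero _ (wb_ne_zero _)) (pow_ne_zero _ (wb_ne_zero _))

theorem KK_ne_top (p : ℂ × ℂ) (c : ℂ) (y : ℂ × ℂ) : KK p c y ≠ ∞ :=
  ne_top_of_le_ne_top one_ne_top (KK_le_one p c y)

theorem lintegral_wb_mul_wb {n : ℕ} (hn : 3 ≤ n) (a b : ℂ) :
    ∫⁻ y : ℂ × ℂ, wb (y.1 + a) ^ n * wb (y.2 + b) ^ n ≤ wbI ^ 2 := by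
  rw [Measure.volume_eq_prod, lintegral_prod_mul (f := fun z => wb (z + a) ^ n)
    (g := fun z => wb (z + b) ^ n) (by fun_prop) (by fun_prop),
    lintegral_add_right_eq_self (fun z => wb z ^ n), lintegral_add_right_eq_self (fun z => wb z ^ n), sq]
  gcongr <;> exact lintegral_wb_le hn

theorem lintegral_KK_left (p : ℂ × ℂ) (c : ℂ) (x : ℂ × ℂ) : ∫⁻ y, KK p c (y - x) ≤ wbI ^ 2 := by
  rw [lintegral_sub_right_eq_self (KK p c)]
  exact lintegral_wb_mul_wb (by norm_num) _ _

theorem lintegral_KK_right (p : ℂ × ℂ) (c : ℂ) (y : ℂ × ℂ) : ∫⁻ x, KK p c (y - x) ≤ wbI ^ 2 := by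
  rw [lintegral_sub_left_eq_self (KK p c)]
  exact lintegral_wb_mul_wb (by norm_num) _ _

theorem lintegral_wb_conv' {n : ℕ} (hn : 3 ≤ n) (A B : ℂ) :
    ∫⁻ x, wb (A - x) ^ n * wb (B - x) ^ n ≤ 2 ^ (n + 1) * wbI * wb (A - B) ^ n := by
  refine le_trans (le_of_eq ?_) (lintegral_wb_conv hn (A - B))
  rw [← lintegral_add_right_eq_self _ B]
  refine lintegral_congr fun x => ?_
  rw [show A - (x + B) = A - B - x by ring, show B - (x + B) = -x by ring, wb_neg]

theorem lintegral_KK_mul_KK (p : ℂ × ℂ) (c c' : ℂ) (y y' : ℂ × ℂ) :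
    ∫⁻ x, KK p c' (y' - x) * KK p c (y - x) ≤ (2 ^ 9 * wbI) ^ 2 * KK p (c' - c) (y' - y) := by
  have e : ∀ x : ℂ × ℂ, KK p c' (y' - x) * KK p c (y - x) =
      (fun z => wb (y'.1 + c' * p.2 - z) ^ 8 * wb (y.1 + c * p.2 - z) ^ 8) x.1 *
      (fun z => wb (y'.2 + c' * p.1 - z) ^ 8 * wb (y.2 + c * p.1 - z) ^ 8) x.2 := by
    intro x
    simp only [KK, Prod.fst_sub, Prod.snd_sub, sub_add_eq_add_sub]
    ring
  rw [lintegral_congr e, Measure.volume_eq_prod, lintegral_prod_mul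
    (f := fun z => wb (y'.1 + c' * p.2 - z) ^ 8 * wb (y.1 + c * p.2 - z) ^ 8)
    (g := fun z => wb (y'.2 + c' * p.1 - z) ^ 8 * wb (y.2 + c * p.1 - z) ^ 8)
    (by fun_prop) (by fun_prop)]
  calc _ ≤ (2 ^ (8 + 1) * wbI * wb (y'.1 + c' * p.2 - (y.1 + c * p.2)) ^ 8) *
        (2 ^ (8 + 1) * wbI * wb (y'.2 + c' * p.1 - (y.2 + c * p.1)) ^ 8) := by
        gcongr <;> exact lintegral_wb_conv' (by norm_num) _ _
    _ = _ := by
        rw [KK, show (y' - y).1 + (c' - c) * p.2 = y'.1 + c' * p.2 - (y.1 + c * p.2) by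
          simp only [Prod.fst_sub]; ring, show (y' - y).2 + (c' - c) * p.1 =
          y'.2 + c' * p.1 - (y.2 + c * p.1) by simp only [Prod.snd_sub]; ring]
        ring

/-- The trace estimate: wave packets transversal to a family of planes. -/
theorem lintegral_KK_mul_wb_le {N : ℝ} (hN : 0 < N) {K : ℝ≥0∞} (hK : K ≠ ∞) (h1 : 1 ≤ K)
    {ξ η D : ℂ × ℂ} (hD1 : ‖D.1 / N‖ₑ ≤ K) (hD2 : ‖D.2 / N‖ₑ ≤ K) {δ : ℝ≥0∞} (hδ : δ ≠ 0)
    (hσ : δ * ENNReal.ofReal N ≤ ‖(D.1 * (η.2 - ξ.2) + D.2 * (η.1 - ξ.1)) / N‖ₑ)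
    (x y0 : ℂ × ℂ) (c0 : ℂ) :
    ∫⁻ c : ℂ, ∫⁻ y : ℂ × ℂ, KK η c (y - x) * wb ((D.1 * (y.1 - y0.1) + D.2 * (y.2 - y0.2) +
      (c - c0) * (D.1 * ξ.2 + D.2 * ξ.1)) / N) ^ 4 ≤
      K ^ 12 * wbI ^ 3 * δ⁻¹ ^ 2 * (ENNReal.ofReal N)⁻¹ ^ 2 := by
  set σ := (D.1 * (η.2 - ξ.2) + D.2 * (η.1 - ξ.1)) / N with hσd
  have hN' : (N : ℂ) ≠ 0 := by exact_mod_cast hN.ne'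
  have hσ0 : σ ≠ 0 := by
    intro h
    rw [h, enorm_zero, nonpos_iff_eq_zero, mul_eq_zero] at hσ
    simp [hδ, hN.not_ge] at hσ
  set b : ℂ := (D.1 * (x.1 - y0.1) + D.2 * (x.2 - y0.2) - c0 * (D.1 * ξ.2 + D.2 * ξ.1)) / N with hb
  have key : ∀ (c : ℂ) (y : ℂ × ℂ), KK η c (y - x) * wb ((D.1 * (y.1 - y0.1) + D.2 * (y.2 - y0.2) +
      (c - c0) * (D.1 * ξ.2 + D.2 * ξ.1)) / N) ^ 4 ≤ K ^ 12 * wb (b + (-σ) * c) ^ 4 *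
      (wb (y.1 + (c * η.2 - x.1)) ^ 4 * wb (y.2 + (c * η.1 - x.2)) ^ 4) := by
    intro c y
    have h := wb_mul_mul_le hK h1 (d := -(D.1 / N)) (e := -(D.2 / N)) (f := 1) (by rwa [enorm_neg])
      (by rwa [enorm_neg]) (by simpa using h1) (y.1 + (c * η.2 - x.1)) (y.2 + (c * η.1 - x.2))
      ((D.1 * (y.1 - y0.1) + D.2 * (y.2 - y0.2) + (c - c0) * (D.1 * ξ.2 + D.2 * ξ.1)) / N)
    rw [show -(D.1 / N) * (y.1 + (c * η.2 - x.1)) + -(D.2 / N) * (y.2 + (c * η.1 - x.2)) + 1 *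
      ((D.1 * (y.1 - y0.1) + D.2 * (y.2 - y0.2) + (c - c0) * (D.1 * ξ.2 + D.2 * ξ.1)) / N) =
      b + (-σ) * c by rw [hb, hσd]; field_simp; ring] at h
    have h4 := pow_le_pow_left₀ zero_le h 4
    rw [KK, Prod.fst_sub, Prod.snd_sub, show y.1 - x.1 + c * η.2 = y.1 + (c * η.2 - x.1) by ring,
      show y.2 - x.2 + c * η.1 = y.2 + (c * η.1 - x.2) by ring]
    set wA := wb (y.1 + (c * η.2 - x.1))
    set wB := wb (y.2 + (c * η.1 - x.2))
    set wL := wb ((D.1 * (y.1 - y0.1) + D.2 * (y.2 - y0.2) + (c - c0) * (D.1 * ξ.2 + D.2 * ξ.1)) / N)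
    calc wA ^ 8 * wB ^ 8 * wL ^ 4 = (wA * wB * wL) ^ 4 * (wA ^ 4 * wB ^ 4) := by ring
      _ ≤ (K ^ 3 * wb (b + -σ * c)) ^ 4 * (wA ^ 4 * wB ^ 4) := by gcongr
      _ = _ := by ring
  calc _ ≤ ∫⁻ c : ℂ, K ^ 12 * wb (b + (-σ) * c) ^ 4 * wbI ^ 2 := by
        refine lintegral_mono fun c => (lintegral_mono (key c)).trans ?_
        rw [lintegral_const_mul _ (by fun_prop)]
        gcongr
        exact lintegral_wb_mul_wb (by norm_num) _ _
    _ = K ^ 12 * wbI ^ 2 * ∫⁻ c : ℂ, wb (b + (-σ) * c) ^ 4 := by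
        rw [← lintegral_const_mul _ (by fun_prop)]
        refine lintegral_congr fun c => by ring
    _ ≤ K ^ 12 * wbI ^ 2 * (‖-σ‖ₑ⁻¹ ^ 2 * wbI) := by
        gcongr; exact lintegral_wb_affine (by norm_num) _ (neg_ne_zero.2 hσ0)
    _ ≤ K ^ 12 * wbI ^ 2 * ((δ * ENNReal.ofReal N)⁻¹ ^ 2 * wbI) := by
        gcongr; rwa [enorm_neg]
    _ = _ := by
        rw [ENNReal.mul_inv (Or.inl hδ) (Or.inr (by simpa using hN))]; ring

/-- Gaussian integers in a ball. -/
theorem card_gi_le {S : Finset (ℤ × ℤ)} {z : ℂ} {ρ s : ℝ} (hs : 1 ≤ s)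
    (h : ∀ n ∈ S, ‖gi n - z‖ ≤ ρ * s) :
    (S.card : ℝ≥0∞) ≤ (1 + ENNReal.ofReal ρ) ^ 4 * (3 ^ 4 * wbI) * ENNReal.ofReal s ^ 2 := by
  have hs0 : (0 : ℝ) < s := by linarith
  have hsn : ‖((s⁻¹ : ℝ) : ℂ)‖ₑ = (ENNReal.ofReal s)⁻¹ := by
    rw [← ofReal_norm, Complex.norm_real, Real.norm_of_nonneg (by positivity),
      ENNReal.ofReal_inv_of_pos hs0]
  have h1 : ∀ n ∈ S, 1 ≤ (1 + ENNReal.ofReal ρ) ^ 4 *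
      wb (-(((s⁻¹ : ℝ) : ℂ) * z) + ((s⁻¹ : ℝ) : ℂ) * gi n) ^ 4 := by
    intro n hn
    rw [← mul_pow]
    refine one_le_pow₀ ?_
    rw [wb, ← div_eq_mul_inv, ENNReal.le_div_iff_mul_le (by simp) (by simp), one_mul]
    gcongr
    rw [show -(((s⁻¹ : ℝ) : ℂ) * z) + ((s⁻¹ : ℝ) : ℂ) * gi n = ((s⁻¹ : ℝ) : ℂ) * (gi n - z) by ring,
      ← ofReal_norm, norm_mul, Complex.norm_real, Real.norm_of_nonneg (by positivity)]
    refine ENNReal.ofReal_le_ofReal ?_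
    rw [inv_mul_le_iff₀ hs0, mul_comm]; exact h n hn
  have h0 : ((s⁻¹ : ℝ) : ℂ) ≠ 0 := by exact_mod_cast (inv_pos.2 hs0).ne'
  calc (S.card : ℝ≥0∞) = ∑ n ∈ S, 1 := by simp
    _ ≤ ∑ n ∈ S, (1 + ENNReal.ofReal ρ) ^ 4 *
        wb (-(((s⁻¹ : ℝ) : ℂ) * z) + ((s⁻¹ : ℝ) : ℂ) * gi n) ^ 4 := Finset.sum_le_sum h1
    _ ≤ (1 + ENNReal.ofReal ρ) ^ 4 *
        ∑' n, wb (-(((s⁻¹ : ℝ) : ℂ) * z) + ((s⁻¹ : ℝ) : ℂ) * gi n) ^ 4 := by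
        rw [← Finset.mul_sum]; gcongr; exact ENNReal.sum_le_tsum _
    _ ≤ (1 + ENNReal.ofReal ρ) ^ 4 * ((1 + 2 * ‖((s⁻¹ : ℝ) : ℂ)‖ₑ) ^ 4 *
        (‖((s⁻¹ : ℝ) : ℂ)‖ₑ⁻¹ ^ 2 * wbI)) := by gcongr; exact tsum_gi_le _ h0
    _ ≤ (1 + ENNReal.ofReal ρ) ^ 4 * ((1 + 2 * 1) ^ 4 * (ENNReal.ofReal s ^ 2 * wbI)) := by
        rw [hsn, inv_inv]
        gcongr
        rw [ENNReal.inv_le_one]; simpa using ENNReal.ofReal_le_ofReal hs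
    _ = _ := by norm_num; ring

@[fun_prop] theorem measurable_KK_comp {α : Type*} [MeasurableSpace α] {p : ℂ × ℂ} {f : α → ℂ}
    {g : α → ℂ × ℂ} (hf : Measurable f) (hg : Measurable g) :
    Measurable (fun x => KK p (f x) (g x)) := by
  unfold KK; fun_prop

/-- The lattice point of phase space with the given index. -/
def g2 (ξ : (ℤ × ℤ) × (ℤ × ℤ)) : ℂ × ℂ := (gi ξ.1, gi ξ.2)

theorem sum_KK_le {N : ℝ} (hN : 0 < N) {K : ℝ≥0∞} (hK : K ≠ ∞) (h1 : 1 ≤ K) {ξ D : ℂ × ℂ}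
    (hD1 : ‖D.1 / N‖ₑ ≤ K) (hD2 : ‖D.2 / N‖ₑ ≤ K) {S : Finset ((ℤ × ℤ) × (ℤ × ℤ))}
    (hrel : ∀ ζ ∈ S, ‖(D.1 * (gi ζ.2 - ξ.2) + D.2 * (gi ζ.1 - ξ.1)) / N‖ₑ ≤ K) {M : ℝ≥0∞}
    (hM : ∀ n, ((S.filter fun ζ => ζ.1 = n).card : ℝ≥0∞) ≤ M) (s : ℂ) (y : ℂ × ℂ) :
    ∑ ζ ∈ S, KK (g2 ζ) s y ≤ K ^ 12 * (1 + ‖s‖ₑ) ^ 4 *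
      wb ((D.1 * y.1 + D.2 * y.2 + s * (D.1 * ξ.2 + D.2 * ξ.1)) / N) ^ 4 *
      (M * ∑ n ∈ S.image Prod.fst, wb (y.2 + s * gi n) ^ 4) := by
  have hN' : (N : ℂ) ≠ 0 := by exact_mod_cast hN.ne'
  set L := (D.1 * y.1 + D.2 * y.2 + s * (D.1 * ξ.2 + D.2 * ξ.1)) / N with hL
  have key : ∀ ζ ∈ S, KK (g2 ζ) s y ≤ K ^ 12 * (1 + ‖s‖ₑ) ^ 4 * wb L ^ 4 *
      wb (y.2 + s * gi ζ.1) ^ 4 := by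
    intro ζ hζ
    have h := wb_mul_mul_le hK h1 hD1 hD2 (f := -((D.1 * (gi ζ.2 - ξ.2) +
      D.2 * (gi ζ.1 - ξ.1)) / N)) (by rw [enorm_neg]; exact hrel ζ hζ) (y.1 + s * gi ζ.2)
      (y.2 + s * gi ζ.1) s
    rw [show D.1 / N * (y.1 + s * gi ζ.2) + D.2 / N * (y.2 + s * gi ζ.1) +
      -((D.1 * (gi ζ.2 - ξ.2) + D.2 * (gi ζ.1 - ξ.1)) / N) * s = L by
        rw [hL]; field_simp; ring] at h
    have h' : wb (y.1 + s * gi ζ.2) * wb (y.2 + s * gi ζ.1) ≤ K ^ 3 * wb L * (1 + ‖s‖ₑ) := by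
      rw [← wb_inv, ← div_eq_mul_inv,
        ENNReal.le_div_iff_mul_le (Or.inl (wb_ne_zero s)) (Or.inl (wb_ne_top s))]
      exact h
    calc KK (g2 ζ) s y ≤ (wb (y.1 + s * gi ζ.2) * wb (y.2 + s * gi ζ.1)) ^ 4 *
          wb (y.2 + s * gi ζ.1) ^ 4 := by
          rw [KK, mul_pow, mul_assoc, ← pow_add]
          exact mul_le_mul' (wb_pow_le (by norm_num) _) le_rfl
      _ ≤ (K ^ 3 * wb L * (1 + ‖s‖ₑ)) ^ 4 * wb (y.2 + s * gi ζ.1) ^ 4 := by gcongr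
      _ = _ := by ring
  calc _ ≤ ∑ ζ ∈ S, K ^ 12 * (1 + ‖s‖ₑ) ^ 4 * wb L ^ 4 * wb (y.2 + s * gi ζ.1) ^ 4 :=
        Finset.sum_le_sum key
    _ = K ^ 12 * (1 + ‖s‖ₑ) ^ 4 * wb L ^ 4 * ∑ n ∈ S.image Prod.fst,
        ((S.filter fun ζ => ζ.1 = n).card : ℝ≥0∞) * wb (y.2 + s * gi n) ^ 4 := by
        rw [← Finset.mul_sum, Finset.sum_comp (fun n => wb (y.2 + s * gi n) ^ 4) Prod.fst]
        simp only [nsmul_eq_mul]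
    _ ≤ _ := by
        gcongr
        rw [Finset.mul_sum]
        gcongr; exact hM _

theorem sum_wb_gi_le {N κ ρ : ℝ} (hN : 1 ≤ N) (hκ : 0 < κ) {S : Finset (ℤ × ℤ)} {z : ℂ}
    (hS : ∀ n ∈ S, ‖gi n - z‖ ≤ ρ * N) {s t : ℂ} (hst : κ ≤ 2 * ‖s + t‖) (b : ℂ) :
    ∑ n ∈ S, wb (b + s * gi n) ^ 4 ≤ (1 + ENNReal.ofReal ρ) ^ 4 * (3 ^ 4 * wbI) * 16 *
      (1 + ‖s‖ₑ) ^ 4 * (ENNReal.ofReal κ)⁻¹ ^ 2 * (1 + ENNReal.ofReal N * ‖t‖ₑ) ^ 2 := by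
  have h4 : κ ≤ 4 * ‖s‖ ∨ κ ≤ 4 * ‖t‖ := by
    by_contra! h
    linarith [norm_add_le s t]
  have hκ' : ∀ {x : ℂ}, κ ≤ 4 * ‖x‖ → ENNReal.ofReal κ ≤ 4 * ‖x‖ₑ := by
    intro x hx
    rw [← ofReal_norm, show (4 : ℝ≥0∞) = ENNReal.ofReal 4 by simp, ← ENNReal.ofReal_mul (by norm_num)]
    exact ENNReal.ofReal_le_ofReal hx
  have hκ0 : ENNReal.ofReal κ ≠ 0 := by simpa using hκ
  have hinv : ∀ {x : ℂ}, κ ≤ 4 * ‖x‖ → ‖x‖ₑ⁻¹ ≤ 4 * (ENNReal.ofReal κ)⁻¹ := by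
    intro x hx
    rw [← div_eq_mul_inv, ENNReal.le_div_iff_mul_le (Or.inl hκ0) (Or.inl ofReal_ne_top)]
    have hx0 : ‖x‖ₑ ≠ 0 := by
      rw [enorm_ne_zero]; rintro rfl; simp at hx; linarith
    calc _ ≤ ‖x‖ₑ⁻¹ * (4 * ‖x‖ₑ) := by gcongr; exact hκ' hx
      _ = 4 * (‖x‖ₑ⁻¹ * ‖x‖ₑ) := by ring
      _ = 4 := by rw [ENNReal.inv_mul_cancel hx0 enorm_ne_top, mul_one]
  rcases h4 with h | h
  · have hs : s ≠ 0 := by rintro rfl; simp at h; linarith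
    calc _ ≤ (1 + 2 * ‖s‖ₑ) ^ 4 * (‖s‖ₑ⁻¹ ^ 2 * wbI) :=
          (ENNReal.sum_le_tsum _).trans (tsum_gi_le b hs)
      _ ≤ (3 * (1 + ‖s‖ₑ)) ^ 4 * ((4 * (ENNReal.ofReal κ)⁻¹) ^ 2 * wbI) := by
          gcongr
          · rw [mul_add]; gcongr <;> norm_num
          · exact hinv h
      _ = 1 ^ 4 * (3 ^ 4 * wbI) * 16 * (1 + ‖s‖ₑ) ^ 4 * (ENNReal.ofReal κ)⁻¹ ^ 2 * 1 ^ 2 := by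
          norm_num; ring
      _ ≤ _ := by gcongr <;> exact le_self_add
  · calc _ ≤ ∑ n ∈ S, (1 : ℝ≥0∞) :=
          Finset.sum_le_sum fun n _ => pow_le_one₀ zero_le (wb_le_one _)
      _ = S.card := by simp
      _ ≤ _ := card_gi_le hN hS
      _ ≤ (1 + ENNReal.ofReal ρ) ^ 4 * (3 ^ 4 * wbI) * (ENNReal.ofReal N *
          (4 * (ENNReal.ofReal κ)⁻¹ * ‖t‖ₑ)) ^ 2 := by
          gcongr
          calc ENNReal.ofReal N = ENNReal.ofReal N * ((ENNReal.ofReal κ)⁻¹ * ENNReal.ofReal κ) := by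
                rw [ENNReal.inv_mul_cancel hκ0 ofReal_ne_top, mul_one]
            _ ≤ ENNReal.ofReal N * ((ENNReal.ofReal κ)⁻¹ * (4 * ‖t‖ₑ)) := by gcongr; exact hκ' h
            _ = _ := by ring
      _ = (1 + ENNReal.ofReal ρ) ^ 4 * (3 ^ 4 * wbI) * 16 * 1 ^ 4 * (ENNReal.ofReal κ)⁻¹ ^ 2 *
          (ENNReal.ofReal N * ‖t‖ₑ) ^ 2 := by rw [one_pow]; ring
      _ ≤ _ := by gcongr <;> first | exact le_self_add | exact le_add_self


/-- The time weight. -/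
def om (c : ℂ) : ℝ≥0∞ := wb c ^ 8

@[fun_prop] theorem measurable_om : Measurable om := by unfold om; fun_prop

theorem om_ne_top (c : ℂ) : om c ≠ ∞ := ENNReal.pow_ne_top (wb_ne_top _)

theorem convConst_ne_top : ((2 : ℝ≥0∞) ^ 9 * wbI) ^ 2 ≠ ∞ :=
  ENNReal.pow_ne_top (ENNReal.mul_ne_top (by simp) wbI_lt_top.ne)

/-- The smoothed density of a family of wave packets. -/
def muD (η : ℂ × ℂ) (H : ℂ × ℂ → ℝ≥0∞) (c : ℂ) (y : ℂ × ℂ) : ℝ≥0∞ := ∫⁻ x, H x * KK η c (y - x)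

theorem measurable_muD (η : ℂ × ℂ) {H : ℂ × ℂ → ℝ≥0∞} (hH : Measurable H) :
    Measurable fun z : ℂ × (ℂ × ℂ) => muD η H z.1 z.2 := by
  unfold muD
  exact Measurable.lintegral_prod_right' (f := fun z : (ℂ × (ℂ × ℂ)) × (ℂ × ℂ) =>
    H z.2 * KK η z.1.1 (z.1.2 - z.2)) (by fun_prop)

/-- The mass carried by a wave packet tube in a set of times. -/
def mB (P : Set ℂ) (μ : ℂ → ℂ × ℂ → ℝ≥0∞) (ξ x : ℂ × ℂ) : ℝ≥0∞ :=
  ∫⁻ c in P, om c * ∫⁻ y, μ c y * KK ξ c (y - x)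

theorem measurable_mB (P : Set ℂ) {μ : ℂ → ℂ × ℂ → ℝ≥0∞}
    (hμ : Measurable fun z : ℂ × (ℂ × ℂ) => μ z.1 z.2) (ξ : ℂ × ℂ) : Measurable (mB P μ ξ) := by
  have h1 : Measurable fun z : ((ℂ × ℂ) × ℂ) => ∫⁻ y, μ z.2 y * KK ξ z.2 (y - z.1) :=
    Measurable.lintegral_prod_right' (f := fun z : ((ℂ × ℂ) × ℂ) × (ℂ × ℂ) =>
      μ z.1.2 z.2 * KK ξ z.1.2 (z.2 - z.1.1))
      ((hμ.comp (by fun_prop : Measurable fun z : ((ℂ × ℂ) × ℂ) × (ℂ × ℂ) => (z.1.2, z.2))).mul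
        (by fun_prop))
  unfold mB
  exact Measurable.lintegral_prod_right' (f := fun z : (ℂ × ℂ) × ℂ =>
    om z.2 * ∫⁻ y, μ z.2 y * KK ξ z.2 (y - z.1)) ((measurable_om.comp measurable_snd).mul h1)

theorem lintegral_mB_mul_KK_le {P : Set ℂ} {μ : ℂ → ℂ × ℂ → ℝ≥0∞}
    (hμ : Measurable fun z : ℂ × (ℂ × ℂ) => μ z.1 z.2) (ξ : ℂ × ℂ) (c : ℂ) (y : ℂ × ℂ) :
    ∫⁻ x, mB P μ ξ x * KK ξ c (y - x) ≤ (2 ^ 9 * wbI) ^ 2 *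
      ∫⁻ c' in P, om c' * ∫⁻ y', μ c' y' * KK ξ (c' - c) (y' - y) := by
  have hμ1 : ∀ c', Measurable (μ c') := fun c' => hμ.comp (Measurable.prodMk measurable_const measurable_id)
  have h1 : Measurable fun z : ((ℂ × ℂ) × ℂ) => ∫⁻ y, μ z.2 y * KK ξ z.2 (y - z.1) :=
    Measurable.lintegral_prod_right' (f := fun z : ((ℂ × ℂ) × ℂ) × (ℂ × ℂ) =>
      μ z.1.2 z.2 * KK ξ z.1.2 (z.2 - z.1.1))
      ((hμ.comp (by fun_prop : Measurable fun z : ((ℂ × ℂ) × ℂ) × (ℂ × ℂ) => (z.1.2, z.2))).mul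
        (by fun_prop))
  have h2 : Measurable fun z : ℂ × (ℂ × ℂ) => ∫⁻ y', μ z.1 y' * KK ξ (z.1 - c) (y' - y) :=
    Measurable.lintegral_prod_right' (f := fun z : (ℂ × (ℂ × ℂ)) × (ℂ × ℂ) =>
      μ z.1.1 z.2 * KK ξ (z.1.1 - c) (z.2 - y))
      ((hμ.comp (by fun_prop : Measurable fun z : (ℂ × (ℂ × ℂ)) × (ℂ × ℂ) => (z.1.1, z.2))).mul
        (by fun_prop))
  calc ∫⁻ x, mB P μ ξ x * KK ξ c (y - x)
      = ∫⁻ x, ∫⁻ c' in P, (om c' * ∫⁻ y', μ c' y' * KK ξ c' (y' - x)) * KK ξ c (y - x) := by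
        refine lintegral_congr fun x => ?_
        rw [mB, lintegral_mul_const']
        exact KK_ne_top _ _ _
    _ = ∫⁻ c' in P, ∫⁻ x, (om c' * ∫⁻ y', μ c' y' * KK ξ c' (y' - x)) * KK ξ c (y - x) := by
        rw [lintegral_lintegral_swap]
        exact (((measurable_om.comp measurable_snd).mul h1).mul (by fun_prop)).aemeasurable
    _ ≤ ∫⁻ c' in P, (2 ^ 9 * wbI) ^ 2 * (om c' * ∫⁻ y', μ c' y' * KK ξ (c' - c) (y' - y)) := by
        refine lintegral_mono fun c' => ?_
        calc ∫⁻ x, (om c' * ∫⁻ y', μ c' y' * KK ξ c' (y' - x)) * KK ξ c (y - x)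
            = om c' * ∫⁻ x, ∫⁻ y', μ c' y' * (KK ξ c' (y' - x) * KK ξ c (y - x)) := by
              rw [← lintegral_const_mul' _ _ (om_ne_top c')]
              refine lintegral_congr fun x => ?_
              rw [mul_assoc, ← lintegral_mul_const' _ _ (KK_ne_top _ _ _)]
              simp only [mul_assoc]
          _ = om c' * ∫⁻ y', ∫⁻ x, μ c' y' * (KK ξ c' (y' - x) * KK ξ c (y - x)) := by
              rw [lintegral_lintegral_swap]
              exact (((hμ1 c').comp measurable_snd).mul (by fun_prop)).aemeasurable
          _ ≤ om c' * ∫⁻ y', (2 ^ 9 * wbI) ^ 2 * (μ c' y' * KK ξ (c' - c) (y' - y)) := by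
              gcongr with y'
              rw [lintegral_const_mul _ (by fun_prop), mul_left_comm]
              gcongr
              exact lintegral_KK_mul_KK _ _ _ _ _
          _ = _ := by
              rw [lintegral_const_mul' _ _ convConst_ne_top, mul_left_comm]
    _ = _ := lintegral_const_mul' _ _ convConst_ne_top

theorem lintegral_muD_le (η : ℂ × ℂ) {H : ℂ × ℂ → ℝ≥0∞} (hH : Measurable H) {k : ℂ → ℂ × ℂ → ℝ≥0∞}
    (hk : Measurable fun z : ℂ × (ℂ × ℂ) => k z.1 z.2) {A : ℝ≥0∞}
    (h : ∀ x, ∫⁻ c, ∫⁻ y, KK η c (y - x) * k c y ≤ A) :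
    ∫⁻ c, ∫⁻ y, muD η H c y * k c y ≤ A * ∫⁻ x, H x := by
  have hk1 : ∀ c, Measurable (k c) := fun c => hk.comp (Measurable.prodMk measurable_const measurable_id)
  have hg : Measurable fun z : ℂ × (ℂ × ℂ) => ∫⁻ y, KK η z.1 (y - z.2) * k z.1 y :=
    Measurable.lintegral_prod_right' (f := fun z : (ℂ × (ℂ × ℂ)) × (ℂ × ℂ) =>
      KK η z.1.1 (z.2 - z.1.2) * k z.1.1 z.2) ((by fun_prop : Measurable
      fun z : (ℂ × (ℂ × ℂ)) × (ℂ × ℂ) => KK η z.1.1 (z.2 - z.1.2)).mul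
        (hk.comp (by fun_prop : Measurable fun z : (ℂ × (ℂ × ℂ)) × (ℂ × ℂ) => (z.1.1, z.2))))
  have hgx : ∀ x, Measurable fun c : ℂ => ∫⁻ y, KK η c (y - x) * k c y := fun x =>
    Measurable.lintegral_prod_right' (f := fun z : ℂ × (ℂ × ℂ) => KK η z.1 (z.2 - x) * k z.1 z.2)
      ((by fun_prop : Measurable fun z : ℂ × (ℂ × ℂ) => KK η z.1 (z.2 - x)).mul hk)
  calc ∫⁻ c, ∫⁻ y, muD η H c y * k c y
      = ∫⁻ c, ∫⁻ x, H x * ∫⁻ y, KK η c (y - x) * k c y := by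
        refine lintegral_congr fun c => ?_
        calc ∫⁻ y, muD η H c y * k c y = ∫⁻ y, ∫⁻ x, H x * KK η c (y - x) * k c y := by
              refine lintegral_congr fun y => ?_
              rw [muD, lintegral_mul_const _ (by fun_prop)]
          _ = ∫⁻ x, ∫⁻ y, H x * KK η c (y - x) * k c y := by
              rw [lintegral_lintegral_swap]
              exact ((by fun_prop : Measurable fun z : (ℂ × ℂ) × (ℂ × ℂ) => H z.2 * KK η c (z.1 - z.2)).mul
                ((hk1 c).comp measurable_fst)).aemeasurable
          _ = _ := by
              refine lintegral_congr fun x => ?_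
              simp only [mul_assoc]
              exact lintegral_const_mul (H x) (f := fun y => KK η c (y - x) * k c y)
                ((by fun_prop : Measurable fun y : ℂ × ℂ => KK η c (y - x)).mul (hk1 c))
    _ = ∫⁻ x, ∫⁻ c, H x * ∫⁻ y, KK η c (y - x) * k c y := by
        rw [lintegral_lintegral_swap]
        exact ((hH.comp measurable_snd).mul hg).aemeasurable
    _ = ∫⁻ x, H x * ∫⁻ c, ∫⁻ y, KK η c (y - x) * k c y := by
        refine lintegral_congr fun x => ?_
        exact lintegral_const_mul (H x) (hgx x)
    _ ≤ ∫⁻ x, A * H x := lintegral_mono fun x => by rw [mul_comm]; gcongr; exact h x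
    _ = _ := lintegral_const_mul _ hH

theorem om_mul_le (c c' : ℂ) : om c' * (1 + ‖c' - c‖ₑ) ^ 8 ≤ (1 + ‖c‖ₑ) ^ 8 := by
  rw [om, ← mul_pow]
  gcongr
  have := wb_le_mul_inv c' (-c)
  rw [enorm_neg, ← sub_eq_add_neg] at this
  calc wb c' * (1 + ‖c' - c‖ₑ) ≤ wb (c' - c) * (1 + ‖c‖ₑ) * (1 + ‖c' - c‖ₑ) := by gcongr
    _ = (wb (c' - c) * (wb (c' - c))⁻¹) * (1 + ‖c‖ₑ) := by rw [wb_inv]; ring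
    _ = _ := by rw [ENNReal.mul_inv_cancel (wb_ne_zero _) (wb_ne_top _), one_mul]


theorem measurable_slice {k : ℂ → ℂ × ℂ → ℝ≥0∞} (hk : Measurable fun z : ℂ × (ℂ × ℂ) => k z.1 z.2)
    (c : ℂ) : Measurable (k c) :=
  hk.comp (Measurable.prodMk measurable_const measurable_id)

theorem measurable_lintegral_slice {k : ℂ → ℂ × ℂ → ℝ≥0∞}
    (hk : Measurable fun z : ℂ × (ℂ × ℂ) => k z.1 z.2) : Measurable fun c => ∫⁻ y, k c y :=
  Measurable.lintegral_prod_right' (f := fun z : ℂ × (ℂ × ℂ) => k z.1 z.2) hk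

/-- The weight concentrated near a family of planes. -/
def wL (N : ℝ) (ξ D : ℂ × ℂ) (s : ℂ) (y : ℂ × ℂ) : ℝ≥0∞ :=
  wb ((D.1 * y.1 + D.2 * y.2 + s * (D.1 * ξ.2 + D.2 * ξ.1)) / N) ^ 4

theorem measurable_wL (N : ℝ) (ξ D : ℂ × ℂ) (c : ℂ) (y : ℂ × ℂ) :
    Measurable fun z : ℂ × (ℂ × ℂ) => wL N ξ D (z.1 - c) (z.2 - y) := by
  unfold wL; fun_prop

theorem lintegral_lintegral_sum_mul {ι : Type*} (T : Finset ι) {m : ι → ℂ → ℂ × ℂ → ℝ≥0∞}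
    {L : ℂ → ℂ × ℂ → ℝ≥0∞} (hm : ∀ j, Measurable fun z : ℂ × (ℂ × ℂ) => m j z.1 z.2)
    (hL : Measurable fun z : ℂ × (ℂ × ℂ) => L z.1 z.2) :
    ∫⁻ c, ∫⁻ y, (∑ j ∈ T, m j c y) * L c y = ∑ j ∈ T, ∫⁻ c, ∫⁻ y, m j c y * L c y := by
  rw [← lintegral_finsetSum T fun j _ =>
    measurable_lintegral_slice (k := fun c y => m j c y * L c y) ((hm j).mul hL)]
  refine lintegral_congr fun c => ?_
  rw [← lintegral_finsetSum T fun j _ =>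
    measurable_slice (k := fun c y => m j c y * L c y) ((hm j).mul hL) c]
  simp only [Finset.sum_mul]

theorem lintegral_sum_muD_wL_le {N : ℝ} (hN : 0 < N) {K : ℝ≥0∞} (hK : K ≠ ∞) (h1 : 1 ≤ K)
    {ξ D : ℂ × ℂ} (hD1 : ‖D.1 / N‖ₑ ≤ K) (hD2 : ‖D.2 / N‖ₑ ≤ K) {ι : Type*} {T : Finset ι}
    {η : ι → ℂ × ℂ} {δ : ℝ≥0∞} (hδ : δ ≠ 0) (hσ : ∀ j ∈ T, δ * ENNReal.ofReal N ≤
      ‖(D.1 * ((η j).2 - ξ.2) + D.2 * ((η j).1 - ξ.1)) / N‖ₑ) {H : ι → ℂ × ℂ → ℝ≥0∞}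
    (hH : ∀ j, Measurable (H j)) (c : ℂ) (y : ℂ × ℂ) :
    ∫⁻ c', ∫⁻ y', (∑ j ∈ T, muD (η j) (H j) c' y') * wL N ξ D (c' - c) (y' - y) ≤
      K ^ 12 * wbI ^ 3 * δ⁻¹ ^ 2 * (ENNReal.ofReal N)⁻¹ ^ 2 * ∑ j ∈ T, ∫⁻ x, H j x := by
  rw [lintegral_lintegral_sum_mul T (m := fun j c' y' => muD (η j) (H j) c' y')
    (L := fun c' y' => wL N ξ D (c' - c) (y' - y)) (fun j => measurable_muD (η j) (hH j))
    (measurable_wL N ξ D c y), Finset.mul_sum]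
  refine Finset.sum_le_sum fun j hj => lintegral_muD_le (η j) (hH j) (measurable_wL N ξ D c y) fun x => ?_
  exact lintegral_KK_mul_wb_le hN hK h1 hD1 hD2 hδ (hσ j hj) x y c

theorem om_mul_sum_le {N κ ρ : ℝ} (hN : 1 ≤ N) (hκ : 0 < κ) {K : ℝ≥0∞} (hK : K ≠ ∞) (h1 : 1 ≤ K)
    {ξ D z : ℂ × ℂ} (hD1 : ‖D.1 / N‖ₑ ≤ K) (hD2 : ‖D.2 / N‖ₑ ≤ K)
    {S : Finset ((ℤ × ℤ) × (ℤ × ℤ))} (hS : ∀ ζ ∈ S, ‖gi ζ.1 - z.1‖ ≤ ρ * N)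
    (hrel : ∀ ζ ∈ S, ‖(D.1 * (gi ζ.2 - ξ.2) + D.2 * (gi ζ.1 - ξ.1)) / N‖ₑ ≤ K) {M : ℝ≥0∞}
    (hM : ∀ n, ((S.filter fun ζ => ζ.1 = n).card : ℝ≥0∞) ≤ M) {c0 c' : ℂ}
    (hc' : κ ≤ 2 * ‖c' - c0‖) (c : ℂ) (y y' : ℂ × ℂ) :
    om c' * ∑ ζ ∈ S, KK (g2 ζ) (c' - c) (y' - y) ≤
      K ^ 12 * M * ((1 + ENNReal.ofReal ρ) ^ 4 * (3 ^ 4 * wbI) * 16) *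
      ((ENNReal.ofReal κ)⁻¹ ^ 2 * (1 + ENNReal.ofReal N * ‖c - c0‖ₑ) ^ 2) * (1 + ‖c‖ₑ) ^ 8 *
      wL N ξ D (c' - c) (y' - y) := by
  have hsum := sum_wb_gi_le (S := S.image Prod.fst) (z := z.1) (ρ := ρ) hN hκ (by
    intro n hn
    obtain ⟨ζ, hζ, rfl⟩ := Finset.mem_image.1 hn
    exact hS ζ hζ) (s := c' - c) (t := c - c0) (by rw [sub_add_sub_cancel]; exact hc') (y' - y).2
  have hs := sum_KK_le (by linarith : 0 < N) hK h1 hD1 hD2 hrel hM (c' - c) (y' - y)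
  generalize (1 + ENNReal.ofReal ρ) ^ 4 * (3 ^ 4 * wbI) * 16 = W at *
  calc _ ≤ om c' * (K ^ 12 * (1 + ‖c' - c‖ₑ) ^ 4 * wL N ξ D (c' - c) (y' - y) * (M *
        (W * (1 + ‖c' - c‖ₑ) ^ 4 * (ENNReal.ofReal κ)⁻¹ ^ 2 *
          (1 + ENNReal.ofReal N * ‖c - c0‖ₑ) ^ 2))) := by
        gcongr
        exact hs.trans (mul_le_mul' le_rfl (mul_le_mul' le_rfl hsum))
    _ = (K ^ 12 * M * W * ((ENNReal.ofReal κ)⁻¹ ^ 2 * (1 + ENNReal.ofReal N * ‖c - c0‖ₑ) ^ 2)) *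
        (om c' * (1 + ‖c' - c‖ₑ) ^ 8) * wL N ξ D (c' - c) (y' - y) := by ring
    _ ≤ _ := by gcongr; exact om_mul_le c c'

/-- The fan estimate: the mass of the tubes through a point, in the far region. -/
theorem fan_le {N κ ρ : ℝ} (hN : 1 ≤ N) (hκ : 0 < κ) {K : ℝ≥0∞} (hK : K ≠ ∞) (h1 : 1 ≤ K)
    {ξ D z : ℂ × ℂ} (hD1 : ‖D.1 / N‖ₑ ≤ K) (hD2 : ‖D.2 / N‖ₑ ≤ K)
    {S : Finset ((ℤ × ℤ) × (ℤ × ℤ))} (hS : ∀ ζ ∈ S, ‖gi ζ.1 - z.1‖ ≤ ρ * N)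
    (hrel : ∀ ζ ∈ S, ‖(D.1 * (gi ζ.2 - ξ.2) + D.2 * (gi ζ.1 - ξ.1)) / N‖ₑ ≤ K) {M : ℝ≥0∞}
    (hM : ∀ n, ((S.filter fun ζ => ζ.1 = n).card : ℝ≥0∞) ≤ M) {ι : Type*} {T : Finset ι}
    {η : ι → ℂ × ℂ} {δ : ℝ≥0∞} (hδ : δ ≠ 0) (hσ : ∀ j ∈ T, δ * ENNReal.ofReal N ≤
      ‖(D.1 * ((η j).2 - ξ.2) + D.2 * ((η j).1 - ξ.1)) / N‖ₑ) {H : ι → ℂ × ℂ → ℝ≥0∞}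
    (hH : ∀ j, Measurable (H j)) {P : Set ℂ} (hP : MeasurableSet P) {c0 : ℂ}
    (hP0 : ∀ c ∈ P, κ ≤ 2 * ‖c - c0‖)
    (c : ℂ) (y : ℂ × ℂ) :
    ∑ ζ ∈ S, ∫⁻ x, mB P (fun c y => ∑ j ∈ T, muD (η j) (H j) c y) (g2 ζ) x * KK (g2 ζ) c (y - x) ≤
      ((2 ^ 9 * wbI) ^ 2 * (K ^ 12 * M * ((1 + ENNReal.ofReal ρ) ^ 4 * (3 ^ 4 * wbI) * 16)) *
        (K ^ 12 * wbI ^ 3 * δ⁻¹ ^ 2)) *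
      ((ENNReal.ofReal κ)⁻¹ ^ 2 * (ENNReal.ofReal N)⁻¹ ^ 2 * (1 + ENNReal.ofReal N * ‖c - c0‖ₑ) ^ 2 *
        (1 + ‖c‖ₑ) ^ 8) * ∑ j ∈ T, ∫⁻ x, H j x := by
  have hμ : Measurable fun z : ℂ × (ℂ × ℂ) => ∑ j ∈ T, muD (η j) (H j) z.1 z.2 :=
    Finset.measurable_fun_sum _ fun j _ => measurable_muD (η j) (hH j)
  have trace := lintegral_sum_muD_wL_le (by linarith : 0 < N) hK h1 hD1 hD2 hδ hσ hH c y
  have pt0 : ∀ c' ∈ P, ∀ y' : ℂ × ℂ, _ := fun c' hc' y' =>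
    om_mul_sum_le hN hκ hK h1 hD1 hD2 hS hrel hM (hP0 c' hc') c y y'
  generalize K ^ 12 * M * ((1 + ENNReal.ofReal ρ) ^ 4 * (3 ^ 4 * wbI) * 16) = W1 at *
  generalize K ^ 12 * wbI ^ 3 * δ⁻¹ ^ 2 = W2 at *
  generalize hμd : (fun c y => ∑ j ∈ T, muD (η j) (H j) c y) = μ at *
  replace hμ : Measurable fun z : ℂ × (ℂ × ℂ) => μ z.1 z.2 := by rw [← hμd]; exact hμ
  replace trace : ∫⁻ c', ∫⁻ y', μ c' y' * wL N ξ D (c' - c) (y' - y) ≤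
      W2 * (ENNReal.ofReal N)⁻¹ ^ 2 * ∑ j ∈ T, ∫⁻ x, H j x := by
    rw [← hμd]; exact trace
  have hk : ∀ ζ, Measurable fun z : ℂ × (ℂ × ℂ) => μ z.1 z.2 * KK (g2 ζ) (z.1 - c) (z.2 - y) :=
    fun ζ => hμ.mul (by fun_prop)
  have hkL : Measurable fun z : ℂ × (ℂ × ℂ) => μ z.1 z.2 * wL N ξ D (z.1 - c) (z.2 - y) :=
    hμ.mul (measurable_wL N ξ D c y)
  have hk1 : ∀ c' ζ, Measurable fun y' => μ c' y' * KK (g2 ζ) (c' - c) (y' - y) := fun c' ζ =>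
    (hk ζ).comp (Measurable.prodMk measurable_const measurable_id)
  have hkL1 : ∀ c', Measurable fun y' => μ c' y' * wL N ξ D (c' - c) (y' - y) := fun c' =>
    hkL.comp (Measurable.prodMk measurable_const measurable_id)
  have hk2 : ∀ ζ, Measurable fun c' => ∫⁻ y', μ c' y' * KK (g2 ζ) (c' - c) (y' - y) := fun ζ =>
    measurable_lintegral_slice (k := fun c' y' => μ c' y' * KK (g2 ζ) (c' - c) (y' - y)) (hk ζ)
  have hkL2 : Measurable fun c' => ∫⁻ y', μ c' y' * wL N ξ D (c' - c) (y' - y) :=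
    measurable_lintegral_slice (k := fun c' y' => μ c' y' * wL N ξ D (c' - c) (y' - y)) hkL
  generalize hQ : (ENNReal.ofReal κ)⁻¹ ^ 2 * (1 + ENNReal.ofReal N * ‖c - c0‖ₑ) ^ 2 = Q at *
  have pt : ∀ c' ∈ P, om c' * ∑ ζ ∈ S, ∫⁻ y', μ c' y' * KK (g2 ζ) (c' - c) (y' - y) ≤
      W1 * Q * (1 + ‖c‖ₑ) ^ 8 * ∫⁻ y', μ c' y' * wL N ξ D (c' - c) (y' - y) := by
    intro c' hc'
    rw [← lintegral_finsetSum S fun ζ _ => hk1 c' ζ,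
      ← lintegral_const_mul' _ _ (om_ne_top c'), ← lintegral_const_mul _ (hkL1 c')]
    refine lintegral_mono fun y' => ?_
    rw [← Finset.mul_sum]
    calc _ = μ c' y' * (om c' * ∑ ζ ∈ S, KK (g2 ζ) (c' - c) (y' - y)) := by ring
      _ ≤ _ := mul_le_mul' le_rfl (pt0 c' hc' y')
      _ = _ := by ring
  calc _ ≤ ∑ ζ ∈ S, (2 ^ 9 * wbI) ^ 2 *
        ∫⁻ c' in P, om c' * ∫⁻ y', μ c' y' * KK (g2 ζ) (c' - c) (y' - y) :=
        Finset.sum_le_sum fun ζ _ => lintegral_mB_mul_KK_le hμ _ c y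
    _ = (2 ^ 9 * wbI) ^ 2 * ∫⁻ c' in P, om c' * ∑ ζ ∈ S,
        ∫⁻ y', μ c' y' * KK (g2 ζ) (c' - c) (y' - y) := by
        have hk3 : ∀ ζ ∈ S, Measurable fun c' =>
            om c' * ∫⁻ y', μ c' y' * KK (g2 ζ) (c' - c) (y' - y) := fun ζ _ =>
          measurable_om.mul (hk2 ζ)
        rw [← Finset.mul_sum, ← lintegral_finsetSum S hk3]
        simp only [Finset.mul_sum]
    _ ≤ (2 ^ 9 * wbI) ^ 2 * ∫⁻ c' in P, W1 * Q * (1 + ‖c‖ₑ) ^ 8 *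
        ∫⁻ y', μ c' y' * wL N ξ D (c' - c) (y' - y) :=
        mul_le_mul' le_rfl (setLIntegral_mono' hP pt)
    _ ≤ (2 ^ 9 * wbI) ^ 2 * (W1 * Q * (1 + ‖c‖ₑ) ^ 8 *
        ∫⁻ c', ∫⁻ y', μ c' y' * wL N ξ D (c' - c) (y' - y)) := by
        refine mul_le_mul' le_rfl ((setLIntegral_le_lintegral _ _).trans (le_of_eq ?_))
        exact lintegral_const_mul _ hkL2
    _ ≤ _ := by
        refine (mul_le_mul' le_rfl (mul_le_mul' le_rfl trace)).trans (le_of_eq ?_)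
        rw [← hQ]; ring

theorem hasSum_gb (w : ℂ × ℂ) : HasSum (fun ξ => gb (g2 ξ) w ^ 2) 1 := by
  have h := (hasSum_gc w.1).mul (hasSum_gc w.2) ((hasSum_gc w.1).summable.mul_of_nonneg
    (hasSum_gc w.2).summable (fun _ => sq_nonneg _) (fun _ => sq_nonneg _))
  have := Complex.hasSum_ofReal.2 h
  simpa [gb, g2, mul_pow] using this

theorem sum_enorm_gb_sq_le (S : Finset ((ℤ × ℤ) × (ℤ × ℤ))) (w : ℂ × ℂ) :
    ∑ ξ ∈ S, ‖gb (g2 ξ) w‖ₑ ^ 2 ≤ 1 := by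
  have h := (hasSum_gc w.1).mul (hasSum_gc w.2) ((hasSum_gc w.1).summable.mul_of_nonneg
    (hasSum_gc w.2).summable (fun _ => sq_nonneg _) (fun _ => sq_nonneg _))
  have h' := sum_le_hasSum S (fun ξ _ => mul_nonneg (sq_nonneg _) (sq_nonneg _)) h
  have e : ∀ ξ : (ℤ × ℤ) × (ℤ × ℤ), ‖gb (g2 ξ) w‖ₑ ^ 2 =
      ENNReal.ofReal (gc (w.1 - gi ξ.1) ^ 2 * gc (w.2 - gi ξ.2) ^ 2) := by
    intro ξ
    rw [← ofReal_norm, ← ENNReal.ofReal_pow (norm_nonneg _), gb, norm_mul, Complex.norm_real,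
      Complex.norm_real, mul_pow]
    simp [g2]
  simp only [e]
  rw [← ENNReal.ofReal_sum_of_nonneg fun ξ _ => mul_nonneg (sq_nonneg _) (sq_nonneg _),
    ← ENNReal.ofReal_one]
  exact ENNReal.ofReal_le_ofReal (by simpa using h')

theorem exists_gb_cover {D : Set (ℂ × ℂ)} (hD : Bornology.IsBounded D) :
    ∃ S : Finset ((ℤ × ℤ) × (ℤ × ℤ)), (∀ ξ ∈ S, ∃ p ∈ D, ‖p - g2 ξ‖ ≤ 2) ∧
      ∀ w ∈ D, ∑ ξ ∈ S, gb (g2 ξ) w ^ 2 = 1 := by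
  obtain ⟨R, hR⟩ := hD.exists_norm_le
  have hfin : {ξ : (ℤ × ℤ) × (ℤ × ℤ) | ∃ p ∈ D, ‖p - g2 ξ‖ ≤ 2}.Finite := by
    set M : ℤ := ⌈R + 2⌉ with hM
    refine (((Set.finite_Icc (-M) M).prod (Set.finite_Icc (-M) M)).prod
      ((Set.finite_Icc (-M) M).prod (Set.finite_Icc (-M) M))).subset ?_
    rintro ξ ⟨p, hp, h⟩
    have h1 : ‖g2 ξ‖ ≤ R + 2 := by
      have := norm_sub_le p (p - g2 ξ)
      rw [_root_.sub_sub_cancel] at this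
      linarith [hR p hp]
    have hi : ∀ n : ℤ × ℤ, ‖gi n‖ ≤ R + 2 → n ∈ Set.Icc (-M) M ×ˢ Set.Icc (-M) M := by
      intro n hn
      have a1 := (Complex.abs_re_le_norm (gi n)).trans hn
      have a2 := (Complex.abs_im_le_norm (gi n)).trans hn
      have b1 : (|n.1| : ℤ) ≤ M := by
        have : ((|n.1| : ℤ) : ℝ) ≤ R + 2 := by simpa [gi] using a1
        exact_mod_cast this.trans (Int.le_ceil _)
      have b2 : (|n.2| : ℤ) ≤ M := by
        have : ((|n.2| : ℤ) : ℝ) ≤ R + 2 := by simpa [gi] using a2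
        exact_mod_cast this.trans (Int.le_ceil _)
      exact ⟨abs_le.1 b1, abs_le.1 b2⟩
    exact ⟨hi _ ((norm_fst_le (g2 ξ)).trans h1), hi _ ((norm_snd_le (g2 ξ)).trans h1)⟩
  refine ⟨hfin.toFinset, fun ξ hξ => by simpa using hξ, fun w hw => ?_⟩
  refine (hasSum_sum_of_ne_finset_zero fun ξ hξ => ?_).unique (hasSum_gb w)
  by_contra h
  refine hξ (hfin.mem_toFinset.2 ⟨w, hw, norm_le_of_gb_ne_zero ?_⟩)
  exact fun h0 => h (by rw [h0]; simp)

theorem memLp_mul_gb {f : ℂ × ℂ → ℂ} (h2 : MemLp f 2) (p : ℂ × ℂ) :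
    MemLp (fun w => gb p w * f w) 2 := by
  refine h2.of_le ((continuous_gb p).aestronglyMeasurable.mul h2.1)
    (Filter.Eventually.of_forall fun w => ?_)
  rw [norm_mul]
  refine mul_le_of_le_one_left (norm_nonneg _) ?_
  have := enorm_gb_le_one p w
  rw [← ofReal_norm, ← ENNReal.ofReal_one] at this
  exact (ENNReal.ofReal_le_ofReal_iff zero_le_one).1 this

theorem memLp_gb (p : ℂ × ℂ) : MemLp (gb p) 2 :=
  (continuous_gb p).memLp_of_hasCompactSupport (hasCompactSupport_gb p)

theorem integrable_gb_mul {f : ℂ × ℂ → ℂ} (h2 : MemLp f 2) (p : ℂ × ℂ) :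
    Integrable (fun w => gb p w * f w) := (memLp_gb p).integrable_mul h2

theorem sum_lintegral_gb_mul_le (S : Finset ((ℤ × ℤ) × (ℤ × ℤ))) {f : ℂ × ℂ → ℂ} (h2 : MemLp f 2) :
    ∑ ξ ∈ S, ∫⁻ w, ‖gb (g2 ξ) w * f w‖ₑ ^ 2 ≤ ∫⁻ w, ‖f w‖ₑ ^ 2 := by
  rw [← lintegral_finsetSum' S fun ξ _ => (memLp_mul_gb h2 (g2 ξ)).1.enorm.pow_const 2]
  refine lintegral_mono fun w => ?_
  simp only [enorm_mul, mul_pow, ← Finset.sum_mul]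
  exact mul_le_of_le_one_left zero_le (sum_enorm_gb_sq_le S w)

theorem lintegral_div_mul_mul_sq_le {V m m' k : ℂ × ℂ → ℝ≥0∞} (hV : Measurable V)
    (hm : Measurable m) (hm' : Measurable m') (hk : Measurable k) (hle : ∀ x, m' x ≤ m x) :
    (∫⁻ x, m' x / m x * V x * k x) ^ 2 ≤ (∫⁻ x, V x ^ 2 * (m x)⁻¹ * k x) * ∫⁻ x, m' x * k x := by
  have hr : Measurable fun x => (m x)⁻¹ ^ (1 / 2 : ℝ) := hm.inv.pow_const _
  have hsq : ∀ x, ((m x)⁻¹ ^ (1 / 2 : ℝ)) ^ 2 = (m x)⁻¹ := fun x => by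
    rw [← ENNReal.rpow_natCast, ← ENNReal.rpow_mul]; norm_num
  calc _ = (∫⁻ x, (V x * (m x)⁻¹ ^ (1 / 2 : ℝ)) * (m' x * (m x)⁻¹ ^ (1 / 2 : ℝ)) * k x) ^ 2 := by
        congr 1
        refine lintegral_congr fun x => ?_
        calc _ = V x * m' x * (((m x)⁻¹ ^ (1 / 2 : ℝ)) ^ 2) * k x := by
              rw [hsq, div_eq_mul_inv]; ring
          _ = _ := by ring
    _ ≤ _ := lintegral_mul_mul_sq_le (hV.mul hr) (hm'.mul hr) hk
    _ ≤ _ := by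
        gcongr with x x
        · rw [mul_pow, hsq]
        · rw [mul_pow, hsq, sq, mul_assoc]
          refine mul_le_of_le_one_right zero_le ?_
          rw [← div_eq_mul_inv]
          exact ENNReal.div_le_of_le_mul (by rw [one_mul]; exact hle x)

/-- The packet decomposition at one frequency. -/
theorem exists_packets : ∃ C : ℝ≥0∞, C ≠ ∞ ∧ ∀ {β : Type} [Fintype β] {f : ℂ × ℂ → ℂ}, MemLp f 2 →
    ∀ {m : ℂ × ℂ → ℝ≥0∞} {m' : β → ℂ × ℂ → ℝ≥0∞}, (∀ B, Measurable (m' B)) →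
    (∀ x, ∑ B, m' B x = m x) → (∀ x, m x ≠ 0) → (∀ x, m x ≠ ∞) → ∀ p : ℂ × ℂ,
    ∃ F : β → ℂ × ℂ → ℂ, (∀ B, MemLp (F B) 2) ∧
      ((fun w => ∑ B, F B w) =ᵐ[volume] fun w => gb p w * f w) ∧
      ∑ B, ∫⁻ w, ‖F B w‖ₑ ^ 2 ≤ ∫⁻ w, ‖gb p w * f w‖ₑ ^ 2 ∧
      ∀ B c y, ‖EE (fun w => gb p w * F B w) c y‖ₑ ^ 2 ≤ (C * (1 + 2 * ‖c‖ₑ) ^ 16) ^ 2 *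
        ((∫⁻ x, ‖FT (fun w => gb p w * f w) x‖ₑ ^ 2 * (m x)⁻¹ * KK p c (y - x)) *
        ∫⁻ x, m' B x * KK p c (y - x)) := by
  obtain ⟨C, hC, hb⟩ := exists_EE_gb_le
  refine ⟨C, hC, fun {β} _ {f} h2 {m m'} hm' hsum h0 ht p => ?_⟩
  have hle : ∀ B x, m' B x ≤ m x := fun B x => by
    rw [← hsum]; exact Finset.single_le_sum (f := fun B => m' B x) (fun _ _ => zero_le) (Finset.mem_univ B)
  have hm : Measurable m := by
    have : m = fun x => ∑ B, m' B x := funext fun x => (hsum x).symm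
    rw [this]; exact Finset.measurable_fun_sum _ fun B _ => hm' B
  have hdt : ∀ B x, m' B x / m x ≠ ∞ := fun B x =>
    (ENNReal.div_lt_top (ne_top_of_le_ne_top (ht x) (hle B x)) (h0 x)).ne
  obtain ⟨F, hF1, hF2, hF3, hF4⟩ := exists_fourier_split (memLp_mul_gb h2 p) (integrable_gb_mul h2 p)
    (w := fun B x => (m' B x / m x).toReal) (fun B => ((hm' B).div hm).ennreal_toReal)
    (fun B x => ENNReal.toReal_nonneg) (fun x => by
      rw [← ENNReal.toReal_sum fun B _ => hdt B x]
      simp only [div_eq_mul_inv]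
      rw [← Finset.sum_mul, hsum, ENNReal.mul_inv_cancel (h0 x) (ht x), ENNReal.toReal_one])
  refine ⟨F, hF1, hF2, hF3, fun B c y => ?_⟩
  have hgi : Integrable fun w => ee (ph c y w) * gb p w := integrable_ee_mul (integrable_gb p) c y
  have hg2 : MemLp (fun w => ee (ph c y w) * gb p w) 2 :=
    (memLp_gb p).of_le hgi.1 (Filter.Eventually.of_forall fun w => by simp)
  have hFT : ∀ x, FT (fun w => ee (ph c y w) * gb p w) (-x) = EE (gb p) c (y - x) := fun x => by
    unfold FT EE
    refine integral_congr_ae (Filter.Eventually.of_forall fun w => ?_)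
    simp only [← mul_assoc, ← ee_add]
    congr 2; simp [ph, dotc]; ring
  have key : EE (fun w => gb p w * F B w) c y = ∫ x, ((m' B x / m x).toReal : ℂ) *
      FT (fun w => gb p w * f w) x * EE (gb p) c (y - x) := by
    have := hF4 B _ hg2 hgi
    simp only [hFT] at this
    rw [← this, EE]
    refine integral_congr_ae (Filter.Eventually.of_forall fun w => ?_)
    simp only []; ring
  have hV : Measurable fun x => ‖FT (fun w => gb p w * f w) x‖ₑ :=
    (continuous_FT (integrable_gb_mul h2 p)).measurable.enorm
  have hk : Measurable fun x => KK p c (y - x) := by fun_prop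
  have hct : C * (1 + 2 * ‖c‖ₑ) ^ 16 ≠ ∞ := ENNReal.mul_ne_top hC (ENNReal.pow_ne_top (by finiteness))
  calc _ ≤ (C * (1 + 2 * ‖c‖ₑ) ^ 16 * ∫⁻ x, m' B x / m x * ‖FT (fun w => gb p w * f w) x‖ₑ *
        KK p c (y - x)) ^ 2 := by
        rw [key, ← lintegral_const_mul' _ _ hct]
        gcongr
        refine (enorm_integral_le_lintegral_enorm _).trans (lintegral_mono fun x => ?_)
        simp only [enorm_mul]
        have e : ‖((m' B x / m x).toReal : ℂ)‖ₑ = m' B x / m x := by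
          rw [← ofReal_norm, Complex.norm_real, Real.norm_of_nonneg ENNReal.toReal_nonneg,
            ENNReal.ofReal_toReal (hdt B x)]
        rw [e]
        calc _ ≤ m' B x / m x * ‖FT (fun w => gb p w * f w) x‖ₑ *
              (C * (1 + 2 * ‖c‖ₑ) ^ 16 * KK p c (y - x)) := by gcongr; exact hb p c (y - x)
          _ = _ := by ring
    _ ≤ _ := by
        rw [mul_pow]
        gcongr
        exact lintegral_div_mul_mul_sq_le hV hm (hm' B) hk (hle B)

theorem integral_mul_integral_eq_zero {Z W : Type*} [MeasurableSpace Z] [MeasurableSpace W]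
    {μ : Measure Z} {ν : Measure W} [SFinite μ] [SFinite ν] {T : Z → ℂ} (hT : Integrable T μ)
    {e : Z → W → ℂ} (he : StronglyMeasurable fun p : Z × W => e p.1 p.2) (he1 : ∀ z w, ‖e z w‖ ≤ 1)
    {k : W → ℂ} (hk : Integrable k ν) (h : ∀ w, k w ≠ 0 → ∫ z, T z * e z w ∂μ = 0) :
    ∫ z, T z * ∫ w, e z w * k w ∂ν ∂μ = 0 := by
  have hi : Integrable (Function.uncurry fun z w => T z * (e z w * k w)) (μ.prod ν) := by
    have := (hT.mul_prod hk).bdd_mul (c := 1) he.aestronglyMeasurable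
      (Filter.Eventually.of_forall fun p => he1 p.1 p.2)
    refine this.congr (Filter.Eventually.of_forall fun p => ?_)
    simp only [Function.uncurry]; ring
  calc _ = ∫ z, ∫ w, T z * (e z w * k w) ∂ν ∂μ := by simp only [integral_const_mul]
    _ = ∫ w, ∫ z, T z * (e z w * k w) ∂μ ∂ν := integral_integral_swap hi
    _ = ∫ w, (0 : ℂ) ∂ν := by
        refine integral_congr_ae (Filter.Eventually.of_forall fun w => ?_)
        simp only [← mul_assoc, integral_mul_const]
        by_cases hw : k w = 0
        · rw [hw, mul_zero]
        · rw [h w hw, zero_mul]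
    _ = 0 := by simp

/-- The smooth localisation to a plate in space-time. -/
def Th (N : ℝ) (c0 : ℂ) (q : ℂ × ℂ) (z : ℂ × (ℂ × ℂ)) : ℝ :=
  th (N * (z.1 - c0)) * (th (z.2.1 - q.1) * th (z.2.2 - q.2))

theorem Th_nonneg (N : ℝ) (c0 : ℂ) (q : ℂ × ℂ) (z : ℂ × (ℂ × ℂ)) : 0 ≤ Th N c0 q z :=
  mul_nonneg (th_nonneg _) (mul_nonneg (th_nonneg _) (th_nonneg _))

theorem integrable_th_affine {N : ℝ} (hN : 0 < N) (c0 : ℂ) :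
    Integrable fun c : ℂ => th (N * (c - c0)) := by
  have h := (integrable_th.comp_smul (R := N) hN.ne').comp_sub_right c0
  refine h.congr (Filter.Eventually.of_forall fun c => ?_)
  simp [Complex.real_smul]

theorem integrable_Th {N : ℝ} (hN : 0 < N) (c0 : ℂ) (q : ℂ × ℂ) : Integrable (Th N c0 q) :=
  (integrable_th_affine hN c0).mul_prod
    ((integrable_th.comp_sub_right q.1).mul_prod (integrable_th.comp_sub_right q.2))

theorem integral_th_sub_ee {U : ℂ} (hU : 3 ≤ ‖U‖) (q : ℂ) :
    ∫ a : ℂ, (th (a - q) : ℂ) * ee ((a * U).re) = 0 := by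
  have h := integral_sub_right_eq_self (μ := (volume : Measure ℂ))
    (fun a : ℂ => (th a : ℂ) * ee (((a + q) * U).re)) q
  simp only [sub_add_cancel] at h
  rw [h]
  have e : ∀ a : ℂ, (th a : ℂ) * ee (((a + q) * U).re) =
      ee ((q * U).re) * (ee ((a * U).re) * (th a : ℂ)) := fun a => by
    rw [show ((a + q) * U).re = (q * U).re + (a * U).re by rw [add_mul, Complex.add_re, add_comm],
      ee_add]
    ring
  simp only [e]
  rw [integral_const_mul, th_fourier_eq_zero hU, mul_zero]

theorem integral_th_affine_ee {N : ℝ} (hN : 0 < N) {W : ℂ} (hW : 3 * N ≤ ‖W‖) (c0 : ℂ) :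
    ∫ c : ℂ, (th (N * (c - c0)) : ℂ) * ee ((c * W).re) = 0 := by
  have h := Measure.integral_comp_smul (volume : Measure ℂ)
    (fun c : ℂ => (th (c - N * c0) : ℂ) * ee ((c * (W / N)).re)) N
  have hN' : (N : ℂ) ≠ 0 := by exact_mod_cast hN.ne'
  rw [integral_th_sub_ee (by
    rw [norm_div, Complex.norm_real, Real.norm_of_nonneg hN.le]
    exact (le_div_iff₀ hN).2 hW), smul_zero] at h
  rw [← h]
  refine integral_congr_ae (Filter.Eventually.of_forall fun c => ?_)
  simp only [Complex.real_smul]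
  rw [mul_sub, show (N : ℂ) * c * (W / N) = c * W by field_simp]

theorem integral_Th_ee {N : ℝ} (hN : 0 < N) (c0 : ℂ) (q : ℂ × ℂ) {U V W : ℂ}
    (h : 3 ≤ ‖U‖ ∨ 3 ≤ ‖V‖ ∨ 3 * N ≤ ‖W‖) :
    ∫ z : ℂ × (ℂ × ℂ), (Th N c0 q z : ℂ) * ee ((z.2.1 * U + z.2.2 * V + z.1 * W).re) = 0 := by
  have e : ∀ z : ℂ × (ℂ × ℂ), (Th N c0 q z : ℂ) * ee ((z.2.1 * U + z.2.2 * V + z.1 * W).re) =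
      ((th (N * (z.1 - c0)) : ℂ) * ee ((z.1 * W).re)) *
      (((th (z.2.1 - q.1) : ℂ) * ee ((z.2.1 * U).re)) *
        ((th (z.2.2 - q.2) : ℂ) * ee ((z.2.2 * V).re))) := fun z => by
    rw [Complex.add_re, Complex.add_re, ee_add, ee_add, Th]
    push_cast; ring
  simp only [e]
  rw [Measure.volume_eq_prod, integral_prod_mul (fun c : ℂ => (th (N * (c - c0)) : ℂ) * ee ((c * W).re))
    (fun y : ℂ × ℂ => ((th (y.1 - q.1) : ℂ) * ee ((y.1 * U).re)) *
        ((th (y.2 - q.2) : ℂ) * ee ((y.2 * V).re))), Measure.volume_eq_prod,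
    integral_prod_mul (fun a : ℂ => (th (a - q.1) : ℂ) * ee ((a * U).re))
      (fun a : ℂ => (th (a - q.2) : ℂ) * ee ((a * V).re))]
  rcases h with h | h | h
  · rw [integral_th_sub_ee h]; ring
  · rw [integral_th_sub_ee h]; ring
  · rw [integral_th_affine_ee hN h]; ring

theorem norm_EE_le (f : ℂ × ℂ → ℂ) (c : ℂ) (y : ℂ × ℂ) : ‖EE f c y‖ ≤ ∫ w, ‖f w‖ := by
  refine (norm_integral_le_integral_norm _).trans (le_of_eq ?_)
  simp only [norm_mul, norm_ee, one_mul]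

theorem conj_EE (f : ℂ × ℂ → ℂ) (c : ℂ) (y : ℂ × ℂ) : (starRingEnd ℂ) (EE f c y) =
    ∫ w, ee (-ph c y w) * (starRingEnd ℂ) (f w) := by
  rw [EE, ← integral_conj]
  refine integral_congr_ae (Filter.Eventually.of_forall fun w => ?_)
  simp only [map_mul]
  congr 1
  rw [ee_neg]

theorem continuous_ph_all : Continuous fun p : (ℂ × (ℂ × ℂ)) × (ℂ × ℂ) => ph p.1.1 p.1.2 p.2 := by
  unfold ph; fun_prop

theorem continuous_EE_comp {f : ℂ × ℂ → ℂ} (hf : Integrable f) :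
    Continuous fun z : ℂ × (ℂ × ℂ) => EE f z.1 z.2 := continuous_EE hf

/-- Four functions whose frequencies do not balance have no interaction on a plate. -/
theorem integral_Th_mul_eq_zero {N : ℝ} (hN : 0 < N) (c0 : ℂ) (q : ℂ × ℂ) {k₁ k₂ k₃ k₄ : ℂ × ℂ → ℂ}
    (h₁ : Integrable k₁) (h₂ : Integrable k₂) (h₃ : Integrable k₃) (h₄ : Integrable k₄)
    (h : ∀ w₁ w₂ w₃ w₄, k₁ w₁ ≠ 0 → k₂ w₂ ≠ 0 → k₃ w₃ ≠ 0 → k₄ w₄ ≠ 0 →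
      3 ≤ ‖w₁.1 + w₂.1 - w₃.1 - w₄.1‖ ∨ 3 ≤ ‖w₁.2 + w₂.2 - w₃.2 - w₄.2‖ ∨
      3 * N ≤ ‖w₁.1 * w₁.2 + w₂.1 * w₂.2 - w₃.1 * w₃.2 - w₄.1 * w₄.2‖) :
    ∫ z : ℂ × (ℂ × ℂ), (Th N c0 q z : ℂ) * ((EE k₁ z.1 z.2 * EE k₂ z.1 z.2) *
      (starRingEnd ℂ) (EE k₃ z.1 z.2 * EE k₄ z.1 z.2)) = 0 := by
  have hT : Integrable fun z => (Th N c0 q z : ℂ) := (integrable_Th hN c0 q).ofReal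
  have b : ∀ {T g : ℂ × (ℂ × ℂ) → ℂ} (C : ℝ), Integrable T → Continuous g → (∀ z, ‖g z‖ ≤ C) →
      Integrable fun z => T z * g z := fun C hT hg hb =>
    (hT.bdd_mul (c := C) hg.aestronglyMeasurable (Filter.Eventually.of_forall hb)).congr
      (Filter.Eventually.of_forall fun z => mul_comm _ _)
  have cee : ∀ w, Continuous fun z : ℂ × (ℂ × ℂ) => ee (ph z.1 z.2 w) := fun w => by
    unfold ph; fun_prop
  have cee' : ∀ w, Continuous fun z : ℂ × (ℂ × ℂ) => ee (-ph z.1 z.2 w) := fun w => by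
    unfold ph; fun_prop
  have m1 : StronglyMeasurable fun p : (ℂ × (ℂ × ℂ)) × (ℂ × ℂ) => ee (ph p.1.1 p.1.2 p.2) :=
    (continuous_ee.comp continuous_ph_all).stronglyMeasurable
  have m2 : StronglyMeasurable fun p : (ℂ × (ℂ × ℂ)) × (ℂ × ℂ) => ee (-ph p.1.1 p.1.2 p.2) :=
    (continuous_ee.comp continuous_ph_all.neg).stronglyMeasurable
  have c3 := Complex.continuous_conj.comp (continuous_EE h₃)
  have c4 := Complex.continuous_conj.comp (continuous_EE h₄)
  have hc : ∀ {k : ℂ × ℂ → ℂ}, Integrable k → Integrable fun w => (starRingEnd ℂ) (k w) := fun hk =>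
    Complex.conjCLE.toContinuousLinearMap.integrable_comp hk
  have i4 := b _ hT c4 (fun z => by simpa using norm_EE_le k₄ z.1 z.2)
  have i3 := b _ i4 c3 (fun z => by simpa using norm_EE_le k₃ z.1 z.2)
  have i2 := b _ i3 (continuous_EE h₂) (fun z => norm_EE_le k₂ z.1 z.2)
  have e1 := integral_mul_integral_eq_zero i2 (e := fun z w => ee (ph z.1 z.2 w)) m1 (fun z w => (norm_ee _).le) h₁ (fun w₁ hw₁ => by
    have i3' := b 1 i3 (cee w₁) (fun z => (norm_ee _).le)
    have e2 := integral_mul_integral_eq_zero i3' (e := fun z w => ee (ph z.1 z.2 w)) m1 (fun z w => (norm_ee _).le) h₂ (fun w₂ hw₂ => by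
      have i4' := b 1 (b 1 i4 (cee w₁) (fun z => (norm_ee _).le)) (cee w₂) (fun z => (norm_ee _).le)
      have e3 := integral_mul_integral_eq_zero i4' (e := fun z w => ee (-ph z.1 z.2 w)) m2 (fun z w => (norm_ee _).le) (hc h₃)
        (fun w₃ hw₃ => by
          have i5' := b 1 (b 1 (b 1 hT (cee w₁) (fun z => (norm_ee _).le)) (cee w₂)
            (fun z => (norm_ee _).le)) (cee' w₃) (fun z => (norm_ee _).le)
          have e4 := integral_mul_integral_eq_zero i5' (e := fun z w => ee (-ph z.1 z.2 w)) m2 (fun z w => (norm_ee _).le) (hc h₄)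
            (fun w₄ hw₄ => by
              rw [← integral_Th_ee hN c0 q (h w₁ w₂ w₃ w₄ hw₁ hw₂ (by simpa using hw₃)
                (by simpa using hw₄))]
              refine integral_congr_ae (Filter.Eventually.of_forall fun z => ?_)
              simp only [mul_assoc, ← ee_add]
              congr 2
              simp [ph]; ring)
          rw [← e4]
          refine integral_congr_ae (Filter.Eventually.of_forall fun z => ?_)
          simp only [Function.comp, conj_EE]; ring)
      rw [← e3]
      refine integral_congr_ae (Filter.Eventually.of_forall fun z => ?_)
      simp only [Function.comp, conj_EE k₃]; ring)
    rw [← e2]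
    refine integral_congr_ae (Filter.Eventually.of_forall fun z => ?_)
    simp only [EE]; ring)
  rw [← e1]
  refine integral_congr_ae (Filter.Eventually.of_forall fun z => ?_)
  have e : EE k₁ z.1 z.2 = ∫ w, ee (ph z.1 z.2 w) * k₁ w := rfl
  simp only [Function.comp, map_mul]
  rw [e]; ring

open Classical in
theorem lintegral_sq_sum_le {Z J : Type*} [MeasurableSpace Z] [TopologicalSpace Z] [BorelSpace Z]
    [SecondCountableTopology Z] {μ : Measure Z} {T : Z → ℝ} (hT : Integrable T μ) (h0 : ∀ z, 0 ≤ T z) {S : Finset J}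
    {G : J → Z → ℂ} (hG : ∀ j, Continuous (G j)) (hb : ∀ j, ∃ C, ∀ z, ‖G j z‖ ≤ C)
    {rel : J → J → Prop}
    (hv : ∀ j ∈ S, ∀ j' ∈ S, ¬ rel j j' → ∫ z, (T z : ℂ) * (G j z * (starRingEnd ℂ) (G j' z)) ∂μ = 0) :
    ∫⁻ z, ENNReal.ofReal (T z) * ‖∑ j ∈ S, G j z‖ₑ ^ 2 ∂μ ≤
      ∫⁻ z, ENNReal.ofReal (T z) * ∑ j ∈ S, ∑ j' ∈ S,
        (if rel j j' then ‖G j z‖ₑ * ‖G j' z‖ₑ else 0) ∂μ := by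
  have hm : ∀ j j', Measurable fun z => if rel j j' then ‖G j z‖ₑ * ‖G j' z‖ₑ else 0 := fun j j' => by
    split_ifs
    · exact (hG j).measurable.enorm.mul (hG j').measurable.enorm
    · exact measurable_const
  have hTm : AEMeasurable (fun z => ENNReal.ofReal (T z)) μ := hT.1.aemeasurable.ennreal_ofReal
  have hsum : ∑ j ∈ S, ∑ j' ∈ S, ∫⁻ z, ENNReal.ofReal (T z) *
      (if rel j j' then ‖G j z‖ₑ * ‖G j' z‖ₑ else 0) ∂μ = ∫⁻ z, ENNReal.ofReal (T z) *
      ∑ j ∈ S, ∑ j' ∈ S, (if rel j j' then ‖G j z‖ₑ * ‖G j' z‖ₑ else 0) ∂μ := by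
    have hm2 : ∀ j j', AEMeasurable (fun z => ENNReal.ofReal (T z) *
        if rel j j' then ‖G j z‖ₑ * ‖G j' z‖ₑ else 0) μ :=
      fun j j' => hTm.mul (hm j j').aemeasurable
    simp only [Finset.mul_sum]
    rw [lintegral_finsetSum' S fun j _ => Finset.aemeasurable_fun_sum S fun j' _ => hm2 j j']
    refine Finset.sum_congr rfl fun j _ => ?_
    rw [lintegral_finsetSum' S fun j' _ => hm2 j j']
  rw [← hsum]
  have hi : ∀ j j', Integrable (fun z => (T z : ℂ) * (G j z * (starRingEnd ℂ) (G j' z))) μ := by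
    intro j j'
    obtain ⟨C, hC⟩ := hb j
    obtain ⟨C', hC'⟩ := hb j'
    have := hT.ofReal (𝕜 := ℂ) |>.bdd_mul (c := C * C') (f := fun z => G j z * (starRingEnd ℂ) (G j' z))
      ((hG j).mul (Complex.continuous_conj.comp (hG j'))).aestronglyMeasurable
      (Filter.Eventually.of_forall fun z => by
        rw [norm_mul, RCLike.norm_conj]
        exact mul_le_mul (hC z) (hC' z) (norm_nonneg _) ((norm_nonneg _).trans (hC z)))
    exact this.congr (Filter.Eventually.of_forall fun z => mul_comm _ _)
  have e : ∀ z, ((T z * ‖∑ j ∈ S, G j z‖ ^ 2 : ℝ) : ℂ) =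
      ∑ j ∈ S, ∑ j' ∈ S, (T z : ℂ) * (G j z * (starRingEnd ℂ) (G j' z)) := by
    intro z
    push_cast
    rw [← Complex.mul_conj', map_sum, Finset.sum_mul_sum, Finset.mul_sum]
    simp only [Finset.mul_sum]
  have hi' : Integrable (fun z => T z * ‖∑ j ∈ S, G j z‖ ^ 2) μ := by
    have : Integrable (fun z => ((T z * ‖∑ j ∈ S, G j z‖ ^ 2 : ℝ) : ℂ)) μ := by
      simp only [e]
      exact integrable_finsetSum _ fun j _ => integrable_finsetSum _ fun j' _ => hi j j'
    exact this.re
  calc _ = ∫⁻ z, ENNReal.ofReal (T z * ‖∑ j ∈ S, G j z‖ ^ 2) ∂μ := by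
        refine lintegral_congr fun z => ?_
        rw [ENNReal.ofReal_mul (h0 z), ENNReal.ofReal_pow (norm_nonneg _), ofReal_norm]
    _ = ENNReal.ofReal (∫ z, T z * ‖∑ j ∈ S, G j z‖ ^ 2 ∂μ) :=
        (ofReal_integral_eq_lintegral_ofReal hi' (Filter.Eventually.of_forall fun z =>
          mul_nonneg (h0 z) (sq_nonneg _))).symm
    _ ≤ ‖∫ z, ((T z * ‖∑ j ∈ S, G j z‖ ^ 2 : ℝ) : ℂ) ∂μ‖ₑ := by
        rw [integral_complex_ofReal, ← ofReal_norm, Complex.norm_real]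
        exact ENNReal.ofReal_le_ofReal (le_abs_self _)
    _ = ‖∑ j ∈ S, ∑ j' ∈ S, ∫ z, (T z : ℂ) * (G j z * (starRingEnd ℂ) (G j' z)) ∂μ‖ₑ := by
        simp only [e]
        rw [integral_finsetSum _ fun j _ => integrable_finsetSum _ fun j' _ => hi j j']
        congr 1
        exact Finset.sum_congr rfl fun j _ => integral_finsetSum _ fun j' _ => hi j j'
    _ ≤ ∑ j ∈ S, ∑ j' ∈ S, ‖∫ z, (T z : ℂ) * (G j z * (starRingEnd ℂ) (G j' z)) ∂μ‖ₑ :=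
        (enorm_sum_le _ _).trans (Finset.sum_le_sum fun j _ => enorm_sum_le _ _)
    _ ≤ _ := by
        refine Finset.sum_le_sum fun j hj => Finset.sum_le_sum fun j' hj' => ?_
        split_ifs with hr
        · refine (enorm_integral_le_lintegral_enorm _).trans (le_of_eq (lintegral_congr fun z => ?_))
          rw [enorm_mul, enorm_mul, ← ofReal_norm (T z : ℂ), Complex.norm_real,
            Real.norm_of_nonneg (h0 z)]
          congr 2
          rw [← ofReal_norm, RCLike.norm_conj, ofReal_norm]
        · rw [hv j hj j' hj' hr, enorm_zero]; exact zero_le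

/-- Four frequency cells which can interact on a plate. -/
def Bal (N : ℝ) (j j' : ((ℤ × ℤ) × (ℤ × ℤ)) × ((ℤ × ℤ) × (ℤ × ℤ))) : Prop :=
  ∃ w₁ w₂ w₃ w₄ : ℂ × ℂ, (‖w₁ - g2 j.1‖ ≤ 2 ∧ ‖w₂ - g2 j.2‖ ≤ 2 ∧ ‖w₃ - g2 j'.1‖ ≤ 2 ∧
    ‖w₄ - g2 j'.2‖ ≤ 2) ∧ ‖w₁.1 + w₂.1 - w₃.1 - w₄.1‖ < 3 ∧ ‖w₁.2 + w₂.2 - w₃.2 - w₄.2‖ < 3 ∧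
    ‖w₁.1 * w₁.2 + w₂.1 * w₂.2 - w₃.1 * w₃.2 - w₄.1 * w₄.2‖ < 3 * N

theorem Bal.symm {N : ℝ} {j j' : ((ℤ × ℤ) × (ℤ × ℤ)) × ((ℤ × ℤ) × (ℤ × ℤ))} (h : Bal N j j') :
    Bal N j' j := by
  obtain ⟨w₁, w₂, w₃, w₄, ⟨h1, h2, h3, h4⟩, hU, hV, hW⟩ := h
  refine ⟨w₃, w₄, w₁, w₂, ⟨h3, h4, h1, h2⟩, ?_, ?_, ?_⟩
  · rwa [show w₃.1 + w₄.1 - w₁.1 - w₂.1 = -(w₁.1 + w₂.1 - w₃.1 - w₄.1) by ring, norm_neg]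
  · rwa [show w₃.2 + w₄.2 - w₁.2 - w₂.2 = -(w₁.2 + w₂.2 - w₃.2 - w₄.2) by ring, norm_neg]
  · rwa [show w₃.1 * w₃.2 + w₄.1 * w₄.2 - w₁.1 * w₁.2 - w₂.1 * w₂.2 =
      -(w₁.1 * w₁.2 + w₂.1 * w₂.2 - w₃.1 * w₃.2 - w₄.1 * w₄.2) by ring, norm_neg]

theorem norm_mul_le_of {a b : ℂ} {x y : ℝ} (ha : ‖a‖ ≤ x) (hb : ‖b‖ ≤ y) : ‖a * b‖ ≤ x * y := by
  rw [norm_mul]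
  exact mul_le_mul ha hb (norm_nonneg _) ((norm_nonneg _).trans ha)

theorem Bal.norm_cross_le {N : ℝ} (hN : 1 ≤ N) {ξ η ξ' η' : (ℤ × ℤ) × (ℤ × ℤ)}
    (h : Bal N (ξ, η) (ξ', η')) (h1 : ‖g2 ξ‖ ≤ N + 2) (h2 : ‖g2 η‖ ≤ N + 2) (h3 : ‖g2 ξ'‖ ≤ N + 2)
    (h4 : ‖g2 η'‖ ≤ N + 2) :
    ‖(g2 η' - g2 ξ).1 * (gi ξ'.2 - (g2 ξ).2) + (g2 η' - g2 ξ).2 * (gi ξ'.1 - (g2 ξ).1)‖ ≤ 200 * N := by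
  obtain ⟨w₁, w₂, w₃, w₄, ⟨b1, b2, b3, b4⟩, hU, hV, hW⟩ := h
  simp only at b1 b2 b3 b4
  have p1 := (norm_fst_le _).trans b1
  have q1 := (norm_snd_le _).trans b1
  have p2 := (norm_fst_le _).trans b2
  have q2 := (norm_snd_le _).trans b2
  have p3 := (norm_fst_le _).trans b3
  have q3 := (norm_snd_le _).trans b3
  have p4 := (norm_fst_le _).trans b4
  have q4 := (norm_snd_le _).trans b4
  have r1 := (norm_fst_le _).trans h1
  have s1 := (norm_snd_le _).trans h1
  have r2 := (norm_fst_le _).trans h2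
  have s2 := (norm_snd_le _).trans h2
  have r3 := (norm_fst_le _).trans h3
  have s3 := (norm_snd_le _).trans h3
  have r4 := (norm_fst_le _).trans h4
  have s4 := (norm_snd_le _).trans h4
  simp only [g2, Prod.fst_sub, Prod.snd_sub] at *
  generalize gi ξ.1 = x1 at *
  generalize gi ξ.2 = y1 at *
  generalize gi η.1 = x2 at *
  generalize gi η.2 = y2 at *
  generalize gi ξ'.1 = x3 at *
  generalize gi ξ'.2 = y3 at *
  generalize gi η'.1 = x4 at *
  generalize gi η'.2 = y4 at *
  generalize w₁.1 = u1 at *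
  generalize w₁.2 = v1 at *
  generalize w₂.1 = u2 at *
  generalize w₂.2 = v2 at *
  generalize w₃.1 = u3 at *
  generalize w₃.2 = v3 at *
  generalize w₄.1 = u4 at *
  generalize w₄.2 = v4 at *
  have tri : ∀ {a b : ℂ} {s t : ℝ}, ‖a - b‖ ≤ s → ‖b‖ ≤ t → ‖a‖ ≤ s + t := fun {a b s t} h h' => by
    have := norm_add_le (a - b) b
    rw [sub_add_cancel] at this; linarith
  have tri2 : ∀ {a b : ℂ} {s t : ℝ}, ‖a‖ ≤ s → ‖b‖ ≤ t → ‖a - b‖ ≤ s + t := fun h h' =>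
    (norm_sub_le _ _).trans (add_le_add h h')
  have e : (x4 - x1) * (y3 - y1) + (y4 - y1) * (x3 - x1) =
      (((u1 * v1 + u2 * v2 - u3 * v3 - u4 * v4) - (u1 + u2 - u3 - u4) * v2
        - (v1 + v2 - v3 - v4) * (u2 - (u1 + u2 - u3 - u4)))
        - (x4 - x1) * ((v3 - y3) - (v1 - y1)) - ((u4 - x4) - (u1 - x1)) * (v3 - v1))
        - (y4 - y1) * ((u3 - x3) - (u1 - x1)) - ((v4 - y4) - (v1 - y1)) * (u3 - u1) := by ring
  rw [e]
  have k := tri2 (tri2 (tri2 (tri2 (tri2 (tri2 hW.le (norm_mul_le_of hU.le (tri q2 s2)))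
    (norm_mul_le_of hV.le (tri2 (tri p2 r2) hU.le)))
    (norm_mul_le_of (tri2 r4 r1) (tri2 q3 q1))) (norm_mul_le_of (tri2 p4 p1) (tri2 (tri q3 s3) (tri q1 s1))))
    (norm_mul_le_of (tri2 s4 s1) (tri2 p3 p1))) (norm_mul_le_of (tri2 q4 q1) (tri2 (tri p3 r3) (tri p1 r1)))
  refine k.trans ?_
  linarith

theorem Bal.norm_snd_sub_le {N : ℝ} {ξ η ξ' η' : (ℤ × ℤ) × (ℤ × ℤ)}
    (h : Bal N (ξ, η) (ξ', η')) : ‖g2 η - (g2 ξ' + g2 η' - g2 ξ)‖ ≤ 11 := by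
  obtain ⟨w₁, w₂, w₃, w₄, ⟨b1, b2, b3, b4⟩, hU, hV, -⟩ := h
  simp only at b1 b2 b3 b4
  have e : g2 η - (g2 ξ' + g2 η' - g2 ξ) = (w₁ + w₂ - w₃ - w₄) - (w₁ - g2 ξ) - (w₂ - g2 η) +
      (w₃ - g2 ξ') + (w₄ - g2 η') := by abel
  have hUV : ‖w₁ + w₂ - w₃ - w₄‖ ≤ 3 := max_le hU.le hV.le
  rw [e]
  refine (norm_add_le _ _).trans ?_
  have := norm_add_le (w₁ + w₂ - w₃ - w₄ - (w₁ - g2 ξ) - (w₂ - g2 η)) (w₃ - g2 ξ')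
  have := norm_sub_le (w₁ + w₂ - w₃ - w₄ - (w₁ - g2 ξ)) (w₂ - g2 η)
  have := norm_sub_le (w₁ + w₂ - w₃ - w₄) (w₁ - g2 ξ)
  linarith

/-- The number of lattice points in a disc. -/
def cgi (ρ : ℝ) : ℝ≥0∞ := (1 + ENNReal.ofReal ρ) ^ 4 * (3 ^ 4 * wbI)

theorem cgi_ne_top (ρ : ℝ) : cgi ρ ≠ ∞ :=
  ENNReal.mul_ne_top (ENNReal.pow_ne_top (by finiteness)) (ENNReal.mul_ne_top (by finiteness) wbI_lt_top.ne)

theorem card_gi_le' {S : Finset (ℤ × ℤ)} {z : ℂ} {ρ : ℝ} (h : ∀ n ∈ S, ‖gi n - z‖ ≤ ρ) :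
    (S.card : ℝ≥0∞) ≤ cgi ρ := by
  have := card_gi_le (S := S) (z := z) (ρ := ρ) le_rfl (by simpa using h)
  simpa [cgi] using this

open Classical in
theorem card_filter_bal_le {N : ℝ} (S : Finset ((ℤ × ℤ) × (ℤ × ℤ))) (ξ ξ' η' : (ℤ × ℤ) × (ℤ × ℤ)) :
    ((S.filter fun η => Bal N (ξ, η) (ξ', η')).card : ℝ≥0∞) ≤ cgi 11 * cgi 11 := by
  set R := S.filter fun η => Bal N (ξ, η) (ξ', η') with hR
  have hsub : R ⊆ R.image Prod.fst ×ˢ R.image Prod.snd := fun η hη =>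
    Finset.mem_product.2 ⟨Finset.mem_image_of_mem _ hη, Finset.mem_image_of_mem _ hη⟩
  have hc := Finset.card_le_card hsub
  rw [Finset.card_product] at hc
  have hb : ∀ η ∈ R, ‖g2 η - (g2 ξ' + g2 η' - g2 ξ)‖ ≤ 11 := fun η hη =>
    (Finset.mem_filter.1 hη).2.norm_snd_sub_le
  calc (R.card : ℝ≥0∞) ≤ ((R.image Prod.fst).card : ℝ≥0∞) * ((R.image Prod.snd).card : ℝ≥0∞) := by
        exact_mod_cast hc
    _ ≤ _ := by
        refine mul_le_mul' (card_gi_le' (z := (g2 ξ' + g2 η' - g2 ξ).1) fun n hn => ?_)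
          (card_gi_le' (z := (g2 ξ' + g2 η' - g2 ξ).2) fun n hn => ?_)
        · obtain ⟨η, hη, rfl⟩ := Finset.mem_image.1 hn
          exact (norm_fst_le _).trans (hb η hη)
        · obtain ⟨η, hη, rfl⟩ := Finset.mem_image.1 hn
          exact (norm_snd_le _).trans (hb η hη)

theorem card_fibre_le {κ₀ N : ℝ} (hκ₀ : 0 < κ₀) (hN : 16 ≤ κ₀ * N) {ξ D : ℂ × ℂ}
    (hD : κ₀ * N - 4 ≤ ‖D.1‖) {S : Finset ((ℤ × ℤ) × (ℤ × ℤ))}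
    (hS : ∀ ζ ∈ S, ‖D.1 * (gi ζ.2 - ξ.2) + D.2 * (gi ζ.1 - ξ.1)‖ ≤ 200 * N) (n : ℤ × ℤ) :
    ((S.filter fun ζ => ζ.1 = n).card : ℝ≥0∞) ≤ cgi (800 / κ₀) := by
  rcases (S.filter fun ζ => ζ.1 = n).eq_empty_or_nonempty with h | ⟨ζ₀, hζ₀⟩
  · simp [h]
  obtain ⟨hζ₀, hn₀⟩ := Finset.mem_filter.1 hζ₀
  have hc := Finset.card_image_of_injOn (s := S.filter fun ζ => ζ.1 = n) (f := Prod.snd)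
    (by intro a ha b hb hab; exact Prod.ext ((Finset.mem_filter.1 ha).2.trans (Finset.mem_filter.1 hb).2.symm) hab)
  rw [← hc]
  refine card_gi_le' (z := gi ζ₀.2) fun m hm => ?_
  obtain ⟨ζ, hζ, rfl⟩ := Finset.mem_image.1 hm
  obtain ⟨hζ, hn⟩ := Finset.mem_filter.1 hζ
  have h1 := norm_sub_le (D.1 * (gi ζ.2 - ξ.2) + D.2 * (gi ζ.1 - ξ.1))
    (D.1 * (gi ζ₀.2 - ξ.2) + D.2 * (gi ζ₀.1 - ξ.1))
  rw [show D.1 * (gi ζ.2 - ξ.2) + D.2 * (gi ζ.1 - ξ.1) -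
    (D.1 * (gi ζ₀.2 - ξ.2) + D.2 * (gi ζ₀.1 - ξ.1)) = D.1 * (gi ζ.2 - gi ζ₀.2) by
      rw [hn, hn₀]; ring, norm_mul] at h1
  have h2 := hS ζ hζ
  have h3 := hS ζ₀ hζ₀
  rw [le_div_iff₀ hκ₀]
  have h4 : κ₀ * N / 2 * ‖gi ζ.2 - gi ζ₀.2‖ ≤ 400 * N :=
    (mul_le_mul_of_nonneg_right (by linarith : κ₀ * N / 2 ≤ ‖D.1‖) (norm_nonneg _)).trans
      (by linarith)
  have hN0 : 0 < N := by
    by_contra! h; nlinarith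
  refine le_of_mul_le_mul_right (?_ : _ * N ≤ _ * N) hN0
  linarith

theorem le_norm_cross {κ₀ N : ℝ} (hN : 16 ≤ κ₀ * N) {ξ η η' : ℂ × ℂ}
    (h1 : κ₀ * N - 4 ≤ ‖(η' - ξ).1‖) (h2 : κ₀ * N - 4 ≤ ‖(η' - ξ).2‖)
    (h : ‖η - η'‖ ≤ κ₀ * N / 16 + 4) :
    κ₀ ^ 2 / 4 * N ^ 2 ≤ ‖(η' - ξ).1 * (η.2 - ξ.2) + (η' - ξ).2 * (η.1 - ξ.1)‖ := by
  have k1 := (norm_fst_le _).trans h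
  have k2 := (norm_snd_le _).trans h
  simp only [Prod.fst_sub, Prod.snd_sub] at *
  set a := η'.1 - ξ.1
  set b := η'.2 - ξ.2
  have e : a * (η.2 - ξ.2) + b * (η.1 - ξ.1) = 2 * (a * b) - (-(a * (η.2 - η'.2)) - b * (η.1 - η'.1)) := by
    simp only [a, b]; ring
  rw [e]
  have t := norm_sub_norm_le (2 * (a * b)) (-(a * (η.2 - η'.2)) - b * (η.1 - η'.1))
  have t2 := norm_sub_le (-(a * (η.2 - η'.2))) (b * (η.1 - η'.1))
  rw [norm_neg, norm_mul, norm_mul] at t2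
  rw [norm_mul, norm_mul, Complex.norm_ofNat] at t
  have m1 : ‖a‖ * ‖η.2 - η'.2‖ ≤ ‖a‖ * (‖b‖ / 2) :=
    mul_le_mul_of_nonneg_left (by linarith) (norm_nonneg _)
  have m2 : ‖b‖ * ‖η.1 - η'.1‖ ≤ ‖b‖ * (‖a‖ / 2) :=
    mul_le_mul_of_nonneg_left (by linarith) (norm_nonneg _)
  have m3 : (κ₀ * N / 2) * (κ₀ * N / 2) ≤ ‖a‖ * ‖b‖ :=
    mul_le_mul (by linarith) (by linarith) (by linarith) (norm_nonneg _)
  nlinarith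

theorem le_add_of_sq_le_mul {t x y : ℝ≥0∞} (h : t ^ 2 ≤ x * y) : t ≤ x + y := by
  by_contra! hc
  have hx : x < t := lt_of_le_of_lt le_self_add hc
  have hy : y < t := lt_of_le_of_lt le_add_self hc
  exact absurd h (not_le.2 (by rw [sq]; exact ENNReal.mul_lt_mul hx hy))

open Classical in
/-- The combinatorial summation over balanced quadruples. -/
theorem sum_bal_le {N : ℝ} {S₁ S₂ : Finset ((ℤ × ℤ) × (ℤ × ℤ))}
    {φ ψ α β : (ℤ × ℤ) × (ℤ × ℤ) → ℝ≥0∞} {A Q : ℝ≥0∞} (hφ : ∀ ξ ∈ S₁, φ ξ ^ 2 ≤ A * (α ξ * β ξ))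
    (hfan : ∀ ξ ∈ S₁, ∀ η' ∈ S₂,
      ∑ ξ' ∈ S₁.filter (fun ξ' => ∃ η ∈ S₂, Bal N (ξ, η) (ξ', η')), β ξ' ≤ Q) :
    ∑ j ∈ S₁ ×ˢ S₂, ∑ j' ∈ S₁ ×ˢ S₂, (if Bal N j j' then
      (φ j.1 * ψ j.2) * (φ j'.1 * ψ j'.2) else 0) ≤
      2 * (cgi 11 * cgi 11) * A * Q * ((∑ ξ ∈ S₁, α ξ) * ∑ η ∈ S₂, ψ η ^ 2) := by
  set X : ((ℤ × ℤ) × (ℤ × ℤ)) × ((ℤ × ℤ) × (ℤ × ℤ)) → ((ℤ × ℤ) × (ℤ × ℤ)) × ((ℤ × ℤ) × (ℤ × ℤ)) → ℝ≥0∞ :=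
    fun j j' => if Bal N j j' then A * (α j.1 * β j'.1 * ψ j'.2 ^ 2) else 0 with hX
  have key : ∀ j ∈ S₁ ×ˢ S₂, ∀ j' ∈ S₁ ×ˢ S₂, (if Bal N j j' then
      (φ j.1 * ψ j.2) * (φ j'.1 * ψ j'.2) else 0) ≤ X j j' + X j' j := by
    intro j hj j' hj'
    by_cases h : Bal N j j'
    · simp only [hX, if_pos h, if_pos h.symm]
      refine le_add_of_sq_le_mul ?_
      have h1 := hφ j.1 (Finset.mem_product.1 hj).1
      have h2 := hφ j'.1 (Finset.mem_product.1 hj').1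
      calc _ = φ j.1 ^ 2 * φ j'.1 ^ 2 * (ψ j.2 ^ 2 * ψ j'.2 ^ 2) := by ring
        _ ≤ (A * (α j.1 * β j.1)) * (A * (α j'.1 * β j'.1)) * (ψ j.2 ^ 2 * ψ j'.2 ^ 2) := by gcongr
        _ = _ := by ring
    · simp [h]
  have hXX : ∑ j ∈ S₁ ×ˢ S₂, ∑ j' ∈ S₁ ×ˢ S₂, X j j' ≤
      (cgi 11 * cgi 11) * A * Q * ((∑ ξ ∈ S₁, α ξ) * ∑ η ∈ S₂, ψ η ^ 2) := by
    simp only [Finset.sum_product]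
    calc _ = ∑ ξ ∈ S₁, ∑ η' ∈ S₂, A * (α ξ * ψ η' ^ 2) * ∑ ξ' ∈ S₁,
          ((S₂.filter fun η => Bal N (ξ, η) (ξ', η')).card : ℝ≥0∞) * β ξ' := by
          refine Finset.sum_congr rfl fun ξ _ => ?_
          rw [Finset.sum_comm, Finset.sum_congr rfl fun ξ' _ => Finset.sum_comm]
          rw [Finset.sum_comm]
          refine Finset.sum_congr rfl fun η' _ => ?_
          rw [Finset.mul_sum]
          refine Finset.sum_congr rfl fun ξ' _ => ?_
          simp only [hX]
          rw [← Finset.sum_filter, Finset.sum_const, nsmul_eq_mul]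
          ring
      _ ≤ ∑ ξ ∈ S₁, ∑ η' ∈ S₂, A * (α ξ * ψ η' ^ 2) * ((cgi 11 * cgi 11) * Q) := by
          refine Finset.sum_le_sum fun ξ hξ => Finset.sum_le_sum fun η' hη' => mul_le_mul' le_rfl ?_
          refine le_trans ?_ (mul_le_mul' le_rfl (hfan ξ hξ η' hη'))
          rw [Finset.mul_sum, Finset.sum_filter]
          refine Finset.sum_le_sum fun ξ' _ => ?_
          split_ifs with h
          · exact mul_le_mul' (card_filter_bal_le _ _ _ _) le_rfl
          · have : (S₂.filter fun η => Bal N (ξ, η) (ξ', η')) = ∅ :=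
              Finset.filter_eq_empty_iff.2 fun η hη hb => h ⟨η, hη, hb⟩
            simp [this]
      _ = _ := by
          simp only [← Finset.sum_mul, ← Finset.mul_sum]
          ring
  calc _ ≤ ∑ j ∈ S₁ ×ˢ S₂, ∑ j' ∈ S₁ ×ˢ S₂, (X j j' + X j' j) :=
        Finset.sum_le_sum fun j hj => Finset.sum_le_sum fun j' hj' => key j hj j' hj'
    _ = 2 * ∑ j ∈ S₁ ×ˢ S₂, ∑ j' ∈ S₁ ×ˢ S₂, X j j' := by
        simp only [Finset.sum_add_distrib]
        rw [Finset.sum_comm (f := fun j j' => X j' j)]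
        ring
    _ ≤ _ := by
        refine (mul_le_mul' le_rfl hXX).trans (le_of_eq ?_)
        ring

theorem ofReal_Th (N : ℝ) (c0 : ℂ) (q : ℂ × ℂ) (z : ℂ × ℂ × ℂ) : ENNReal.ofReal (Th N c0 q z) =
    ENNReal.ofReal (th (N * (z.1 - c0))) *
      (ENNReal.ofReal (th (z.2.1 - q.1)) * ENNReal.ofReal (th (z.2.2 - q.2))) := by
  rw [Th, ENNReal.ofReal_mul (th_nonneg _), ENNReal.ofReal_mul (th_nonneg _)]

theorem measurable_ofReal_Th (N : ℝ) : Measurable fun p : (ℂ × ℂ × ℂ) × ℂ × ℂ × ℂ =>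
    ENNReal.ofReal (Th N p.2.1 p.2.2 p.1) := by
  have := continuous_th
  refine ENNReal.measurable_ofReal.comp (Continuous.measurable ?_)
  unfold Th
  fun_prop

theorem lintegral_ofReal_Th (N : ℝ) (c0 : ℂ) (z : ℂ × ℂ × ℂ) :
    ∫⁻ q, ENNReal.ofReal (Th N c0 q z) = ENNReal.ofReal (th (N * (z.1 - c0))) * thI ^ 2 := by
  have h : ∀ a : ℂ, ∫⁻ q : ℂ, ENNReal.ofReal (th (a - q)) = thI := fun a =>
    lintegral_sub_left_eq_self (fun x => ENNReal.ofReal (th x)) a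
  have hm : ∀ a : ℂ, Measurable fun q : ℂ => ENNReal.ofReal (th (a - q)) := fun a =>
    ENNReal.measurable_ofReal.comp (continuous_th.comp (continuous_const.sub continuous_id)).measurable
  simp only [ofReal_Th]
  rw [lintegral_const_mul' _ _ ENNReal.ofReal_ne_top, Measure.volume_eq_prod,
    lintegral_prod_mul (f := fun q : ℂ => ENNReal.ofReal (th (z.2.1 - q)))
      (g := fun q : ℂ => ENNReal.ofReal (th (z.2.2 - q))) (hm _).aemeasurable (hm _).aemeasurable, h, h, sq]

theorem le_lintegral_th {N : ℝ} (hN : 0 < N) {Y : Set ℂ} {c : ℂ} (h : Metric.ball c (1 / N) ⊆ Y) :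
    (∫⁻ a in Metric.ball 0 1, ENNReal.ofReal (th a)) ≤
      ENNReal.ofReal N ^ 2 * ∫⁻ c0 in Y, ENNReal.ofReal (th (N * (c - c0))) := by
  set G : ℂ → ℝ≥0∞ := (Metric.ball 0 1).indicator fun a => ENNReal.ofReal (th a) with hG
  have hGm : Measurable G :=
    (ENNReal.measurable_ofReal.comp continuous_th.measurable).indicator Metric.isOpen_ball.measurableSet
  have h1 := lintegral_comp_affine G hGm (N * c) (s := (-N : ℂ)) (by simpa using hN.ne')
  have hN' : ‖(-N : ℂ)‖ₑ = ENNReal.ofReal N := by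
    rw [enorm_neg, ← ofReal_norm, Complex.norm_real, Real.norm_of_nonneg hN.le]
  have h0 : ENNReal.ofReal N ≠ 0 := by simpa using hN
  have h2 : ∫⁻ a, G a = ENNReal.ofReal N ^ 2 * ∫⁻ z, G (N * c + -N * z) := by
    rw [h1, hN', ← mul_assoc, ← mul_pow, ENNReal.mul_inv_cancel h0 ENNReal.ofReal_ne_top, one_pow, one_mul]
  rw [← lintegral_indicator Metric.isOpen_ball.measurableSet]
  refine h2.le.trans (mul_le_mul' le_rfl ?_)
  refine le_trans (lintegral_mono fun z => ?_) (lintegral_indicator_le _ Y)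
  by_cases hz : (N * c + -N * z : ℂ) ∈ Metric.ball (0 : ℂ) 1
  · have hzY : z ∈ Y := by
      refine h ?_
      rw [mem_ball_zero_iff, show (N * c + -N * z : ℂ) = N * (c - z) by ring, norm_mul, Complex.norm_real,
        Real.norm_of_nonneg hN.le] at hz
      rw [mem_ball_iff_norm', lt_div_iff₀' hN]
      exact hz
    rw [hG, Set.indicator_of_mem hz, Set.indicator_of_mem hzY,
      show (N * c + -N * z : ℂ) = N * (c - z) by ring]
  · rw [hG, Set.indicator_of_notMem hz]; exact zero_le

theorem lintegral_plates_swap {A B Z : Type*} [MeasureSpace A] [MeasureSpace B] [MeasureSpace Z]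
    [SFinite (volume : Measure A)] [SFinite (volume : Measure B)] [SFinite (volume : Measure Z)]
    {T : A → B → Z → ℝ≥0∞} (hT : Measurable fun p : Z × A × B => T p.2.1 p.2.2 p.1)
    {t : A → Z → ℝ≥0∞} {K : ℝ≥0∞} (hK : K ≠ ∞) (ht : Measurable fun p : A × Z => t p.1 p.2)
    (h : ∀ a z, ∫⁻ b, T a b z = t a z * K) {Φ : A → Z → ℝ≥0∞}
    (hΦ : Measurable fun p : A × Z => Φ p.1 p.2) (Y : Set A) :
    ∫⁻ a in Y, ∫⁻ b, ∫⁻ z, T a b z * Φ a z = K * ∫⁻ z, ∫⁻ a in Y, t a z * Φ a z := by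
  have e1 : ∀ a, ∫⁻ b, ∫⁻ z, T a b z * Φ a z = ∫⁻ z, K * (t a z * Φ a z) := by
    intro a
    have m1 : Measurable fun p : B × Z => T a p.1 p.2 :=
      hT.comp (f := fun p : B × Z => (p.2, a, p.1)) (by fun_prop)
    have m0 : Measurable fun p : B × Z => Φ a p.2 :=
      hΦ.comp (f := fun p : B × Z => (a, p.2)) (by fun_prop)
    have m2 : Measurable fun p : B × Z => T a p.1 p.2 * Φ a p.2 := m1.mul m0
    rw [lintegral_lintegral_swap (f := fun b z => T a b z * Φ a z) m2.aemeasurable]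
    refine lintegral_congr fun z => ?_
    have m3 : Measurable fun b => T a b z :=
      hT.comp (f := fun b : B => (z, a, b)) (by fun_prop)
    rw [lintegral_mul_const _ m3, h]
    ring
  simp only [e1]
  have m4 : Measurable fun p : A × Z => K * (t p.1 p.2 * Φ p.1 p.2) := (ht.mul hΦ).const_mul K
  rw [lintegral_lintegral_swap (f := fun a z => K * (t a z * Φ a z)) m4.aemeasurable,
    ← lintegral_const_mul' _ _ hK]
  exact lintegral_congr fun z => lintegral_const_mul' _ _ hK

theorem lintegral_le_of_plates {N : ℝ} (hN : 0 < N) {X Y : Set ℂ} (hX : MeasurableSet X)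
    (hXY : ∀ c ∈ X, Metric.ball c (1 / N) ⊆ Y)
    {F W : ℂ × ℂ × ℂ → ℝ≥0∞} (hF : Measurable F) (hW : Measurable W) {g : ℂ → ℂ → ℝ≥0∞}
    (hg : Measurable fun p : ℂ × ℂ => g p.1 p.2)
    (h : ∀ c0 ∈ Y, ∀ q, ∫⁻ z, ENNReal.ofReal (Th N c0 q z) * F z ≤
      ∫⁻ z, ENNReal.ofReal (Th N c0 q z) * (g c0 z.1 * W z)) (hY : MeasurableSet Y)
    {w : ℂ → ℝ≥0∞} (hA : ∀ c, ENNReal.ofReal N ^ 2 * ∫⁻ c0 in Y, ENNReal.ofReal (th (N * (c - c0))) * g c0 c ≤ w c) :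
    (∫⁻ a in Metric.ball 0 1, ENNReal.ofReal (th a)) * ∫⁻ z in X ×ˢ Set.univ, F z ≤
      ∫⁻ z, w z.1 * W z := by
  set t0 := ∫⁻ a in Metric.ball 0 1, ENNReal.ofReal (th a)
  set T : ℂ → ℂ × ℂ → ℂ × ℂ × ℂ → ℝ≥0∞ := fun c0 q z => ENNReal.ofReal (Th N c0 q z) with hT
  have hTm : Measurable fun p : (ℂ × ℂ × ℂ) × ℂ × ℂ × ℂ => T p.2.1 p.2.2 p.1 := measurable_ofReal_Th N
  have ht : Measurable fun p : ℂ × ℂ × ℂ × ℂ => ENNReal.ofReal (th (N * (p.2.1 - p.1))) :=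
    ENNReal.measurable_ofReal.comp (continuous_th.comp (by fun_prop)).measurable
  have swap := fun {Φ} hΦ => lintegral_plates_swap hTm (t := fun c0 z => ENNReal.ofReal (th (N * (z.1 - c0))))
    (ENNReal.pow_ne_top (n := 2) thI_ne_top) ht (fun c0 z => lintegral_ofReal_Th N c0 z) (Φ := Φ) hΦ Y
  have hN2 : ENNReal.ofReal N ^ 2 ≠ ∞ := ENNReal.pow_ne_top ENNReal.ofReal_ne_top
  have k1 : ∫⁻ c0 in Y, ∫⁻ q, ∫⁻ z, T c0 q z * F z ≤
      ∫⁻ c0 in Y, ∫⁻ q, ∫⁻ z, T c0 q z * (g c0 z.1 * W z) :=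
    setLIntegral_mono' hY fun c0 hc0 => lintegral_mono fun q => h c0 hc0 q
  have mg : Measurable fun p : ℂ × ℂ × ℂ × ℂ => g p.1 p.2.1 * W p.2 :=
    (hg.comp (by fun_prop : Measurable fun p : ℂ × ℂ × ℂ × ℂ => (p.1, p.2.1))).mul (hW.comp measurable_snd)
  rw [swap (Φ := fun _ z => F z) (hF.comp measurable_snd), swap (Φ := fun c0 z => g c0 z.1 * W z) mg,
    ENNReal.mul_le_mul_iff_right (pow_ne_zero _ thI_ne_zero) (ENNReal.pow_ne_top thI_ne_top)] at k1
  have mt : ∀ c : ℂ, Measurable fun c0 : ℂ => ENNReal.ofReal (th (N * (c - c0))) := fun c =>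
    ENNReal.measurable_ofReal.comp (continuous_th.comp (by fun_prop)).measurable
  calc t0 * ∫⁻ z in X ×ˢ Set.univ, F z = ∫⁻ z in X ×ˢ Set.univ, t0 * F z := by
        rw [lintegral_const_mul _ hF]
    _ ≤ ∫⁻ z in X ×ˢ Set.univ, ENNReal.ofReal N ^ 2 *
          ∫⁻ c0 in Y, ENNReal.ofReal (th (N * (z.1 - c0))) * F z := by
        refine setLIntegral_mono' (hX.prod MeasurableSet.univ) fun z hz => ?_
        rw [lintegral_mul_const _ (mt _), ← mul_assoc]
        exact mul_le_mul' (le_lintegral_th hN (hXY _ hz.1)) le_rfl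
    _ ≤ ENNReal.ofReal N ^ 2 * ∫⁻ z, ∫⁻ c0 in Y, ENNReal.ofReal (th (N * (z.1 - c0))) * F z := by
        rw [← lintegral_const_mul' _ _ hN2]
        exact setLIntegral_le_lintegral _ _
    _ ≤ ENNReal.ofReal N ^ 2 * ∫⁻ z, ∫⁻ c0 in Y, ENNReal.ofReal (th (N * (z.1 - c0))) * (g c0 z.1 * W z) :=
        mul_le_mul' le_rfl k1
    _ ≤ _ := by
        rw [← lintegral_const_mul' _ _ hN2]
        refine lintegral_mono fun z => ?_
        have m5 : Measurable fun c0 : ℂ => ENNReal.ofReal (th (N * (z.1 - c0))) * g c0 z.1 :=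
          (mt z.1).mul (hg.comp (by fun_prop : Measurable fun c0 : ℂ => (c0, z.1)))
        simp only [← mul_assoc]
        rw [lintegral_mul_const _ m5, ← mul_assoc]
        exact mul_le_mul' (hA z.1) le_rfl

theorem exists_plate_weight_le (e : ℕ) (R : ℝ≥0∞) (hR : R ≠ ∞) : ∃ C : ℝ≥0∞, C ≠ ∞ ∧ ∀ {N : ℝ}, 1 ≤ N → ∀ {Y : Set ℂ},
    MeasurableSet Y → (∀ c ∈ Y, ‖c‖ₑ ≤ R) → ∀ c : ℂ, ENNReal.ofReal N ^ 2 * ∫⁻ c0 in Y, ENNReal.ofReal (th (N * (c - c0))) *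
      ((1 + ENNReal.ofReal N * ‖c - c0‖ₑ) ^ 2 * (1 + ‖c‖ₑ) ^ e) ≤ C * om c := by
  obtain ⟨C, hC, h⟩ := th_decay (e + 8 + 2 + 3)
  refine ⟨C * (1 + R) ^ (e + 8) * wbI, ENNReal.mul_ne_top (ENNReal.mul_ne_top hC (by finiteness)) wbI_lt_top.ne, ?_⟩
  intro N hN Y hY hYR c
  have hN0 : (0 : ℝ) < N := by linarith
  have hNn : ‖(N : ℂ)‖ₑ = ENNReal.ofReal N := by
    rw [← ofReal_norm, Complex.norm_real, Real.norm_of_nonneg hN0.le]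
  have h0 : ENNReal.ofReal N ≠ 0 := by simpa using hN0
  have key : ∀ c0 ∈ Y, ENNReal.ofReal (th (N * (c - c0))) *
      ((1 + ENNReal.ofReal N * ‖c - c0‖ₑ) ^ 2 * (1 + ‖c‖ₑ) ^ e) ≤
      (C * (1 + R) ^ (e + 8) * om c) * wb (N * c + -N * c0) ^ 3 := by
    intro c0 hc0
    rw [show (N * c + -N * c0 : ℂ) = N * (c - c0) by ring]
    set x : ℝ≥0∞ := 1 + ENNReal.ofReal N * ‖c - c0‖ₑ with hx
    have hwx : wb (N * (c - c0)) = x⁻¹ := by rw [wb, enorm_mul, hNn]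
    have hx0 : x ≠ 0 := by simp [hx]
    have hxt : x ≠ ∞ := by rw [hx]; finiteness
    have h1 : (1 + ‖c‖ₑ) ≤ (1 + R) * x := by
      have : ‖c‖ₑ ≤ ‖c0‖ₑ + ‖c - c0‖ₑ := by
        simpa using enorm_add_le c0 (c - c0)
      have h2 : ‖c - c0‖ₑ ≤ ENNReal.ofReal N * ‖c - c0‖ₑ := by
        refine le_mul_of_one_le_left zero_le ?_
        simpa using hN
      calc 1 + ‖c‖ₑ ≤ 1 + (R + ENNReal.ofReal N * ‖c - c0‖ₑ) := by
            gcongr; exact this.trans (add_le_add (hYR c0 hc0) h2)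
        _ ≤ 1 + (R + ENNReal.ofReal N * ‖c - c0‖ₑ) + R * (ENNReal.ofReal N * ‖c - c0‖ₑ) := le_self_add
        _ = _ := by rw [hx]; ring
    have hom : (1 + ‖c‖ₑ) ^ 8 * om c = 1 := by
      rw [om, wb, ← mul_pow, ENNReal.mul_inv_cancel (by simp) (by finiteness), one_pow]
    have hxx : x⁻¹ * x = 1 := ENNReal.inv_mul_cancel hx0 hxt
    calc _ ≤ (C * wb (N * (c - c0)) ^ (e + 8 + 2 + 3)) * (x ^ 2 * (1 + ‖c‖ₑ) ^ e) :=
          mul_le_mul' (h _) le_rfl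
      _ = C * x⁻¹ ^ (e + 8 + 2 + 3) * (x ^ 2 * (1 + ‖c‖ₑ) ^ e) * ((1 + ‖c‖ₑ) ^ 8 * om c) := by
          rw [hwx, hom, mul_one]
      _ = C * x⁻¹ ^ (e + 8 + 2 + 3) * x ^ 2 * om c * (1 + ‖c‖ₑ) ^ (e + 8) := by rw [pow_add (1 + ‖c‖ₑ)]; ring
      _ ≤ C * x⁻¹ ^ (e + 8 + 2 + 3) * x ^ 2 * om c * ((1 + R) * x) ^ (e + 8) := by gcongr
      _ = C * (1 + R) ^ (e + 8) * om c * x⁻¹ ^ 3 * ((x⁻¹ * x) ^ 2 * (x⁻¹ * x) ^ (e + 8)) := by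
          rw [mul_pow (1 + R), mul_pow, mul_pow, pow_add x⁻¹, pow_add x⁻¹]; ring
      _ = _ := by rw [hxx, one_pow, one_pow, one_mul, mul_one, hwx]
  have h3 : ∫⁻ c0, wb (N * c + -N * c0) ^ 3 ≤ (ENNReal.ofReal N)⁻¹ ^ 2 * wbI := by
    have := lintegral_wb_affine le_rfl (N * c) (s := (-N : ℂ)) (by simpa using hN0.ne')
    rwa [enorm_neg, hNn] at this
  have hot : C * (1 + R) ^ (e + 8) * om c ≠ ∞ :=
    ENNReal.mul_ne_top (ENNReal.mul_ne_top hC (by finiteness)) (om_ne_top c)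
  calc _ ≤ ENNReal.ofReal N ^ 2 * ∫⁻ c0 in Y, (C * (1 + R) ^ (e + 8) * om c) * wb (N * c + -N * c0) ^ 3 := by
        gcongr 1
        exact setLIntegral_mono' hY key
    _ ≤ ENNReal.ofReal N ^ 2 * ((C * (1 + R) ^ (e + 8) * om c) * ((ENNReal.ofReal N)⁻¹ ^ 2 * wbI)) := by
        rw [lintegral_const_mul' _ _ hot]
        gcongr
        exact (setLIntegral_le_lintegral _ _).trans h3
    _ = C * (1 + R) ^ (e + 8) * wbI * om c * (ENNReal.ofReal N * (ENNReal.ofReal N)⁻¹) ^ 2 := by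
        rw [mul_pow]; ring
    _ = _ := by rw [ENNReal.mul_inv_cancel h0 ENNReal.ofReal_ne_top, one_pow, mul_one]

theorem sum_lintegral_le {ι Z : Type*} [MeasurableSpace Z] {μ : Measure Z} (s : Finset ι)
    (f : ι → Z → ℝ≥0∞) : ∑ i ∈ s, ∫⁻ z, f i z ∂μ ≤ ∫⁻ z, ∑ i ∈ s, f i z ∂μ := by
  classical
  induction s using Finset.induction_on with
  | empty => simp
  | insert a s ha ih =>
    simp only [Finset.sum_insert ha]
    exact (add_le_add le_rfl ih).trans (le_lintegral_add _ _)

theorem plate_le {N : ℝ} (hN : 0 < N) {S₁ S₂ : Finset ((ℤ × ℤ) × (ℤ × ℤ))} {ι : Type} [Fintype ι]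
    {k : (ℤ × ℤ) × (ℤ × ℤ) → ℂ × ℂ → ℂ} {l : ι → (ℤ × ℤ) × (ℤ × ℤ) → ℂ × ℂ → ℂ}
    (hk : ∀ ξ, Integrable (k ξ)) (hl : ∀ i η, Integrable (l i η))
    (hks : ∀ ξ w, k ξ w ≠ 0 → ‖w - g2 ξ‖ ≤ 2) (hls : ∀ i η w, l i η w ≠ 0 → ‖w - g2 η‖ ≤ 2)
    {A B Q : ℂ → ℝ≥0∞} {α β : (ℤ × ℤ) × (ℤ × ℤ) → ℂ → ℂ × ℂ → ℝ≥0∞} {μ : ℂ → ℂ × ℂ → ℝ≥0∞}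
    (hφ : ∀ ξ ∈ S₁, ∀ c y, ‖EE (k ξ) c y‖ₑ ^ 2 ≤ A c * (α ξ c y * β ξ c y))
    (hfan : open Classical in ∀ c y, ∀ ξ ∈ S₁, ∀ η' ∈ S₂,
      ∑ ξ' ∈ S₁.filter (fun ξ' => ∃ η ∈ S₂, Bal N (ξ, η) (ξ', η')), β ξ' c y ≤ Q c)
    (hψ : ∀ c y, ∑ i, ∑ η ∈ S₂, ‖EE (l i η) c y‖ₑ ^ 2 ≤ B c * μ c y) (c0 : ℂ) (q : ℂ × ℂ) :
    ∑ i, ∫⁻ z, ENNReal.ofReal (Th N c0 q z) *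
      ‖(∑ ξ ∈ S₁, EE (k ξ) z.1 z.2) * ∑ η ∈ S₂, EE (l i η) z.1 z.2‖ₑ ^ 2 ≤
    ∫⁻ z, ENNReal.ofReal (Th N c0 q z) * (2 * (cgi 11 * cgi 11) * A z.1 * Q z.1 * B z.1 *
      ((∑ ξ ∈ S₁, α ξ z.1 z.2) * μ z.1 z.2)) := by
  classical
  have ck := fun ξ => continuous_EE_comp (hk ξ)
  have cl := fun i η => continuous_EE_comp (hl i η)
  have hTm : AEMeasurable fun z => ENNReal.ofReal (Th N c0 q z) :=
    (integrable_Th hN c0 q).1.aemeasurable.ennreal_ofReal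
  have step : ∀ i, ∫⁻ z, ENNReal.ofReal (Th N c0 q z) *
      ‖(∑ ξ ∈ S₁, EE (k ξ) z.1 z.2) * ∑ η ∈ S₂, EE (l i η) z.1 z.2‖ₑ ^ 2 ≤
      ∫⁻ z, ENNReal.ofReal (Th N c0 q z) * ((2 * (cgi 11 * cgi 11) * A z.1 * Q z.1 *
        (∑ ξ ∈ S₁, α ξ z.1 z.2)) * ∑ η ∈ S₂, ‖EE (l i η) z.1 z.2‖ₑ ^ 2) := by
    intro i
    have h := lintegral_sq_sum_le (integrable_Th hN c0 q) (Th_nonneg N c0 q) (S := S₁ ×ˢ S₂)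
      (G := fun j z => EE (k j.1) z.1 z.2 * EE (l i j.2) z.1 z.2) (rel := Bal N)
      (fun j => (ck j.1).mul (cl i j.2))
      (fun j => ⟨(∫ w, ‖k j.1 w‖) * ∫ w, ‖l i j.2 w‖, fun z => by
        rw [norm_mul]
        exact mul_le_mul (norm_EE_le _ _ _) (norm_EE_le _ _ _) (norm_nonneg _)
          (integral_nonneg fun _ => norm_nonneg _)⟩)
      (fun j _ j' _ hjj => by
        refine integral_Th_mul_eq_zero hN c0 q (hk _) (hl _ _) (hk _) (hl _ _) ?_
        intro w₁ w₂ w₃ w₄ h1 h2 h3 h4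
        by_contra! hc
        exact hjj ⟨w₁, w₂, w₃, w₄, ⟨hks _ _ h1, hls _ _ _ h2, hks _ _ h3, hls _ _ _ h4⟩, hc⟩)
    refine le_trans (le_of_eq (lintegral_congr fun z => ?_)) (h.trans (lintegral_mono fun z => ?_))
    · rw [Finset.sum_mul_sum, Finset.sum_product]
    · refine mul_le_mul' le_rfl ?_
      simp only [enorm_mul]
      refine (sum_bal_le (N := N) (φ := fun ξ => ‖EE (k ξ) z.1 z.2‖ₑ) (ψ := fun η => ‖EE (l i η) z.1 z.2‖ₑ)
        (fun ξ hξ => hφ ξ hξ z.1 z.2) (hfan z.1 z.2)).trans (le_of_eq ?_)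
      ring
  refine (Finset.sum_le_sum fun i _ => step i).trans ((sum_lintegral_le _ _).trans
    (lintegral_mono fun z => ?_))
  rw [← Finset.mul_sum, ← Finset.mul_sum]
  refine mul_le_mul' le_rfl ((mul_le_mul' le_rfl (hψ z.1 z.2)).trans (le_of_eq ?_))
  ring

theorem exists_dual_density : ∃ C : ℝ≥0∞, C ≠ ∞ ∧ ∀ {ι : Type} [Fintype ι] {h : ι → ℂ × ℂ → ℂ},
    (∀ i, MemLp (h i) 2) → ∀ S : Finset ((ℤ × ℤ) × (ℤ × ℤ)), ∃ H : (ℤ × ℤ) × (ℤ × ℤ) → ℂ × ℂ → ℝ≥0∞,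
      (∀ η, Measurable (H η)) ∧ ∑ η ∈ S, ∫⁻ x, H η x ≤ ∑ i, ∫⁻ w, ‖h i w‖ₑ ^ 2 ∧
      ∀ c y, ∑ i, ∑ η ∈ S, ‖EE (fun w => gb (g2 η) w * (gb (g2 η) w * h i w)) c y‖ₑ ^ 2 ≤
        ((C * (1 + 2 * ‖c‖ₑ) ^ 16) ^ 2 * wbI ^ 2) * ∑ η ∈ S, muD (g2 η) (H η) c y := by
  obtain ⟨C, hC, hp⟩ := exists_packets
  refine ⟨C, hC, ?_⟩
  intro ι _ h hh S
  have cF : ∀ i η, Continuous (FT fun w => gb (g2 η) w * h i w) := fun i η =>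
    continuous_FT (integrable_gb_mul (hh i) _)
  refine ⟨fun η x => ∑ i, ‖FT (fun w => gb (g2 η) w * h i w) x‖ₑ ^ 2, fun η =>
    Finset.measurable_fun_sum _ fun i _ => (cF i η).measurable.enorm.pow_const 2, ?_, ?_⟩
  · calc _ = ∑ η ∈ S, ∑ i, ∫⁻ w, ‖gb (g2 η) w * h i w‖ₑ ^ 2 := by
          refine Finset.sum_congr rfl fun η _ => ?_
          rw [lintegral_finsetSum _ fun i _ => (cF i η).measurable.enorm.pow_const 2]
          exact Finset.sum_congr rfl fun i _ =>
            FT_lintegral_sq (memLp_mul_gb (hh i) _) (integrable_gb_mul (hh i) _)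
      _ ≤ _ := by
          rw [Finset.sum_comm]
          exact Finset.sum_le_sum fun i _ => sum_lintegral_gb_mul_le S (hh i)
  · intro c y
    rw [Finset.sum_comm, Finset.mul_sum]
    refine Finset.sum_le_sum fun η _ => ?_
    have e : muD (g2 η) (fun x => ∑ i, ‖FT (fun w => gb (g2 η) w * h i w) x‖ₑ ^ 2) c y =
        ∑ i, ∫⁻ x, ‖FT (fun w => gb (g2 η) w * h i w) x‖ₑ ^ 2 * KK (g2 η) c (y - x) := by
      have hm : ∀ i ∈ Finset.univ, Measurable fun x =>
          ‖FT (fun w => gb (g2 η) w * h i w) x‖ₑ ^ 2 * KK (g2 η) c (y - x) := fun i _ =>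
        ((cF i η).measurable.enorm.pow_const 2).mul
          (measurable_KK_comp measurable_const (measurable_const.sub measurable_id))
      rw [← lintegral_finsetSum _ hm]
      simp only [← Finset.sum_mul]
      rfl
    rw [e, Finset.mul_sum]
    refine Finset.sum_le_sum fun i _ => ?_
    obtain ⟨F, hF, hs, -, hE⟩ := hp (hh i) (m := fun _ => 1) (m' := fun _ : Unit => fun _ => 1)
      (fun _ => measurable_const) (fun _ => by simp) (fun _ => one_ne_zero) (fun _ => one_ne_top) (g2 η)
    have h1 : EE (fun w => gb (g2 η) w * (gb (g2 η) w * h i w)) c y =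
        EE (fun w => gb (g2 η) w * F () w) c y := by
      refine EE_congr_ae ?_ c y
      filter_upwards [hs] with w hw
      rw [← hw]; simp
    rw [h1]
    refine (hE () c y).trans ?_
    simp only [inv_one, mul_one, one_mul]
    rw [mul_assoc]
    refine mul_le_mul' le_rfl ?_
    rw [mul_comm]
    exact mul_le_mul' (lintegral_KK_right _ _ _) le_rfl

open Classical in
theorem exists_fan_bal_le {κ₀ : ℝ} (hκ₀ : 0 < κ₀) : ∃ C : ℝ≥0∞, C ≠ ∞ ∧ ∀ {N κ : ℝ}, 1 ≤ N → 16 ≤ κ₀ * N →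
    0 < κ → ∀ {S₁ S₂ : Finset ((ℤ × ℤ) × (ℤ × ℤ))}, (∀ ξ ∈ S₁, ‖g2 ξ‖ ≤ N + 2) → (∀ η ∈ S₂, ‖g2 η‖ ≤ N + 2) →
    (∀ ξ ∈ S₁, ∀ η ∈ S₂, κ₀ * N - 4 ≤ ‖(g2 η - g2 ξ).1‖ ∧ κ₀ * N - 4 ≤ ‖(g2 η - g2 ξ).2‖) →
    (∀ η ∈ S₂, ∀ η' ∈ S₂, ‖g2 η - g2 η'‖ ≤ κ₀ * N / 16 + 4) →
    ∀ {H : (ℤ × ℤ) × (ℤ × ℤ) → ℂ × ℂ → ℝ≥0∞}, (∀ η, Measurable (H η)) →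
    ∀ {P : Set ℂ}, MeasurableSet P → ∀ {c0 : ℂ}, (∀ c ∈ P, κ ≤ 2 * ‖c - c0‖) →
    ∀ (c : ℂ) (y : ℂ × ℂ), ∀ ξ ∈ S₁, ∀ η' ∈ S₂,
      ∑ ξ' ∈ S₁.filter (fun ξ' => ∃ η ∈ S₂, Bal N (ξ, η) (ξ', η')),
        ∫⁻ x, mB P (fun c y => ∑ η ∈ S₂, muD (g2 η) (H η) c y) (g2 ξ') x * KK (g2 ξ') c (y - x) ≤
      C * ((ENNReal.ofReal κ)⁻¹ ^ 2 * (ENNReal.ofReal N)⁻¹ ^ 2 * (1 + ENNReal.ofReal N * ‖c - c0‖ₑ) ^ 2 *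
        (1 + ‖c‖ₑ) ^ 8) * ∑ η ∈ S₂, ∫⁻ x, H η x := by
  have hδ : ENNReal.ofReal (κ₀ ^ 2 / 4) ≠ 0 := by
    have : 0 < κ₀ ^ 2 / 4 := by positivity
    simpa using this
  refine ⟨(2 ^ 9 * wbI) ^ 2 * (200 ^ 12 * cgi (800 / κ₀) * ((1 + ENNReal.ofReal 3) ^ 4 * (3 ^ 4 * wbI) * 16)) *
    (200 ^ 12 * wbI ^ 3 * (ENNReal.ofReal (κ₀ ^ 2 / 4))⁻¹ ^ 2), ?_, ?_⟩
  · have := wbI_lt_top.ne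
    have := cgi_ne_top (800 / κ₀)
    have : (ENNReal.ofReal (κ₀ ^ 2 / 4))⁻¹ ≠ ∞ := ENNReal.inv_ne_top.2 hδ
    finiteness
  intro N κ hN hκN hκ S₁ S₂ h1 h2 hsep hdiam H hH P hP c0 hP0 c y ξ hξ η' hη'
  have hN0 : (0 : ℝ) < N := by linarith
  have hdiv : ∀ {a : ℂ} {t : ℝ}, ‖a‖ ≤ t * N → ‖a / N‖ₑ ≤ ENNReal.ofReal t := fun {a t} h => by
    rw [← ofReal_norm, norm_div, Complex.norm_real, Real.norm_of_nonneg hN0.le]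
    exact ENNReal.ofReal_le_ofReal ((div_le_iff₀ hN0).2 h)
  have hdiv' : ∀ {a : ℂ}, ‖a‖ ≤ 200 * N → ‖a / N‖ₑ ≤ 200 := fun {a} h => by
    simpa using hdiv h
  have hD : ‖g2 η' - g2 ξ‖ ≤ 200 * N := (norm_sub_le _ _).trans (by linarith [h1 ξ hξ, h2 η' hη'])
  have hcr : ∀ ζ ∈ S₁.filter (fun ξ' => ∃ η ∈ S₂, Bal N (ξ, η) (ξ', η')),
      ‖(g2 η' - g2 ξ).1 * (gi ζ.2 - (g2 ξ).2) + (g2 η' - g2 ξ).2 * (gi ζ.1 - (g2 ξ).1)‖ ≤ 200 * N := by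
    intro ζ hζ
    obtain ⟨hζ1, η, hη, hb⟩ := Finset.mem_filter.1 hζ
    exact hb.norm_cross_le hN (h1 ξ hξ) (h2 η hη) (h1 ζ hζ1) (h2 η' hη')
  refine fan_le (ρ := 3) (z := 0) (T := S₂) (η := g2) (ξ := g2 ξ) (D := g2 η' - g2 ξ) hN hκ (by finiteness) (by norm_num)
    (hdiv' ((norm_fst_le _).trans hD)) (hdiv' ((norm_snd_le _).trans hD)) (fun ζ hζ => ?_)
    (fun ζ hζ => hdiv' (hcr ζ hζ)) (fun n => ?_) hδ (fun η hη => ?_) hH hP hP0 c y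
  · rw [Prod.fst_zero, sub_zero]
    exact (norm_fst_le (g2 ζ)).trans ((h1 ζ (Finset.mem_filter.1 hζ).1).trans (by linarith))
  · have := card_fibre_le hκ₀ hκN (hsep ξ hξ η' hη').1 hcr n
    convert this
  · have := le_norm_cross (η := g2 η) hκN (hsep ξ hξ η' hη').1 (hsep ξ hξ η' hη').2 (hdiam η hη η' hη')
    rw [← ofReal_norm, norm_div, Complex.norm_real, Real.norm_of_nonneg hN0.le,
      ← ENNReal.ofReal_mul (by positivity)]
    refine ENNReal.ofReal_le_ofReal ((le_div_iff₀ hN0).2 ?_)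
    linarith

theorem sum_mB {β : Type*} [Fintype β] {P : β → Set ℂ} (hP : ∀ B, MeasurableSet (P B))
    (hd : Pairwise fun B B' => Disjoint (P B) (P B')) (hu : ⋃ B, P B = Set.univ)
    (μ : ℂ → ℂ × ℂ → ℝ≥0∞) (ξ x : ℂ × ℂ) : ∑ B, mB (P B) μ ξ x = mB Set.univ μ ξ x := by
  unfold mB
  rw [← hu, lintegral_iUnion hP hd, tsum_fintype]

theorem lintegral_ne_zero_of_ne_zero {Z : Type*} [MeasurableSpace Z] {μ : Measure Z} [NeZero μ] {f : Z → ℝ≥0∞}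
    (hf : Measurable f) (h : ∀ z, f z ≠ 0) : ∫⁻ z, f z ∂μ ≠ 0 := by
  rw [Ne, lintegral_eq_zero_iff hf]
  intro hc
  obtain ⟨z, hz⟩ := hc.exists
  exact h z hz

theorem mB_univ_ne_zero {μ : ℂ → ℂ × ℂ → ℝ≥0∞} (hμ : Measurable fun z : ℂ × ℂ × ℂ => μ z.1 z.2)
    (h : ∀ c y, μ c y ≠ 0) (ξ x : ℂ × ℂ) : mB Set.univ μ ξ x ≠ 0 := by
  have m : Measurable fun z : ℂ × ℂ × ℂ => μ z.1 z.2 * KK ξ z.1 (z.2 - x) :=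
    hμ.mul (measurable_KK_comp measurable_fst (measurable_snd.sub measurable_const))
  unfold mB
  rw [Measure.restrict_univ]
  refine lintegral_ne_zero_of_ne_zero ?_ fun c => mul_ne_zero (pow_ne_zero _ (wb_ne_zero c)) ?_
  · exact (measurable_wb.pow_const 8).mul
      (measurable_lintegral_slice (k := fun c y => μ c y * KK ξ c (y - x)) m)
  · exact lintegral_ne_zero_of_ne_zero (measurable_slice (k := fun c y => μ c y * KK ξ c (y - x)) m c) fun y =>
      mul_ne_zero (h c y) (KK_ne_zero _ _ _)

theorem mB_univ_ne_top {μ : ℂ → ℂ × ℂ → ℝ≥0∞} {A : ℝ≥0∞} (hA : A ≠ ∞)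
    (h : ∀ c, ∫⁻ y, μ c y ≤ A) (ξ x : ℂ × ℂ) : mB Set.univ μ ξ x ≠ ∞ := by
  refine ne_top_of_le_ne_top (ENNReal.mul_ne_top wbI_lt_top.ne hA) ?_
  unfold mB
  calc _ ≤ ∫⁻ c, om c * A := by
        rw [Measure.restrict_univ]
        refine lintegral_mono fun c => mul_le_mul' le_rfl ((lintegral_mono fun y => ?_).trans (h c))
        exact mul_le_of_le_one_right zero_le (KK_le_one _ _ _)
    _ ≤ _ := by
        rw [lintegral_mul_const' _ _ hA]
        exact mul_le_mul' (lintegral_wb_le (by norm_num)) le_rfl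

theorem lintegral_mul_lintegral_inv_mul {Z X : Type*} [MeasureSpace Z] [MeasureSpace X]
    [SFinite (volume : Measure Z)] [SFinite (volume : Measure X)] {w : Z → ℝ≥0∞} (hw : Measurable w)
    {k : Z → X → ℝ≥0∞} (hk : Measurable fun p : Z × X => k p.1 p.2) {M V : X → ℝ≥0∞} (hM : Measurable M)
    (hV : Measurable V) (h : ∀ x, ∫⁻ z, w z * k z x = M x) (h0 : ∀ x, M x ≠ 0) (ht : ∀ x, M x ≠ ∞) :
    ∫⁻ z, w z * ∫⁻ x, V x * (M x)⁻¹ * k z x = ∫⁻ x, V x := by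
  have m1 : Measurable fun p : Z × X => V p.2 * (M p.2)⁻¹ * (w p.1 * k p.1 p.2) :=
    ((hV.mul hM.inv).comp measurable_snd).mul ((hw.comp measurable_fst).mul hk)
  have m2 : ∀ z, Measurable fun x => V x * (M x)⁻¹ * k z x := fun z =>
    (hV.mul hM.inv).mul (hk.comp measurable_prodMk_left)
  calc _ = ∫⁻ z, ∫⁻ x, V x * (M x)⁻¹ * (w z * k z x) := by
        refine lintegral_congr fun z => ?_
        rw [← lintegral_const_mul _ (m2 z)]
        refine lintegral_congr fun x => ?_
        ring
    _ = ∫⁻ x, ∫⁻ z, V x * (M x)⁻¹ * (w z * k z x) :=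
        lintegral_lintegral_swap (f := fun z x => V x * (M x)⁻¹ * (w z * k z x)) m1.aemeasurable
    _ = ∫⁻ x, V x := by
        refine lintegral_congr fun x => ?_
        have m3 : Measurable fun z => w z * k z x := hw.mul (hk.comp measurable_prodMk_right)
        rw [lintegral_const_mul _ m3, h, mul_assoc, ENNReal.inv_mul_cancel (h0 x) (ht x), mul_one]

theorem lintegral_om_mul_eq {μ : ℂ → ℂ × ℂ → ℝ≥0∞} (hμ : Measurable fun z : ℂ × ℂ × ℂ => μ z.1 z.2)
    {ξ : ℂ × ℂ} (h0 : ∀ x, mB Set.univ μ ξ x ≠ 0) (ht : ∀ x, mB Set.univ μ ξ x ≠ ∞)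
    {V : ℂ × ℂ → ℝ≥0∞} (hV : Measurable V) :
    ∫⁻ z : ℂ × ℂ × ℂ, om z.1 * μ z.1 z.2 * ∫⁻ x, V x * (mB Set.univ μ ξ x)⁻¹ * KK ξ z.1 (z.2 - x) =
      ∫⁻ x, V x := by
  have hw : Measurable fun z : ℂ × ℂ × ℂ => om z.1 * μ z.1 z.2 :=
    Measurable.mul ((measurable_wb.pow_const 8).comp measurable_fst) hμ
  have hk : Measurable fun p : (ℂ × ℂ × ℂ) × ℂ × ℂ => KK ξ p.1.1 (p.1.2 - p.2) :=
    measurable_KK_comp (by fun_prop) (by fun_prop)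
  refine lintegral_mul_lintegral_inv_mul (w := fun z : ℂ × ℂ × ℂ => om z.1 * μ z.1 z.2)
    (k := fun z x => KK ξ z.1 (z.2 - x)) hw hk (measurable_mB Set.univ hμ ξ) hV (fun x => ?_) h0 ht
  have m4 : Measurable fun z : ℂ × ℂ × ℂ => om z.1 * μ z.1 z.2 * KK ξ z.1 (z.2 - x) :=
    hw.mul (measurable_KK_comp measurable_fst (by fun_prop))
  rw [Measure.volume_eq_prod, lintegral_prod _ m4.aemeasurable, mB, Measure.restrict_univ]
  refine lintegral_congr fun c => ?_
  rw [← lintegral_const_mul' _ _ (om_ne_top c)]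
  exact lintegral_congr fun y => mul_assoc _ _ _

theorem sq_mul_one_add_le (C : ℝ≥0∞) (c : ℂ) :
    (C * (1 + 2 * ‖c‖ₑ) ^ 16) ^ 2 ≤ C ^ 2 * 2 ^ 32 * (1 + ‖c‖ₑ) ^ 32 := by
  have h : 1 + 2 * ‖c‖ₑ ≤ 2 * (1 + ‖c‖ₑ) := by
    rw [mul_add, mul_one]
    gcongr
    norm_num
  calc _ ≤ (C * (2 * (1 + ‖c‖ₑ)) ^ 16) ^ 2 := by gcongr
    _ = _ := by ring

theorem sum_lintegral_le_of_plates {N : ℝ} (hN : 0 < N) {X Y : Set ℂ} (hX : MeasurableSet X) (hY : MeasurableSet Y)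
    (hXY : ∀ c ∈ X, Metric.ball c (1 / N) ⊆ Y) {ι : Type} [Fintype ι]
    {G : ι → ℂ × ℂ × ℂ → ℝ≥0∞} {W : ℂ × ℂ × ℂ → ℝ≥0∞} (hG : ∀ i, Measurable (G i)) (hW : Measurable W) {g : ℂ → ℂ → ℝ≥0∞}
    (hg : Measurable fun p : ℂ × ℂ => g p.1 p.2)
    (h : ∀ c0 ∈ Y, ∀ q, ∑ i, ∫⁻ z, ENNReal.ofReal (Th N c0 q z) * G i z ≤
      ∫⁻ z, ENNReal.ofReal (Th N c0 q z) * (g c0 z.1 * W z))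
    {w : ℂ → ℝ≥0∞} (hA : ∀ c, ENNReal.ofReal N ^ 2 * ∫⁻ c0 in Y, ENNReal.ofReal (th (N * (c - c0))) * g c0 c ≤ w c) :
    (∫⁻ a in Metric.ball 0 1, ENNReal.ofReal (th a)) * ∑ i, ∫⁻ z in X ×ˢ Set.univ, G i z ≤
      ∫⁻ z, w z.1 * W z := by
  have mF : Measurable fun z => ∑ i, G i z := Finset.measurable_fun_sum _ fun i _ => hG i
  have key := lintegral_le_of_plates hN hX hXY mF hW hg (fun c0 hc0 q => by
    have mT : Measurable fun z : ℂ × ℂ × ℂ => ENNReal.ofReal (Th N c0 q z) :=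
      (measurable_ofReal_Th N).comp (f := fun z : ℂ × ℂ × ℂ => (z, c0, q)) (by fun_prop)
    have mTG : ∀ i ∈ Finset.univ, Measurable fun z => ENNReal.ofReal (Th N c0 q z) * G i z :=
      fun i _ => mT.mul (hG i)
    simp only [Finset.mul_sum]
    rw [lintegral_finsetSum _ mTG]
    exact h c0 hc0 q) hY hA
  rwa [lintegral_finsetSum _ fun i _ => hG i] at key

theorem sum_lintegral_le_of_fan {N : ℝ} (hN : 0 < N) {X Y : Set ℂ} (hX : MeasurableSet X) (hY : MeasurableSet Y)
    (hXY : ∀ c ∈ X, Metric.ball c (1 / N) ⊆ Y) {S₁ S₂ : Finset ((ℤ × ℤ) × (ℤ × ℤ))} {ι : Type} [Fintype ι]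
    {k : (ℤ × ℤ) × (ℤ × ℤ) → ℂ × ℂ → ℂ} {l : ι → (ℤ × ℤ) × (ℤ × ℤ) → ℂ × ℂ → ℂ}
    (hk : ∀ ξ, Integrable (k ξ)) (hl : ∀ i η, Integrable (l i η))
    (hks : ∀ ξ w, k ξ w ≠ 0 → ‖w - g2 ξ‖ ≤ 2) (hls : ∀ i η w, l i η w ≠ 0 → ‖w - g2 η‖ ≤ 2)
    {α β : (ℤ × ℤ) × (ℤ × ℤ) → ℂ → ℂ × ℂ → ℝ≥0∞} {μ : ℂ → ℂ × ℂ → ℝ≥0∞} {A B w : ℂ → ℝ≥0∞} {Q g : ℂ → ℂ → ℝ≥0∞} {D : ℝ≥0∞}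
    (hα : ∀ ξ, Measurable fun z : ℂ × ℂ × ℂ => α ξ z.1 z.2) (hμ : Measurable fun z : ℂ × ℂ × ℂ => μ z.1 z.2)
    (hg : Measurable fun p : ℂ × ℂ => g p.1 p.2)
    (hφ : ∀ ξ ∈ S₁, ∀ c y, ‖EE (k ξ) c y‖ₑ ^ 2 ≤ A c * (α ξ c y * β ξ c y))
    (hfan : open Classical in ∀ c0 ∈ Y, ∀ c y, ∀ ξ ∈ S₁, ∀ η' ∈ S₂,
      ∑ ξ' ∈ S₁.filter (fun ξ' => ∃ η ∈ S₂, Bal N (ξ, η) (ξ', η')), β ξ' c y ≤ Q c0 c)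
    (hψ : ∀ c y, ∑ i, ∑ η ∈ S₂, ‖EE (l i η) c y‖ₑ ^ 2 ≤ B c * μ c y)
    (hQ : ∀ c0 c, 2 * (cgi 11 * cgi 11) * A c * Q c0 c * B c ≤ D * g c0 c)
    (hA : ∀ c, ENNReal.ofReal N ^ 2 * ∫⁻ c0 in Y, ENNReal.ofReal (th (N * (c - c0))) * g c0 c ≤ w c) :
    (∫⁻ a in Metric.ball 0 1, ENNReal.ofReal (th a)) *
      ∑ i, ∫⁻ z in X ×ˢ Set.univ, ‖(∑ ξ ∈ S₁, EE (k ξ) z.1 z.2) * ∑ η ∈ S₂, EE (l i η) z.1 z.2‖ₑ ^ 2 ≤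
      ∫⁻ z : ℂ × ℂ × ℂ, w z.1 * (D * ((∑ ξ ∈ S₁, α ξ z.1 z.2) * μ z.1 z.2)) := by
  have mG : ∀ i, Measurable fun z : ℂ × ℂ × ℂ =>
      ‖(∑ ξ ∈ S₁, EE (k ξ) z.1 z.2) * ∑ η ∈ S₂, EE (l i η) z.1 z.2‖ₑ ^ 2 := fun i =>
    (((continuous_finsetSum _ fun ξ _ => continuous_EE_comp (hk ξ)).mul
      (continuous_finsetSum _ fun η _ => continuous_EE_comp (hl i η))).enorm.measurable).pow_const 2
  have mW : Measurable fun z : ℂ × ℂ × ℂ => D * ((∑ ξ ∈ S₁, α ξ z.1 z.2) * μ z.1 z.2) :=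
    ((Finset.measurable_fun_sum _ fun ξ _ => hα ξ).mul hμ).const_mul _
  refine sum_lintegral_le_of_plates hN hX hY hXY mG mW hg (fun c0 hc0 x => ?_) hA
  refine (plate_le hN hk hl hks hls hφ (hfan c0 hc0) hψ c0 x).trans (lintegral_mono fun z => mul_le_mul' le_rfl ?_)
  exact (mul_le_mul' (hQ c0 z.1) le_rfl).trans (le_of_eq (by rw [mul_comm D, mul_assoc]))

theorem off_weight_le (u v x E₁ E₂ Cs q : ℝ≥0∞) (hE₁ : u ≤ E₁ * x ^ 32) (hE₂ : v ≤ E₂ * x ^ 32) (t : ℝ≥0∞) :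
    Cs * u * (q * (t * x ^ 8)) * (v * wbI ^ 2) ≤ Cs * E₁ * (E₂ * wbI ^ 2) * q * (t * x ^ 72) := by
  calc _ ≤ Cs * (E₁ * x ^ 32) * (q * (t * x ^ 8)) * ((E₂ * x ^ 32) * wbI ^ 2) := by gcongr
    _ = _ := by
      have : x ^ 72 = x ^ 32 * x ^ 32 * x ^ 8 := by rw [← pow_add, ← pow_add]
      rw [this]
      generalize x ^ 32 = x1
      generalize x ^ 8 = x2
      generalize wbI ^ 2 = W
      ring

set_option maxHeartbeats 1000000 in
theorem exists_off_bound {κ₀ : ℝ} (hκ₀ : 0 < κ₀) {C₁ C₂ : ℝ≥0∞} (hC₁ : C₁ ≠ ∞) (hC₂ : C₂ ≠ ∞) (R : ℝ) :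
    ∃ C : ℝ≥0∞, C ≠ ∞ ∧ ∀ {N κ : ℝ}, 1 ≤ N → 16 ≤ κ₀ * N →
    0 < κ → 2 ≤ κ * N → ∀ {S₁ S₂ : Finset ((ℤ × ℤ) × (ℤ × ℤ))}, (∀ ξ ∈ S₁, ‖g2 ξ‖ ≤ N + 2) →
    (∀ η ∈ S₂, ‖g2 η‖ ≤ N + 2) →
    (∀ ξ ∈ S₁, ∀ η ∈ S₂, κ₀ * N - 4 ≤ ‖(g2 η - g2 ξ).1‖ ∧ κ₀ * N - 4 ≤ ‖(g2 η - g2 ξ).2‖) →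
    (∀ η ∈ S₂, ∀ η' ∈ S₂, ‖g2 η - g2 η'‖ ≤ κ₀ * N / 16 + 4) →
    ∀ {H : (ℤ × ℤ) × (ℤ × ℤ) → ℂ × ℂ → ℝ≥0∞}, (∀ η, Measurable (H η)) →
    ∀ {P X : Set ℂ}, MeasurableSet P → MeasurableSet X → (∀ c ∈ X, ‖c‖ ≤ R) →
    (∀ c ∈ X, ∀ c' ∈ P, κ ≤ ‖c' - c‖) →
    ∀ {ι : Type} [Fintype ι] {k : (ℤ × ℤ) × (ℤ × ℤ) → ℂ × ℂ → ℂ} {l : ι → (ℤ × ℤ) × (ℤ × ℤ) → ℂ × ℂ → ℂ},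
    (∀ ξ, Integrable (k ξ)) → (∀ i η, Integrable (l i η)) →
    (∀ ξ w, k ξ w ≠ 0 → ‖w - g2 ξ‖ ≤ 2) → (∀ i η w, l i η w ≠ 0 → ‖w - g2 η‖ ≤ 2) →
    ∀ {α : (ℤ × ℤ) × (ℤ × ℤ) → ℂ → ℂ × ℂ → ℝ≥0∞}, (∀ ξ, Measurable fun z : ℂ × ℂ × ℂ => α ξ z.1 z.2) →
    ∀ {μ : ℂ → ℂ × ℂ → ℝ≥0∞}, (μ = fun c y => ∑ η ∈ S₂, muD (g2 η) (H η) c y) →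
    (∀ ξ ∈ S₁, ∀ c y, ‖EE (k ξ) c y‖ₑ ^ 2 ≤ (C₁ * (1 + 2 * ‖c‖ₑ) ^ 16) ^ 2 *
      (α ξ c y * ∫⁻ x, mB P μ (g2 ξ) x * KK (g2 ξ) c (y - x))) →
    (∀ c y, ∑ i, ∑ η ∈ S₂, ‖EE (l i η) c y‖ₑ ^ 2 ≤ ((C₂ * (1 + 2 * ‖c‖ₑ) ^ 16) ^ 2 * wbI ^ 2) * μ c y) →
    ∑ i, ∫⁻ z in X ×ˢ Set.univ, ‖(∑ ξ ∈ S₁, EE (k ξ) z.1 z.2) * ∑ η ∈ S₂, EE (l i η) z.1 z.2‖ₑ ^ 2 ≤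
      C * ((ENNReal.ofReal κ)⁻¹ ^ 2 * (ENNReal.ofReal N)⁻¹ ^ 2) * (∑ η ∈ S₂, ∫⁻ x, H η x) *
        ∑ ξ ∈ S₁, ∫⁻ z : ℂ × ℂ × ℂ, om z.1 * μ z.1 z.2 * α ξ z.1 z.2 := by
  classical
  obtain ⟨Cf, hCf, fan⟩ := exists_fan_bal_le hκ₀
  obtain ⟨Cw, hCw, wt⟩ := exists_plate_weight_le 72 (ENNReal.ofReal (R + 1)) ENNReal.ofReal_ne_top
  have t00 : (∫⁻ a in Metric.ball 0 1, ENNReal.ofReal (th a)) ≠ 0 := lintegral_th_ball_ne_zero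
  have t0t : (∫⁻ a in Metric.ball 0 1, ENNReal.ofReal (th a)) ≠ ∞ :=
    ne_top_of_le_ne_top thI_ne_top (setLIntegral_le_lintegral _ _)
  have key0 := @sum_lintegral_le_of_fan
  generalize (∫⁻ a in Metric.ball 0 1, ENNReal.ofReal (th a)) = t0 at t00 t0t key0
  refine ⟨t0⁻¹ * (Cw * (2 * (cgi 11 * cgi 11) * (C₁ ^ 2 * 2 ^ 32) * (C₂ ^ 2 * 2 ^ 32 * wbI ^ 2) * Cf)), ?_, ?_⟩
  · have := wbI_lt_top.ne
    have := cgi_ne_top 11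
    exact ENNReal.mul_ne_top (ENNReal.inv_ne_top.2 t00) (by finiteness)
  intro N κ hN hκN hκ hκN2 S₁ S₂ h1 h2 hsep hdiam H hH P X hP hX hXR hXP ι _ k l hk hl hks hls α hα μ hμ hφ hψ
  have hN0 : (0 : ℝ) < N := by linarith
  have hNκ : 1 / N ≤ κ / 2 := by rw [div_le_iff₀ hN0]; linarith
  have hμm : Measurable fun z : ℂ × ℂ × ℂ => μ z.1 z.2 := by
    rw [hμ]; exact Finset.measurable_fun_sum _ fun η _ => measurable_muD _ (hH η)
  have hYR : ∀ c ∈ Metric.thickening (1 / N) X, ‖c‖ₑ ≤ ENNReal.ofReal (R + 1) := by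
    intro c hc
    obtain ⟨c1, hc1, hd⟩ := Metric.mem_thickening_iff.1 hc
    rw [← ofReal_norm]
    refine ENNReal.ofReal_le_ofReal ?_
    have h3 : 1 / N ≤ 1 := by rw [div_le_iff₀ hN0]; linarith
    have h4 := norm_add_le (c - c1) c1
    rw [sub_add_cancel, ← dist_eq_norm] at h4
    linarith [hXR c1 hc1]
  have hYm : MeasurableSet (Metric.thickening (1 / N) X) := Metric.isOpen_thickening.measurableSet
  have key := key0 hN0 hX hYm (fun c hc => Metric.ball_subset_thickening hc _) hk hl hks hls
    hα hμm (g := fun c0 c => (1 + ENNReal.ofReal N * ‖c - c0‖ₑ) ^ 2 * (1 + ‖c‖ₑ) ^ 72)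
    (Q := fun c0 c => (Cf * ((ENNReal.ofReal κ)⁻¹ ^ 2 * (ENNReal.ofReal N)⁻¹ ^ 2) * ∑ η ∈ S₂, ∫⁻ x, H η x) *
      ((1 + ENNReal.ofReal N * ‖c - c0‖ₑ) ^ 2 * (1 + ‖c‖ₑ) ^ 8))
    (by fun_prop) hφ
    (fun c0 hc0 c y ξ hξ η' hη' => by
      obtain ⟨c1, hc1, hd⟩ := Metric.mem_thickening_iff.1 hc0
      have hP0 : ∀ c ∈ P, κ ≤ 2 * ‖c - c0‖ := by
        intro c hc
        have h3 := hXP c1 hc1 c hc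
        have h4 := norm_add_le (c - c0) (c0 - c1)
        rw [sub_add_sub_cancel, ← dist_eq_norm c0] at h4
        linarith
      have := fan (N := N) (κ := κ) hN hκN hκ h1 h2 hsep hdiam hH hP hP0 c y ξ hξ η' hη'
      rw [← hμ] at this
      refine this.trans (le_of_eq ?_)
      ring) hψ (fun c0 c => off_weight_le _ _ _ _ _ _ _ (sq_mul_one_add_le C₁ c) (sq_mul_one_add_le C₂ c) _) (fun c => wt hN hYm hYR c)
  generalize (∑ η ∈ S₂, ∫⁻ x, H η x) = h at key ⊢
  generalize (ENNReal.ofReal κ)⁻¹ ^ 2 * (ENNReal.ofReal N)⁻¹ ^ 2 = κN at key ⊢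
  generalize 2 * (cgi 11 * cgi 11) * (C₁ ^ 2 * 2 ^ 32) * (C₂ ^ 2 * 2 ^ 32 * wbI ^ 2) = Cs at key ⊢
  have e2 : ∫⁻ z : ℂ × ℂ × ℂ, Cw * om z.1 * (Cs * (Cf * κN * h) * ((∑ ξ ∈ S₁, α ξ z.1 z.2) * μ z.1 z.2)) =
      Cw * (Cs * (Cf * κN * h)) * ∑ ξ ∈ S₁, ∫⁻ z : ℂ × ℂ × ℂ, om z.1 * μ z.1 z.2 * α ξ z.1 z.2 := by
    have mo : Measurable fun z : ℂ × ℂ × ℂ => om z.1 * μ z.1 z.2 :=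
      Measurable.mul ((measurable_wb.pow_const 8).comp measurable_fst) hμm
    have ms : ∀ ξ ∈ S₁, Measurable fun z : ℂ × ℂ × ℂ => om z.1 * μ z.1 z.2 * α ξ z.1 z.2 :=
      fun ξ _ => mo.mul (hα ξ)
    rw [← lintegral_finsetSum _ ms, ← lintegral_const_mul _ (Finset.measurable_fun_sum _ ms)]
    refine lintegral_congr fun z => ?_
    simp only [← Finset.mul_sum]
    ring
  rw [e2] at key
  generalize (∑ ξ ∈ S₁, ∫⁻ z : ℂ × ℂ × ℂ, om z.1 * μ z.1 z.2 * α ξ z.1 z.2) = U at key ⊢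
  have key2 := mul_le_mul' (le_refl t0⁻¹) key
  rw [← mul_assoc, ENNReal.inv_mul_cancel t00 t0t, one_mul] at key2
  exact key2.trans (le_of_eq (by ring))

theorem enorm_sum_gb_mul_sq_le (S : Finset ((ℤ × ℤ) × (ℤ × ℤ))) (G : (ℤ × ℤ) × (ℤ × ℤ) → ℂ) (w : ℂ × ℂ) :
    ‖∑ ξ ∈ S, gb (g2 ξ) w * G ξ‖ₑ ^ 2 ≤ ∑ ξ ∈ S, ‖G ξ‖ₑ ^ 2 := by
  have h1 : ‖∑ ξ ∈ S, gb (g2 ξ) w * G ξ‖ₑ ≤ ∑ ξ ∈ S, ‖gb (g2 ξ) w‖ₑ * ‖G ξ‖ₑ :=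
    (enorm_sum_le _ _).trans (by simp only [enorm_mul]; exact le_rfl)
  have h2 := ENNReal.inner_le_Lp_mul_Lq S (fun ξ => ‖gb (g2 ξ) w‖ₑ) (fun ξ => ‖G ξ‖ₑ) Real.HolderConjugate.two_two
  simp only [ENNReal.rpow_two] at h2
  have hs : ∀ x : ℝ≥0∞, (x ^ (1 / 2 : ℝ)) ^ 2 = x := fun x => by
    rw [← ENNReal.rpow_two, ← ENNReal.rpow_mul]; norm_num
  calc _ ≤ ((∑ ξ ∈ S, ‖gb (g2 ξ) w‖ₑ ^ 2) ^ (1 / 2 : ℝ) * (∑ ξ ∈ S, ‖G ξ‖ₑ ^ 2) ^ (1 / 2 : ℝ)) ^ 2 := by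
        gcongr; exact h1.trans h2
    _ = (∑ ξ ∈ S, ‖gb (g2 ξ) w‖ₑ ^ 2) * ∑ ξ ∈ S, ‖G ξ‖ₑ ^ 2 := by rw [mul_pow, hs, hs]
    _ ≤ 1 * ∑ ξ ∈ S, ‖G ξ‖ₑ ^ 2 := by gcongr; exact sum_enorm_gb_sq_le S w
    _ = _ := one_mul _

theorem sum_gb_mul_gb_mul {S : Finset ((ℤ × ℤ) × (ℤ × ℤ))} {D : Set (ℂ × ℂ)}
    (hS : ∀ w ∈ D, ∑ ξ ∈ S, gb (g2 ξ) w ^ 2 = 1) {f : ℂ × ℂ → ℂ} (hf : Function.support f ⊆ D) (w : ℂ × ℂ) :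
    ∑ ξ ∈ S, gb (g2 ξ) w * (gb (g2 ξ) w * f w) = f w := by
  by_cases hw : f w = 0
  · simp [hw]
  · have := hS w (hf hw)
    calc _ = (∑ ξ ∈ S, gb (g2 ξ) w ^ 2) * f w := by
          rw [Finset.sum_mul]; exact Finset.sum_congr rfl fun _ _ => by ring
      _ = _ := by rw [this, one_mul]

theorem lintegral_muD_slice_le (η : ℂ × ℂ) {H : ℂ × ℂ → ℝ≥0∞} (hH : Measurable H) (c : ℂ) :
    ∫⁻ y, muD η H c y ≤ wbI ^ 2 * ∫⁻ x, H x := by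
  unfold muD
  rw [lintegral_lintegral_swap (f := fun y x => H x * KK η c (y - x)) (by fun_prop), ← lintegral_const_mul _ hH]
  refine lintegral_mono fun x => ?_
  rw [lintegral_const_mul _ (by fun_prop), mul_comm]
  exact mul_le_mul' (lintegral_KK_left η c x) le_rfl

theorem muD_ne_zero {η : ℂ × ℂ} {H : ℂ × ℂ → ℝ≥0∞} (hH : Measurable H) (h : ∫⁻ x, H x ≠ 0) (c : ℂ) (y : ℂ × ℂ) :
    muD η H c y ≠ 0 := by
  intro h0
  apply h
  rw [muD, lintegral_eq_zero_iff (by fun_prop)] at h0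
  rw [lintegral_eq_zero_iff hH]
  filter_upwards [h0] with x hx
  simpa [KK_ne_zero] using hx

theorem muD_eq_zero {η : ℂ × ℂ} {H : ℂ × ℂ → ℝ≥0∞} (hH : Measurable H) (h : ∫⁻ x, H x = 0) (c : ℂ) (y : ℂ × ℂ) :
    muD η H c y = 0 := by
  rw [lintegral_eq_zero_iff hH] at h
  rw [muD, lintegral_eq_zero_iff (by fun_prop)]
  filter_upwards [h] with x hx
  simp only [Pi.zero_apply] at hx
  simp [hx]

/-- Decomposition of `f` along a partition of time, adapted to a density `μ`. -/
theorem exists_time_split : ∃ C : ℝ≥0∞, C ≠ ∞ ∧ ∀ {β : Type} [Fintype β] {f : ℂ × ℂ → ℂ}, MemLp f 2 →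
    ∀ {S : Finset ((ℤ × ℤ) × (ℤ × ℤ))} {D : Set (ℂ × ℂ)}, (∀ w ∈ D, ∑ ξ ∈ S, gb (g2 ξ) w ^ 2 = 1) →
    Function.support f ⊆ D → ∀ {P : β → Set ℂ}, (∀ B, MeasurableSet (P B)) →
    (Pairwise fun B B' => Disjoint (P B) (P B')) → ⋃ B, P B = Set.univ →
    ∀ {μ : ℂ → ℂ × ℂ → ℝ≥0∞}, (Measurable fun z : ℂ × ℂ × ℂ => μ z.1 z.2) → (∀ c y, μ c y ≠ 0) →
    ∀ {A : ℝ≥0∞}, A ≠ ∞ → (∀ c, ∫⁻ y, μ c y ≤ A) →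
    ∃ F : (ℤ × ℤ) × (ℤ × ℤ) → β → ℂ × ℂ → ℂ, (∀ ξ B, MemLp (F ξ B) 2) ∧
      ((fun w => ∑ B, ∑ ξ ∈ S, gb (g2 ξ) w * F ξ B w) =ᵐ[volume] f) ∧
      ∑ B, ∫⁻ w, ‖∑ ξ ∈ S, gb (g2 ξ) w * F ξ B w‖ₑ ^ 2 ≤ ∫⁻ w, ‖f w‖ₑ ^ 2 ∧
      ∃ α : (ℤ × ℤ) × (ℤ × ℤ) → ℂ → ℂ × ℂ → ℝ≥0∞, (∀ ξ, Measurable fun z : ℂ × ℂ × ℂ => α ξ z.1 z.2) ∧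
        (∀ ξ B c y, ‖EE (fun w => gb (g2 ξ) w * F ξ B w) c y‖ₑ ^ 2 ≤ (C * (1 + 2 * ‖c‖ₑ) ^ 16) ^ 2 *
          (α ξ c y * ∫⁻ x, mB (P B) μ (g2 ξ) x * KK (g2 ξ) c (y - x))) ∧
        ∑ ξ ∈ S, ∫⁻ z : ℂ × ℂ × ℂ, om z.1 * μ z.1 z.2 * α ξ z.1 z.2 ≤ ∫⁻ w, ‖f w‖ₑ ^ 2 := by
  obtain ⟨C, hC, hp⟩ := exists_packets
  refine ⟨C, hC, fun {β} _ {f} hf {S D} hS hfD {P} hP hd hu {μ} hμ h0 {A} hA hμA => ?_⟩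
  have m0 : ∀ ξ x, mB Set.univ μ ξ x ≠ 0 := mB_univ_ne_zero hμ h0
  have mt : ∀ ξ x, mB Set.univ μ ξ x ≠ ∞ := mB_univ_ne_top hA hμA
  have hp' := fun ξ => hp hf (m := mB Set.univ μ (g2 ξ)) (m' := fun B => mB (P B) μ (g2 ξ))
    (fun B => measurable_mB (P B) hμ (g2 ξ)) (fun x => sum_mB hP hd hu μ (g2 ξ) x) (m0 _) (mt _) (g2 ξ)
  choose F hF1 hF2 hF3 hF4 using hp'
  have hmF : ∀ ξ B, AEMeasurable fun w => ‖F ξ B w‖ₑ ^ 2 := fun ξ B => (hF1 ξ B).1.enorm.pow_const 2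
  have hV : ∀ ξ, Measurable fun x => ‖FT (fun w => gb (g2 ξ) w * f w) x‖ₑ ^ 2 := fun ξ =>
    (continuous_FT (integrable_gb_mul hf (g2 ξ))).measurable.enorm.pow_const 2
  refine ⟨F, hF1, ?_, ?_, fun ξ => muD (g2 ξ) (fun x => ‖FT (fun w => gb (g2 ξ) w * f w) x‖ₑ ^ 2 *
    (mB Set.univ μ (g2 ξ) x)⁻¹), ?_, hF4, ?_⟩
  · have : ∀ᵐ w, ∀ ξ : (ℤ × ℤ) × (ℤ × ℤ), ∑ B, F ξ B w = gb (g2 ξ) w * f w := ae_all_iff.2 hF2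
    filter_upwards [this] with w hw
    rw [Finset.sum_comm]
    simp only [← Finset.mul_sum, hw]
    exact sum_gb_mul_gb_mul hS hfD w
  · calc _ ≤ ∑ B, ∫⁻ w, ∑ ξ ∈ S, ‖F ξ B w‖ₑ ^ 2 :=
          Finset.sum_le_sum fun B _ => lintegral_mono fun w => enorm_sum_gb_mul_sq_le S (fun ξ => F ξ B w) w
      _ = ∑ ξ ∈ S, ∑ B, ∫⁻ w, ‖F ξ B w‖ₑ ^ 2 := by
          rw [Finset.sum_comm]
          exact Finset.sum_congr rfl fun B _ => lintegral_finsetSum' _ fun ξ _ => hmF ξ B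
      _ ≤ ∑ ξ ∈ S, ∫⁻ w, ‖gb (g2 ξ) w * f w‖ₑ ^ 2 := Finset.sum_le_sum fun ξ _ => hF3 ξ
      _ ≤ _ := sum_lintegral_gb_mul_le S hf
  · exact fun ξ => measurable_muD _ ((hV ξ).mul (measurable_mB _ hμ _).inv)
  · refine le_trans (Finset.sum_le_sum fun ξ _ => ?_) (sum_lintegral_gb_mul_le S hf)
    rw [← FT_lintegral_sq (memLp_mul_gb hf _) (integrable_gb_mul hf _)]
    exact (lintegral_om_mul_eq hμ (m0 _) (mt _) (hV ξ)).le

theorem EE_eq_sum {S : Finset ((ℤ × ℤ) × (ℤ × ℤ))} {D : Set (ℂ × ℂ)}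
    (hS : ∀ w ∈ D, ∑ ξ ∈ S, gb (g2 ξ) w ^ 2 = 1) {f : ℂ × ℂ → ℂ} (h2 : MemLp f 2) (hf : Function.support f ⊆ D)
    (c : ℂ) (y : ℂ × ℂ) :
    EE f c y = ∑ ξ ∈ S, EE (fun w => gb (g2 ξ) w * (gb (g2 ξ) w * f w)) c y := by
  rw [← EE_sum S (fun ξ _ => integrable_gb_mul (memLp_mul_gb h2 _) _)]
  congr 1
  exact funext fun w => (sum_gb_mul_gb_mul hS hf w).symm

theorem sub_le_norm_sub {p p' x x' : ℂ} {d : ℝ} (h : d ≤ ‖p' - p‖) (h1 : ‖p - x‖ ≤ 2) (h2 : ‖p' - x'‖ ≤ 2) :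
    d - 4 ≤ ‖x' - x‖ := by
  have h3 := norm_sub_le (p' - x') (p - x)
  have h4 := norm_add_le (p' - x' - (p - x)) (x' - x)
  rw [show p' - x' - (p - x) + (x' - x) = p' - p by ring] at h4
  linarith

/-- Off-diagonal estimate for a decomposition adapted to a partition of time. -/
theorem exists_off {κ₀ : ℝ} (hκ₀ : 0 < κ₀) (R : ℝ) : ∃ C : ℝ≥0∞, C ≠ ∞ ∧ ∀ {N κ : ℝ}, 1 ≤ N → 16 ≤ κ₀ * N →
    0 < κ → 2 ≤ κ * N → ∀ {D₁ D₂ : Set (ℂ × ℂ)}, (∀ p ∈ D₁, ‖p‖ ≤ N) → (∀ p ∈ D₂, ‖p‖ ≤ N) →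
    (∀ p ∈ D₁, ∀ p' ∈ D₂, κ₀ * N ≤ ‖(p' - p).1‖ ∧ κ₀ * N ≤ ‖(p' - p).2‖) →
    (∀ p ∈ D₂, ∀ p' ∈ D₂, ‖p - p'‖ ≤ κ₀ * N / 16) →
    ∀ {β : Type} [Fintype β] {P X : β → Set ℂ}, (∀ B, MeasurableSet (P B)) → (∀ B, MeasurableSet (X B)) →
    (Pairwise fun B B' => Disjoint (P B) (P B')) → ⋃ B, P B = Set.univ → (∀ B, ∀ c ∈ X B, ‖c‖ ≤ R) →
    (∀ B B', B' ≠ B → ∀ c ∈ X B, ∀ c' ∈ P B', κ ≤ ‖c' - c‖) →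
    ∀ {f : ℂ × ℂ → ℂ} {ι : Type} [Fintype ι] {h : ι → ℂ × ℂ → ℂ}, MemLp f 2 → Function.support f ⊆ D₁ →
    (∀ i, MemLp (h i) 2) → (∀ i, Function.support (h i) ⊆ D₂) →
    ∃ fB : β → ℂ × ℂ → ℂ, (∀ B, MemLp (fB B) 2) ∧ (∀ B w, fB B w ≠ 0 → ∃ p ∈ D₁, ‖p - w‖ ≤ 4) ∧
      ((fun w => ∑ B, fB B w) =ᵐ[volume] f) ∧ ∑ B, ∫⁻ w, ‖fB B w‖ₑ ^ 2 ≤ ∫⁻ w, ‖f w‖ₑ ^ 2 ∧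
      ∀ B B', B' ≠ B → ∑ i, ∫⁻ z in X B ×ˢ Set.univ, ‖EE (fB B') z.1 z.2 * EE (h i) z.1 z.2‖ₑ ^ 2 ≤
        C * ((ENNReal.ofReal κ)⁻¹ ^ 2 * (ENNReal.ofReal N)⁻¹ ^ 2) * (∫⁻ w, ‖f w‖ₑ ^ 2) *
          ∑ i, ∫⁻ w, ‖h i w‖ₑ ^ 2 := by
  classical
  obtain ⟨C₁, hC₁, split⟩ := exists_time_split
  obtain ⟨C₂, hC₂, dual⟩ := exists_dual_density
  obtain ⟨C, hC, bound⟩ := exists_off_bound hκ₀ hC₁ hC₂ R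
  refine ⟨C, hC, ?_⟩
  intro N κ hN hκN hκ hκN2 D₁ D₂ hD₁ hD₂ hsep hdiam β _ P X hP hX hd hu hXR hXP f ι _ h hf hfD hh hhD
  have bdd : ∀ {D : Set (ℂ × ℂ)}, (∀ p ∈ D, ‖p‖ ≤ N) → Bornology.IsBounded D := fun hD =>
    isBounded_iff_forall_norm_le.2 ⟨N, hD⟩
  obtain ⟨S₁, hS₁, hS₁'⟩ := exists_gb_cover (bdd hD₁)
  obtain ⟨S₂, hS₂, hS₂'⟩ := exists_gb_cover (bdd hD₂)
  obtain ⟨H, hH, hHle, hψ⟩ := dual hh S₂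
  have hEEh := fun i => EE_eq_sum hS₂' (hh i) (hhD i)
  obtain ⟨μ, hμ⟩ : ∃ μ, μ = fun c y => ∑ η ∈ S₂, muD (g2 η) (H η) c y := ⟨_, rfl⟩
  have hψ' : ∀ c y, ∑ i, ∑ η ∈ S₂, ‖EE (fun w => gb (g2 η) w * (gb (g2 η) w * h i w)) c y‖ₑ ^ 2 ≤
      (C₂ * (1 + 2 * ‖c‖ₑ) ^ 16) ^ 2 * wbI ^ 2 * μ c y := by rw [hμ]; exact hψ
  by_cases hz : ∀ η ∈ S₂, ∫⁻ x, H η x = 0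
  · obtain ⟨B0, -⟩ : ∃ B, (0 : ℂ) ∈ P B := by
      have : (0 : ℂ) ∈ ⋃ B, P B := hu ▸ Set.mem_univ _
      simpa using this
    refine ⟨Pi.single B0 f, fun B => ?_, fun B w hw => ?_, ?_, ?_, fun B B' _ => ?_⟩
    · rcases eq_or_ne B B0 with rfl | hB
      · simpa using hf
      · rw [Pi.single_eq_of_ne hB]; exact MemLp.zero
    · rcases eq_or_ne B B0 with rfl | hB
      · exact ⟨w, hfD (by simpa using hw), by simp⟩
      · simp [Pi.single_eq_of_ne hB] at hw
    · refine Filter.Eventually.of_forall fun w => ?_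
      simp only []
      rw [Finset.sum_eq_single B0 (fun B _ hB => by simp [Pi.single_eq_of_ne hB]) (by simp)]
      simp
    · rw [Finset.sum_eq_single B0 (fun B _ hB => by simp [Pi.single_eq_of_ne hB]) (by simp)]
      simp
    · have h0 : ∀ i c y, EE (h i) c y = 0 := by
        intro i c y
        have hμ0 : μ c y = 0 := by
          rw [hμ]; exact Finset.sum_eq_zero fun η hη => muD_eq_zero (hH η) (hz η hη) c y
        have := hψ' c y
        rw [hμ0, mul_zero, nonpos_iff_eq_zero, Finset.sum_eq_zero_iff] at this
        have := this i (Finset.mem_univ i)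
        rw [Finset.sum_eq_zero_iff] at this
        rw [hEEh]
        exact Finset.sum_eq_zero fun η hη => by simpa using this η hη
      simp [h0]
  · push Not at hz
    obtain ⟨η0, hη0, hη0'⟩ := hz
    have hμm : Measurable fun z : ℂ × ℂ × ℂ => μ z.1 z.2 := by
      rw [hμ]; exact Finset.measurable_fun_sum _ fun η _ => measurable_muD _ (hH η)
    have hμ0 : ∀ c y, μ c y ≠ 0 := fun c y h0 => by
      rw [hμ] at h0
      exact muD_ne_zero (hH η0) hη0' c y (Finset.sum_eq_zero_iff.1 h0 η0 hη0)
    have hhfin : ∑ i, ∫⁻ w, ‖h i w‖ₑ ^ 2 ≠ ∞ := ENNReal.sum_ne_top.2 fun i _ => by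
      have := (hh i).2
      rw [eLpNorm_lt_top_iff_lintegral_rpow_enorm_lt_top (by norm_num) (by norm_num)] at this
      simpa using this.ne
    have hμA : ∀ c, ∫⁻ y, μ c y ≤ wbI ^ 2 * ∑ η ∈ S₂, ∫⁻ x, H η x := fun c => by
      rw [hμ, lintegral_finsetSum _ fun η _ => measurable_slice (k := muD (g2 η) (H η)) (measurable_muD _ (hH η)) c,
        Finset.mul_sum]
      exact Finset.sum_le_sum fun η _ => lintegral_muD_slice_le _ (hH η) c
    have hA : wbI ^ 2 * ∑ η ∈ S₂, ∫⁻ x, H η x ≠ ∞ :=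
      ENNReal.mul_ne_top (ENNReal.pow_ne_top wbI_lt_top.ne) (ne_top_of_le_ne_top hhfin hHle)
    obtain ⟨F, hF, hFsum, hFle, α, hα, hφ, hα2⟩ := split hf hS₁' hfD hP hd hu hμm hμ0 hA hμA
    refine ⟨fun B w => ∑ ξ ∈ S₁, gb (g2 ξ) w * F ξ B w,
      fun B => memLp_finsetSum _ fun ξ _ => memLp_mul_gb (hF ξ B) _, fun B w hw => ?_, hFsum, hFle,
      fun B B' hBB => ?_⟩
    · obtain ⟨ξ, hξ, hne⟩ := Finset.exists_ne_zero_of_sum_ne_zero hw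
      obtain ⟨p, hp, hp2⟩ := hS₁ ξ hξ
      refine ⟨p, hp, ?_⟩
      have h1 := norm_le_of_gb_ne_zero (left_ne_zero_of_mul hne)
      have h2 := norm_sub_le (p - g2 ξ) (w - g2 ξ)
      rw [sub_sub_sub_cancel_right] at h2
      linarith
    · have nrm : ∀ {D : Set (ℂ × ℂ)} {S : Finset ((ℤ × ℤ) × (ℤ × ℤ))}, (∀ p ∈ D, ‖p‖ ≤ N) →
          (∀ ξ ∈ S, ∃ p ∈ D, ‖p - g2 ξ‖ ≤ 2) → ∀ ξ ∈ S, ‖g2 ξ‖ ≤ N + 2 := by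
        intro D S hD hS ξ hξ
        obtain ⟨p, hp, hp2⟩ := hS ξ hξ
        have h2 := norm_sub_le p (p - g2 ξ)
        rw [_root_.sub_sub_cancel] at h2
        linarith [hD p hp]
      have key := bound (N := N) (κ := κ) hN hκN hκ hκN2 (nrm hD₁ hS₁) (nrm hD₂ hS₂) (fun ξ hξ η hη => by
          obtain ⟨p, hp, hp2⟩ := hS₁ ξ hξ
          obtain ⟨p', hp', hp2'⟩ := hS₂ η hη
          have hs := hsep p hp p' hp'
          exact ⟨sub_le_norm_sub hs.1 ((norm_fst_le _).trans hp2) ((norm_fst_le _).trans hp2'),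
            sub_le_norm_sub hs.2 ((norm_snd_le _).trans hp2) ((norm_snd_le _).trans hp2')⟩)
        (fun η hη η' hη' => by
          obtain ⟨p, hp, hp2⟩ := hS₂ η hη
          obtain ⟨p', hp', hp2'⟩ := hS₂ η' hη'
          have hs := hdiam p hp p' hp'
          have h3 := norm_sub_le (p' - g2 η') (p - g2 η)
          have h4 := norm_add_le (p' - g2 η' - (p - g2 η)) (p - p')
          rw [show p' - g2 η' - (p - g2 η) + (p - p') = g2 η - g2 η' by abel] at h4
          linarith)
        hH (hP B') (hX B) (hXR B) (hXP B B' hBB)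
        (k := fun ξ w => gb (g2 ξ) w * F ξ B' w) (l := fun i η w => gb (g2 η) w * (gb (g2 η) w * h i w))
        (fun ξ => integrable_gb_mul (hF ξ B') _) (fun i η => integrable_gb_mul (memLp_mul_gb (hh i) _) _)
        (fun ξ w hw => norm_le_of_gb_ne_zero (left_ne_zero_of_mul hw))
        (fun i η w hw => norm_le_of_gb_ne_zero (left_ne_zero_of_mul hw)) hα hμ (fun ξ _ => hφ ξ B') hψ'
      have e1 : ∀ c y, EE (fun w => ∑ ξ ∈ S₁, gb (g2 ξ) w * F ξ B' w) c y =
          ∑ ξ ∈ S₁, EE (fun w => gb (g2 ξ) w * F ξ B' w) c y :=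
        EE_sum S₁ fun ξ _ => integrable_gb_mul (hF ξ B') _
      simp only [e1, hEEh]
      refine key.trans ?_
      calc _ ≤ C * ((ENNReal.ofReal κ)⁻¹ ^ 2 * (ENNReal.ofReal N)⁻¹ ^ 2) * (∑ i, ∫⁻ w, ‖h i w‖ₑ ^ 2) *
            ∫⁻ w, ‖f w‖ₑ ^ 2 := by gcongr
        _ = _ := mul_right_comm _ _ _

/-- The coordinatewise affine map of `ℂ × ℂ`. -/
def aff (b s w : ℂ × ℂ) : ℂ × ℂ := (b.1 + s.1 * w.1, b.2 + s.2 * w.2)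

theorem measurable_aff (b s : ℂ × ℂ) : Measurable (aff b s) := by unfold aff; fun_prop

theorem map_affine_volume (b : ℂ) {s : ℂ} (hs : s ≠ 0) :
    Measure.map (fun z => b + s * z) volume = (‖s‖ₑ⁻¹ ^ 2) • (volume : Measure ℂ) := by
  ext S hS
  have hm : Measurable fun z : ℂ => b + s * z := by fun_prop
  rw [Measure.map_apply hm hS, Measure.smul_apply, smul_eq_mul, ← lintegral_indicator_one hS,
    ← lintegral_indicator_one (hm hS), ← lintegral_comp_affine _ (measurable_one.indicator hS) b hs]
  rfl

theorem map_aff_volume (b : ℂ × ℂ) {s : ℂ × ℂ} (h1 : s.1 ≠ 0) (h2 : s.2 ≠ 0) :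
    Measure.map (aff b s) volume = (‖s.1‖ₑ⁻¹ ^ 2 * ‖s.2‖ₑ⁻¹ ^ 2) • (volume : Measure (ℂ × ℂ)) := by
  have : aff b s = Prod.map (fun z => b.1 + s.1 * z) fun z => b.2 + s.2 * z := rfl
  rw [this, Measure.volume_eq_prod, ← Measure.map_prod_map _ _ (by fun_prop) (by fun_prop), map_affine_volume _ h1,
    map_affine_volume _ h2, Measure.prod_smul_left, Measure.prod_smul_right, smul_smul]

theorem enorm_inv_ne_top {s : ℂ} (h : s ≠ 0) : ‖s‖ₑ⁻¹ ≠ ∞ := by simpa using h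

theorem measurableEmbedding_aff (b : ℂ × ℂ) {s : ℂ × ℂ} (h1 : s.1 ≠ 0) (h2 : s.2 ≠ 0) : MeasurableEmbedding (aff b s) := by
  let e : ℂ × ℂ ≃ᵐ ℂ × ℂ :=
    { toFun := aff b s
      invFun := fun w => ((w.1 - b.1) / s.1, (w.2 - b.2) / s.2)
      left_inv := fun w => by ext <;> simp [aff, h1, h2]
      right_inv := fun w => by ext <;> simp [aff] <;> field_simp <;> ring
      measurable_toFun := measurable_aff b s
      measurable_invFun := by simp only [Equiv.coe_fn_symm_mk]; fun_prop }
  exact e.measurableEmbedding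

theorem lintegral_comp_aff (b : ℂ × ℂ) {s : ℂ × ℂ} (h1 : s.1 ≠ 0) (h2 : s.2 ≠ 0) (g : ℂ × ℂ → ℝ≥0∞) :
    ∫⁻ w, g (aff b s w) = ‖s.1‖ₑ⁻¹ ^ 2 * ‖s.2‖ₑ⁻¹ ^ 2 * ∫⁻ w, g w := by
  rw [← (measurableEmbedding_aff b h1 h2).lintegral_map, map_aff_volume b h1 h2, lintegral_smul_measure, smul_eq_mul]

theorem integral_comp_aff (b : ℂ × ℂ) {s : ℂ × ℂ} (h1 : s.1 ≠ 0) (h2 : s.2 ≠ 0) (g : ℂ × ℂ → ℂ) :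
    ∫ w, g (aff b s w) = ((‖s.1‖⁻¹ ^ 2 * ‖s.2‖⁻¹ ^ 2 : ℝ) : ℂ) * ∫ w, g w := by
  rw [← (measurableEmbedding_aff b h1 h2).integral_map, map_aff_volume b h1 h2, integral_smul_measure]
  simp [toReal_inv, enorm_eq_nnnorm]

theorem memLp_comp_aff (b : ℂ × ℂ) {s : ℂ × ℂ} (h1 : s.1 ≠ 0) (h2 : s.2 ≠ 0) {g : ℂ × ℂ → ℂ} {p : ℝ≥0∞}
    (hg : MemLp g p) : MemLp (fun w => g (aff b s w)) p := by
  have h := hg.smul_measure (c := ‖s.1‖ₑ⁻¹ ^ 2 * ‖s.2‖ₑ⁻¹ ^ 2)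
    (ENNReal.mul_ne_top (ENNReal.pow_ne_top (enorm_inv_ne_top h1)) (ENNReal.pow_ne_top (enorm_inv_ne_top h2)))
  rw [← map_aff_volume b h1 h2] at h
  exact (measurableEmbedding_aff b h1 h2).memLp_map_measure_iff.1 h

/-- The change of variables in space-time corresponding to `aff b s` on the frequency side. -/
def gal (c0 : ℂ) (b s : ℂ × ℂ) (z : ℂ × ℂ × ℂ) : ℂ × ℂ × ℂ :=
  (s.1 * s.2 * (z.1 - c0), s.1 * (z.2.1 + (z.1 - c0) * b.2), s.2 * (z.2.2 + (z.1 - c0) * b.1))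

theorem continuous_gal (c0 : ℂ) (b s : ℂ × ℂ) : Continuous (gal c0 b s) := by unfold gal; fun_prop

theorem EE_gal (c0 : ℂ) (b : ℂ × ℂ) {s : ℂ × ℂ} (h1 : s.1 ≠ 0) (h2 : s.2 ≠ 0) (f : ℂ × ℂ → ℂ) (z : ℂ × ℂ × ℂ) :
    EE (fun w => modu c0 f (aff b s w)) (gal c0 b s z).1 (gal c0 b s z).2 =
      ee (((z.1 - c0) * b.1 * b.2 + (s.1 * 0 - z.2.1 - (z.1 - c0) * b.2) * b.1 -
        (z.2.2 + (z.1 - c0) * b.1) * b.2).re) * (((‖s.1‖⁻¹ ^ 2 * ‖s.2‖⁻¹ ^ 2 : ℝ) : ℂ) * EE f z.1 z.2) := by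
  obtain ⟨c, a, d⟩ := z
  have h := integral_comp_aff b h1 h2 fun w => ee (ph c (a, d) w) * f w
  have e : EE f c (a, d) = ∫ w, ee (ph c (a, d) w) * f w := rfl
  simp only [e]
  rw [← h, ← integral_const_mul]
  unfold EE modu
  refine integral_congr_ae (Filter.Eventually.of_forall fun w => ?_)
  simp only [← mul_assoc, ← ee_add]
  congr 2
  simp only [ph, gal, aff, ← Complex.add_re]
  congr 1
  ring

theorem enorm_EE_gal (c0 : ℂ) (b : ℂ × ℂ) {s : ℂ × ℂ} (h1 : s.1 ≠ 0) (h2 : s.2 ≠ 0) (f : ℂ × ℂ → ℂ) (z : ℂ × ℂ × ℂ) :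
    ‖EE f z.1 z.2‖ₑ = ‖s.1‖ₑ ^ 2 * ‖s.2‖ₑ ^ 2 *
      ‖EE (fun w => modu c0 f (aff b s w)) (gal c0 b s z).1 (gal c0 b s z).2‖ₑ := by
  rw [EE_gal c0 b h1 h2]
  have e : ‖((‖s.1‖⁻¹ ^ 2 * ‖s.2‖⁻¹ ^ 2 : ℝ) : ℂ)‖ₑ = ‖s.1‖ₑ⁻¹ ^ 2 * ‖s.2‖ₑ⁻¹ ^ 2 := by
    have n : ∀ x : ℂ, ‖((‖x‖ : ℝ) : ℂ)‖ₑ = ‖x‖ₑ := fun x => by rw [← ofReal_norm, Complex.norm_real, norm_norm, ofReal_norm]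
    simp [enorm_mul, enorm_pow, enorm_inv, h1, h2, n, ENNReal.inv_pow]
  have k : ∀ {x : ℂ}, x ≠ 0 → ‖x‖ₑ ^ 2 * ‖x‖ₑ⁻¹ ^ 2 = 1 := fun {x} hx => by
    rw [← mul_pow, ENNReal.mul_inv_cancel (by simpa using hx) enorm_ne_top, one_pow]
  rw [enorm_mul, enorm_mul, e]
  have : ∀ t, ‖ee t‖ₑ = 1 := fun t => by rw [← ofReal_norm]; simp
  rw [this, one_mul]
  calc _ = (‖s.1‖ₑ ^ 2 * ‖s.1‖ₑ⁻¹ ^ 2) * (‖s.2‖ₑ ^ 2 * ‖s.2‖ₑ⁻¹ ^ 2) * ‖EE f z.1 z.2‖ₑ := by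
        rw [k h1, k h2, one_mul, one_mul]
    _ = _ := by ring

theorem lintegral_comp_gal (c0 : ℂ) (b : ℂ × ℂ) {s : ℂ × ℂ} (h1 : s.1 ≠ 0) (h2 : s.2 ≠ 0) {Φ : ℂ × ℂ × ℂ → ℝ≥0∞}
    (hΦ : Measurable Φ) :
    ∫⁻ z, Φ (gal c0 b s z) = ‖s.1‖ₑ⁻¹ ^ 4 * ‖s.2‖ₑ⁻¹ ^ 4 * ∫⁻ z, Φ z := by
  have h12 : s.1 * s.2 ≠ 0 := mul_ne_zero h1 h2
  have hg : Measurable fun z => Φ (gal c0 b s z) := hΦ.comp (continuous_gal c0 b s).measurable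
  rw [Measure.volume_eq_prod, lintegral_prod _ hg.aemeasurable, lintegral_prod _ hΦ.aemeasurable]
  have e1 : ∀ c : ℂ, ∫⁻ y : ℂ × ℂ, Φ (gal c0 b s (c, y)) = ‖s.1‖ₑ⁻¹ ^ 2 * ‖s.2‖ₑ⁻¹ ^ 2 *
      ∫⁻ y : ℂ × ℂ, Φ (-(s.1 * s.2 * c0) + s.1 * s.2 * c, y) := fun c => by
    rw [← lintegral_comp_aff (s.1 * ((c - c0) * b.2), s.2 * ((c - c0) * b.1)) h1 h2]
    refine lintegral_congr fun y => ?_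
    congr 1
    simp only [gal, aff, Prod.mk.injEq]
    refine ⟨?_, ?_, ?_⟩ <;> ring
  simp only [e1]
  have hm : Measurable fun c : ℂ => ∫⁻ y : ℂ × ℂ, Φ (c, y) := hΦ.lintegral_prod_right'
  have hm' : Measurable fun c : ℂ => ∫⁻ y : ℂ × ℂ, Φ (-(s.1 * s.2 * c0) + s.1 * s.2 * c, y) :=
    hm.comp (g := fun c => ∫⁻ y : ℂ × ℂ, Φ (c, y)) (f := fun c => -(s.1 * s.2 * c0) + s.1 * s.2 * c) (by fun_prop)
  rw [lintegral_const_mul _ hm',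
    lintegral_comp_affine (fun c => ∫⁻ y : ℂ × ℂ, Φ (c, y)) hm _ h12, enorm_mul,
    ENNReal.mul_inv (Or.inr enorm_ne_top) (Or.inl enorm_ne_top)]
  ring

/-- Isotropic frequency dilation by `N` after recentring time at `c0`. -/
def dil (c0 : ℂ) (N : ℝ) (f : ℂ × ℂ → ℂ) (w : ℂ × ℂ) : ℂ :=
  modu c0 f (aff 0 ((N : ℂ)⁻¹, (N : ℂ)⁻¹) w)

theorem aff_zero_inv {N : ℝ} (w : ℂ × ℂ) : aff 0 ((N : ℂ)⁻¹, (N : ℂ)⁻¹) w = (N : ℂ)⁻¹ • w := by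
  ext <;> simp [aff]

theorem enorm_ofReal_inv {N : ℝ} (hN : 0 < N) : ‖(N : ℂ)⁻¹‖ₑ = (ENNReal.ofReal N)⁻¹ := by
  rw [enorm_inv (by exact_mod_cast hN.ne'), ← ofReal_norm, Complex.norm_real, Real.norm_of_nonneg hN.le]

theorem memLp_dil (c0 : ℂ) {N : ℝ} (hN : 0 < N) {f : ℂ × ℂ → ℂ} (hf : MemLp f 2) : MemLp (dil c0 N f) 2 := by
  have h : (N : ℂ)⁻¹ ≠ 0 := inv_ne_zero (by exact_mod_cast hN.ne')
  exact memLp_comp_aff 0 (s := ((N : ℂ)⁻¹, (N : ℂ)⁻¹)) h h (memLp_modu c0 hf)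

theorem lintegral_dil_sq (c0 : ℂ) {N : ℝ} (hN : 0 < N) (f : ℂ × ℂ → ℂ) :
    ∫⁻ w, ‖dil c0 N f w‖ₑ ^ 2 = ENNReal.ofReal N ^ 4 * ∫⁻ w, ‖f w‖ₑ ^ 2 := by
  have h : (N : ℂ)⁻¹ ≠ 0 := inv_ne_zero (by exact_mod_cast hN.ne')
  have := lintegral_comp_aff 0 (s := ((N : ℂ)⁻¹, (N : ℂ)⁻¹)) h h fun w => ‖f w‖ₑ ^ 2
  simp only [enorm_ofReal_inv hN, inv_inv] at this
  simp only [dil, enorm_modu, this]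
  ring

theorem lintegral_dil_mul_sq (c0 : ℂ) {N : ℝ} (hN : 0 < N) {f h : ℂ × ℂ → ℂ} (hf : Integrable (dil c0 N f))
    (hh : Integrable (dil c0 N h)) {X : Set ℂ} (hX : MeasurableSet X) :
    ∫⁻ z in X ×ˢ Set.univ, ‖EE f z.1 z.2 * EE h z.1 z.2‖ₑ ^ 2 = (ENNReal.ofReal N)⁻¹ ^ 8 *
      ∫⁻ z in ((fun c : ℂ => c0 + (N : ℂ) ^ 2 * c) ⁻¹' X) ×ˢ Set.univ,
        ‖EE (dil c0 N f) z.1 z.2 * EE (dil c0 N h) z.1 z.2‖ₑ ^ 2 := by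
  have hN0 : (N : ℂ) ≠ 0 := by exact_mod_cast hN.ne'
  have h0 : (N : ℂ)⁻¹ ≠ 0 := inv_ne_zero hN0
  have hX' : MeasurableSet ((fun c : ℂ => c0 + (N : ℂ) ^ 2 * c) ⁻¹' X) :=
    (show Measurable fun c : ℂ => c0 + (N : ℂ) ^ 2 * c by fun_prop) hX
  obtain ⟨X', hXX⟩ : ∃ X', X' = (fun c : ℂ => c0 + (N : ℂ) ^ 2 * c) ⁻¹' X := ⟨_, rfl⟩
  rw [← hXX] at hX' ⊢
  obtain ⟨Φ, hΦd⟩ : ∃ Φ : ℂ × ℂ × ℂ → ℝ≥0∞, Φ = (X' ×ˢ Set.univ).indicator fun z =>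
      ‖EE (dil c0 N f) z.1 z.2 * EE (dil c0 N h) z.1 z.2‖ₑ ^ 2 := ⟨_, rfl⟩
  have hΦ : Measurable Φ := by
    rw [hΦd]
    exact (((continuous_EE_comp hf).mul (continuous_EE_comp hh)).enorm.measurable.pow_const 2).indicator
      (hX'.prod MeasurableSet.univ)
  have key : ∀ z, (X ×ˢ Set.univ).indicator (fun z : ℂ × ℂ × ℂ => ‖EE f z.1 z.2 * EE h z.1 z.2‖ₑ ^ 2) z =
      (ENNReal.ofReal N)⁻¹ ^ 16 * Φ (gal c0 0 ((N : ℂ)⁻¹, (N : ℂ)⁻¹) z) := fun z => by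
    have hmem : (gal c0 0 ((N : ℂ)⁻¹, (N : ℂ)⁻¹) z ∈ X' ×ˢ (Set.univ : Set (ℂ × ℂ))) ↔
        z ∈ X ×ˢ (Set.univ : Set (ℂ × ℂ)) := by
      have : c0 + (N : ℂ) ^ 2 * ((N : ℂ)⁻¹ * (N : ℂ)⁻¹ * (z.1 - c0)) = z.1 := by field_simp; ring
      simp [hXX, gal, this]
    by_cases hz : z ∈ X ×ˢ (Set.univ : Set (ℂ × ℂ))
    · rw [hΦd, Set.indicator_of_mem hz, Set.indicator_of_mem (hmem.2 hz), enorm_mul, enorm_mul,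
        enorm_EE_gal c0 0 (s := ((N : ℂ)⁻¹, (N : ℂ)⁻¹)) h0 h0 f, enorm_EE_gal c0 0 (s := ((N : ℂ)⁻¹, (N : ℂ)⁻¹)) h0 h0 h,
        enorm_ofReal_inv hN]
      unfold dil
      ring
    · rw [hΦd, Set.indicator_of_notMem hz, Set.indicator_of_notMem (fun h => hz (hmem.1 h)), mul_zero]
  have hn : (ENNReal.ofReal N)⁻¹ * ENNReal.ofReal N = 1 :=
    ENNReal.inv_mul_cancel (by simpa using hN) ENNReal.ofReal_ne_top
  have hn' : (ENNReal.ofReal N)⁻¹ ^ 8 * ENNReal.ofReal N ^ 8 = 1 := by rw [← mul_pow, hn, one_pow]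
  rw [← lintegral_indicator (hX.prod MeasurableSet.univ), ← lintegral_indicator (hX'.prod MeasurableSet.univ), ← hΦd]
  simp only [key]
  rw [lintegral_const_mul' _ _ (ENNReal.pow_ne_top (by simpa using hN)),
    lintegral_comp_gal c0 0 (s := ((N : ℂ)⁻¹, (N : ℂ)⁻¹)) h0 h0 hΦ, enorm_ofReal_inv hN, inv_inv]
  generalize (ENNReal.ofReal N) = a at *
  calc _ = (a⁻¹ ^ 8 * a ^ 8) * (a⁻¹ ^ 8 * ∫⁻ z, Φ z) := by
        generalize (∫⁻ z, Φ z) = I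
        generalize a⁻¹ = b
        ring
    _ = _ := by rw [hn', one_mul]

theorem dil_inv (c0 : ℂ) {N : ℝ} (hN : 0 < N) (g : ℂ × ℂ → ℂ) :
    dil c0 N (modu (-c0) fun w => g ((N : ℂ) • w)) = g := by
  have hN0 : (N : ℂ) ≠ 0 := by exact_mod_cast hN.ne'
  ext w
  simp only [dil, modu, aff_zero_inv, ← mul_assoc, ← ee_add, smul_smul, mul_inv_cancel₀ hN0, one_smul]
  rw [← Complex.add_re, neg_mul, neg_mul, add_neg_cancel]
  simp [ee]

theorem dil_injOn (c0 : ℂ) {N : ℝ} (hN : 0 < N) (f : ℂ × ℂ → ℂ) :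
    (modu (-c0) fun w => dil c0 N f ((N : ℂ) • w)) = f := by
  have hN0 : (N : ℂ) ≠ 0 := by exact_mod_cast hN.ne'
  ext w
  simp only [dil, modu, aff_zero_inv, smul_smul, inv_mul_cancel₀ hN0, one_smul, ← mul_assoc, ← ee_add]
  rw [← Complex.add_re, neg_mul, neg_mul, neg_add_cancel]
  simp [ee]

theorem integrable_of_memLp_two {f : ℂ × ℂ → ℂ} (hf : MemLp f 2) {r : ℝ} (hr : ∀ w, f w ≠ 0 → ‖w‖ ≤ r) :
    Integrable f := by
  have hs : Function.support f ⊆ Metric.closedBall 0 r := fun w hw => by simpa using hr w hw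
  rw [← integrableOn_iff_integrable_of_support_subset hs]
  have : IsFiniteMeasure (volume.restrict (Metric.closedBall (0 : ℂ × ℂ) r)) :=
    ⟨by simpa using measure_closedBall_lt_top⟩
  exact (hf.restrict _).integrable (by norm_num)

theorem exists_off_dil {κ₀ : ℝ} (hκ₀ : 0 < κ₀) (R : ℝ) : ∃ C : ℝ≥0∞, C ≠ ∞ ∧ ∀ {N κ : ℝ}, 1 ≤ N → 16 ≤ κ₀ * N →
    0 < κ → 2 ≤ κ * N → ∀ {D₁ D₂ : Set (ℂ × ℂ)}, (∀ p ∈ D₁, ‖p‖ ≤ 1) → (∀ p ∈ D₂, ‖p‖ ≤ 1) →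
    (∀ p ∈ D₁, ∀ p' ∈ D₂, κ₀ ≤ ‖(p' - p).1‖ ∧ κ₀ ≤ ‖(p' - p).2‖) →
    (∀ p ∈ D₂, ∀ p' ∈ D₂, ‖p - p'‖ ≤ κ₀ / 16) → ∀ c0 : ℂ,
    ∀ {β : Type} [Fintype β] {P X : β → Set ℂ}, (∀ B, MeasurableSet (P B)) → (∀ B, MeasurableSet (X B)) →
    (Pairwise fun B B' => Disjoint (P B) (P B')) → ⋃ B, P B = Set.univ → (∀ B, ∀ c ∈ X B, ‖c - c0‖ ≤ R * N ^ 2) →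
    (∀ B B', B' ≠ B → ∀ c ∈ X B, ∀ c' ∈ P B', κ * N ^ 2 ≤ ‖c' - c‖) →
    ∀ {f : ℂ × ℂ → ℂ} {ι : Type} [Fintype ι] {h : ι → ℂ × ℂ → ℂ}, MemLp f 2 → Function.support f ⊆ D₁ →
    (∀ i, MemLp (h i) 2) → (∀ i, Function.support (h i) ⊆ D₂) →
    ∃ fB : β → ℂ × ℂ → ℂ, (∀ B, MemLp (fB B) 2) ∧ (∀ B w, fB B w ≠ 0 → ∃ p ∈ D₁, ‖p - w‖ ≤ 4 / N) ∧
      ((fun w => ∑ B, fB B w) =ᵐ[volume] f) ∧ ∑ B, ∫⁻ w, ‖fB B w‖ₑ ^ 2 ≤ ∫⁻ w, ‖f w‖ₑ ^ 2 ∧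
      ∀ B B', B' ≠ B → ∑ i, ∫⁻ z in X B ×ˢ Set.univ, ‖EE (fB B') z.1 z.2 * EE (h i) z.1 z.2‖ₑ ^ 2 ≤
        C * ((ENNReal.ofReal κ)⁻¹ ^ 2 * (ENNReal.ofReal N)⁻¹ ^ 2) * (∫⁻ w, ‖f w‖ₑ ^ 2) *
          ∑ i, ∫⁻ w, ‖h i w‖ₑ ^ 2 := by
  obtain ⟨C, hC, H⟩ := exists_off hκ₀ R
  refine ⟨C, hC, ?_⟩
  intro N κ hN hκN hκ hκN2 D₁ D₂ hD₁ hD₂ hsep hdiam c0 β _ P X hP hX hd hu hXR hXP f ι _ h hf hfD hh hhD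
  have hN' : 0 < N := one_pos.trans_le hN
  have hN0 : (N : ℂ) ≠ 0 := by exact_mod_cast hN'.ne'
  have nN : ∀ w : ℂ × ℂ, ‖(N : ℂ) • w‖ = N * ‖w‖ := fun w => by
    rw [norm_smul, Complex.norm_real, Real.norm_of_nonneg hN'.le]
  have nN2 : ∀ w : ℂ, ‖(N : ℂ) ^ 2 * w‖ = N ^ 2 * ‖w‖ := fun w => by
    rw [norm_mul, norm_pow, Complex.norm_real, Real.norm_of_nonneg hN'.le]
  have hS : ∀ {k : ℂ × ℂ → ℂ} {D : Set (ℂ × ℂ)}, Function.support k ⊆ D →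
      Function.support (dil c0 N k) ⊆ (fun p => (N : ℂ) • p) '' D := fun {k D} hk w hw => by
    refine ⟨(N : ℂ)⁻¹ • w, hk fun h0 => hw ?_, by simp [smul_smul, hN0]⟩
    simp [dil, aff_zero_inv, modu, h0]
  have hm : Measurable fun c : ℂ => c0 + (N : ℂ) ^ 2 * c := by fun_prop
  have hN2 : 0 < N ^ 2 := by positivity
  obtain ⟨g, hg, hgs, hgf, hgn, hgo⟩ := H hN hκN hκ hκN2 (D₁ := (fun p => (N : ℂ) • p) '' D₁)
    (D₂ := (fun p => (N : ℂ) • p) '' D₂)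
    (by rintro _ ⟨p, hp, rfl⟩; rw [nN]; nlinarith [hD₁ p hp])
    (by rintro _ ⟨p, hp, rfl⟩; rw [nN]; nlinarith [hD₂ p hp])
    (by
      rintro _ ⟨p, hp, rfl⟩ _ ⟨p', hp', rfl⟩
      have := hsep p hp p' hp'
      simp only [← smul_sub, Prod.smul_fst, Prod.smul_snd, norm_smul, Complex.norm_real, Real.norm_of_nonneg hN'.le]
      constructor <;> nlinarith [this.1, this.2])
    (by
      rintro _ ⟨p, hp, rfl⟩ _ ⟨p', hp', rfl⟩
      rw [← smul_sub, nN]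
      nlinarith [hdiam p hp p' hp'])
    (P := fun B => (fun c : ℂ => c0 + (N : ℂ) ^ 2 * c) ⁻¹' P B)
    (X := fun B => (fun c : ℂ => c0 + (N : ℂ) ^ 2 * c) ⁻¹' X B)
    (fun B => hm (hP B)) (fun B => hm (hX B)) (fun B B' hB => (hd hB).preimage _)
    (by rw [← Set.preimage_iUnion, hu, Set.preimage_univ])
    (fun B c hc => by
      have := hXR B _ hc
      rw [add_sub_cancel_left, nN2] at this
      nlinarith)
    (fun B B' hB c hc c' hc' => by
      have := hXP B B' hB _ hc _ hc'
      rw [add_sub_add_left_eq_sub, ← mul_sub, nN2] at this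
      nlinarith)
    (memLp_dil c0 hN' hf) (hS hfD) (fun i => memLp_dil c0 hN' (hh i)) fun i => hS (hhD i)
  obtain ⟨fB, hfB⟩ : ∃ fB : β → ℂ × ℂ → ℂ, fB = fun B => modu (-c0) fun w => g B ((N : ℂ) • w) := ⟨_, rfl⟩
  have hdil : ∀ B, dil c0 N (fB B) = g B := fun B => by rw [hfB]; exact dil_inv c0 hN' (g B)
  have hne : ∀ B w, fB B w ≠ 0 → g B ((N : ℂ) • w) ≠ 0 := fun B w hw h0 => hw (by simp only [hfB, modu, h0, mul_zero])
  have haff : ∀ w : ℂ × ℂ, aff 0 ((N : ℂ), (N : ℂ)) w = (N : ℂ) • w := fun w => by ext <;> simp [aff]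
  have hemb := measurableEmbedding_aff 0 (s := ((N : ℂ), (N : ℂ))) hN0 hN0
  have hmem : ∀ B, MemLp (fB B) 2 := fun B => by
    rw [hfB]
    refine memLp_modu _ ?_
    simpa only [haff] using memLp_comp_aff 0 (s := ((N : ℂ), (N : ℂ))) hN0 hN0 (hg B)
  have hsq : ∀ k : ℂ × ℂ → ℂ, ∫⁻ w, ‖dil c0 N k w‖ₑ ^ 2 = ENNReal.ofReal N ^ 4 * ∫⁻ w, ‖k w‖ₑ ^ 2 :=
    lintegral_dil_sq c0 hN'
  have ha0 : ENNReal.ofReal N ≠ 0 := by simpa using hN'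
  have ha1 : ENNReal.ofReal N ≠ ∞ := ENNReal.ofReal_ne_top
  refine ⟨fB, hmem, fun B w hw => ?_, ?_, ?_, fun B B' hB => ?_⟩
  · obtain ⟨_, ⟨p, hp, rfl⟩, hpw⟩ := hgs B _ (hne B w hw)
    refine ⟨p, hp, ?_⟩
    rw [← smul_sub, nN] at hpw
    rwa [le_div_iff₀ hN', mul_comm]
  · have hqmp : Measure.QuasiMeasurePreserving (aff 0 ((N : ℂ), (N : ℂ))) volume volume := by
      refine ⟨measurable_aff _ _, ?_⟩
      rw [map_aff_volume 0 (s := ((N : ℂ), (N : ℂ))) hN0 hN0]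
      exact Measure.smul_absolutelyContinuous
    filter_upwards [hqmp.ae hgf] with w hw
    rw [haff] at hw
    have h1 := congrFun (dil_injOn c0 hN' f) w
    simp only [modu] at h1
    rw [← h1, ← hw, Finset.mul_sum]
    simp only [hfB, modu]
  · have h1 := hgn
    simp only [← hdil, hsq, ← Finset.mul_sum] at h1
    exact (ENNReal.mul_le_mul_iff_right (pow_ne_zero _ ha0) (ENNReal.pow_ne_top ha1)).1 h1
  · have ig : ∀ B, Integrable (dil c0 N (fB B)) := fun B => by
      rw [hdil]
      refine integrable_of_memLp_two (hg B) (r := N + 4) fun w hw => ?_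
      obtain ⟨_, ⟨p, hp, rfl⟩, hpw⟩ := hgs B _ hw
      have := hD₁ p hp
      have h3 := norm_sub_le ((N : ℂ) • p) ((N : ℂ) • p - w)
      rw [_root_.sub_sub_cancel, nN] at h3
      nlinarith
    have ih : ∀ i, Integrable (dil c0 N (h i)) := fun i =>
      integrable_of_memLp_two (memLp_dil c0 hN' (hh i)) (r := N) fun w hw => by
        obtain ⟨p, hp, rfl⟩ := hS (hhD i) hw
        rw [nN]
        nlinarith [hD₂ p hp]
    have h1 := hgo B B' hB
    simp only [← hdil, hsq, ← Finset.mul_sum] at h1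
    simp only [lintegral_dil_mul_sq c0 hN' (ig B') (ih _) (hX B), ← Finset.mul_sum]
    refine (mul_le_mul_right h1 _).trans (le_of_eq ?_)
    have hn : (ENNReal.ofReal N)⁻¹ ^ 8 * ENNReal.ofReal N ^ 8 = 1 := by
      rw [← mul_pow, ENNReal.inv_mul_cancel ha0 ha1, one_pow]
    generalize (ENNReal.ofReal N)⁻¹ ^ 8 = x at *
    generalize (ENNReal.ofReal N)⁻¹ = b at *
    generalize (∑ i, ∫⁻ w, ‖h i w‖ₑ ^ 2) = V at *
    generalize (∫⁻ w, ‖f w‖ₑ ^ 2) = U at *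
    generalize (ENNReal.ofReal N) = a at *
    calc _ = (x * a ^ 8) * (C * ((ENNReal.ofReal κ)⁻¹ ^ 2 * b ^ 2) * U * V) := by ring
      _ = _ := by rw [hn, one_mul]

theorem lintegral_rpow_interp {α : Type*} [MeasurableSpace α] {μ : Measure α} {g : α → ℝ≥0∞} (hg : AEMeasurable g μ)
    {r : ℝ} (h1 : 1 ≤ r) (h2 : r ≤ 2) :
    ∫⁻ x, g x ^ r ∂μ ≤ (∫⁻ x, g x ∂μ) ^ (2 - r) * (∫⁻ x, g x ^ 2 ∂μ) ^ (r - 1) := by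
  refine le_trans (le_of_eq (lintegral_congr fun x => ?_))
    (ENNReal.lintegral_mul_norm_pow_le hg (hg.pow_const 2) (by linarith) (by linarith) (by ring))
  rw [← ENNReal.rpow_natCast, ← ENNReal.rpow_mul,
    ← ENNReal.rpow_add_of_nonneg _ _ (by linarith) (mul_nonneg (by norm_num) (by linarith))]
  congr 1
  push_cast
  ring

theorem sum_rpow_le {ι : Type*} (s : Finset ι) (x : ι → ℝ≥0∞) {r : ℝ} (hr : 1 ≤ r) :
    ∑ i ∈ s, x i ^ r ≤ (∑ i ∈ s, x i) ^ r := by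
  classical
  induction s using Finset.induction_on with
  | empty => simp
  | insert a s ha ih =>
    rw [Finset.sum_insert ha, Finset.sum_insert ha]
    exact (add_le_add le_rfl ih).trans (ENNReal.add_rpow_le_rpow_add _ _ hr)

theorem sum_sqrt_mul_le {ι : Type*} (s : Finset ι) (x y : ι → ℝ≥0∞) :
    ∑ i ∈ s, (x i * y i) ^ (1 / 2 : ℝ) ≤ ((∑ i ∈ s, x i) * ∑ i ∈ s, y i) ^ (1 / 2 : ℝ) := by
  have h := ENNReal.inner_le_Lp_mul_Lq s (fun i => x i ^ (1 / 2 : ℝ)) (fun i => y i ^ (1 / 2 : ℝ))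
    Real.HolderConjugate.two_two
  simp only [← ENNReal.rpow_mul] at h
  norm_num at h
  simp only [ENNReal.mul_rpow_of_nonneg _ _ (by norm_num : (0 : ℝ) ≤ 1 / 2)]
  norm_num
  exact h

theorem lintegral_EE_sq_prod {f : ℂ × ℂ → ℂ} (h2 : MemLp f 2) (h1 : Integrable f) (X : Set ℂ) :
    ∫⁻ z in X ×ˢ Set.univ, ‖EE f z.1 z.2‖ₑ ^ 2 = volume X * ∫⁻ w, ‖f w‖ₑ ^ 2 := by
  have hm : Measurable fun z : ℂ × ℂ × ℂ => ‖EE f z.1 z.2‖ₑ ^ 2 := (continuous_EE_comp h1).enorm.measurable.pow_const 2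
  rw [Measure.volume_eq_prod, ← Measure.prod_restrict, lintegral_prod _ hm.aemeasurable, Measure.restrict_univ]
  simp only [EE_lintegral_sq h2 h1, lintegral_const, Measure.restrict_apply MeasurableSet.univ, Set.univ_inter]
  exact mul_comm _ _

theorem lintegral_EE_mul_le {f h : ℂ × ℂ → ℂ} (f2 : MemLp f 2) (f1 : Integrable f) (h2 : MemLp h 2) (h1 : Integrable h)
    (X : Set ℂ) :
    ∫⁻ z in X ×ˢ Set.univ, ‖EE f z.1 z.2 * EE h z.1 z.2‖ₑ ≤
      volume X * ((∫⁻ w, ‖f w‖ₑ ^ 2) * ∫⁻ w, ‖h w‖ₑ ^ 2) ^ (1 / 2 : ℝ) := by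
  have hm : ∀ {f : ℂ × ℂ → ℂ}, Integrable f → Measurable fun z : ℂ × ℂ × ℂ => ‖EE f z.1 z.2‖ₑ ^ 2 := fun h1 =>
    (continuous_EE_comp h1).enorm.measurable.pow_const 2
  have := ENNReal.lintegral_mul_norm_pow_le (μ := volume.restrict (X ×ˢ (Set.univ : Set (ℂ × ℂ))))
    (hm f1).aemeasurable (hm h1).aemeasurable (p := 1 / 2) (q := 1 / 2) (by norm_num) (by norm_num) (by norm_num)
  rw [lintegral_EE_sq_prod f2 f1, lintegral_EE_sq_prod h2 h1] at this
  have e : ∀ x : ℝ≥0∞, (x ^ 2) ^ (1 / 2 : ℝ) = x := fun x => by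
    rw [← ENNReal.rpow_natCast, ← ENNReal.rpow_mul]; norm_num
  simp only [e, ← enorm_mul] at this
  refine this.trans (le_of_eq ?_)
  rw [ENNReal.mul_rpow_of_nonneg _ _ (by norm_num), ENNReal.mul_rpow_of_nonneg _ _ (by norm_num),
    ENNReal.mul_rpow_of_nonneg _ _ (by norm_num)]
  have ev : volume X ^ (1 / 2 : ℝ) * volume X ^ (1 / 2 : ℝ) = volume X := by
    rw [← ENNReal.rpow_add_of_nonneg _ _ (by norm_num) (by norm_num)]; norm_num
  generalize volume X ^ (1 / 2 : ℝ) = v at *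
  rw [← ev]
  ring

/-- Interpolation of an `L²` bound for a product of extensions with the trivial `L¹` bound. -/
theorem lintegral_EE_mul_rpow_le {f h : ℂ × ℂ → ℂ} (f2 : MemLp f 2) (f1 : Integrable f) (h2 : MemLp h 2)
    (h1 : Integrable h) {X : Set ℂ} {r : ℝ} (r1 : 1 ≤ r) (r2 : r ≤ 2) {V L n : ℝ≥0∞}
    (hV : volume X ≤ V) (hfn : (∫⁻ w, ‖f w‖ₑ ^ 2) * ∫⁻ w, ‖h w‖ₑ ^ 2 ≤ n)
    (hL : ∫⁻ z in X ×ˢ Set.univ, ‖EE f z.1 z.2 * EE h z.1 z.2‖ₑ ^ 2 ≤ L * n) :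
    ∫⁻ z in X ×ˢ Set.univ, ‖EE f z.1 z.2 * EE h z.1 z.2‖ₑ ^ r ≤ V ^ (2 - r) * L ^ (r - 1) * n ^ (r / 2) := by
  have hm : Measurable fun z : ℂ × ℂ × ℂ => ‖EE f z.1 z.2 * EE h z.1 z.2‖ₑ :=
    ((continuous_EE_comp f1).mul (continuous_EE_comp h1)).enorm.measurable
  refine (lintegral_rpow_interp hm.aemeasurable r1 r2).trans ?_
  have a : ∫⁻ z in X ×ˢ Set.univ, ‖EE f z.1 z.2 * EE h z.1 z.2‖ₑ ≤ V * n ^ (1 / 2 : ℝ) :=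
    (lintegral_EE_mul_le f2 f1 h2 h1 X).trans (mul_le_mul' hV (ENNReal.rpow_le_rpow hfn (by norm_num)))
  refine (mul_le_mul' (ENNReal.rpow_le_rpow a (by linarith)) (ENNReal.rpow_le_rpow hL (by linarith))).trans
    (le_of_eq ?_)
  rw [ENNReal.mul_rpow_of_nonneg _ _ (by linarith), ENNReal.mul_rpow_of_nonneg _ _ (by linarith), ← ENNReal.rpow_mul,
    mul_mul_mul_comm, ← ENNReal.rpow_add_of_nonneg _ _ (by linarith) (by linarith)]
  congr 2
  ring

/-- Two functions with separated frequency supports decompose, relative to a partition of time, so that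
off-diagonal products are small. -/
theorem exists_pair_split {ρ : ℝ} (hρ : 0 < ρ) : ∃ C : ℝ≥0∞, C ≠ ∞ ∧ ∀ {N κ σ : ℝ}, 1 ≤ N → 1 ≤ ρ * N → 0 < κ →
    2 ≤ κ * N → σ + 4 / N ≤ 2 * ρ → ∀ {p₁ p₂ : ℂ × ℂ}, ‖p₁‖ + 2 * ρ ≤ 1 → ‖p₂‖ + 2 * ρ ≤ 1 →
    68 * ρ ≤ ‖(p₂ - p₁).1‖ → 68 * ρ ≤ ‖(p₂ - p₁).2‖ → ∀ c0 : ℂ,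
    ∀ {β : Type} [Fintype β] {P X : β → Set ℂ}, (∀ B, MeasurableSet (P B)) → (∀ B, MeasurableSet (X B)) →
    (Pairwise fun B B' => Disjoint (P B) (P B')) → ⋃ B, P B = Set.univ → (∀ B, ∀ c ∈ X B, ‖c - c0‖ ≤ 2 * N ^ 2) →
    (∀ B B', B' ≠ B → ∀ c ∈ X B, ∀ c' ∈ P B', κ * N ^ 2 ≤ ‖c' - c‖) →
    ∀ {f₁ f₂ : ℂ × ℂ → ℂ}, MemLp f₁ 2 → MemLp f₂ 2 → (∀ w, f₁ w ≠ 0 → ‖w - p₁‖ ≤ σ) → (∀ w, f₂ w ≠ 0 → ‖w - p₂‖ ≤ σ) →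
    ∃ g₁ g₂ : β → ℂ × ℂ → ℂ, (∀ B, MemLp (g₁ B) 2) ∧ (∀ B, MemLp (g₂ B) 2) ∧
      (∀ B w, g₁ B w ≠ 0 → ‖w - p₁‖ ≤ σ + 4 / N) ∧ (∀ B w, g₂ B w ≠ 0 → ‖w - p₂‖ ≤ σ + 4 / N) ∧
      ((fun w => ∑ B, g₁ B w) =ᵐ[volume] f₁) ∧ ((fun w => ∑ B, g₂ B w) =ᵐ[volume] f₂) ∧
      ∑ B, ∫⁻ w, ‖g₁ B w‖ₑ ^ 2 ≤ ∫⁻ w, ‖f₁ w‖ₑ ^ 2 ∧ ∑ B, ∫⁻ w, ‖g₂ B w‖ₑ ^ 2 ≤ ∫⁻ w, ‖f₂ w‖ₑ ^ 2 ∧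
      (∀ B B', B' ≠ B → ∫⁻ z in X B ×ˢ Set.univ, ‖EE (g₁ B') z.1 z.2 * EE f₂ z.1 z.2‖ₑ ^ 2 ≤
        C * ((ENNReal.ofReal κ)⁻¹ ^ 2 * (ENNReal.ofReal N)⁻¹ ^ 2) *
          ((∫⁻ w, ‖f₁ w‖ₑ ^ 2) * ∫⁻ w, ‖f₂ w‖ₑ ^ 2)) ∧
      ∀ B B', B' ≠ B → ∫⁻ z in X B ×ˢ Set.univ, ‖EE (g₁ B) z.1 z.2 * EE (g₂ B') z.1 z.2‖ₑ ^ 2 ≤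
        C * ((ENNReal.ofReal κ)⁻¹ ^ 2 * (ENNReal.ofReal N)⁻¹ ^ 2) *
          ((∫⁻ w, ‖f₁ w‖ₑ ^ 2) * ∫⁻ w, ‖f₂ w‖ₑ ^ 2) := by
  obtain ⟨C, hC, H⟩ := exists_off_dil (show 0 < 64 * ρ by linarith) 2
  refine ⟨C, hC, ?_⟩
  intro N κ σ hN hρN hκ hκN hσ p₁ p₂ hp₁ hp₂ hs1 hs2 c0 β _ P X hP hX hd hu hXR hXP f₁ f₂ hf₁ hf₂ hs₁ hs₂
  have hN' : 0 < N := one_pos.trans_le hN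
  have h4 : 0 < 4 / N := by positivity
  have ball : ∀ {p w : ℂ × ℂ}, ‖p‖ + 2 * ρ ≤ 1 → ‖w - p‖ ≤ 2 * ρ → ‖w‖ ≤ 1 := fun {p w} h1 h2 => by
    have := norm_add_le (w - p) p
    rw [sub_add_cancel] at this
    linarith
  have diam : ∀ {p w w' : ℂ × ℂ}, ‖w - p‖ ≤ 2 * ρ → ‖w' - p‖ ≤ 2 * ρ → ‖w - w'‖ ≤ 64 * ρ / 16 := fun {p w w'} h1 h2 => by
    have := norm_sub_le (w - p) (w' - p)
    rw [sub_sub_sub_cancel_right] at this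
    linarith
  have sep : ∀ {x y : ℂ} {a b : ℂ}, 68 * ρ ≤ ‖b - a‖ → ‖x - a‖ ≤ 2 * ρ → ‖y - b‖ ≤ 2 * ρ → 64 * ρ ≤ ‖y - x‖ := by
    intro x y a b h h1 h2
    have e : b - a = (y - x) - (y - b) + (x - a) := by ring
    have := norm_add_le ((y - x) - (y - b)) (x - a)
    have := norm_sub_le (y - x) (y - b)
    rw [e] at h
    linarith
  have n1 : ∀ {w : ℂ × ℂ}, ‖w.1‖ ≤ ‖w‖ := fun {w} => norm_fst_le w
  have n2 : ∀ {w : ℂ × ℂ}, ‖w.2‖ ≤ ‖w‖ := fun {w} => norm_snd_le w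
  obtain ⟨g₁, hg₁, hgs₁, hgf₁, hgn₁, ho₁⟩ := H hN (by linarith) hκ hκN (D₁ := Metric.closedBall p₁ σ)
    (D₂ := Metric.closedBall p₂ σ)
    (fun w hw => ball hp₁ (by rw [mem_closedBall_iff_norm] at hw; linarith))
    (fun w hw => ball hp₂ (by rw [mem_closedBall_iff_norm] at hw; linarith))
    (fun w hw w' hw' => by
      rw [mem_closedBall_iff_norm] at hw hw'
      exact ⟨sep hs1 (n1.trans (by linarith : ‖w - p₁‖ ≤ 2 * ρ)) (n1.trans (by linarith : ‖w' - p₂‖ ≤ 2 * ρ)),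
        sep hs2 (n2.trans (by linarith : ‖w - p₁‖ ≤ 2 * ρ)) (n2.trans (by linarith : ‖w' - p₂‖ ≤ 2 * ρ))⟩)
    (fun w hw w' hw' => by
      rw [mem_closedBall_iff_norm] at hw hw'
      exact diam (p := p₂) (by linarith) (by linarith))
    c0 hP hX hd hu hXR hXP hf₁ (fun w hw => mem_closedBall_iff_norm.2 (hs₁ w hw)) (ι := Unit) (h := fun _ => f₂)
    (fun _ => hf₂) fun _ w hw => mem_closedBall_iff_norm.2 (hs₂ w hw)
  have near : ∀ {p w : ℂ × ℂ}, (∃ q ∈ Metric.closedBall p σ, ‖q - w‖ ≤ 4 / N) → ‖w - p‖ ≤ σ + 4 / N := by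
    rintro p w ⟨q, hq, h⟩
    rw [mem_closedBall_iff_norm] at hq
    have := norm_sub_le (q - p) (q - w)
    rw [show q - p - (q - w) = w - p by abel] at this
    linarith
  have hg₁s : ∀ B w, g₁ B w ≠ 0 → ‖w - p₁‖ ≤ σ + 4 / N := fun B w hw => near (hgs₁ B w hw)
  obtain ⟨g₂, hg₂, hgs₂, hgf₂, hgn₂, ho₂⟩ := H hN (by linarith) hκ hκN (D₁ := Metric.closedBall p₂ σ)
    (D₂ := Metric.closedBall p₁ (σ + 4 / N))
    (fun w hw => ball hp₂ (by rw [mem_closedBall_iff_norm] at hw; linarith))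
    (fun w hw => ball hp₁ (by rw [mem_closedBall_iff_norm] at hw; linarith))
    (fun w' hw' w hw => by
      rw [mem_closedBall_iff_norm] at hw hw'
      rw [← norm_neg (w - w').1, ← norm_neg (w - w').2, ← Prod.fst_neg, ← Prod.snd_neg, neg_sub]
      exact ⟨sep hs1 (n1.trans (by linarith : ‖w - p₁‖ ≤ 2 * ρ)) (n1.trans (by linarith : ‖w' - p₂‖ ≤ 2 * ρ)),
        sep hs2 (n2.trans (by linarith : ‖w - p₁‖ ≤ 2 * ρ)) (n2.trans (by linarith : ‖w' - p₂‖ ≤ 2 * ρ))⟩)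
    (fun w hw w' hw' => by
      rw [mem_closedBall_iff_norm] at hw hw'
      exact diam (p := p₁) (by linarith) (by linarith))
    c0 hP hX hd hu hXR hXP hf₂ (fun w hw => mem_closedBall_iff_norm.2 (hs₂ w hw)) (h := g₁) hg₁
    fun B w hw => mem_closedBall_iff_norm.2 (hg₁s B w hw)
  refine ⟨g₁, g₂, hg₁, hg₂, hg₁s, fun B w hw => near (hgs₂ B w hw), hgf₁, hgf₂, hgn₁, hgn₂, fun B B' hB => ?_,
    fun B B' hB => ?_⟩
  · have := ho₁ B B' hB
    simpa [mul_assoc] using this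
  · have h1 := (Finset.single_le_sum (f := fun i => ∫⁻ z in X B ×ˢ Set.univ,
      ‖EE (g₂ B') z.1 z.2 * EE (g₁ i) z.1 z.2‖ₑ ^ 2) (fun _ _ => zero_le) (Finset.mem_univ B)).trans (ho₂ B B' hB)
    simp only [mul_comm (EE (g₂ B') _ _)] at h1
    refine h1.trans ((mul_le_mul_right hgn₁ _).trans (le_of_eq ?_))
    ring

theorem eLpNorm_ofReal_le_iff {α : Type*} [MeasurableSpace α] {μ : Measure α} {f : α → ℂ} {r : ℝ} (hr : 0 < r)
    {x : ℝ≥0∞} : eLpNorm f (ENNReal.ofReal r) μ ≤ x ↔ ∫⁻ z, ‖f z‖ₑ ^ r ∂μ ≤ x ^ r := by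
  rw [eLpNorm_eq_lintegral_rpow_enorm_toReal (by simpa using hr) ENNReal.ofReal_ne_top, ENNReal.toReal_ofReal hr.le,
    one_div, ENNReal.rpow_inv_le_iff hr]

theorem eLpNorm_sum_mul_sum_le {α β : Type*} [MeasurableSpace α] [Fintype β] [DecidableEq β] {μ : Measure α}
    {G₁ G₂ : β → α → ℂ} (h₁ : ∀ B, AEStronglyMeasurable (G₁ B) μ) (h₂ : ∀ B, AEStronglyMeasurable (G₂ B) μ)
    {p : ℝ≥0∞} (hp : 1 ≤ p) (B : β) :
    eLpNorm (fun z => (∑ B', G₁ B' z) * ∑ B', G₂ B' z) p μ ≤ eLpNorm (fun z => G₁ B z * G₂ B z) p μ +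
      ∑ B' ∈ Finset.univ.erase B, (eLpNorm (fun z => G₁ B' z * ∑ B'', G₂ B'' z) p μ +
        eLpNorm (fun z => G₁ B z * G₂ B' z) p μ) := by
  have hs : AEStronglyMeasurable (fun z => ∑ B', G₂ B' z) μ :=
    Finset.aestronglyMeasurable_fun_sum _ fun B' _ => h₂ B'
  have e : (fun z => (∑ B', G₁ B' z) * ∑ B', G₂ B' z) = (fun z => G₁ B z * G₂ B z) +
      ∑ B' ∈ Finset.univ.erase B, ((fun z => G₁ B' z * ∑ B'', G₂ B'' z) + fun z => G₁ B z * G₂ B' z) := by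
    ext z
    simp only [Pi.add_apply, Finset.sum_apply, Finset.sum_add_distrib, ← Finset.sum_mul, ← Finset.mul_sum]
    have k1 := Finset.add_sum_erase Finset.univ (fun B' => G₁ B' z) (Finset.mem_univ B)
    have k2 := Finset.add_sum_erase Finset.univ (fun B' => G₂ B' z) (Finset.mem_univ B)
    rw [← k1, ← k2]
    ring
  rw [e]
  refine (eLpNorm_add_le ((h₁ B).mul (h₂ B)) (Finset.aestronglyMeasurable_sum _ fun B' _ =>
    ((h₁ B').mul hs).add ((h₁ B).mul (h₂ B'))) hp).trans (add_le_add le_rfl ?_)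
  refine (eLpNorm_sum_le (fun B' _ => ((h₁ B').mul hs).add ((h₁ B).mul (h₂ B'))) hp).trans
    (Finset.sum_le_sum fun B' _ => eLpNorm_add_le ((h₁ B').mul hs) ((h₁ B).mul (h₂ B')) hp)

/-- The square in `ℂ` with centre `s` and half-side `R`. -/
def csq (s : ℂ) (R : ℝ) : Set ℂ := {c | |(c - s).re| ≤ R ∧ |(c - s).im| ≤ R}

theorem measurableSet_csq (s : ℂ) (R : ℝ) : MeasurableSet (csq s R) := by
  have h1 : Continuous fun c : ℂ => |(c - s).re| := (Complex.continuous_re.comp (by fun_prop)).abs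
  have h2 : Continuous fun c : ℂ => |(c - s).im| := (Complex.continuous_im.comp (by fun_prop)).abs
  exact ((isClosed_le h1 continuous_const).inter (isClosed_le h2 continuous_const)).measurableSet

theorem norm_sub_le_of_mem_csq {s c : ℂ} {R : ℝ} (h : c ∈ csq s R) : ‖c - s‖ ≤ 2 * R :=
  (Complex.norm_le_abs_re_add_abs_im _).trans (by linarith [h.1, h.2])

theorem volume_csq_le (s : ℂ) (R : ℝ) : volume (csq s R) ≤ ENNReal.ofReal (16 * R ^ 2) := by
  refine (measure_mono (t := Metric.closedBall s (2 * R)) fun c hc => by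
    rw [mem_closedBall_iff_norm]; exact norm_sub_le_of_mem_csq hc).trans ?_
  rw [Complex.volume_closedBall]
  rcases le_or_gt 0 R with hR | hR
  · rw [← ENNReal.ofReal_pow (by linarith)]
    have : (NNReal.pi : ℝ≥0∞) ≤ 4 := by
      have h : NNReal.pi ≤ 4 := by
        rw [← NNReal.coe_le_coe]; exact Real.pi_le_four
      exact_mod_cast h
    refine (mul_le_mul_right this _).trans (le_of_eq ?_)
    rw [show (16 * R ^ 2 : ℝ) = (2 * R) ^ 2 * 4 by ring, ENNReal.ofReal_mul (by positivity)]
    norm_num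
  · simp [ENNReal.ofReal_of_nonpos (show 2 * R ≤ 0 by linarith)]

/-- The quadrants around `t`. -/
def quad (t : ℂ) (B : Bool × Bool) : Set ℂ := {c | (B.1 = true ↔ t.re ≤ c.re) ∧ (B.2 = true ↔ t.im ≤ c.im)}

theorem measurableSet_quad (t : ℂ) (B : Bool × Bool) : MeasurableSet (quad t B) := by
  have h1 : MeasurableSet {c : ℂ | t.re ≤ c.re} := measurableSet_le (by fun_prop) (by fun_prop)
  have h2 : MeasurableSet {c : ℂ | t.im ≤ c.im} := measurableSet_le (by fun_prop) (by fun_prop)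
  have key : ∀ {S : Set ℂ} (b : Bool), MeasurableSet S → MeasurableSet {c | b = true ↔ c ∈ S} := fun {S} b hS => by
    cases b
    · convert hS.compl using 1; ext; simp
    · convert hS using 1; ext; simp
  exact (key B.1 h1).inter (key B.2 h2)

theorem disjoint_quad (t : ℂ) : Pairwise fun B B' => Disjoint (quad t B) (quad t B') := by
  intro B B' hB
  rw [Set.disjoint_left]
  rintro c ⟨h1, h2⟩ ⟨h3, h4⟩
  exact hB (Prod.ext (Bool.eq_iff_iff.2 (h1.trans h3.symm)) (Bool.eq_iff_iff.2 (h2.trans h4.symm)))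

theorem iUnion_quad (t : ℂ) : ⋃ B, quad t B = Set.univ := by
  refine Set.eq_univ_of_forall fun c => Set.mem_iUnion.2 ⟨(decide (t.re ≤ c.re), decide (t.im ≤ c.im)), ?_⟩
  simp [quad]

/-- The complement of the cross of half-width `ε` centred at `t`. -/
def offCross (t : ℂ) (ε : ℝ) : Set ℂ := {c | ε ≤ |(c - t).re| ∧ ε ≤ |(c - t).im|}

theorem measurableSet_offCross (t : ℂ) (ε : ℝ) : MeasurableSet (offCross t ε) := by
  have h1 : Continuous fun c : ℂ => |(c - t).re| := (Complex.continuous_re.comp (by fun_prop)).abs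
  have h2 : Continuous fun c : ℂ => |(c - t).im| := (Complex.continuous_im.comp (by fun_prop)).abs
  exact ((isClosed_le continuous_const h1).inter (isClosed_le continuous_const h2)).measurableSet

theorem le_norm_sub_of_quad {t c c' : ℂ} {ε : ℝ} {B B' : Bool × Bool} (hB : B' ≠ B) (hc : c ∈ offCross t ε)
    (hcB : c ∈ quad t B) (hc' : c' ∈ quad t B') : ε ≤ ‖c' - c‖ := by
  obtain ⟨h1, h2⟩ := hc
  have key : ∀ {x y z : ℝ}, ε ≤ |x - z| → ¬(z ≤ x ↔ z ≤ y) → ε ≤ |y - x| := by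
    intro x y z h hn
    by_cases hx : z ≤ x
    · have hy : y < z := not_le.1 fun hy => hn (iff_of_true hx hy)
      rw [abs_of_nonneg (by linarith)] at h
      rw [abs_of_nonpos (by linarith)]
      linarith
    · have hy : z ≤ y := by by_contra hy; exact hn (iff_of_false hx hy)
      rw [not_le] at hx
      rw [abs_of_neg (by linarith)] at h
      rw [abs_of_pos (by linarith)]
      linarith
  by_cases hr : t.re ≤ c.re ↔ t.re ≤ c'.re
  · by_cases hi : t.im ≤ c.im ↔ t.im ≤ c'.im
    · exact absurd (Prod.ext (Bool.eq_iff_iff.2 (hc'.1.trans (hr.symm.trans hcB.1.symm)))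
        (Bool.eq_iff_iff.2 (hc'.2.trans (hi.symm.trans hcB.2.symm)))) hB
    · exact (key h2 hi).trans (Complex.abs_im_le_norm (c' - c))
  · exact (key h1 hr).trans (Complex.abs_re_le_norm (c' - c))

theorem exists_csq_of_quad {s t : ℂ} {R : ℝ} (h1 : |(t - s).re| ≤ R / 2) (h2 : |(t - s).im| ≤ R / 2) (B : Bool × Bool) :
    ∃ s', csq s R ∩ quad t B ⊆ csq s' (3 * R / 4) := by
  have key : ∀ {a z : ℝ} (b : Bool), |z - a| ≤ R / 2 → ∃ a', ∀ x, |x - a| ≤ R → (b = true ↔ z ≤ x) →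
      |x - a'| ≤ 3 * R / 4 := by
    intro a z b h
    rw [abs_le] at h
    cases b
    · refine ⟨a - R / 4, fun x hx hb => ?_⟩
      have hb : x < z := by simpa using hb
      rw [abs_le] at hx ⊢
      constructor <;> linarith
    · refine ⟨a + R / 4, fun x hx hb => ?_⟩
      have hb : z ≤ x := by simpa using hb
      rw [abs_le] at hx ⊢
      constructor <;> linarith
  obtain ⟨a, ha⟩ := key B.1 h1
  obtain ⟨b, hb⟩ := key B.2 h2
  exact ⟨⟨a, b⟩, fun c hc => ⟨ha _ hc.1.1 hc.2.1, hb _ hc.1.2 hc.2.2⟩⟩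

/-- The bilinear extension estimate over time squares of half-side `R` with constant `A`, for functions supported within
`σ` of `p₁` and `p₂` respectively. -/
def Bil (p₁ p₂ : ℂ × ℂ) (r σ R : ℝ) (A : ℝ≥0∞) : Prop :=
  ∀ f₁ f₂ : ℂ × ℂ → ℂ, MemLp f₁ 2 → MemLp f₂ 2 → (∀ w, f₁ w ≠ 0 → ‖w - p₁‖ ≤ σ) → (∀ w, f₂ w ≠ 0 → ‖w - p₂‖ ≤ σ) →
    ∀ s : ℂ, ∫⁻ z in csq s R ×ˢ Set.univ, ‖EE f₁ z.1 z.2 * EE f₂ z.1 z.2‖ₑ ^ r ≤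
      (A * ((∫⁻ w, ‖f₁ w‖ₑ ^ 2) * ∫⁻ w, ‖f₂ w‖ₑ ^ 2) ^ (1 / 2 : ℝ)) ^ r

theorem integrable_of_near {f : ℂ × ℂ → ℂ} (hf : MemLp f 2) {p : ℂ × ℂ} {σ : ℝ} (hs : ∀ w, f w ≠ 0 → ‖w - p‖ ≤ σ) :
    Integrable f :=
  integrable_of_memLp_two hf (r := σ + ‖p‖) fun w hw => by
    have := norm_add_le (w - p) p
    rw [sub_add_cancel] at this
    linarith [hs w hw]

theorem bil_offCross {C : ℝ≥0∞} {N κ σ r : ℝ} {p₁ p₂ : ℂ × ℂ} (r1 : 1 ≤ r) (r2 : r ≤ 2) {A E : ℝ≥0∞}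
    (hA : Bil p₁ p₂ r (σ + 4 / N) (3 * N ^ 2 / 4) A)
    (hE : ENNReal.ofReal (16 * (N ^ 2) ^ 2) ^ (2 - r) *
      (C * ((ENNReal.ofReal κ)⁻¹ ^ 2 * (ENNReal.ofReal N)⁻¹ ^ 2)) ^ (r - 1) ≤ E ^ r)
    {f₁ f₂ : ℂ × ℂ → ℂ} (hf₁ : MemLp f₁ 2) (hf₂ : MemLp f₂ 2) (hs₁ : ∀ w, f₁ w ≠ 0 → ‖w - p₁‖ ≤ σ)
    (hs₂ : ∀ w, f₂ w ≠ 0 → ‖w - p₂‖ ≤ σ) {s t : ℂ} (h1 : |(t - s).re| ≤ N ^ 2 / 2) (h2 : |(t - s).im| ≤ N ^ 2 / 2)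
    {g₁ g₂ : Bool × Bool → ℂ × ℂ → ℂ} (hg₁ : ∀ B, MemLp (g₁ B) 2) (hg₂ : ∀ B, MemLp (g₂ B) 2)
    (hgs₁ : ∀ B w, g₁ B w ≠ 0 → ‖w - p₁‖ ≤ σ + 4 / N) (hgs₂ : ∀ B w, g₂ B w ≠ 0 → ‖w - p₂‖ ≤ σ + 4 / N)
    (hgf₁ : (fun w => ∑ B, g₁ B w) =ᵐ[volume] f₁) (hgf₂ : (fun w => ∑ B, g₂ B w) =ᵐ[volume] f₂)
    (hgn₁ : ∑ B, ∫⁻ w, ‖g₁ B w‖ₑ ^ 2 ≤ ∫⁻ w, ‖f₁ w‖ₑ ^ 2) (hgn₂ : ∑ B, ∫⁻ w, ‖g₂ B w‖ₑ ^ 2 ≤ ∫⁻ w, ‖f₂ w‖ₑ ^ 2)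
    (ho₁ : ∀ B B', B' ≠ B → ∫⁻ z in (csq s (N ^ 2) ∩ quad t B ∩ offCross t (κ * N ^ 2)) ×ˢ Set.univ,
      ‖EE (g₁ B') z.1 z.2 * EE f₂ z.1 z.2‖ₑ ^ 2 ≤ C * ((ENNReal.ofReal κ)⁻¹ ^ 2 * (ENNReal.ofReal N)⁻¹ ^ 2) *
        ((∫⁻ w, ‖f₁ w‖ₑ ^ 2) * ∫⁻ w, ‖f₂ w‖ₑ ^ 2))
    (ho₂ : ∀ B B', B' ≠ B → ∫⁻ z in (csq s (N ^ 2) ∩ quad t B ∩ offCross t (κ * N ^ 2)) ×ˢ Set.univ,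
      ‖EE (g₁ B) z.1 z.2 * EE (g₂ B') z.1 z.2‖ₑ ^ 2 ≤ C * ((ENNReal.ofReal κ)⁻¹ ^ 2 * (ENNReal.ofReal N)⁻¹ ^ 2) *
        ((∫⁻ w, ‖f₁ w‖ₑ ^ 2) * ∫⁻ w, ‖f₂ w‖ₑ ^ 2)) :
    ∫⁻ z in (csq s (N ^ 2) ∩ offCross t (κ * N ^ 2)) ×ˢ Set.univ, ‖EE f₁ z.1 z.2 * EE f₂ z.1 z.2‖ₑ ^ r ≤
      ((A + 24 * E) * ((∫⁻ w, ‖f₁ w‖ₑ ^ 2) * ∫⁻ w, ‖f₂ w‖ₑ ^ 2) ^ (1 / 2 : ℝ)) ^ r := by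
  have r0 : 0 < r := by linarith
  have if₁ := integrable_of_near hf₁ hs₁
  have if₂ := integrable_of_near hf₂ hs₂
  have ig₁ := fun B => integrable_of_near (hg₁ B) (hgs₁ B)
  have ig₂ := fun B => integrable_of_near (hg₂ B) (hgs₂ B)
  have e₁ : ∀ z : ℂ × ℂ × ℂ, EE f₁ z.1 z.2 = ∑ B, EE (g₁ B) z.1 z.2 := fun z => by
    rw [← EE_congr_ae hgf₁, EE_sum _ fun B _ => ig₁ B]
  have e₂ : ∀ z : ℂ × ℂ × ℂ, EE f₂ z.1 z.2 = ∑ B, EE (g₂ B) z.1 z.2 := fun z => by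
    rw [← EE_congr_ae hgf₂, EE_sum _ fun B _ => ig₂ B]
  obtain ⟨L, hL⟩ : ∃ L, L = C * ((ENNReal.ofReal κ)⁻¹ ^ 2 * (ENNReal.ofReal N)⁻¹ ^ 2) := ⟨_, rfl⟩
  obtain ⟨X, hX⟩ : ∃ X : Bool × Bool → Set ℂ, X = fun B => csq s (N ^ 2) ∩ quad t B ∩ offCross t (κ * N ^ 2) := ⟨_, rfl⟩
  have hXv : ∀ B, volume (X B) ≤ ENNReal.ofReal (16 * (N ^ 2) ^ 2) := fun B => by
    rw [hX]
    exact (measure_mono (Set.inter_subset_left.trans Set.inter_subset_left)).trans (volume_csq_le s _)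
  have hXU : csq s (N ^ 2) ∩ offCross t (κ * N ^ 2) = ⋃ B, X B := by
    rw [hX, ← Set.iUnion_inter, ← Set.inter_iUnion, iUnion_quad, Set.inter_univ]
  obtain ⟨n, hn⟩ : ∃ n, n = (∫⁻ w, ‖f₁ w‖ₑ ^ 2) * ∫⁻ w, ‖f₂ w‖ₑ ^ 2 := ⟨_, rfl⟩
  have hEn : ∀ {I : ℝ≥0∞}, I ≤ ENNReal.ofReal (16 * (N ^ 2) ^ 2) ^ (2 - r) * L ^ (r - 1) * n ^ (r / 2) →
      I ≤ (E * n ^ (1 / 2 : ℝ)) ^ r := fun {I} h => by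
    rw [← hL] at hE
    refine h.trans ((mul_le_mul_left hE _).trans (le_of_eq ?_))
    rw [ENNReal.mul_rpow_of_nonneg _ _ r0.le, ← ENNReal.rpow_mul]
    congr 2
    ring
  have b₁ : ∀ B, ∫⁻ w, ‖g₁ B w‖ₑ ^ 2 ≤ ∫⁻ w, ‖f₁ w‖ₑ ^ 2 := fun B =>
    (Finset.single_le_sum (f := fun B => ∫⁻ w, ‖g₁ B w‖ₑ ^ 2) (fun _ _ => zero_le) (Finset.mem_univ B)).trans hgn₁
  have b₂ : ∀ B, ∫⁻ w, ‖g₂ B w‖ₑ ^ 2 ≤ ∫⁻ w, ‖f₂ w‖ₑ ^ 2 := fun B =>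
    (Finset.single_le_sum (f := fun B => ∫⁻ w, ‖g₂ B w‖ₑ ^ 2) (fun _ _ => zero_le) (Finset.mem_univ B)).trans hgn₂
  rw [← hn] at ho₁ ho₂ ⊢
  rw [← hL] at ho₁ ho₂
  have loc : ∀ B, ∫⁻ z in X B ×ˢ Set.univ, ‖EE f₁ z.1 z.2 * EE f₂ z.1 z.2‖ₑ ^ r ≤
      (A * ((∫⁻ w, ‖g₁ B w‖ₑ ^ 2) * ∫⁻ w, ‖g₂ B w‖ₑ ^ 2) ^ (1 / 2 : ℝ) + 6 * (E * n ^ (1 / 2 : ℝ))) ^ r := fun B => by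
    rw [← eLpNorm_ofReal_le_iff r0]
    have hsplit := eLpNorm_sum_mul_sum_le (μ := volume.restrict (X B ×ˢ (Set.univ : Set (ℂ × ℂ))))
      (G₁ := fun B z => EE (g₁ B) z.1 z.2) (G₂ := fun B z => EE (g₂ B) z.1 z.2)
      (fun B => (continuous_EE_comp (ig₁ B)).aestronglyMeasurable)
      (fun B => (continuous_EE_comp (ig₂ B)).aestronglyMeasurable) (p := ENNReal.ofReal r) (by simpa using r1) B
    simp only [← e₁, ← e₂] at hsplit
    refine hsplit.trans (add_le_add ?_ ?_)
    · rw [eLpNorm_ofReal_le_iff r0]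
      obtain ⟨s', hs'⟩ := exists_csq_of_quad h1 h2 B
      refine le_trans (lintegral_mono_set (Set.prod_mono ?_ subset_rfl))
        (hA (g₁ B) (g₂ B) (hg₁ B) (hg₂ B) (hgs₁ B) (hgs₂ B) s')
      rw [hX]
      exact Set.inter_subset_left.trans hs'
    · have c3 : (Finset.univ.erase B).card = 3 := by
        rw [Finset.card_erase_of_mem (Finset.mem_univ B)]; rfl
      refine (Finset.sum_le_card_nsmul _ _ (E * n ^ (1 / 2 : ℝ) + E * n ^ (1 / 2 : ℝ)) fun B' hB' => ?_).trans
        (le_of_eq ?_)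
      · have hB'' := Finset.ne_of_mem_erase hB'
        refine add_le_add ?_ ?_
        · rw [eLpNorm_ofReal_le_iff r0]
          refine hEn (lintegral_EE_mul_rpow_le (hg₁ B') (ig₁ B') hf₂ if₂ r1 r2 (hXv B) ?_ ?_)
          · rw [hn]; exact mul_le_mul_left (b₁ B') _
          · rw [hX]; exact ho₁ B B' hB''
        · rw [eLpNorm_ofReal_le_iff r0]
          refine hEn (lintegral_EE_mul_rpow_le (hg₁ B) (ig₁ B) (hg₂ B') (ig₂ B') r1 r2 (hXv B) ?_ ?_)
          · rw [hn]; exact mul_le_mul' (b₁ B) (b₂ B')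
          · rw [hX]; exact ho₂ B B' hB''
      · rw [c3, nsmul_eq_mul]
        push_cast
        ring
  have hXU' : (csq s (N ^ 2) ∩ offCross t (κ * N ^ 2)) ×ˢ (Set.univ : Set (ℂ × ℂ)) = ⋃ B, X B ×ˢ Set.univ := by
    rw [hXU, Set.iUnion_prod_const]
  rw [hXU']
  refine (lintegral_iUnion_le _ _).trans ?_
  rw [tsum_fintype]
  refine (Finset.sum_le_sum fun B _ => loc B).trans ((sum_rpow_le _ _ r1).trans (ENNReal.rpow_le_rpow ?_ r0.le))
  rw [Finset.sum_add_distrib, ← Finset.mul_sum, add_mul, Finset.sum_const, Finset.card_univ]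
  refine add_le_add (mul_le_mul_right ((sum_sqrt_mul_le _ _ _).trans
    (ENNReal.rpow_le_rpow (by rw [hn]; exact mul_le_mul' hgn₁ hgn₂) (by norm_num))) _) (le_of_eq ?_)
  have c4 : Fintype.card (Bool × Bool) = 4 := rfl
  rw [c4, nsmul_eq_mul]
  push_cast
  ring

/-- The `j`-th of `J` equally spaced points on the diagonal of the square centred at `s`. -/
def diagPt (s : ℂ) (R : ℝ) (J j : ℕ) : ℂ := s + ⟨-(R / 2) + j * (R / J), -(R / 2) + j * (R / J)⟩

theorem card_near_le_one {R x : ℝ} (hR : 0 < R) {J : ℕ} (hJ : 0 < J) :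
    ((Finset.range J).filter fun j : ℕ => |x - (-(R / 2) + j * (R / J))| < R / (4 * J)).card ≤ 1 := by
  rw [Finset.card_le_one]
  intro a ha b hb
  simp only [Finset.mem_filter, abs_lt] at ha hb
  have hJ' : (0 : ℝ) < J := by exact_mod_cast hJ
  have e : R / (4 * J) = (R / J) / 4 := by field_simp
  have hd : 0 < R / J := by positivity
  rw [e] at ha hb
  generalize R / (J : ℝ) = d at *
  by_contra hab
  rcases lt_or_gt_of_ne hab with h | h
  · have : (a : ℝ) + 1 ≤ b := by exact_mod_cast h
    nlinarith [ha.2.1, ha.2.2, hb.2.1, hb.2.2]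
  · have : (b : ℝ) + 1 ≤ a := by exact_mod_cast h
    nlinarith [ha.2.1, ha.2.2, hb.2.1, hb.2.2]

open Classical in
theorem le_card_offCross {R : ℝ} (hR : 0 < R) {J : ℕ} (hJ : 0 < J) (s c : ℂ) :
    J - 2 ≤ ((Finset.range J).filter fun j => c ∈ offCross (diagPt s R J j) (R / (4 * J))).card := by
  have h1 := card_near_le_one (x := (c - s).re) hR hJ
  have h2 := card_near_le_one (x := (c - s).im) hR hJ
  have h3 : Finset.range J ⊆ ((Finset.range J).filter fun j => c ∈ offCross (diagPt s R J j) (R / (4 * J))) ∪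
      (((Finset.range J).filter fun j : ℕ => |(c - s).re - (-(R / 2) + j * (R / J))| < R / (4 * J)) ∪
      (Finset.range J).filter fun j : ℕ => |(c - s).im - (-(R / 2) + j * (R / J))| < R / (4 * J)) := by
    intro j hj
    simp only [Finset.mem_union, Finset.mem_filter, hj, true_and]
    simp only [offCross, diagPt, Set.mem_ofPred_eq]
    simp only [← sub_sub, Complex.sub_re, Complex.sub_im]
    by_contra hn
    push Not at hn
    exact absurd hn.2.2 (not_le.2 (hn.1 hn.2.1))
  have h4 := (Finset.card_le_card h3).trans ((Finset.card_union_le _ _).trans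
    (add_le_add le_rfl (Finset.card_union_le _ _)))
  rw [Finset.card_range] at h4
  omega

theorem lintegral_le_sum_offCross {R : ℝ} (hR : 0 < R) {J : ℕ} (hJ : 0 < J) (s : ℂ) {Φ : ℂ × ℂ × ℂ → ℝ≥0∞}
    (hΦ : Measurable Φ) {Q : Set ℂ} :
    ((J - 2 : ℕ) : ℝ≥0∞) * ∫⁻ z in Q ×ˢ Set.univ, Φ z ≤
      ∑ j ∈ Finset.range J, ∫⁻ z in (Q ∩ offCross (diagPt s R J j) (R / (4 * J))) ×ˢ Set.univ, Φ z := by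
  classical
  have hm : ∀ {X : Set ℂ}, MeasurableSet X → MeasurableSet (X ×ˢ (Set.univ : Set (ℂ × ℂ))) := fun hX =>
    hX.prod MeasurableSet.univ
  have e : ∀ j, ∫⁻ z in (Q ∩ offCross (diagPt s R J j) (R / (4 * J))) ×ˢ Set.univ, Φ z =
      ∫⁻ z in Q ×ˢ Set.univ, (offCross (diagPt s R J j) (R / (4 * J)) ×ˢ Set.univ).indicator Φ z := fun j => by
    rw [lintegral_indicator (hm (measurableSet_offCross _ _)), Measure.restrict_restrict (hm (measurableSet_offCross _ _)),
      Set.prod_inter_prod, Set.univ_inter, Set.inter_comm]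
  simp only [e]
  rw [← lintegral_finsetSum _ fun j _ => hΦ.indicator (hm (measurableSet_offCross _ _)), ← lintegral_const_mul _ hΦ]
  refine lintegral_mono fun z => ?_
  calc ((J - 2 : ℕ) : ℝ≥0∞) * Φ z ≤
      (((Finset.range J).filter fun j => z.1 ∈ offCross (diagPt s R J j) (R / (4 * J))).card : ℝ≥0∞) * Φ z := by
        gcongr; exact le_card_offCross hR hJ s z.1
    _ = _ := by
        rw [Finset.card_filter]
        push_cast
        rw [Finset.sum_mul]
        refine Finset.sum_congr rfl fun j _ => ?_
        by_cases h : z.1 ∈ offCross (diagPt s R J j) (R / (4 * J)) <;> simp [Set.indicator, h]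

theorem abs_diagPt_sub_le {R : ℝ} (hR : 0 < R) {J j : ℕ} (hj : j < J) (s : ℂ) :
    |(diagPt s R J j - s).re| ≤ R / 2 ∧ |(diagPt s R J j - s).im| ≤ R / 2 := by
  have hJ' : (0 : ℝ) < J := by exact_mod_cast (Nat.zero_le j).trans_lt hj
  have h : (j : ℝ) * (R / J) ≤ R := by
    rw [mul_div_assoc', div_le_iff₀ hJ', mul_comm]
    have : (j : ℝ) ≤ J := by exact_mod_cast hj.le
    gcongr
  have h0 : 0 ≤ (j : ℝ) * (R / J) := by positivity
  simp only [diagPt, add_sub_cancel_left, abs_le]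
  refine ⟨⟨?_, ?_⟩, ?_, ?_⟩ <;> linarith

theorem exists_bil_step {ρ : ℝ} (hρ : 0 < ρ) : ∃ C : ℝ≥0∞, C ≠ ∞ ∧ ∀ {N σ r : ℝ} {J : ℕ}, 1 ≤ N → 1 ≤ ρ * N → 4 ≤ J →
    8 * (J : ℝ) ≤ N → σ + 4 / N ≤ 2 * ρ → ∀ {p₁ p₂ : ℂ × ℂ}, ‖p₁‖ + 2 * ρ ≤ 1 → ‖p₂‖ + 2 * ρ ≤ 1 →
    68 * ρ ≤ ‖(p₂ - p₁).1‖ → 68 * ρ ≤ ‖(p₂ - p₁).2‖ → 1 ≤ r → r ≤ 2 → ∀ {A E : ℝ≥0∞},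
    Bil p₁ p₂ r (σ + 4 / N) (3 * N ^ 2 / 4) A →
    ENNReal.ofReal (16 * (N ^ 2) ^ 2) ^ (2 - r) *
      (C * ((ENNReal.ofReal (1 / (4 * J)))⁻¹ ^ 2 * (ENNReal.ofReal N)⁻¹ ^ 2)) ^ (r - 1) ≤ E ^ r →
    Bil p₁ p₂ r σ (N ^ 2) ((1 + 4 * (J : ℝ≥0∞)⁻¹) * (A + 24 * E)) := by
  obtain ⟨C, hC, H⟩ := exists_pair_split hρ
  refine ⟨C, hC, ?_⟩
  intro N σ r J hN hρN hJ hJN hσ p₁ p₂ hp₁ hp₂ hs1 hs2 r1 r2 A E hA hE f₁ f₂ hf₁ hf₂ hs₁ hs₂ s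
  have hJ' : (0 : ℝ) < J := by exact_mod_cast (by omega : 0 < J)
  have hN2 : 0 < N ^ 2 := by positivity
  obtain ⟨X, hX⟩ : ∃ X, X = (A + 24 * E) * ((∫⁻ w, ‖f₁ w‖ₑ ^ 2) * ∫⁻ w, ‖f₂ w‖ₑ ^ 2) ^ (1 / 2 : ℝ) := ⟨_, rfl⟩
  have if₁ := integrable_of_near hf₁ hs₁
  have if₂ := integrable_of_near hf₂ hs₂
  have hcr : N ^ 2 / (4 * J) = 1 / (4 * J) * N ^ 2 := by ring
  have shift : ∀ j ∈ Finset.range J, ∫⁻ z in (csq s (N ^ 2) ∩ offCross (diagPt s (N ^ 2) J j) (N ^ 2 / (4 * J))) ×ˢ Set.univ,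
      ‖EE f₁ z.1 z.2 * EE f₂ z.1 z.2‖ₑ ^ r ≤ X ^ r := fun j hj => by
    obtain ⟨h1, h2⟩ := abs_diagPt_sub_le hN2 (Finset.mem_range.1 hj) s
    generalize diagPt s (N ^ 2) J j = t at *
    obtain ⟨g₁, g₂, hg₁, hg₂, hgs₁, hgs₂, hgf₁, hgf₂, hgn₁, hgn₂, ho₁, ho₂⟩ := H (κ := 1 / (4 * J)) hN hρN
      (by positivity) (by rw [div_mul_eq_mul_div, one_mul, le_div_iff₀ (by positivity)]; linarith) hσ hp₁ hp₂ hs1 hs2 s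
      (P := quad t) (X := fun B => csq s (N ^ 2) ∩ quad t B ∩ offCross t (1 / (4 * J) * N ^ 2)) (measurableSet_quad t)
      (fun B => ((measurableSet_csq _ _).inter (measurableSet_quad t B)).inter (measurableSet_offCross _ _))
      (disjoint_quad t) (iUnion_quad t) (fun B c hc => norm_sub_le_of_mem_csq hc.1.1)
      (fun B B' hB c hc c' hc' => le_norm_sub_of_quad hB hc.2 hc.1.2 hc') hf₁ hf₂ hs₁ hs₂
    rw [hX, hcr]
    exact bil_offCross r1 r2 hA hE hf₁ hf₂ hs₁ hs₂ h1 h2 hg₁ hg₂ hgs₁ hgs₂ hgf₁ hgf₂ hgn₁ hgn₂ ho₁ ho₂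
  have hm : Measurable fun z : ℂ × ℂ × ℂ => ‖EE f₁ z.1 z.2 * EE f₂ z.1 z.2‖ₑ ^ r :=
    ((continuous_EE_comp if₁).mul (continuous_EE_comp if₂)).enorm.measurable.pow_const r
  have h := (lintegral_le_sum_offCross hN2 (by omega : 0 < J) s hm).trans
    (Finset.sum_le_card_nsmul _ _ _ shift)
  rw [Finset.card_range, nsmul_eq_mul] at h
  rw [mul_assoc, ← hX, ENNReal.mul_rpow_of_nonneg _ _ (by linarith)]
  have hJ0 : (J : ℝ≥0∞) ≠ 0 := by exact_mod_cast (by omega : J ≠ 0)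
  have hj0 : ((J - 2 : ℕ) : ℝ≥0∞) ≠ 0 := by exact_mod_cast (by omega : J - 2 ≠ 0)
  have k1 : (J : ℝ≥0∞) ≤ ((J - 2 : ℕ) : ℝ≥0∞) * (1 + 4 * (J : ℝ≥0∞)⁻¹) := by
    obtain ⟨m, rfl⟩ : ∃ m, J = m + 2 := ⟨J - 2, by omega⟩
    have hm2 : (2 : ℝ≥0∞) ≤ m := by exact_mod_cast (by omega : 2 ≤ m)
    rw [Nat.add_sub_cancel, ← ENNReal.mul_le_mul_iff_left hJ0 (ENNReal.natCast_ne_top _), mul_assoc, add_mul, mul_assoc,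
      ENNReal.inv_mul_cancel hJ0 (ENNReal.natCast_ne_top _)]
    have : (m + 2) * (m + 2) ≤ m * (1 * (m + 2) + 4 * 1) := by nlinarith [(by omega : 2 ≤ m)]
    exact_mod_cast this
  have k2 : (1 + 4 * (J : ℝ≥0∞)⁻¹) ≤ (1 + 4 * (J : ℝ≥0∞)⁻¹) ^ r := by
    conv_lhs => rw [← ENNReal.rpow_one (1 + 4 * (J : ℝ≥0∞)⁻¹)]
    exact ENNReal.rpow_le_rpow_of_exponent_le (by simp) r1
  rw [← ENNReal.mul_le_mul_iff_right hj0 (ENNReal.natCast_ne_top _)]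
  refine h.trans ?_
  rw [← mul_assoc]
  exact mul_le_mul_left (k1.trans (mul_le_mul_right k2 _)) _

theorem lintegral_enorm_sq_le_of_near {f : ℂ × ℂ → ℂ} (hf : AEStronglyMeasurable f volume) {p : ℂ × ℂ} {σ : ℝ}
    (hs : ∀ w, f w ≠ 0 → ‖w - p‖ ≤ σ) :
    (∫⁻ w, ‖f w‖ₑ) ^ 2 ≤ volume (Metric.closedBall p σ) * ∫⁻ w, ‖f w‖ₑ ^ 2 := by
  have h0 : Function.support (fun w => ‖f w‖ₑ) ⊆ Metric.closedBall p σ := fun w hw => by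
    rw [mem_closedBall_iff_norm]
    exact hs w (by simpa using hw)
  have := ENNReal.lintegral_mul_norm_pow_le (μ := volume.restrict (Metric.closedBall p σ))
    (f := fun _ => 1) (g := fun w => ‖f w‖ₑ ^ 2) aemeasurable_const (hf.enorm.pow_const 2).restrict
    (p := 1 / 2) (q := 1 / 2) (by norm_num) (by norm_num) (by norm_num)
  have e : ∀ x : ℝ≥0∞, (x ^ 2) ^ (1 / 2 : ℝ) = x := fun x => by
    rw [← ENNReal.rpow_natCast, ← ENNReal.rpow_mul]; norm_num
  have e' : ∀ x : ℝ≥0∞, (x ^ (1 / 2 : ℝ)) ^ 2 = x := fun x => by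
    rw [← ENNReal.rpow_natCast, ← ENNReal.rpow_mul]; norm_num
  simp only [e, ENNReal.one_rpow, one_mul, lintegral_one, Measure.restrict_apply_univ] at this
  rw [← setLIntegral_eq_of_support_subset h0]
  refine (pow_le_pow_left' this 2).trans ?_
  rw [mul_pow, e', e']
  exact mul_le_mul_right (setLIntegral_le_lintegral _ _) _

theorem Bil.mono {p₁ p₂ : ℂ × ℂ} {r σ σ' R : ℝ} {A A' : ℝ≥0∞} (r0 : 0 ≤ r) (hσ : σ' ≤ σ) (hA : A ≤ A')
    (h : Bil p₁ p₂ r σ R A) : Bil p₁ p₂ r σ' R A' := fun f₁ f₂ h₁ h₂ s₁ s₂ s =>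
  (h f₁ f₂ h₁ h₂ (fun w hw => (s₁ w hw).trans hσ) (fun w hw => (s₂ w hw).trans hσ) s).trans
    (ENNReal.rpow_le_rpow (mul_le_mul_left hA _) r0)

theorem exists_bil_base (p₁ p₂ : ℂ × ℂ) {r : ℝ} (r1 : 1 ≤ r) (r2 : r ≤ 2) (σ R : ℝ) :
    ∃ A : ℝ≥0∞, A ≠ ∞ ∧ Bil p₁ p₂ r σ R A := by
  have r0 : 0 < r := by linarith
  obtain ⟨V, hV⟩ : ∃ V, V = ENNReal.ofReal (16 * R ^ 2) := ⟨_, rfl⟩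
  obtain ⟨b, hb⟩ : ∃ b, b = volume (Metric.closedBall p₁ σ) := ⟨_, rfl⟩
  have hVt : V ≠ ∞ := hV ▸ ENNReal.ofReal_ne_top
  have hbt : b ≠ ∞ := by rw [hb]; exact measure_closedBall_lt_top.ne
  have hfin : V ^ (2 - r) * (b * V) ^ (r - 1) ≠ ∞ := ENNReal.mul_ne_top (ENNReal.rpow_ne_top_of_nonneg (by linarith) hVt)
    (ENNReal.rpow_ne_top_of_nonneg (by linarith) (ENNReal.mul_ne_top hbt hVt))
  refine ⟨(V ^ (2 - r) * (b * V) ^ (r - 1)) ^ (1 / r), ENNReal.rpow_ne_top_of_nonneg (by positivity) hfin, ?_⟩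
  intro f₁ f₂ h₁ h₂ s₁ s₂ s
  have i₁ := integrable_of_near h₁ s₁
  have i₂ := integrable_of_near h₂ s₂
  have hvs : volume (csq s R) ≤ V := hV ▸ volume_csq_le s R
  refine (lintegral_EE_mul_rpow_le h₁ i₁ h₂ i₂ r1 r2 (L := b * V) hvs le_rfl ?_).trans (le_of_eq ?_)
  · calc ∫⁻ z in csq s R ×ˢ Set.univ, ‖EE f₁ z.1 z.2 * EE f₂ z.1 z.2‖ₑ ^ 2 ≤
        ∫⁻ z in csq s R ×ˢ Set.univ, (b * ∫⁻ w, ‖f₁ w‖ₑ ^ 2) * ‖EE f₂ z.1 z.2‖ₑ ^ 2 := by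
          refine lintegral_mono fun z => ?_
          rw [enorm_mul, mul_pow]
          gcongr
          rw [hb]
          exact (pow_le_pow_left' (enorm_EE_le f₁ z.1 z.2) 2).trans
            (lintegral_enorm_sq_le_of_near h₁.aestronglyMeasurable s₁)
      _ = (b * ∫⁻ w, ‖f₁ w‖ₑ ^ 2) * (volume (csq s R) * ∫⁻ w, ‖f₂ w‖ₑ ^ 2) := by
          rw [lintegral_const_mul _ ((continuous_EE_comp i₂).enorm.measurable.pow_const 2), lintegral_EE_sq_prod h₂ i₂]
      _ ≤ (b * ∫⁻ w, ‖f₁ w‖ₑ ^ 2) * (V * ∫⁻ w, ‖f₂ w‖ₑ ^ 2) := by gcongr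
      _ = _ := by ring
  · rw [ENNReal.mul_rpow_of_nonneg _ _ r0.le, ← ENNReal.rpow_mul, ← ENNReal.rpow_mul, one_div_mul_cancel r0.ne',
      ENNReal.rpow_one]
    congr 2
    ring

theorem bil_of_steps {P : ℕ → ℝ≥0∞ → Prop} (mono : ∀ k A A', A ≤ A' → P k A → P k A') {x y : ℝ} (hx0 : 0 ≤ x) (hx : x < 1)
    (hy0 : 0 ≤ y) (hy : y < 1) {V A₀ : ℝ≥0∞} (hV : V ≠ ∞) (hA₀ : A₀ ≠ ∞) (h0 : P 0 A₀)
    (step : ∀ k A, P k A → P (k + 1) ((1 + ENNReal.ofReal (4 * x ^ k)) * (A + V * ENNReal.ofReal (y ^ k)))) :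
    ∃ A : ℝ≥0∞, A ≠ ∞ ∧ ∀ k, P k A := by
  have key : ∀ k, P k ((∏ j ∈ Finset.range k, (1 + ENNReal.ofReal (4 * x ^ j))) *
      (A₀ + ∑ j ∈ Finset.range k, V * ENNReal.ofReal (y ^ j))) := fun k => by
    induction k with
    | zero => simpa using h0
    | succ k ih =>
      refine mono _ _ _ ?_ (step k _ ih)
      have h1 : 1 ≤ ∏ j ∈ Finset.range k, (1 + ENNReal.ofReal (4 * x ^ j)) :=
        Finset.one_le_prod'' fun j => by simp
      have h2 := mul_le_mul_left h1 (V * ENNReal.ofReal (y ^ k))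
      rw [one_mul] at h2
      rw [Finset.prod_range_succ, Finset.sum_range_succ, ← add_assoc]
      refine (mul_le_mul_right (add_le_add le_rfl h2) _).trans (le_of_eq ?_)
      ring
  refine ⟨ENNReal.ofReal (Real.exp (4 * (1 - x)⁻¹)) * (A₀ + V * ENNReal.ofReal ((1 - y)⁻¹)), ?_, fun k =>
    mono _ _ _ (mul_le_mul' ?_ (add_le_add le_rfl ?_)) (key k)⟩
  · exact ENNReal.mul_ne_top ENNReal.ofReal_ne_top (ENNReal.add_ne_top.2 ⟨hA₀, ENNReal.mul_ne_top hV ENNReal.ofReal_ne_top⟩)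
  · have e : ∀ j, 1 + ENNReal.ofReal (4 * x ^ j) = ENNReal.ofReal (1 + 4 * x ^ j) := fun j => by
      rw [ENNReal.ofReal_add zero_le_one (by positivity), ENNReal.ofReal_one]
    simp only [e]
    rw [← ENNReal.ofReal_prod_of_nonneg fun j _ => by positivity]
    refine ENNReal.ofReal_le_ofReal ((Real.prod_one_add_le_exp_sum _ fun j => by positivity).trans (Real.exp_le_exp.2 ?_))
    rw [← Finset.mul_sum]
    gcongr
    exact (tsum_geometric_of_lt_one hx0 hx) ▸ (summable_geometric_of_lt_one hx0 hx).sum_le_tsum _ fun _ _ => by positivity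
  · rw [← Finset.mul_sum, ← ENNReal.ofReal_sum_of_nonneg fun j _ => by positivity]
    gcongr
    exact (tsum_geometric_of_lt_one hy0 hy) ▸ (summable_geometric_of_lt_one hy0 hy).sum_le_tsum _ fun _ _ => by positivity


theorem error_const_le {r b η : ℝ} (hb : 0 < b) {C N₀ : ℝ} (hC : 0 ≤ C) (hN₀ : 0 < N₀)
    (r1 : 1 ≤ r) {J k : ℕ} (hJ : (J : ℝ) ≤ 5 * (b ^ η) ^ k) {N : ℝ} (hN : N = N₀ * (b ^ (1 / 2 : ℝ)) ^ k) :
    (16 * (N ^ 2) ^ 2) ^ (2 - r) * (C * ((4 * J) ^ 2 * N⁻¹ ^ 2)) ^ (r - 1) ≤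
      ((16 * (N₀ ^ 2) ^ 2) ^ (2 - r) * (C * (400 * N₀⁻¹ ^ 2)) ^ (r - 1)) * (b ^ (5 - 3 * r + 2 * η * (r - 1))) ^ k := by
  have hN2 : N ^ 2 = N₀ ^ 2 * b ^ (k : ℝ) := by
    rw [hN, mul_pow, ← pow_mul, ← Real.rpow_natCast _ (k * 2), ← Real.rpow_mul hb.le]
    congr 2
    push_cast
    ring
  have hJ2 : (4 * J : ℝ) ^ 2 ≤ 400 * b ^ (2 * η * k) := by
    calc (4 * J : ℝ) ^ 2 ≤ (4 * (5 * (b ^ η) ^ k)) ^ 2 := by gcongr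
      _ = 400 * ((b ^ η) ^ k) ^ 2 := by ring
      _ = _ := by
        rw [← pow_mul, ← Real.rpow_natCast, ← Real.rpow_mul hb.le]
        congr 2
        push_cast
        ring
  have e1 : (16 * (N ^ 2) ^ 2) ^ (2 - r) = (16 * (N₀ ^ 2) ^ 2) ^ (2 - r) * b ^ (2 * (2 - r) * k) := by
    rw [hN2, mul_pow, ← mul_assoc, Real.mul_rpow (by positivity) (by positivity), ← Real.rpow_natCast (b ^ (k : ℝ)),
      ← Real.rpow_mul hb.le, ← Real.rpow_mul hb.le]
    congr 2
    push_cast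
    ring
  have e2 : (C * ((4 * J) ^ 2 * N⁻¹ ^ 2)) ^ (r - 1) ≤ (C * (400 * N₀⁻¹ ^ 2)) ^ (r - 1) * b ^ ((2 * η - 1) * (r - 1) * k) := by
    rw [inv_pow, hN2, mul_inv, ← Real.rpow_neg hb.le]
    calc (C * ((4 * J) ^ 2 * ((N₀ ^ 2)⁻¹ * b ^ (-(k : ℝ))))) ^ (r - 1) ≤
          (C * (400 * b ^ (2 * η * k) * ((N₀ ^ 2)⁻¹ * b ^ (-(k : ℝ))))) ^ (r - 1) := by gcongr
      _ = (C * (400 * N₀⁻¹ ^ 2) * (b ^ (2 * η * k) * b ^ (-(k : ℝ)))) ^ (r - 1) := by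
        congr 1; rw [inv_pow]; ring
      _ = _ := by
        rw [← Real.rpow_add hb, Real.mul_rpow (by positivity) (by positivity), ← Real.rpow_mul hb.le]
        congr 2
        ring
  rw [e1]
  calc _ ≤ (16 * (N₀ ^ 2) ^ 2) ^ (2 - r) * b ^ (2 * (2 - r) * k) *
        ((C * (400 * N₀⁻¹ ^ 2)) ^ (r - 1) * b ^ ((2 * η - 1) * (r - 1) * k)) := by gcongr
    _ = ((16 * (N₀ ^ 2) ^ 2) ^ (2 - r) * (C * (400 * N₀⁻¹ ^ 2)) ^ (r - 1)) *
        (b ^ (2 * (2 - r) * k) * b ^ ((2 * η - 1) * (r - 1) * k)) := by ring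
    _ = _ := by
      rw [← Real.rpow_add hb, ← Real.rpow_natCast _ k, ← Real.rpow_mul hb.le]
      congr 2
      ring

theorem csq_mono (s : ℂ) {R R' : ℝ} (h : R ≤ R') : csq s R ⊆ csq s R' := fun _ hc => ⟨hc.1.trans h, hc.2.trans h⟩

set_option maxHeartbeats 1000000 in
theorem exists_bil_uniform {ρ r : ℝ} (hρ : 0 < ρ) (hr : 5 / 3 < r) (r2 : r < 2) {p₁ p₂ : ℂ × ℂ} (hp₁ : ‖p₁‖ + 2 * ρ ≤ 1)
    (hp₂ : ‖p₂‖ + 2 * ρ ≤ 1) (hs1 : 68 * ρ ≤ ‖(p₂ - p₁).1‖) (hs2 : 68 * ρ ≤ ‖(p₂ - p₁).2‖) :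
    ∃ A : ℝ≥0∞, A ≠ ∞ ∧ ∀ k : ℕ, Bil p₁ p₂ r ρ (k : ℝ) A := by
  have r0 : 0 < r := by linarith
  obtain ⟨C, hC, H⟩ := exists_bil_step hρ
  obtain ⟨b, hb⟩ : ∃ b : ℝ, b = 4 / 3 := ⟨_, rfl⟩
  obtain ⟨η, hη⟩ : ∃ η : ℝ, η = (3 * r - 5) / 4 := ⟨_, rfl⟩
  obtain ⟨N₀, hN₀⟩ : ∃ N₀ : ℝ, N₀ = max 40 (36 / ρ) := ⟨_, rfl⟩
  have b1 : 1 < b := by rw [hb]; norm_num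
  have b0 : 0 < b := by linarith
  have hη0 : 0 < η := by rw [hη]; linarith
  have hη2 : η ≤ 1 / 2 := by rw [hη]; linarith
  have hN40 : 40 ≤ N₀ := hN₀ ▸ le_max_left _ _
  have hN36 : 36 ≤ ρ * N₀ := by rw [← div_le_iff₀' hρ, hN₀]; exact le_max_right _ _
  obtain ⟨θ, hθ⟩ : ∃ θ, θ = b ^ η := ⟨_, rfl⟩
  obtain ⟨μ, hμ⟩ : ∃ μ, μ = b ^ (1 / 2 : ℝ) := ⟨_, rfl⟩
  have θ1 : 1 < θ := hθ ▸ Real.one_lt_rpow b1 hη0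
  have θμ : θ ≤ μ := by rw [hθ, hμ]; exact Real.rpow_le_rpow_of_exponent_le b1.le hη2
  have μ2 : μ ^ 2 = 4 / 3 := by rw [hμ, ← Real.rpow_natCast, ← Real.rpow_mul b0.le, hb]; norm_num
  have μ1 : 1 < μ := θ1.trans_le θμ
  obtain ⟨N, hN⟩ : ∃ N : ℕ → ℝ, N = fun k => N₀ * μ ^ k := ⟨_, rfl⟩
  have hNk : ∀ k, N k = N₀ * μ ^ k := fun k => by rw [hN]
  have hNN : ∀ k, N₀ ≤ N k := fun k => by
    rw [hNk]; exact le_mul_of_one_le_right (by linarith) (one_le_pow₀ μ1.le)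
  have hNs : ∀ k, N (k + 1) = N k * μ := fun k => by rw [hNk, hNk, pow_succ, mul_assoc]
  obtain ⟨c, hc⟩ : ∃ c : ℝ, c = (16 * (N₀ ^ 2) ^ 2) ^ (2 - r) * (C.toReal * (400 * N₀⁻¹ ^ 2)) ^ (r - 1) := ⟨_, rfl⟩
  obtain ⟨w, hw⟩ : ∃ w : ℝ, w = b ^ (5 - 3 * r + 2 * η * (r - 1)) := ⟨_, rfl⟩
  have w0 : 0 < w := hw ▸ Real.rpow_pos_of_pos b0 _
  have w1 : w < 1 := by
    rw [hw]; refine Real.rpow_lt_one_of_one_lt_of_neg b1 ?_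
    rw [hη]; nlinarith
  have c0 : 0 ≤ c := by rw [hc]; positivity
  have y0 : 0 ≤ w ^ (1 / r) := by positivity
  have y1 : w ^ (1 / r) < 1 := Real.rpow_lt_one w0.le w1 (by positivity)
  obtain ⟨A₀, hA₀, hB₀⟩ := exists_bil_base p₁ p₂ (by linarith : 1 ≤ r) r2.le (ρ + 32 / N 0) (N 0 ^ 2)
  obtain ⟨A, hA, hB⟩ := bil_of_steps (P := fun k A => Bil p₁ p₂ r (ρ + 32 / N k) (N k ^ 2) A)
    (fun k A A' h hP => hP.mono r0.le le_rfl h) (x := θ⁻¹) (by positivity) (inv_lt_one_of_one_lt₀ θ1) y0 y1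
    (V := 24 * ENNReal.ofReal ((c * w) ^ (1 / r))) (ENNReal.mul_ne_top (by norm_num) ENNReal.ofReal_ne_top) hA₀ hB₀ (by
      intro k A hP
      have hNk0 : 0 < N k := by linarith [hNN k]
      have hNk1 : 0 < N (k + 1) := by linarith [hNN (k + 1)]
      have hNsq : 3 * N (k + 1) ^ 2 / 4 = N k ^ 2 := by rw [hNs, mul_pow, μ2]; ring
      have hσ : ρ + 32 / N (k + 1) + 4 / N (k + 1) ≤ ρ + 32 / N k := by
        have h1 : 9 / 8 ≤ μ := by nlinarith
        have h2 : 36 / N (k + 1) ≤ 32 / N k := by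
          rw [div_le_div_iff₀ hNk1 hNk0, hNs]
          nlinarith
        have h3 : 32 / N (k + 1) + 4 / N (k + 1) = 36 / N (k + 1) := by ring
        linarith
      obtain ⟨J, hJ⟩ : ∃ J : ℕ, J = ⌈θ ^ (k + 1)⌉₊ + 3 := ⟨_, rfl⟩
      have p1 : 1 ≤ θ ^ (k + 1) := one_le_pow₀ θ1.le
      have hJ1 : θ ^ (k + 1) ≤ J := by
        rw [hJ]; push_cast; linarith [Nat.le_ceil (θ ^ (k + 1))]
      have hJ2 : (J : ℝ) ≤ 5 * θ ^ (k + 1) := by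
        rw [hJ]; push_cast; linarith [Nat.ceil_lt_add_one (by linarith : 0 ≤ θ ^ (k + 1))]
      have hJ4 : 4 ≤ J := by
        have : 0 < ⌈θ ^ (k + 1)⌉₊ := Nat.ceil_pos.2 (by linarith)
        omega
      have hJ0 : (0 : ℝ) < J := by linarith
      have h8 : 8 * (J : ℝ) ≤ N (k + 1) := by
        have : θ ^ (k + 1) ≤ μ ^ (k + 1) := by gcongr
        rw [hNk]
        nlinarith [pow_pos (by linarith : 0 < μ) (k + 1)]
      have hρN : 36 ≤ ρ * N (k + 1) := hN36.trans (mul_le_mul_of_nonneg_left (hNN (k + 1)) hρ.le)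
      have hσ2 : ρ + 32 / N (k + 1) + 4 / N (k + 1) ≤ 2 * ρ := by
        have h3 : 32 / N (k + 1) + 4 / N (k + 1) = 36 / N (k + 1) := by ring
        have : 36 / N (k + 1) ≤ ρ := by rwa [div_le_iff₀ hNk1]
        linarith
      have hP' : Bil p₁ p₂ r (ρ + 32 / N (k + 1) + 4 / N (k + 1)) (3 * N (k + 1) ^ 2 / 4) A := by
        rw [hNsq]; exact hP.mono r0.le hσ le_rfl
      refine (H (by linarith [hNN (k + 1)]) (by linarith) hJ4 h8 hσ2 hp₁ hp₂ hs1 hs2 (by linarith) r2.le hP'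
        (E := ENNReal.ofReal ((c * w ^ (k + 1)) ^ (1 / r))) ?_).mono r0.le le_rfl ?_
      · rw [ENNReal.ofReal_rpow_of_nonneg (by positivity) r0.le, ← Real.rpow_mul (by positivity), one_div_mul_cancel r0.ne',
          Real.rpow_one, ← ENNReal.ofReal_inv_of_pos (by positivity), ← ENNReal.ofReal_inv_of_pos hNk1,
          ← ENNReal.ofReal_toReal hC, ← ENNReal.ofReal_pow (by positivity), ← ENNReal.ofReal_pow (by positivity),
          ← ENNReal.ofReal_mul (by positivity), ← ENNReal.ofReal_mul (by positivity),
          ENNReal.ofReal_rpow_of_nonneg (by positivity) (by linarith),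
          ENNReal.ofReal_rpow_of_nonneg (by positivity) (by linarith), ← ENNReal.ofReal_mul (by positivity), one_div, inv_inv]
        refine ENNReal.ofReal_le_ofReal ?_
        rw [hc, hw]
        exact error_const_le b0 ENNReal.toReal_nonneg (by linarith) (by linarith) (hθ ▸ hJ2) (by rw [hNk, hμ])
      · refine mul_le_mul' (add_le_add le_rfl ?_) (add_le_add le_rfl (le_of_eq ?_))
        · rw [← ENNReal.ofReal_natCast, ← ENNReal.ofReal_inv_of_pos hJ0, ← ENNReal.ofReal_ofNat,
            ← ENNReal.ofReal_mul (by norm_num)]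
          refine ENNReal.ofReal_le_ofReal ?_
          rw [inv_pow]
          gcongr
          exact (pow_le_pow_right₀ θ1.le (Nat.le_succ k)).trans hJ1
        · rw [mul_assoc, ← ENNReal.ofReal_mul (by positivity), ← Real.rpow_natCast (w ^ (1 / r)),
            ← Real.rpow_mul w0.le, mul_comm (1 / r), Real.rpow_mul w0.le, Real.rpow_natCast,
            ← Real.mul_rpow (by positivity) (by positivity), show c * w ^ (k + 1) = c * w * w ^ k by ring])
  refine ⟨A, hA, fun m f₁ f₂ h₁ h₂ s₁ s₂ s => ?_⟩
  obtain ⟨k, hk⟩ := pow_unbounded_of_one_lt (m : ℝ) μ1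
  refine (lintegral_mono_set (Set.prod_mono (csq_mono s ?_) subset_rfl)).trans
    (((hB k).mono r0.le (le_add_of_nonneg_right (div_nonneg (by norm_num) (by linarith [hNN k]))) le_rfl) f₁ f₂ h₁ h₂ s₁ s₂ s)
  have h1 := hNN k
  have h2 : μ ^ k ≤ N k := by rw [hNk]; exact le_mul_of_one_le_left (by positivity) (by linarith)
  nlinarith

/-- The bilinear extension estimate for functions supported near two points whose coordinates are both separated. -/
theorem exists_bilinear {ρ r : ℝ} (hρ : 0 < ρ) (hr : 5 / 3 < r) (r2 : r < 2) {p₁ p₂ : ℂ × ℂ} (hp₁ : ‖p₁‖ + 2 * ρ ≤ 1)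
    (hp₂ : ‖p₂‖ + 2 * ρ ≤ 1) (hs1 : 68 * ρ ≤ ‖(p₂ - p₁).1‖) (hs2 : 68 * ρ ≤ ‖(p₂ - p₁).2‖) :
    ∃ A : ℝ≥0∞, A ≠ ∞ ∧ ∀ f₁ f₂ : ℂ × ℂ → ℂ, MemLp f₁ 2 → MemLp f₂ 2 → (∀ w, f₁ w ≠ 0 → ‖w - p₁‖ ≤ ρ) →
      (∀ w, f₂ w ≠ 0 → ‖w - p₂‖ ≤ ρ) → ∫⁻ z : ℂ × ℂ × ℂ, ‖EE f₁ z.1 z.2 * EE f₂ z.1 z.2‖ₑ ^ r ≤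
        (A * ((∫⁻ w, ‖f₁ w‖ₑ ^ 2) * ∫⁻ w, ‖f₂ w‖ₑ ^ 2) ^ (1 / 2 : ℝ)) ^ r := by
  obtain ⟨A, hA, hB⟩ := exists_bil_uniform hρ hr r2 hp₁ hp₂ hs1 hs2
  refine ⟨A, hA, fun f₁ f₂ h₁ h₂ s₁ s₂ => ?_⟩
  have hU : ⋃ k : ℕ, csq 0 (k : ℝ) ×ˢ (Set.univ : Set (ℂ × ℂ)) = Set.univ := by
    refine Set.eq_univ_of_forall fun z => ?_
    obtain ⟨k, hk⟩ := exists_nat_ge ‖z.1‖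
    refine Set.mem_iUnion.2 ⟨k, ⟨?_, trivial⟩⟩
    simp only [csq, sub_zero]
    exact ⟨(Complex.abs_re_le_norm _).trans hk, (Complex.abs_im_le_norm _).trans hk⟩
  rw [← setLIntegral_univ, ← hU, setLIntegral_iUnion_of_directed]
  · exact iSup_le fun k => hB k f₁ f₂ h₁ h₂ s₁ s₂ 0
  · refine Monotone.directed_le fun k l hkl => Set.prod_mono (csq_mono 0 ?_) subset_rfl
    exact_mod_cast hkl

open Classical in
/-- Inclusion–exclusion for a double sum relative to the neighbours of a distinguished index pair. -/
theorem sum_sum_eq_near_far {ι : Type*} [Fintype ι] (P Q : ι → Prop) (F : ι → ι → ℂ) :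
    ∑ i, ∑ j, F i j = ∑ i with P i, ∑ j, F i j + ∑ j with Q j, ∑ i, F i j - ∑ i with P i, ∑ j with Q j, F i j +
      ∑ i with ¬ P i, ∑ j with ¬ Q j, F i j := by
  have h : ∀ i, ∑ j, F i j = ∑ j with Q j, F i j + ∑ j with ¬ Q j, F i j := fun i =>
    (Finset.sum_filter_add_sum_filter_not _ _ _).symm
  rw [Finset.sum_comm (s := Finset.univ.filter Q), ← Finset.sum_filter_add_sum_filter_not Finset.univ P,
    ← Finset.sum_filter_add_sum_filter_not Finset.univ P fun i => ∑ j with Q j, F i j,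
    Finset.sum_congr rfl fun i _ => h i, Finset.sum_congr (s₁ := Finset.univ.filter fun i => ¬ P i) rfl fun i _ => h i]
  simp only [Finset.sum_add_distrib]
  ring

theorem enorm_sum_le_card_mul {ι : Type*} (s : Finset ι) (F : ι → ℂ) {c : ℕ} (hc : s.card ≤ c) {X : ℝ≥0∞}
    (hX : ∀ i ∈ s, ‖F i‖ₑ ≤ X) : ‖∑ i ∈ s, F i‖ₑ ≤ c * X := by
  refine (enorm_sum_le s F).trans ((Finset.sum_le_card_nsmul _ _ _ hX).trans ?_)
  rw [nsmul_eq_mul]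
  gcongr

theorem le_rpow_sum {ι : Type*} [Fintype ι] (x : ι → ℝ≥0∞) {q : ℝ} (hq : 0 < q) (i : ι) :
    x i ≤ (∑ i, x i ^ q) ^ (1 / q) := by
  rw [one_div, ENNReal.le_rpow_inv_iff hq]
  exact Finset.single_le_sum (f := fun i => x i ^ q) (fun _ _ => zero_le) (Finset.mem_univ i)

open Classical in
theorem enorm_sum_sum_rpow_le {ι : Type*} [Fintype ι] [Nonempty ι] (near : ι → ι → Prop) {c : ℕ}
    (hc : ∀ i, (Finset.univ.filter fun i' => near i i').card ≤ c) (F : ι → ι → ℂ) {q : ℝ} (hq : 1 ≤ q) :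
    ‖∑ i, ∑ j, F i j‖ₑ ^ q ≤
      ((c : ℝ≥0∞) ^ 2 + c + 1) ^ q * (4 : ℝ≥0∞) ^ (q - 1) *
        (∑ i, ‖∑ j, F i j‖ₑ ^ q + ∑ j, ‖∑ i, F i j‖ₑ ^ q + ∑ i, ∑ j, ‖F i j‖ₑ ^ q) +
      ((Fintype.card ι : ℝ≥0∞) ^ 2) ^ (q + q / 2) *
        ∑ i, ∑ j, ∑ i', ∑ j', if ¬ near i i' ∧ ¬ near j j' then ‖F i j * F i' j'‖ₑ ^ (q / 2) else 0 := by
  have q0 : 0 < q := by linarith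
  obtain ⟨⟨i₀, j₀⟩, -, hmax⟩ := Finset.exists_max_image (Finset.univ : Finset (ι × ι)) (fun p => ‖F p.1 p.2‖ₑ)
    Finset.univ_nonempty
  have hmax' : ∀ i j, ‖F i j‖ₑ ≤ ‖F i₀ j₀‖ₑ := fun i j => hmax (i, j) (Finset.mem_univ _)
  obtain ⟨n, hn⟩ : ∃ n : ℕ, n = Fintype.card ι ^ 2 := ⟨_, rfl⟩
  have hn0 : (n : ℝ≥0∞) ≠ 0 := by
    rw [hn]; exact_mod_cast pow_ne_zero 2 Fintype.card_ne_zero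
  have hnE : (Fintype.card ι : ℝ≥0∞) ^ 2 = n := by rw [hn]; push_cast; rfl
  have hcard : (Finset.univ : Finset (ι × ι)).card ≤ n := by rw [Finset.card_univ, Fintype.card_prod, hn, pow_two]
  rw [hnE]
  by_cases h : ∃ i j, ¬ near i₀ i ∧ ¬ near j₀ j ∧ ‖F i₀ j₀‖ₑ ≤ n * ‖F i j‖ₑ
  · obtain ⟨i, j, hi, hj, hM⟩ := h
    refine le_add_of_le_right ?_
    have h1 : ‖∑ i, ∑ j, F i j‖ₑ ≤ n * ‖F i₀ j₀‖ₑ := by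
      rw [← Fintype.sum_prod_type']
      exact enorm_sum_le_card_mul _ _ hcard fun p _ => hmax' p.1 p.2
    have h2 : ‖F i₀ j₀‖ₑ ^ q ≤ (n : ℝ≥0∞) ^ (q / 2) * ‖F i₀ j₀ * F i j‖ₑ ^ (q / 2) := by
      calc ‖F i₀ j₀‖ₑ ^ q = (‖F i₀ j₀‖ₑ * ‖F i₀ j₀‖ₑ) ^ (q / 2) := by
            rw [← pow_two, ← ENNReal.rpow_natCast, ← ENNReal.rpow_mul]; congr 1; push_cast; ring
        _ ≤ (‖F i₀ j₀‖ₑ * (n * ‖F i j‖ₑ)) ^ (q / 2) := by gcongr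
        _ = _ := by
            rw [enorm_mul, ← ENNReal.mul_rpow_of_nonneg _ _ (by positivity)]
            congr 1
            ring
    have h3 : ‖F i₀ j₀ * F i j‖ₑ ^ (q / 2) ≤
        ∑ i, ∑ j, ∑ i', ∑ j', if ¬ near i i' ∧ ¬ near j j' then ‖F i j * F i' j'‖ₑ ^ (q / 2) else 0 := by
      have s : ∀ (f : ι → ℝ≥0∞) (i : ι), f i ≤ ∑ i, f i := fun f i =>
        Finset.single_le_sum (fun _ _ => zero_le) (Finset.mem_univ i)
      refine le_trans ?_ (s _ i₀)
      refine le_trans ?_ (s _ j₀)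
      refine le_trans ?_ (s _ i)
      refine le_trans ?_ (s _ j)
      rw [if_pos ⟨hi, hj⟩]
    calc ‖∑ i, ∑ j, F i j‖ₑ ^ q ≤ (n * ‖F i₀ j₀‖ₑ) ^ q := by gcongr
      _ = (n : ℝ≥0∞) ^ q * ‖F i₀ j₀‖ₑ ^ q := ENNReal.mul_rpow_of_nonneg _ _ q0.le
      _ ≤ (n : ℝ≥0∞) ^ q * ((n : ℝ≥0∞) ^ (q / 2) * ‖F i₀ j₀ * F i j‖ₑ ^ (q / 2)) := by gcongr
      _ = (n : ℝ≥0∞) ^ (q + q / 2) * ‖F i₀ j₀ * F i j‖ₑ ^ (q / 2) := by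
          rw [← mul_assoc, ENNReal.rpow_add _ _ hn0 (ENNReal.natCast_ne_top _)]
      _ ≤ _ := by gcongr
  · push Not at h
    refine le_add_of_le_left ?_
    obtain ⟨X, hX⟩ : ∃ X, X = (∑ i, ‖∑ j, F i j‖ₑ ^ q) ^ (1 / q) := ⟨_, rfl⟩
    obtain ⟨Y, hY⟩ : ∃ Y, Y = (∑ j, ‖∑ i, F i j‖ₑ ^ q) ^ (1 / q) := ⟨_, rfl⟩
    obtain ⟨M, hM⟩ : ∃ M, M = ‖F i₀ j₀‖ₑ := ⟨_, rfl⟩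
    have e : ∀ x : ℝ≥0∞, (x ^ (1 / q)) ^ q = x := fun x => by
      rw [← ENNReal.rpow_mul, one_div_mul_cancel q0.ne', ENNReal.rpow_one]
    have hXq : X ^ q = ∑ i, ‖∑ j, F i j‖ₑ ^ q := by rw [hX, e]
    have hYq : Y ^ q = ∑ j, ‖∑ i, F i j‖ₑ ^ q := by rw [hY, e]
    have hMq : M ^ q ≤ ∑ i, ∑ j, ‖F i j‖ₑ ^ q := by
      have s : ∀ (f : ι → ℝ≥0∞) (i : ι), f i ≤ ∑ i, f i := fun f i =>
        Finset.single_le_sum (fun _ _ => zero_le) (Finset.mem_univ i)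
      rw [hM]
      exact (s (fun j => ‖F i₀ j‖ₑ ^ q) j₀).trans (s (fun i => ∑ j, ‖F i j‖ₑ ^ q) i₀)
    have t1 : ‖∑ i with near i₀ i, ∑ j, F i j‖ₑ ≤ c * X := enorm_sum_le_card_mul _ _ (hc i₀) fun i _ => by
      rw [hX]; exact le_rpow_sum (fun i => ‖∑ j, F i j‖ₑ) q0 i
    have t2 : ‖∑ j with near j₀ j, ∑ i, F i j‖ₑ ≤ c * Y := enorm_sum_le_card_mul _ _ (hc j₀) fun j _ => by
      rw [hY]; exact le_rpow_sum (fun j => ‖∑ i, F i j‖ₑ) q0 j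
    have t3 : ‖∑ i with near i₀ i, ∑ j with near j₀ j, F i j‖ₑ ≤ c * (c * M) :=
      enorm_sum_le_card_mul _ _ (hc i₀) fun i _ => enorm_sum_le_card_mul _ _ (hc j₀) fun j _ => hM ▸ hmax' i j
    have t4 : ‖∑ i with ¬ near i₀ i, ∑ j with ¬ near j₀ j, F i j‖ₑ ≤ M := by
      have hne : ‖(n : ℂ)‖ₑ = n := by
        rw [enorm_eq_nnnorm, Complex.nnnorm_natCast, ENNReal.coe_natCast]
      rw [← ENNReal.mul_le_mul_iff_right hn0 (ENNReal.natCast_ne_top _), ← Finset.sum_product']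
      nth_rw 1 [← hne]
      rw [← enorm_mul, Finset.mul_sum]
      refine enorm_sum_le_card_mul _ _ ((Finset.card_le_univ _).trans hcard) fun p hp => ?_
      simp only [Finset.mem_product, Finset.mem_filter, Finset.mem_univ, true_and] at hp
      rw [enorm_mul, hne, hM]
      exact (h p.1 p.2 hp.1 hp.2).le
    have t : ‖∑ i, ∑ j, F i j‖ₑ ≤ ((c : ℝ≥0∞) ^ 2 + c + 1) * (X + Y + M) := by
      rw [sum_sum_eq_near_far (near i₀) (near j₀) F]
      calc _ ≤ c * X + c * Y + c * (c * M) + M :=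
            (enorm_add_le _ _).trans (add_le_add (enorm_sub_le.trans (add_le_add ((enorm_add_le _ _).trans
              (add_le_add t1 t2)) t3)) t4)
        _ ≤ c * X + c * Y + c * (c * M) + M + (c ^ 2 * X + X + c ^ 2 * Y + Y + c * M) := le_self_add
        _ = _ := by ring
    have q1 : 0 ≤ q - 1 := by linarith
    calc ‖∑ i, ∑ j, F i j‖ₑ ^ q ≤ (((c : ℝ≥0∞) ^ 2 + c + 1) * (X + Y + M)) ^ q := by gcongr
      _ = ((c : ℝ≥0∞) ^ 2 + c + 1) ^ q * (X + Y + M) ^ q := ENNReal.mul_rpow_of_nonneg _ _ q0.le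
      _ ≤ ((c : ℝ≥0∞) ^ 2 + c + 1) ^ q * (4 ^ (q - 1) * (X ^ q + Y ^ q + M ^ q)) := by
          gcongr
          have h2 : (1 : ℝ≥0∞) ≤ 2 ^ (q - 1) := by simpa using ENNReal.rpow_le_rpow (by norm_num : (1 : ℝ≥0∞) ≤ 2) q1
          calc (X + Y + M) ^ q ≤ 2 ^ (q - 1) * ((X + Y) ^ q + M ^ q) := ENNReal.rpow_add_le_mul_rpow_add_rpow _ _ hq
            _ ≤ 2 ^ (q - 1) * (2 ^ (q - 1) * (X ^ q + Y ^ q) + 2 ^ (q - 1) * M ^ q) := by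
                gcongr
                · exact ENNReal.rpow_add_le_mul_rpow_add_rpow _ _ hq
                · exact le_mul_of_one_le_left zero_le h2
            _ = (2 * 2) ^ (q - 1) * (X ^ q + Y ^ q + M ^ q) := by
                rw [ENNReal.mul_rpow_of_nonneg _ _ q1]; ring
            _ = _ := by norm_num
      _ ≤ _ := by rw [← mul_assoc, hXq, hYq]; gcongr

/-- The half-open square `[0, 1/2) × [0, 1/2)` in `ℂ`. -/
def hsq : Set ℂ := {u | (0 ≤ u.re ∧ u.re < 1 / 2) ∧ 0 ≤ u.im ∧ u.im < 1 / 2}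

/-- The product of two half-open squares. -/
def hbox : Set (ℂ × ℂ) := hsq ×ˢ hsq

theorem norm_le_one_of_mem_hsq {u : ℂ} (hu : u ∈ hsq) : ‖u‖ ≤ 1 := by
  obtain ⟨⟨h1, h2⟩, h3, h4⟩ := hu
  have := Complex.norm_le_abs_re_add_abs_im u
  rw [abs_of_nonneg h1, abs_of_nonneg h3] at this
  linarith

theorem hbox_subset : hbox ⊆ Metric.closedBall 0 1 := fun w hw => by
  rw [mem_closedBall_zero_iff, Prod.norm_def]
  exact max_le (norm_le_one_of_mem_hsq hw.1) (norm_le_one_of_mem_hsq hw.2)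

/-- The lower left corner of the square with index `i` in the `K × K` grid on `hsq`. -/
def cellPt (K : ℕ) (i : Fin K × Fin K) : ℂ := ⟨(i.1 : ℕ) / (2 * K), (i.2 : ℕ) / (2 * K)⟩

/-- The index of the square of the `K × K` grid which contains a point of `hsq`. -/
def cellIdx (K : ℕ) [NeZero K] (u : ℂ) : Fin K × Fin K :=
  (Fin.ofNat K ⌊2 * K * u.re⌋₊, Fin.ofNat K ⌊2 * K * u.im⌋₊)

theorem measurable_cellIdx (K : ℕ) [NeZero K] : Measurable (cellIdx K) := by
  refine Measurable.prodMk ?_ ?_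
  · exact (Measurable.of_discrete (f := Fin.ofNat K)).comp (Nat.measurable_floor.comp (by fun_prop))
  · exact (Measurable.of_discrete (f := Fin.ofNat K)).comp (Nat.measurable_floor.comp (by fun_prop))

theorem sub_div_mem_of_floor {K : ℕ} [NeZero K] {x : ℝ} (h0 : 0 ≤ x) (h1 : x < 1 / 2) :
    0 ≤ K * (x - ((Fin.ofNat K ⌊2 * K * x⌋₊ : Fin K) : ℕ) / (2 * K)) ∧
      K * (x - ((Fin.ofNat K ⌊2 * K * x⌋₊ : Fin K) : ℕ) / (2 * K)) < 1 / 2 := by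
  have hK : (0 : ℝ) < K := by exact_mod_cast Nat.pos_of_ne_zero (NeZero.ne K)
  have hlt : ⌊2 * K * x⌋₊ < K := by
    rw [Nat.floor_lt (by positivity)]
    nlinarith
  rw [Fin.val_ofNat, Nat.mod_eq_of_lt hlt]
  have a := Nat.floor_le (show 0 ≤ 2 * K * x by positivity)
  have b := Nat.lt_floor_add_one (2 * K * x)
  have e : K * (x - (⌊2 * K * x⌋₊ : ℝ) / (2 * K)) = (2 * K * x - ⌊2 * K * x⌋₊) / 2 := by
    field_simp
  rw [e]
  constructor <;> linarith

theorem mul_sub_cellPt_mem {K : ℕ} [NeZero K] {u : ℂ} (hu : u ∈ hsq) :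
    (K : ℂ) * (u - cellPt K (cellIdx K u)) ∈ hsq := by
  obtain ⟨⟨h1, h2⟩, h3, h4⟩ := hu
  have := sub_div_mem_of_floor (K := K) h1 h2
  have := sub_div_mem_of_floor (K := K) h3 h4
  simp only [hsq, Set.mem_ofPred_eq, Complex.mul_re, Complex.mul_im, Complex.natCast_re, Complex.natCast_im,
    zero_mul, sub_zero, add_zero, Complex.sub_re, Complex.sub_im]
  exact ⟨‹_›, this⟩

theorem norm_sub_cellPt_le {K : ℕ} [NeZero K] {u : ℂ} (hu : u ∈ hsq) :
    ‖u - cellPt K (cellIdx K u)‖ ≤ 1 / K := by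
  have hK : (0 : ℝ) < K := by exact_mod_cast Nat.pos_of_ne_zero (NeZero.ne K)
  have := norm_le_one_of_mem_hsq (mul_sub_cellPt_mem (K := K) hu)
  rw [norm_mul, Complex.norm_natCast] at this
  rw [le_div_iff₀ hK]
  linarith

theorem norm_cellPt_le {K : ℕ} (hK : 7 ≤ K) (i : Fin K × Fin K) : ‖cellPt K i‖ + 2 * (1 / K) ≤ 1 := by
  have hK' : (7 : ℝ) ≤ K := by exact_mod_cast hK
  have h1 : ((i.1 : ℕ) : ℝ) / (2 * K) ≤ 1 / 2 := by
    rw [div_le_iff₀ (by positivity)]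
    have : ((i.1 : ℕ) : ℝ) ≤ K := by exact_mod_cast i.1.2.le
    linarith
  have h2 : ((i.2 : ℕ) : ℝ) / (2 * K) ≤ 1 / 2 := by
    rw [div_le_iff₀ (by positivity)]
    have : ((i.2 : ℕ) : ℝ) ≤ K := by exact_mod_cast i.2.2.le
    linarith
  have h3 : (0 : ℝ) ≤ ((i.1 : ℕ) : ℝ) / (2 * K) := by positivity
  have h4 : (0 : ℝ) ≤ ((i.2 : ℕ) : ℝ) / (2 * K) := by positivity
  have h5 : ‖cellPt K i‖ ^ 2 ≤ (5 / 7) ^ 2 := by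
    rw [Complex.sq_norm, Complex.normSq_apply]
    simp only [cellPt]
    nlinarith
  have h6 := abs_le_of_sq_le_sq h5 (by norm_num)
  have h7 : (1 : ℝ) / K ≤ 1 / 7 := one_div_le_one_div_of_le (by norm_num) hK'
  linarith [le_abs_self ‖cellPt K i‖]

/-- Two grid indices are near if both coordinates differ by less than `136`. -/
def nearIdx (K : ℕ) (i j : Fin K × Fin K) : Prop :=
  ((i.1 : ℕ) < j.1 + 136 ∧ (j.1 : ℕ) < i.1 + 136) ∧ (i.2 : ℕ) < j.2 + 136 ∧ (j.2 : ℕ) < i.2 + 136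

open Classical in
theorem card_nearIdx_le (K : ℕ) (i : Fin K × Fin K) :
    (Finset.univ.filter fun j => nearIdx K i j).card ≤ 272 ^ 2 := by
  have h := Finset.card_le_card_of_injOn (s := Finset.univ.filter fun j => nearIdx K i j)
    (t := Finset.Ico ((i.1 : ℕ) - 136) (i.1 + 136) ×ˢ Finset.Ico ((i.2 : ℕ) - 136) (i.2 + 136))
    (Prod.map Fin.val Fin.val) ?_ ?_
  · refine h.trans ?_
    simp only [Finset.card_product, Nat.card_Ico]
    have a : (i.1 : ℕ) + 136 - (i.1 - 136) ≤ 272 := by omega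
    have b : (i.2 : ℕ) + 136 - (i.2 - 136) ≤ 272 := by omega
    exact (Nat.mul_le_mul a b).trans (by norm_num)
  · intro j hj
    have hj : nearIdx K i j := (Finset.mem_filter.mp (Finset.mem_coe.mp hj)).2
    unfold nearIdx at hj
    have a := hj.1
    have b := hj.2
    simp only [Finset.coe_product, Set.mem_prod, Finset.coe_Ico, Set.mem_Ico, Prod.map]
    omega
  · exact (Fin.val_injective.prodMap Fin.val_injective).injOn

theorem le_norm_cellPt_sub {K : ℕ} [NeZero K] {i j : Fin K × Fin K} (h : ¬ nearIdx K i j) :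
    68 * (1 / (K : ℝ)) ≤ ‖cellPt K j - cellPt K i‖ := by
  have hK : (0 : ℝ) < K := by exact_mod_cast Nat.pos_of_ne_zero (NeZero.ne K)
  have key : ∀ a b : ℕ, ¬ (a < b + 136 ∧ b < a + 136) → 68 * (1 / (K : ℝ)) ≤ |(b : ℝ) / (2 * K) - a / (2 * K)| := by
    intro a b hab
    rw [← sub_div, abs_div, abs_of_pos (show (0 : ℝ) < 2 * K by positivity), mul_one_div,
      div_le_div_iff₀ hK (by positivity)]
    have : (136 : ℝ) ≤ |(b : ℝ) - a| := by
      rw [le_abs]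
      by_cases h1 : a < b + 136
      · have : a + 136 ≤ b := by omega
        have : (a : ℝ) + 136 ≤ b := by exact_mod_cast this
        left; linarith
      · have : b + 136 ≤ a := by omega
        have : (b : ℝ) + 136 ≤ a := by exact_mod_cast this
        right; linarith
    nlinarith
  by_cases h1 : (i.1 : ℕ) < j.1 + 136 ∧ (j.1 : ℕ) < i.1 + 136
  · have h2 : ¬ ((i.2 : ℕ) < j.2 + 136 ∧ (j.2 : ℕ) < i.2 + 136) := fun h2 => h ⟨h1, h2⟩
    exact (key _ _ h2).trans (Complex.abs_im_le_norm (cellPt K j - cellPt K i))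
  · exact (key _ _ h1).trans (Complex.abs_re_le_norm (cellPt K j - cellPt K i))

/-- The linear extension estimate with constant `A` on the slab over `X`. -/
def Lin (p q : ℝ) (X : Set ℂ) (A : ℝ≥0∞) : Prop :=
  ∀ f : ℂ × ℂ → ℂ, MemLp f (ENNReal.ofReal p) → (∀ w, f w ≠ 0 → w ∈ hbox) →
    ∫⁻ z : ℂ × ℂ × ℂ in X ×ˢ Set.univ, ‖EE f z.1 z.2‖ₑ ^ q ≤ A * (∫⁻ w, ‖f w‖ₑ ^ p) ^ (q / p)

theorem lintegral_rpow_le_of_support {α : Type*} [MeasurableSpace α] {μ : Measure α} {f : α → ℂ}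
    (hf : AEStronglyMeasurable f μ) {S : Set α} (hS : ∀ w, f w ≠ 0 → w ∈ S) {r p : ℝ} (hr : 0 < r) (hrp : r ≤ p) :
    ∫⁻ w, ‖f w‖ₑ ^ r ∂μ ≤ (μ S ^ (1 / r - 1 / p)) ^ r * (∫⁻ w, ‖f w‖ₑ ^ p ∂μ) ^ (r / p) := by
  have key := eLpNorm'_le_eLpNorm'_mul_rpow_measure_univ hr hrp (hf.mono_measure (Measure.restrict_le_self (s := S)))
  have hsupp : ∀ s : ℝ, 0 < s → ∫⁻ w in S, ‖f w‖ₑ ^ s ∂μ = ∫⁻ w, ‖f w‖ₑ ^ s ∂μ := by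
    intro s hs
    refine setLIntegral_eq_of_support_subset ?_
    intro w hw
    refine hS w fun h => hw ?_
    simp [h, hs]
  simp only [eLpNorm', hsupp r hr, hsupp p (hr.trans_le hrp), Measure.restrict_apply_univ] at key
  have := ENNReal.rpow_le_rpow key hr.le
  rw [← ENNReal.rpow_mul, one_div_mul_cancel hr.ne', ENNReal.rpow_one, ENNReal.mul_rpow_of_nonneg _ _ hr.le,
    ← ENNReal.rpow_mul, mul_comm] at this
  rwa [one_div_mul_eq_div] at this

theorem volume_hbox_ne_top : volume hbox ≠ ∞ :=
  ((measure_mono hbox_subset).trans_lt measure_closedBall_lt_top).ne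

theorem memLp_two_of_hbox {f : ℂ × ℂ → ℂ} {p : ℝ} (hp : 2 ≤ p) (hf : MemLp f (ENNReal.ofReal p))
    (hS : ∀ w, f w ≠ 0 → w ∈ hbox) : MemLp f 2 := by
  refine hf.mono_exponent_of_measure_support_ne_top (s := hbox) (fun w hw => ?_) volume_hbox_ne_top ?_
  · by_contra h
    exact hw (hS w h)
  · rw [show (2 : ℝ≥0∞) = ENNReal.ofReal 2 by simp]
    exact ENNReal.ofReal_le_ofReal hp

theorem exists_lintegral_sq_le {p : ℝ} (hp : 2 ≤ p) : ∃ c : ℝ≥0∞, c ≠ ∞ ∧ ∀ f : ℂ × ℂ → ℂ,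
    AEStronglyMeasurable f volume → (∀ w, f w ≠ 0 → w ∈ hbox) →
    ∫⁻ w, ‖f w‖ₑ ^ 2 ≤ c * (∫⁻ w, ‖f w‖ₑ ^ p) ^ (2 / p) := by
  refine ⟨(volume hbox ^ (1 / 2 - 1 / p : ℝ)) ^ (2 : ℝ), ?_, fun f hf hS => ?_⟩
  rotate_left
  · simpa only [ENNReal.rpow_two] using lintegral_rpow_le_of_support hf hS two_pos hp
  · refine ENNReal.rpow_ne_top_of_nonneg zero_le_two (ENNReal.rpow_ne_top_of_nonneg ?_ volume_hbox_ne_top)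
    rw [sub_nonneg]
    exact one_div_le_one_div_of_le two_pos hp

theorem modu_zero_eq (f : ℂ × ℂ → ℂ) : modu 0 f = f := by
  funext w; simp [modu, ee_zero]

theorem integrable_of_hbox {f : ℂ × ℂ → ℂ} (hf : MemLp f 2) (hS : ∀ w, f w ≠ 0 → w ∈ hbox) : Integrable f :=
  integrable_of_memLp_two hf (r := 1) fun w hw => mem_closedBall_zero_iff.mp (hbox_subset (hS w hw))

theorem Lin.rescale {p q : ℝ} (hp : 2 ≤ p) (hq : 0 < q) {T : ℝ} {A : ℝ≥0∞} (hL : Lin p q (Metric.closedBall 0 T) A)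
    (b : ℂ × ℂ) {s : ℂ × ℂ} (h1 : s.1 ≠ 0) (h2 : s.2 ≠ 0) (hs : ‖s.1 * s.2‖ ≤ 1) {f : ℂ × ℂ → ℂ}
    (hf : MemLp f (ENNReal.ofReal p)) (hS : ∀ w, f (aff b s w) ≠ 0 → w ∈ hbox) :
    ∫⁻ z : ℂ × ℂ × ℂ in Metric.closedBall 0 T ×ˢ Set.univ, ‖EE f z.1 z.2‖ₑ ^ q ≤
      (‖s.1‖ₑ ^ 2 * ‖s.2‖ₑ ^ 2) ^ q * (‖s.1‖ₑ⁻¹ ^ 4 * ‖s.2‖ₑ⁻¹ ^ 4) * (‖s.1‖ₑ⁻¹ ^ 2 * ‖s.2‖ₑ⁻¹ ^ 2) ^ (q / p) * A *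
        (∫⁻ w, ‖f w‖ₑ ^ p) ^ (q / p) := by
  have hg := memLp_comp_aff b h1 h2 hf
  have hg2 := memLp_two_of_hbox hp hg hS
  have hgi := integrable_of_hbox hg2 hS
  have hc := continuous_EE_comp hgi
  have hX : MeasurableSet (Metric.closedBall (0 : ℂ) T ×ˢ (Set.univ : Set (ℂ × ℂ))) :=
    Metric.isClosed_closedBall.measurableSet.prod MeasurableSet.univ
  set Φ : ℂ × ℂ × ℂ → ℝ≥0∞ := (Metric.closedBall (0 : ℂ) T ×ˢ (Set.univ : Set (ℂ × ℂ))).indicator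
    fun z => ‖EE (fun w => f (aff b s w)) z.1 z.2‖ₑ ^ q with hΦ
  have hΦm : Measurable Φ := (hc.enorm.measurable.pow_const q).indicator hX
  have hL' := hL _ hg hS
  rw [← lintegral_indicator hX, ← hΦ] at hL'
  have hκ : (‖s.1‖ₑ ^ 2 * ‖s.2‖ₑ ^ 2) ^ q ≠ ∞ :=
    ENNReal.rpow_ne_top_of_nonneg hq.le (by finiteness)
  calc _ ≤ ∫⁻ z : ℂ × ℂ × ℂ, (‖s.1‖ₑ ^ 2 * ‖s.2‖ₑ ^ 2) ^ q * Φ (gal 0 b s z) := by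
        rw [← lintegral_indicator hX]
        refine lintegral_mono fun z => ?_
        by_cases hz : z ∈ Metric.closedBall (0 : ℂ) T ×ˢ (Set.univ : Set (ℂ × ℂ))
        · have hz' : gal 0 b s z ∈ Metric.closedBall (0 : ℂ) T ×ˢ (Set.univ : Set (ℂ × ℂ)) := by
            refine ⟨?_, trivial⟩
            have := mem_closedBall_zero_iff.mp hz.1
            rw [mem_closedBall_zero_iff, gal, sub_zero, norm_mul]
            exact (mul_le_of_le_one_left (norm_nonneg _) hs).trans this
          rw [Set.indicator_of_mem hz, hΦ, Set.indicator_of_mem hz', enorm_EE_gal 0 b h1 h2 f z, modu_zero_eq,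
            ENNReal.mul_rpow_of_nonneg _ _ hq.le]
        · rw [Set.indicator_of_notMem hz]
          exact zero_le
    _ = (‖s.1‖ₑ ^ 2 * ‖s.2‖ₑ ^ 2) ^ q * ((‖s.1‖ₑ⁻¹ ^ 4 * ‖s.2‖ₑ⁻¹ ^ 4) * ∫⁻ z : ℂ × ℂ × ℂ, Φ z) := by
        rw [lintegral_const_mul' _ _ hκ, lintegral_comp_gal 0 b h1 h2 hΦm]
    _ ≤ (‖s.1‖ₑ ^ 2 * ‖s.2‖ₑ ^ 2) ^ q * ((‖s.1‖ₑ⁻¹ ^ 4 * ‖s.2‖ₑ⁻¹ ^ 4) *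
          (A * (∫⁻ w, ‖f (aff b s w)‖ₑ ^ p) ^ (q / p))) := by gcongr
    _ = _ := by
        rw [lintegral_comp_aff b h1 h2 fun w => ‖f w‖ₑ ^ p, ENNReal.mul_rpow_of_nonneg _ (∫⁻ w, ‖f w‖ₑ ^ p) (by positivity)]
        ring

/-- The loss in the rescaled estimate is a negative power of the scale. -/
theorem rescale_const (p q : ℝ) {x : ℝ≥0∞} (h0 : x ≠ 0) (hx : x ≠ ∞) :
    (x ^ 2) ^ q * x⁻¹ ^ 4 * (x⁻¹ ^ 2) ^ (q / p) = x ^ (2 * q - 4 - 2 * (q / p)) := by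
  simp only [← ENNReal.rpow_natCast, ← ENNReal.rpow_neg_one, ← ENNReal.rpow_mul]
  rw [← ENNReal.rpow_add _ _ h0 hx, ← ENNReal.rpow_add _ _ h0 hx]
  congr 1
  push_cast
  ring

theorem Lin.strip {p q : ℝ} (hp : 2 ≤ p) (hq : 0 < q) {T : ℝ} {A : ℝ≥0∞} (hL : Lin p q (Metric.closedBall 0 T) A)
    (K : ℕ) [NeZero K] {f : ℂ × ℂ → ℂ} (hf : MemLp f (ENNReal.ofReal p)) (hS : ∀ w, f w ≠ 0 → w ∈ hbox)
    (i : Fin K × Fin K) (hi : (∀ w, f w ≠ 0 → cellIdx K w.1 = i) ∨ ∀ w, f w ≠ 0 → cellIdx K w.2 = i) :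
    ∫⁻ z : ℂ × ℂ × ℂ in Metric.closedBall 0 T ×ˢ Set.univ, ‖EE f z.1 z.2‖ₑ ^ q ≤
      (K : ℝ≥0∞)⁻¹ ^ (2 * q - 4 - 2 * (q / p)) * A * (∫⁻ w, ‖f w‖ₑ ^ p) ^ (q / p) := by
  have hK0 : K ≠ 0 := NeZero.ne K
  have hK : (K : ℂ) ≠ 0 := by exact_mod_cast hK0
  have hKi : (K : ℂ)⁻¹ ≠ 0 := inv_ne_zero hK
  have he : ‖(K : ℂ)⁻¹‖ₑ = (K : ℝ≥0∞)⁻¹ := by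
    rw [enorm_inv hK]
    congr 1
    rw [← ofReal_norm, Complex.norm_natCast, ENNReal.ofReal_natCast]
  have hn : ‖(K : ℂ)⁻¹‖ ≤ 1 := by
    rw [norm_inv, Complex.norm_natCast]
    exact inv_le_one_of_one_le₀ (by exact_mod_cast Nat.one_le_iff_ne_zero.mpr hK0)
  rw [← rescale_const p q (by simp) (by simpa using hK0), ← he]
  rcases hi with hi | hi
  · have := hL.rescale hp hq (cellPt K i, 0) (s := ((K : ℂ)⁻¹, 1)) hKi one_ne_zero (by simpa using hn) hf ?_
    · simpa using this
    · intro w hw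
      have h1 := hS _ hw
      have h2 := mul_sub_cellPt_mem (K := K) h1.1
      rw [hi _ hw] at h2
      refine ⟨?_, by simpa [aff] using h1.2⟩
      simpa [aff, hK] using h2
  · have := hL.rescale hp hq (0, cellPt K i) (s := (1, (K : ℂ)⁻¹)) one_ne_zero hKi (by simpa using hn) hf ?_
    · simpa using this
    · intro w hw
      have h1 := hS _ hw
      have h2 := mul_sub_cellPt_mem (K := K) h1.2
      rw [hi _ hw] at h2
      refine ⟨by simpa [aff] using h1.1, ?_⟩
      simpa [aff, hK] using h2

theorem sum_indicator_fiber {α ι E : Type*} [Fintype ι] [AddCommMonoid E] (g : α → ι) (f : α → E) (x : α) :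
    ∑ i, {w | g w = i}.indicator f x = f x := by
  classical
  simp [Set.indicator_apply]

theorem sum_fiber_rpow_le {α ι : Type*} [MeasurableSpace α] {μ : Measure α} [Fintype ι] {g : α → ι}
    (hg : ∀ i, MeasurableSet {w | g w = i}) {f : α → ℂ} (hf : AEStronglyMeasurable f μ) {p q : ℝ} (hp : 0 < p)
    (hpq : p ≤ q) :
    ∑ i, (∫⁻ w, ‖{w | g w = i}.indicator f w‖ₑ ^ p ∂μ) ^ (q / p) ≤ (∫⁻ w, ‖f w‖ₑ ^ p ∂μ) ^ (q / p) := by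
  refine (sum_rpow_le _ _ ((one_le_div hp).mpr hpq)).trans_eq ?_
  have h : ∀ i w, ‖{w | g w = i}.indicator f w‖ₑ ^ p = {w | g w = i}.indicator (fun w => ‖f w‖ₑ ^ p) w := by
    intro i w
    by_cases hw : w ∈ {w | g w = i}
    · rw [Set.indicator_of_mem hw, Set.indicator_of_mem hw]
    · rw [Set.indicator_of_notMem hw, Set.indicator_of_notMem hw, enorm_zero, ENNReal.zero_rpow_of_pos hp]
  simp_rw [h]
  rw [← lintegral_finsetSum' _ fun i _ => (hf.enorm.pow_const p).indicator (hg i)]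
  simp_rw [sum_indicator_fiber]

theorem lintegral_mul_rpow_le_of_bil {q p : ℝ} {P x y A c : ℝ≥0∞} (hq : 0 < q)
    (hx : x ≤ c * P ^ (2 / p)) (hy : y ≤ c * P ^ (2 / p)) :
    (A * (x * y) ^ (1 / 2 : ℝ)) ^ (q / 2) ≤ (A * c) ^ (q / 2) * P ^ (q / p) := by
  calc (A * (x * y) ^ (1 / 2 : ℝ)) ^ (q / 2)
      ≤ (A * ((c * P ^ (2 / p)) * (c * P ^ (2 / p))) ^ (1 / 2 : ℝ)) ^ (q / 2) := by gcongr
    _ = ((A * c) * P ^ (2 / p)) ^ (q / 2) := by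
        rw [← pow_two, ← ENNReal.rpow_natCast _ 2, ← ENNReal.rpow_mul, Nat.cast_ofNat,
          mul_one_div_cancel two_ne_zero, ENNReal.rpow_one, mul_assoc]
    _ = (A * c) ^ (q / 2) * P ^ (q / p) := by
        rw [ENNReal.mul_rpow_of_nonneg _ _ (by positivity), ← ENNReal.rpow_mul]
        congr 2
        ring

theorem lintegral_indicator_rpow_le {α : Type*} [MeasurableSpace α] {μ : Measure α} (S : Set α) (f : α → ℂ) {p : ℝ}
    (hp : 0 ≤ p) : ∫⁻ w, ‖S.indicator f w‖ₑ ^ p ∂μ ≤ ∫⁻ w, ‖f w‖ₑ ^ p ∂μ := by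
  refine lintegral_mono fun w => ENNReal.rpow_le_rpow ?_ hp
  exact enorm_indicator_le_enorm_self f w

theorem mem_of_indicator_ne_zero {α : Type*} {S : Set α} {f : α → ℂ} {w : α} (h : S.indicator f w ≠ 0) :
    w ∈ S ∧ f w ≠ 0 := by
  have hw : w ∈ S := Set.mem_of_indicator_ne_zero h
  exact ⟨hw, by rwa [Set.indicator_of_mem hw] at h⟩

theorem Lin.sum_fiber {p q : ℝ} (hp : 2 ≤ p) (hpq : p ≤ q) {T : ℝ} {A : ℝ≥0∞} (hL : Lin p q (Metric.closedBall 0 T) A)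
    (K : ℕ) [NeZero K] {f : ℂ × ℂ → ℂ} (hf : MemLp f (ENNReal.ofReal p)) (hS : ∀ w, f w ≠ 0 → w ∈ hbox)
    {ι : Type*} [Fintype ι] {g : ℂ × ℂ → ι} (hg : ∀ i, MeasurableSet {w | g w = i})
    (hi : ∀ i, (∃ k, ∀ w, g w = i → cellIdx K w.1 = k) ∨ ∃ k, ∀ w, g w = i → cellIdx K w.2 = k) :
    ∫⁻ z : ℂ × ℂ × ℂ in Metric.closedBall 0 T ×ˢ Set.univ, ∑ i, ‖EE ({w | g w = i}.indicator f) z.1 z.2‖ₑ ^ q ≤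
      (K : ℝ≥0∞)⁻¹ ^ (2 * q - 4 - 2 * (q / p)) * A * (∫⁻ w, ‖f w‖ₑ ^ p) ^ (q / p) := by
  have hm : ∀ i, MemLp ({w | g w = i}.indicator f) (ENNReal.ofReal p) := fun i => hf.indicator (hg i)
  have hs : ∀ i w, {w | g w = i}.indicator f w ≠ 0 → w ∈ hbox := fun i w hw => hS w (mem_of_indicator_ne_zero hw).2
  rw [lintegral_finsetSum _ fun i _ => (continuous_EE_comp
    (integrable_of_hbox (memLp_two_of_hbox hp (hm i) (hs i)) (hs i))).enorm.measurable.pow_const q]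
  refine (Finset.sum_le_sum fun i _ => show _ ≤ (K : ℝ≥0∞)⁻¹ ^ (2 * q - 4 - 2 * (q / p)) * A *
    (∫⁻ w, ‖{w | g w = i}.indicator f w‖ₑ ^ p) ^ (q / p) from ?_).trans ?_
  · rcases hi i with ⟨k, hk⟩ | ⟨k, hk⟩
    · exact hL.strip hp (by linarith) K (hm i) (hs i) k (Or.inl fun w hw => hk w (mem_of_indicator_ne_zero hw).1)
    · exact hL.strip hp (by linarith) K (hm i) (hs i) k (Or.inr fun w hw => hk w (mem_of_indicator_ne_zero hw).1)
  · rw [← Finset.mul_sum]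
    gcongr
    exact sum_fiber_rpow_le hg hf.1 (by linarith) hpq

/-- The set of points whose two coordinates lie in prescribed squares of the grid. -/
def cellProd (K : ℕ) [NeZero K] (i j : Fin K × Fin K) : Set (ℂ × ℂ) := {w | (cellIdx K w.1, cellIdx K w.2) = (i, j)}

theorem measurableSet_cellProd (K : ℕ) [NeZero K] (i j : Fin K × Fin K) : MeasurableSet (cellProd K i j) :=
  (((measurable_cellIdx K).comp measurable_fst).prodMk ((measurable_cellIdx K).comp measurable_snd))
    (measurableSet_singleton (i, j))

theorem norm_sub_le_of_cellProd {K : ℕ} [NeZero K] {i j : Fin K × Fin K} {f : ℂ × ℂ → ℂ}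
    (hS : ∀ w, f w ≠ 0 → w ∈ hbox) (w : ℂ × ℂ) (hw : (cellProd K i j).indicator f w ≠ 0) :
    ‖w - (cellPt K i, cellPt K j)‖ ≤ 1 / K := by
  obtain ⟨h1, h2⟩ := mem_of_indicator_ne_zero hw
  simp only [cellProd, Set.mem_ofPred_eq, Prod.mk.injEq] at h1
  have h3 := norm_sub_cellPt_le (K := K) (hS w h2).1
  have h4 := norm_sub_cellPt_le (K := K) (hS w h2).2
  rw [h1.1] at h3
  rw [h1.2] at h4
  exact max_le h3 h4

theorem exists_broad {p q : ℝ} (hp : 2 ≤ p) (hq : 10 / 3 < q) (q4 : q < 4) {K : ℕ} [NeZero K] (hK : 7 ≤ K)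
    (i j i' j' : Fin K × Fin K) (hi : ¬ nearIdx K i i') (hj : ¬ nearIdx K j j') : ∃ B : ℝ≥0∞, B ≠ ∞ ∧
    ∀ f : ℂ × ℂ → ℂ, MemLp f (ENNReal.ofReal p) → (∀ w, f w ≠ 0 → w ∈ hbox) →
      ∫⁻ z : ℂ × ℂ × ℂ, ‖EE ((cellProd K i j).indicator f) z.1 z.2 * EE ((cellProd K i' j').indicator f) z.1 z.2‖ₑ ^
        (q / 2) ≤ B * (∫⁻ w, ‖f w‖ₑ ^ p) ^ (q / p) := by
  have hK0 : (0 : ℝ) < K := by exact_mod_cast (by omega : 0 < K)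
  have hn : ∀ i j, ‖(cellPt K i, cellPt K j)‖ + 2 * (1 / (K : ℝ)) ≤ 1 := fun i j => by
    have a := norm_cellPt_le hK i
    have b := norm_cellPt_le hK j
    rw [Prod.norm_def, ← max_add_add_right]
    exact max_le a b
  obtain ⟨A, hA, h⟩ := exists_bilinear (ρ := 1 / (K : ℝ)) (r := q / 2) (by positivity) (by linarith) (by linarith)
    (hn i j) (hn i' j') (le_norm_cellPt_sub hi) (le_norm_cellPt_sub hj)
  obtain ⟨c, hc, h'⟩ := exists_lintegral_sq_le hp
  refine ⟨(A * c) ^ (q / 2), ENNReal.rpow_ne_top_of_nonneg (by linarith) (ENNReal.mul_ne_top hA hc), fun f hf hS => ?_⟩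
  have hf2 := memLp_two_of_hbox hp hf hS
  have hle : ∀ i j, ∫⁻ w, ‖(cellProd K i j).indicator f w‖ₑ ^ 2 ≤ c * (∫⁻ w, ‖f w‖ₑ ^ p) ^ (2 / p) := fun i j => by
    refine le_trans ?_ (h' f hf.1 hS)
    simpa only [ENNReal.rpow_two] using lintegral_indicator_rpow_le (cellProd K i j) f zero_le_two
  exact (h _ _ (hf2.indicator (measurableSet_cellProd K i j)) (hf2.indicator (measurableSet_cellProd K i' j'))
    (norm_sub_le_of_cellProd hS) (norm_sub_le_of_cellProd hS)).trans
      (lintegral_mul_rpow_le_of_bil (by linarith) (hle i j) (hle i' j'))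

theorem lintegral_comb_le {α : Type*} [MeasurableSpace α] {μ : Measure α} {g₁ g₂ g₃ g₄ : α → ℝ≥0∞}
    (h₁ : Measurable g₁) (h₂ : Measurable g₂) (h₃ : Measurable g₃) {C N x₁ x₂ x₃ x₄ : ℝ≥0∞} (hC : C ≠ ∞) (hN : N ≠ ∞)
    (i₁ : ∫⁻ z, g₁ z ∂μ ≤ x₁) (i₂ : ∫⁻ z, g₂ z ∂μ ≤ x₂) (i₃ : ∫⁻ z, g₃ z ∂μ ≤ x₃) (i₄ : ∫⁻ z, g₄ z ∂μ ≤ x₄) :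
    ∫⁻ z, (C * (g₁ z + g₂ z + g₃ z) + N * g₄ z) ∂μ ≤ C * (x₁ + x₂ + x₃) + N * x₄ := by
  have h₁₂ : Measurable fun z => g₁ z + g₂ z := h₁.add h₂
  have h₁₂₃ : Measurable fun z => C * (g₁ z + g₂ z + g₃ z) := (h₁₂.add h₃).const_mul C
  rw [lintegral_add_left h₁₂₃, lintegral_const_mul' _ _ hC, lintegral_const_mul' _ _ hN, lintegral_add_left h₁₂,
    lintegral_add_left h₁]
  gcongr

/-- One step of the induction on the constant in the linear estimate: all interactions except the transversal ones are
controlled by rescaling. -/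
theorem exists_lin_step {p q : ℝ} (hp : 2 ≤ p) (hpq : p ≤ q) (hq : 10 / 3 < q) (q4 : q < 4) {K : ℕ} [NeZero K]
    (hK : 7 ≤ K) : ∃ C : ℝ≥0∞, C ≠ ∞ ∧ ∀ (T : ℝ) (A : ℝ≥0∞), Lin p q (Metric.closedBall 0 T) A →
      Lin p q (Metric.closedBall 0 T) ((((272 ^ 2 : ℕ) : ℝ≥0∞) ^ 2 + (272 ^ 2 : ℕ) + 1) ^ q * 4 ^ (q - 1) *
        (3 * (K : ℝ≥0∞)⁻¹ ^ (2 * q - 4 - 2 * (q / p))) * A + C) := by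
  classical
  have hB : ∀ i j i' j', ∃ B : ℝ≥0∞, B ≠ ∞ ∧ ∀ f : ℂ × ℂ → ℂ, MemLp f (ENNReal.ofReal p) →
      (∀ w, f w ≠ 0 → w ∈ hbox) → ∫⁻ z : ℂ × ℂ × ℂ, (if ¬ nearIdx K i i' ∧ ¬ nearIdx K j j' then
        ‖EE ((cellProd K i j).indicator f) z.1 z.2 * EE ((cellProd K i' j').indicator f) z.1 z.2‖ₑ ^ (q / 2) else 0) ≤
        B * (∫⁻ w, ‖f w‖ₑ ^ p) ^ (q / p) := by
    intro i j i' j'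
    by_cases h : ¬ nearIdx K i i' ∧ ¬ nearIdx K j j'
    · obtain ⟨B, h1, h2⟩ := exists_broad hp hq q4 hK i j i' j' h.1 h.2
      exact ⟨B, h1, fun f hf hS => by simpa only [if_pos h] using h2 f hf hS⟩
    · exact ⟨0, ENNReal.zero_ne_top, fun f hf hS => by simp only [if_neg h, lintegral_zero, zero_mul, le_refl]⟩
  choose B hB1 hB2 using hB
  refine ⟨((Fintype.card (Fin K × Fin K) : ℝ≥0∞) ^ 2) ^ (q + q / 2) * ∑ i, ∑ j, ∑ i', ∑ j', B i j i' j', ?_,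
    fun T A hL f hf hS => ?_⟩
  · refine ENNReal.mul_ne_top (ENNReal.rpow_ne_top_of_nonneg (by linarith) (by finiteness)) ?_
    refine ENNReal.sum_ne_top.mpr fun i _ => ENNReal.sum_ne_top.mpr fun j _ => ENNReal.sum_ne_top.mpr fun i' _ =>
      ENNReal.sum_ne_top.mpr fun j' _ => hB1 i j i' j'
  have hC : (((272 ^ 2 : ℕ) : ℝ≥0∞) ^ 2 + (272 ^ 2 : ℕ) + 1) ^ q * 4 ^ (q - 1) ≠ ∞ :=
    ENNReal.mul_ne_top (ENNReal.rpow_ne_top_of_nonneg (by linarith) (by finiteness))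
      (ENNReal.rpow_ne_top_of_nonneg (by linarith) (by finiteness))
  have hN : ((Fintype.card (Fin K × Fin K) : ℝ≥0∞) ^ 2) ^ (q + q / 2) ≠ ∞ :=
    ENNReal.rpow_ne_top_of_nonneg (by linarith) (by finiteness)
  have hcard := card_nearIdx_le K
  generalize (272 ^ 2 : ℕ) = c at *
  obtain ⟨C₁, hC₁⟩ : ∃ x, x = ((c : ℝ≥0∞) ^ 2 + c + 1) ^ q * 4 ^ (q - 1) := ⟨_, rfl⟩
  obtain ⟨N, hN'⟩ : ∃ x, x = ((Fintype.card (Fin K × Fin K) : ℝ≥0∞) ^ 2) ^ (q + q / 2) := ⟨_, rfl⟩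
  obtain ⟨κ, hκ⟩ : ∃ x, x = (K : ℝ≥0∞)⁻¹ ^ (2 * q - 4 - 2 * (q / p)) := ⟨_, rfl⟩
  obtain ⟨P, hP⟩ : ∃ x, x = (∫⁻ w, ‖f w‖ₑ ^ p) ^ (q / p) := ⟨_, rfl⟩
  have hf2 := memLp_two_of_hbox hp hf hS
  have hInt : ∀ S : Set (ℂ × ℂ), MeasurableSet S → Integrable (S.indicator f) := fun S hSm =>
    (integrable_of_hbox hf2 hS).indicator hSm
  have hmeas : ∀ S : Set (ℂ × ℂ), MeasurableSet S → Measurable fun z : ℂ × ℂ × ℂ => EE (S.indicator f) z.1 z.2 :=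
    fun S hSm => (continuous_EE_comp (hInt S hSm)).measurable
  set S₁ : Fin K × Fin K → Set (ℂ × ℂ) := fun i => {w | cellIdx K w.1 = i} with hS₁
  set S₂ : Fin K × Fin K → Set (ℂ × ℂ) := fun i => {w | cellIdx K w.2 = i} with hS₂
  have hm₁ : ∀ i, MeasurableSet (S₁ i) := fun i =>
    ((measurable_cellIdx K).comp measurable_fst) (measurableSet_singleton i)
  have hm₂ : ∀ i, MeasurableSet (S₂ i) := fun i =>
    ((measurable_cellIdx K).comp measurable_snd) (measurableSet_singleton i)
  have e₁ : ∀ i (z : ℂ × ℂ × ℂ), ∑ j, EE ((cellProd K i j).indicator f) z.1 z.2 = EE ((S₁ i).indicator f) z.1 z.2 := by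
    intro i z
    rw [← EE_sum _ fun j _ => hInt _ (measurableSet_cellProd K i j)]
    congr 1
    funext w
    rw [← sum_indicator_fiber (fun w : ℂ × ℂ => cellIdx K w.2) ((S₁ i).indicator f) w]
    refine Finset.sum_congr rfl fun j _ => ?_
    rw [Set.indicator_indicator]
    congr 1
    ext w
    simp [cellProd, hS₁, and_comm]
  have e₂ : ∀ j (z : ℂ × ℂ × ℂ), ∑ i, EE ((cellProd K i j).indicator f) z.1 z.2 = EE ((S₂ j).indicator f) z.1 z.2 := by
    intro j z
    rw [← EE_sum _ fun i _ => hInt _ (measurableSet_cellProd K i j)]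
    congr 1
    funext w
    rw [← sum_indicator_fiber (fun w : ℂ × ℂ => cellIdx K w.1) ((S₂ j).indicator f) w]
    refine Finset.sum_congr rfl fun i _ => ?_
    rw [Set.indicator_indicator]
    congr 1
    ext w
    simp [cellProd, hS₂]
  have e₀ : ∀ z : ℂ × ℂ × ℂ, EE f z.1 z.2 = ∑ i, ∑ j, EE ((cellProd K i j).indicator f) z.1 z.2 := by
    intro z
    simp_rw [e₁]
    rw [← EE_sum _ fun i _ => hInt _ (hm₁ i)]
    congr 1
    funext w
    exact (sum_indicator_fiber (fun w : ℂ × ℂ => cellIdx K w.1) f w).symm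
  have i₁ := hL.sum_fiber hp hpq K hf hS (g := fun w : ℂ × ℂ => cellIdx K w.1) hm₁ fun i => Or.inl ⟨i, fun w hw => hw⟩
  have i₂ := hL.sum_fiber hp hpq K hf hS (g := fun w : ℂ × ℂ => cellIdx K w.2) hm₂ fun i => Or.inr ⟨i, fun w hw => hw⟩
  have i₃ := hL.sum_fiber hp hpq K hf hS (g := fun w : ℂ × ℂ => (cellIdx K w.1, cellIdx K w.2))
    (fun i => measurableSet_cellProd K i.1 i.2) fun i => Or.inl ⟨i.1, fun w hw => congrArg Prod.fst hw⟩
  replace i₃ : ∫⁻ z : ℂ × ℂ × ℂ in Metric.closedBall 0 T ×ˢ Set.univ, ∑ i, ∑ j,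
      ‖EE ((cellProd K i j).indicator f) z.1 z.2‖ₑ ^ q ≤ (K : ℝ≥0∞)⁻¹ ^ (2 * q - 4 - 2 * (q / p)) * A *
        (∫⁻ w, ‖f w‖ₑ ^ p) ^ (q / p) := by
    refine (lintegral_congr fun z => ?_).trans_le i₃
    exact (Fintype.sum_prod_type' fun i j => ‖EE ((cellProd K i j).indicator f) z.1 z.2‖ₑ ^ q).symm
  set X : Set (ℂ × ℂ × ℂ) := Metric.closedBall 0 T ×ˢ Set.univ with hX
  have m₁ : Measurable fun z : ℂ × ℂ × ℂ => ∑ i, ‖EE ((S₁ i).indicator f) z.1 z.2‖ₑ ^ q :=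
    Finset.measurable_fun_sum _ fun i _ => (hmeas _ (hm₁ i)).enorm.pow_const q
  have m₂ : Measurable fun z : ℂ × ℂ × ℂ => ∑ i, ‖EE ((S₂ i).indicator f) z.1 z.2‖ₑ ^ q :=
    Finset.measurable_fun_sum _ fun i _ => (hmeas _ (hm₂ i)).enorm.pow_const q
  have m₃ : Measurable fun z : ℂ × ℂ × ℂ => ∑ i, ∑ j, ‖EE ((cellProd K i j).indicator f) z.1 z.2‖ₑ ^ q :=
    Finset.measurable_fun_sum _ fun i _ => Finset.measurable_fun_sum _ fun j _ =>
      (hmeas _ (measurableSet_cellProd K i j)).enorm.pow_const q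
  have m₄ : ∀ i j i' j', Measurable fun z : ℂ × ℂ × ℂ => if ¬ nearIdx K i i' ∧ ¬ nearIdx K j j' then
      ‖EE ((cellProd K i j).indicator f) z.1 z.2 * EE ((cellProd K i' j').indicator f) z.1 z.2‖ₑ ^ (q / 2) else 0 := by
    intro i j i' j'
    split_ifs
    · exact ((hmeas _ (measurableSet_cellProd K i j)).mul (hmeas _ (measurableSet_cellProd K i' j'))).enorm.pow_const _
    · exact measurable_const
  have i₄ : ∫⁻ z : ℂ × ℂ × ℂ in X, ∑ i, ∑ j, ∑ i', ∑ j', (if ¬ nearIdx K i i' ∧ ¬ nearIdx K j j' then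
      ‖EE ((cellProd K i j).indicator f) z.1 z.2 * EE ((cellProd K i' j').indicator f) z.1 z.2‖ₑ ^ (q / 2) else 0) ≤
      (∑ i, ∑ j, ∑ i', ∑ j', B i j i' j') * P := by
    rw [lintegral_finsetSum _ fun i _ => Finset.measurable_fun_sum _ fun j _ => Finset.measurable_fun_sum _ fun i' _ =>
      Finset.measurable_fun_sum _ fun j' _ => m₄ i j i' j', Finset.sum_mul]
    refine Finset.sum_le_sum fun i _ => ?_
    rw [lintegral_finsetSum _ fun j _ => Finset.measurable_fun_sum _ fun i' _ =>
      Finset.measurable_fun_sum _ fun j' _ => m₄ i j i' j', Finset.sum_mul]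
    refine Finset.sum_le_sum fun j _ => ?_
    rw [lintegral_finsetSum _ fun i' _ => Finset.measurable_fun_sum _ fun j' _ => m₄ i j i' j', Finset.sum_mul]
    refine Finset.sum_le_sum fun i' _ => ?_
    rw [lintegral_finsetSum _ fun j' _ => m₄ i j i' j', Finset.sum_mul]
    refine Finset.sum_le_sum fun j' _ => ?_
    rw [hP]
    exact (setLIntegral_le_lintegral _ _).trans (hB2 i j i' j' f hf hS)
  rw [← hκ, ← hP] at i₁ i₂ i₃
  rw [← hκ, ← hC₁, ← hN', ← hP]
  rw [← hC₁] at hC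
  rw [← hN'] at hN
  calc ∫⁻ z : ℂ × ℂ × ℂ in X, ‖EE f z.1 z.2‖ₑ ^ q
      ≤ ∫⁻ z : ℂ × ℂ × ℂ in X, (C₁ * (∑ i, ‖EE ((S₁ i).indicator f) z.1 z.2‖ₑ ^ q +
          ∑ i, ‖EE ((S₂ i).indicator f) z.1 z.2‖ₑ ^ q + ∑ i, ∑ j, ‖EE ((cellProd K i j).indicator f) z.1 z.2‖ₑ ^ q) +
          N * ∑ i, ∑ j, ∑ i', ∑ j', (if ¬ nearIdx K i i' ∧ ¬ nearIdx K j j' then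
      ‖EE ((cellProd K i j).indicator f) z.1 z.2 * EE ((cellProd K i' j').indicator f) z.1 z.2‖ₑ ^ (q / 2) else 0)) := by
        refine lintegral_mono fun z => ?_
        have := enorm_sum_sum_rpow_le (nearIdx K) hcard (fun i j => EE ((cellProd K i j).indicator f) z.1 z.2)
          (by linarith : 1 ≤ q)
        rw [← e₀] at this
        simp_rw [e₁, e₂] at this
        rw [← hC₁, ← hN'] at this
        exact this
    _ ≤ C₁ * (κ * A * P + κ * A * P + κ * A * P) + N * ((∑ i, ∑ j, ∑ i', ∑ j', B i j i' j') * P) := by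
        exact lintegral_comb_le m₁ m₂ m₃ hC hN i₁ i₂ i₃ i₄
    _ = _ := by ring

theorem exists_nat_mul_inv_rpow_le {D : ℝ≥0∞} (hD : D ≠ ∞) {θ : ℝ} (hθ : 0 < θ) :
    ∃ K : ℕ, 7 ≤ K ∧ D * (3 * (K : ℝ≥0∞)⁻¹ ^ θ) ≤ 1 / 2 := by
  have h1 : Filter.Tendsto (fun K : ℕ => (K : ℝ≥0∞)⁻¹ ^ θ) Filter.atTop (nhds 0) := by
    have := (ENNReal.continuous_rpow_const (y := θ)).tendsto 0
    rw [ENNReal.zero_rpow_of_pos hθ] at this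
    exact this.comp ENNReal.tendsto_inv_nat_nhds_zero
  have h2 : Filter.Tendsto (fun K : ℕ => D * (3 * (K : ℝ≥0∞)⁻¹ ^ θ)) Filter.atTop (nhds 0) := by
    have := ENNReal.Tendsto.const_mul (ENNReal.Tendsto.const_mul h1 (Or.inr (by finiteness : (3 : ℝ≥0∞) ≠ ∞))) (Or.inr hD)
    simpa using this
  have h3 := (h2.eventually (ge_mem_nhds (show (0 : ℝ≥0∞) < 1 / 2 by simp))).and (Filter.eventually_ge_atTop 7)
  obtain ⟨K, a, b⟩ := h3.exists
  exact ⟨K, b, a⟩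

theorem lintegral_rpow_ne_top {α : Type*} [MeasurableSpace α] {μ : Measure α} {f : α → ℂ} {p : ℝ} (hp : 0 < p)
    (hf : MemLp f (ENNReal.ofReal p) μ) : ∫⁻ w, ‖f w‖ₑ ^ p ∂μ ≠ ∞ := by
  have := lintegral_rpow_enorm_lt_top_of_eLpNorm_lt_top (by simpa using hp) ENNReal.ofReal_ne_top hf.2
  rw [ENNReal.toReal_ofReal hp.le] at this
  exact this.ne

theorem exists_lin_base {p q : ℝ} (hp : 2 ≤ p) (hpq : p ≤ q) (T : ℝ) :
    ∃ A : ℝ≥0∞, A ≠ ∞ ∧ Lin p q (Metric.closedBall 0 T) A := by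
  obtain ⟨c, hc, hc2⟩ := exists_lintegral_sq_le hp
  obtain ⟨V, hV⟩ : ∃ x, x = volume (Metric.closedBall (0 : ℂ × ℂ) 1) := ⟨_, rfl⟩
  have hVt : V ≠ ∞ := hV ▸ measure_closedBall_lt_top.ne
  refine ⟨(V * c) ^ ((q - 2) / 2) * (volume (Metric.closedBall (0 : ℂ) T) * c), ?_, fun f hf hS => ?_⟩
  · exact ENNReal.mul_ne_top (ENNReal.rpow_ne_top_of_nonneg (by linarith) (by finiteness))
      (ENNReal.mul_ne_top measure_closedBall_lt_top.ne hc)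
  have hf2 := memLp_two_of_hbox hp hf hS
  have hfi := integrable_of_hbox hf2 hS
  have h2 := hc2 f hf.1 hS
  obtain ⟨P, hP⟩ : ∃ x, x = ∫⁻ w, ‖f w‖ₑ ^ p := ⟨_, rfl⟩
  rw [← hP] at h2 ⊢
  have h1 : (∫⁻ w, ‖f w‖ₑ) ≤ (V * c * P ^ (2 / p)) ^ (1 / 2 : ℝ) := by
    have := lintegral_enorm_sq_le_of_near hf.1 (p := 0) (σ := 1) fun w hw => by
      simpa using hbox_subset (hS w hw)
    rw [one_div, ENNReal.le_rpow_inv_iff two_pos, ENNReal.rpow_two, mul_assoc, hV]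
    exact this.trans (by gcongr)
  have hpow : ∀ z : ℂ × ℂ × ℂ, ‖EE f z.1 z.2‖ₑ ^ q ≤
      ((V * c) ^ ((q - 2) / 2) * P ^ ((q - 2) / p)) * ‖EE f z.1 z.2‖ₑ ^ 2 := by
    intro z
    calc ‖EE f z.1 z.2‖ₑ ^ q = ‖EE f z.1 z.2‖ₑ ^ (q - 2) * ‖EE f z.1 z.2‖ₑ ^ 2 := by
          rw [← ENNReal.rpow_two, ← ENNReal.rpow_add_of_nonneg _ _ (by linarith) zero_le_two, sub_add_cancel]
      _ ≤ ((V * c * P ^ (2 / p)) ^ (1 / 2 : ℝ)) ^ (q - 2) * ‖EE f z.1 z.2‖ₑ ^ 2 := by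
          exact mul_le_mul_left (ENNReal.rpow_le_rpow ((enorm_EE_le f z.1 z.2).trans h1) (by linarith)) _
      _ = _ := by
          rw [← ENNReal.rpow_mul, ENNReal.mul_rpow_of_nonneg _ _ (by linarith : 0 ≤ 1 / 2 * (q - 2)), ← ENNReal.rpow_mul]
          congr 3 <;> ring
  calc _ ≤ ∫⁻ z : ℂ × ℂ × ℂ in Metric.closedBall 0 T ×ˢ Set.univ,
        ((V * c) ^ ((q - 2) / 2) * P ^ ((q - 2) / p)) * ‖EE f z.1 z.2‖ₑ ^ 2 := lintegral_mono hpow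
    _ = ((V * c) ^ ((q - 2) / 2) * P ^ ((q - 2) / p)) * (volume (Metric.closedBall (0 : ℂ) T) * ∫⁻ w, ‖f w‖ₑ ^ 2) := by
        rw [lintegral_const_mul _ ((continuous_EE_comp hfi).enorm.measurable.pow_const 2),
          lintegral_EE_sq_prod hf2 hfi]
    _ ≤ ((V * c) ^ ((q - 2) / 2) * P ^ ((q - 2) / p)) * (volume (Metric.closedBall (0 : ℂ) T) * (c * P ^ (2 / p))) := by
        gcongr
    _ = _ := by
        have e : P ^ (q / p) = P ^ ((q - 2) / p) * P ^ (2 / p) := by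
          rw [← ENNReal.rpow_add_of_nonneg _ _ (div_nonneg (by linarith) (by linarith)) (by positivity)]
          congr 1
          ring
        rw [e]
        ring

/-- The linear estimate for functions on the unit box, in the range `2 ≤ p ≤ q < 4`. -/
theorem exists_linear_hbox {p q : ℝ} (hp : 2 ≤ p) (hpq : p ≤ q) (hq : 10 / 3 < q) (q4 : q < 4)
    (h : 1 / p + 2 / q < 1) : ∃ C : ℝ≥0∞, C ≠ ∞ ∧ ∀ f : ℂ × ℂ → ℂ, MemLp f (ENNReal.ofReal p) →
      (∀ w, f w ≠ 0 → w ∈ hbox) → ∫⁻ z : ℂ × ℂ × ℂ, ‖EE f z.1 z.2‖ₑ ^ q ≤ C * (∫⁻ w, ‖f w‖ₑ ^ p) ^ (q / p) := by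
  have hθ : 0 < 2 * q - 4 - 2 * (q / p) := by
    have e : 2 * q - 4 - 2 * (q / p) = 2 * q * (1 - (1 / p + 2 / q)) := by
      field_simp
      ring
    rw [e]
    exact mul_pos (by linarith) (by linarith)
  have hD : (((272 ^ 2 : ℕ) : ℝ≥0∞) ^ 2 + (272 ^ 2 : ℕ) + 1) ^ q * 4 ^ (q - 1) ≠ ∞ :=
    ENNReal.mul_ne_top (ENNReal.rpow_ne_top_of_nonneg (by linarith) (by finiteness))
      (ENNReal.rpow_ne_top_of_nonneg (by linarith) (by finiteness))
  obtain ⟨K, hK, hK2⟩ := exists_nat_mul_inv_rpow_le hD hθ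
  have : NeZero K := ⟨by omega⟩
  obtain ⟨C, hC, hstep⟩ := exists_lin_step hp hpq hq q4 hK
  have hstep' : ∀ T A, Lin p q (Metric.closedBall 0 T) A → Lin p q (Metric.closedBall 0 T) (A / 2 + C) := by
    intro T A hA f hf hS
    refine (hstep T A hA f hf hS).trans ?_
    gcongr
    exact (mul_le_mul_left hK2 A).trans_eq (by rw [mul_comm, mul_one_div])
  have hiter : ∀ T A, Lin p q (Metric.closedBall 0 T) A → ∀ k : ℕ,
      Lin p q (Metric.closedBall 0 T) (A * (2⁻¹) ^ k + 2 * C) := by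
    intro T A hA k
    induction k with
    | zero => exact fun f hf hS => (hA f hf hS).trans (by gcongr; simp)
    | succ k ih =>
      have := hstep' T _ ih
      have e : (A * (2⁻¹) ^ k + 2 * C) / 2 + C = A * (2⁻¹) ^ (k + 1) + 2 * C := by
        rw [ENNReal.add_div, mul_comm 2 C, ENNReal.mul_div_cancel_right two_ne_zero (by finiteness), add_assoc,
          div_eq_mul_inv, pow_succ]
        ring
      rwa [e] at this
  have hT : ∀ T, Lin p q (Metric.closedBall 0 T) (2 * C) := by
    intro T f hf hS
    obtain ⟨A, hA, hL⟩ := exists_lin_base hp hpq T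
    have hlim : Filter.Tendsto (fun k : ℕ => (A * (2⁻¹) ^ k + 2 * C) * (∫⁻ w, ‖f w‖ₑ ^ p) ^ (q / p)) Filter.atTop
        (nhds ((A * 0 + 2 * C) * (∫⁻ w, ‖f w‖ₑ ^ p) ^ (q / p))) := by
      refine ENNReal.Tendsto.mul_const (Filter.Tendsto.add_const _ (ENNReal.Tendsto.const_mul ?_ (Or.inr hA))) (Or.inr ?_)
      · exact ENNReal.tendsto_pow_atTop_nhds_zero_of_lt_one (by simp)
      · refine ENNReal.rpow_ne_top_of_nonneg (div_nonneg (by linarith) (by linarith)) ?_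
        exact lintegral_rpow_ne_top (by linarith) hf
    have := ge_of_tendsto' hlim fun k => hiter T A hL k f hf hS
    simpa using this
  refine ⟨2 * C, by finiteness, fun f hf hS => ?_⟩
  rw [← setLIntegral_univ]
  have hU : (Set.univ : Set (ℂ × ℂ × ℂ)) = ⋃ n : ℕ, Metric.closedBall (0 : ℂ) n ×ˢ (Set.univ : Set (ℂ × ℂ)) := by
    rw [← Set.iUnion_prod_const, Metric.iUnion_closedBall_nat, Set.univ_prod_univ]
  have hmono : Monotone fun n : ℕ => Metric.closedBall (0 : ℂ) n ×ˢ (Set.univ : Set (ℂ × ℂ)) := fun a b hab =>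
    Set.prod_mono (Metric.closedBall_subset_closedBall (by exact_mod_cast hab)) le_rfl
  rw [hU, setLIntegral_iUnion_of_directed _ hmono.directed_le]
  exact iSup_le fun n => hT n f hf hS

theorem tsum_rpow_le (a : ℕ → ℝ≥0∞) {r : ℝ≥0∞} (h0 : r ≠ 0) (h1 : r ≠ ∞) {q : ℝ} (hq : 0 < q) :
    (∑' n, a n) ^ q ≤ (∑' n, r ^ n) ^ q * ∑' n, (r⁻¹ ^ n * a n) ^ q := by
  obtain ⟨M, hM⟩ : ∃ x, x = ∑' n, (r⁻¹ ^ n * a n) ^ q := ⟨_, rfl⟩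
  have key : ∀ n, a n ≤ r ^ n * M ^ (1 / q) := by
    intro n
    have h2 : (r⁻¹ ^ n * a n) ^ q ≤ M := hM ▸ ENNReal.le_tsum (f := fun n => (r⁻¹ ^ n * a n) ^ q) n
    have h3 : r⁻¹ ^ n * a n ≤ M ^ (1 / q) := by
      have := ENNReal.rpow_le_rpow h2 (by positivity : 0 ≤ 1 / q)
      rwa [← ENNReal.rpow_mul, mul_one_div_cancel hq.ne', ENNReal.rpow_one] at this
    calc a n = r ^ n * (r⁻¹ ^ n * a n) := by
          rw [← mul_assoc, ← mul_pow, ENNReal.mul_inv_cancel h0 h1, one_pow, one_mul]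
      _ ≤ _ := mul_le_mul_right h3 _
  calc (∑' n, a n) ^ q ≤ ((∑' n, r ^ n) * M ^ (1 / q)) ^ q := by
        rw [← ENNReal.tsum_mul_right]
        exact ENNReal.rpow_le_rpow (ENNReal.tsum_le_tsum key) hq.le
    _ = _ := by
        rw [ENNReal.mul_rpow_of_nonneg _ _ hq.le, ← ENNReal.rpow_mul, one_div_mul_cancel hq.ne', ENNReal.rpow_one, hM]

theorem lintegral_enorm_rpow_le_of_bound {g : ℂ × ℂ → ℂ} {E : Set (ℂ × ℂ)} {h : ℝ≥0∞} {r : ℝ} (hr : 0 < r)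
    (hE : MeasurableSet E) (hS : ∀ w, g w ≠ 0 → w ∈ E) (hg : ∀ w, ‖g w‖ₑ ≤ h) :
    ∫⁻ w, ‖g w‖ₑ ^ r ≤ h ^ r * volume E := by
  rw [← setLIntegral_const, ← lintegral_indicator hE]
  refine lintegral_mono fun w => ?_
  by_cases hw : w ∈ E
  · rw [Set.indicator_of_mem hw]
    exact ENNReal.rpow_le_rpow (hg w) hr.le
  · have : g w = 0 := by
      by_contra h'
      exact hw (hS w h')
    simp [this, hr]

theorem exists_level_bound {q p₀ q₀ : ℝ} (hp₀ : 2 ≤ p₀) (hpq : p₀ ≤ q₀) (hq₀ : 10 / 3 < q₀) (q4 : q₀ < 4)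
    (h₀ : 1 / p₀ + 2 / q₀ < 1) (hq : 4 ≤ q) :
    ∃ C : ℝ≥0∞, C ≠ ∞ ∧ ∀ (g : ℂ × ℂ → ℂ) (E : Set (ℂ × ℂ)) (h : ℝ≥0∞), h ≠ ∞ → AEStronglyMeasurable g volume →
      MeasurableSet E → E ⊆ hbox → (∀ w, g w ≠ 0 → w ∈ E) → (∀ w, ‖g w‖ₑ ≤ h) →
      ∫⁻ z : ℂ × ℂ × ℂ, ‖EE g z.1 z.2‖ₑ ^ q ≤ C * (h ^ q * volume E ^ (q - q₀ + q₀ / p₀)) := by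
  obtain ⟨C, hC, hL⟩ := exists_linear_hbox hp₀ hpq hq₀ q4 h₀
  refine ⟨C, hC, fun g E h hh hgm hE hEb hS hg => ?_⟩
  have hV : volume E ≠ ∞ := ((measure_mono hEb).trans_lt (lt_top_iff_ne_top.mpr volume_hbox_ne_top)).ne
  have hp0 : 0 < p₀ := by linarith
  have hP := lintegral_enorm_rpow_le_of_bound hp0 hE hS hg
  have hPtop : h ^ p₀ * volume E ≠ ∞ := ENNReal.mul_ne_top (ENNReal.rpow_ne_top_of_nonneg hp0.le hh) hV
  have hmem : MemLp g (ENNReal.ofReal p₀) := by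
    refine ⟨hgm, lt_of_le_of_lt (b := (h ^ p₀ * volume E) ^ (1 / p₀)) ?_ ?_⟩
    · rw [eLpNorm_ofReal_le_iff hp0, ← ENNReal.rpow_mul, one_div_mul_cancel hp0.ne', ENNReal.rpow_one]
      exact hP
    · exact lt_top_iff_ne_top.mpr (ENNReal.rpow_ne_top_of_nonneg (by positivity) hPtop)
  have h1 : ∀ z : ℂ × ℂ × ℂ, ‖EE g z.1 z.2‖ₑ ≤ h * volume E := fun z =>
    (enorm_EE_le g z.1 z.2).trans (by simpa using lintegral_enorm_rpow_le_of_bound one_pos hE hS hg)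
  have hgi : Integrable g := integrable_of_hbox (memLp_two_of_hbox hp₀ hmem fun w hw => hEb (hS w hw))
    fun w hw => hEb (hS w hw)
  calc _ ≤ ∫⁻ z : ℂ × ℂ × ℂ, (h * volume E) ^ (q - q₀) * ‖EE g z.1 z.2‖ₑ ^ q₀ := by
        refine lintegral_mono fun z => ?_
        calc ‖EE g z.1 z.2‖ₑ ^ q = ‖EE g z.1 z.2‖ₑ ^ (q - q₀) * ‖EE g z.1 z.2‖ₑ ^ q₀ := by
              rw [← ENNReal.rpow_add_of_nonneg _ _ (by linarith) (by linarith), sub_add_cancel]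
          _ ≤ _ := mul_le_mul_left (ENNReal.rpow_le_rpow (h1 z) (by linarith)) _
    _ = (h * volume E) ^ (q - q₀) * ∫⁻ z : ℂ × ℂ × ℂ, ‖EE g z.1 z.2‖ₑ ^ q₀ :=
        lintegral_const_mul _ ((continuous_EE_comp hgi).enorm.measurable.pow_const q₀)
    _ ≤ (h * volume E) ^ (q - q₀) * (C * (h ^ p₀ * volume E) ^ (q₀ / p₀)) := by
        refine mul_le_mul_right ((hL g hmem fun w hw => hEb (hS w hw)).trans (mul_le_mul_right ?_ C)) _
        exact ENNReal.rpow_le_rpow hP (div_nonneg (by linarith) hp0.le)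
    _ = _ := by
        have hd : 0 ≤ q₀ / p₀ := div_nonneg (by linarith) hp0.le
        rw [ENNReal.mul_rpow_of_nonneg _ _ (by linarith : 0 ≤ q - q₀), ENNReal.mul_rpow_of_nonneg _ _ hd,
          ← ENNReal.rpow_mul, mul_div_cancel₀ _ hp0.ne', ENNReal.rpow_add_of_nonneg _ _ (by linarith) hd]
        have : h ^ q = h ^ (q - q₀) * h ^ q₀ := by
          rw [← ENNReal.rpow_add_of_nonneg _ _ (by linarith) (by linarith), sub_add_cancel]
        rw [this]
        ring

theorem EE_eq_tsum {f : ℂ × ℂ → ℂ} (hf : Integrable f) {E : ℕ → Set (ℂ × ℂ)} (hE : ∀ n, MeasurableSet (E n))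
    (hd : Pairwise (Function.onFun Disjoint E)) (hU : ⋃ n, E n = Set.univ) (c : ℂ) (y : ℂ × ℂ) :
    EE f c y = ∑' n, EE ((E n).indicator f) c y := by
  have hi := integrable_ee_mul hf c y
  have := integral_iUnion hE hd (f := fun w => ee (ph c y w) * f w) (μ := volume) hi.integrableOn
  rw [hU, setIntegral_univ] at this
  rw [EE, this]
  refine tsum_congr fun n => ?_
  rw [EE, ← integral_indicator (hE n)]
  congr 1
  ext w
  by_cases hw : w ∈ E n <;> simp [hw]

theorem measurableSet_hbox : MeasurableSet hbox := by
  have : MeasurableSet hsq := by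
    unfold hsq
    measurability
  exact this.prod this

/-- The level set of `f` between consecutive dyadic multiples of `lam`. -/
def levelSet (f : ℂ × ℂ → ℂ) (lam : ℝ≥0∞) : ℕ → Set (ℂ × ℂ) :=
  disjointed fun n => {w | ‖f w‖ₑ ≤ lam * 2 ^ n}

theorem measurableSet_levelSet {f : ℂ × ℂ → ℂ} (hf : Measurable f) (lam : ℝ≥0∞) (n : ℕ) :
    MeasurableSet (levelSet f lam n) :=
  MeasurableSet.disjointed (fun _ => measurableSet_le hf.enorm measurable_const) n

theorem iUnion_levelSet (f : ℂ × ℂ → ℂ) {lam : ℝ≥0∞} (h0 : lam ≠ 0) (h1 : lam ≠ ∞) :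
    ⋃ n, levelSet f lam n = Set.univ := by
  rw [levelSet, iUnion_disjointed, Set.eq_univ_iff_forall]
  intro w
  obtain ⟨n, hn⟩ := ENNReal.exists_nat_gt (r := ‖f w‖ₑ / lam) (ENNReal.div_ne_top enorm_ne_top h0)
  refine Set.mem_iUnion.mpr ⟨n, ?_⟩
  have h2 : (n : ℝ≥0∞) ≤ 2 ^ n := by exact_mod_cast n.lt_two_pow_self.le
  have := (ENNReal.div_le_iff h0 h1).mp (hn.le.trans h2)
  simpa [mul_comm] using this

theorem enorm_le_of_mem_levelSet {f : ℂ × ℂ → ℂ} {lam : ℝ≥0∞} {n : ℕ} {w : ℂ × ℂ} (h : w ∈ levelSet f lam n) :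
    ‖f w‖ₑ ≤ lam * 2 ^ n := disjointed_subset _ n h

theorem volume_levelSet_le {f : ℂ × ℂ → ℂ} (hf : Measurable f) {p : ℝ} (hp : 0 < p) {lam : ℝ≥0∞} (h0 : lam ≠ 0)
    (h1 : lam ≠ ∞) (hP : ∫⁻ w, ‖f w‖ₑ ^ p ≤ lam ^ p) (n : ℕ) :
    volume (levelSet f lam n ∩ hbox) ≤ (2 ^ p + volume hbox) * ((2 : ℝ≥0∞) ^ p)⁻¹ ^ n := by
  cases n with
  | zero => exact (measure_mono Set.inter_subset_right).trans (by simp)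
  | succ n =>
    have h2 : levelSet f lam (n + 1) ∩ hbox ⊆ {w | (lam * 2 ^ n) ^ p ≤ ‖f w‖ₑ ^ p} := by
      rintro w ⟨hw, -⟩
      refine ENNReal.rpow_le_rpow ?_ hp.le
      by_contra! h
      rw [levelSet, disjointed_apply] at hw
      refine hw.2 ?_
      simp only [Finset.sup_eq_iSup, Set.iSup_eq_iUnion, Set.mem_iUnion]
      exact ⟨n, by simp, h.le⟩
    have hne : (lam * 2 ^ n) ^ p ≠ 0 := by
      simp [ENNReal.rpow_eq_zero_iff, h0, hp.not_gt]
    have hnt : (lam * 2 ^ n) ^ p ≠ ∞ := ENNReal.rpow_ne_top_of_nonneg hp.le (by finiteness)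
    calc _ ≤ (∫⁻ w, ‖f w‖ₑ ^ p) / (lam * 2 ^ n) ^ p :=
          (measure_mono h2).trans (meas_ge_le_lintegral_div (hf.enorm.pow_const p).aemeasurable hne hnt)
      _ ≤ lam ^ p / (lam * 2 ^ n) ^ p := by gcongr
      _ = ((2 : ℝ≥0∞) ^ p)⁻¹ ^ n := by
          have hl0 : lam ^ p ≠ 0 := by simp [ENNReal.rpow_eq_zero_iff, h0, h1]
          have hl1 : lam ^ p ≠ ∞ := ENNReal.rpow_ne_top_of_nonneg hp.le h1
          rw [ENNReal.mul_rpow_of_nonneg _ _ hp.le, ENNReal.div_eq_inv_mul,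
            ENNReal.mul_inv (Or.inl hl0) (Or.inl hl1), mul_right_comm, ENNReal.inv_mul_cancel hl0 hl1, one_mul,
            ← ENNReal.inv_pow]
          congr 1
          rw [← ENNReal.rpow_natCast, ← ENNReal.rpow_natCast, ← ENNReal.rpow_mul, ← ENNReal.rpow_mul, mul_comm]
      _ ≤ (2 ^ p + volume hbox) * ((2 : ℝ≥0∞) ^ p)⁻¹ ^ (n + 1) := by
          have h3 : (2 : ℝ≥0∞) ^ p ≠ 0 := by simp [ENNReal.rpow_eq_zero_iff]
          have h4 : (2 : ℝ≥0∞) ^ p ≠ ∞ := ENNReal.rpow_ne_top_of_nonneg hp.le (by finiteness)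
          calc _ = 2 ^ p * ((2 : ℝ≥0∞) ^ p)⁻¹ ^ (n + 1) := by
                rw [pow_succ', ← mul_assoc, ENNReal.mul_inv_cancel h3 h4, one_mul]
            _ ≤ _ := by gcongr; exact le_self_add

theorem exists_linear_hbox_large {q p : ℝ} (hp : 1 ≤ p) (hq : 4 ≤ q) (h : 1 / p + 2 / q < 1) :
    ∃ C : ℝ≥0∞, C ≠ ∞ ∧ ∀ f : ℂ × ℂ → ℂ, Measurable f → (∀ w, f w ≠ 0 → w ∈ hbox) → MemLp f (ENNReal.ofReal p) →
      Integrable f →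
      ∫⁻ z : ℂ × ℂ × ℂ, ‖EE f z.1 z.2‖ₑ ^ q ≤ C * (∫⁻ w, ‖f w‖ₑ ^ p) ^ (q / p) := by
  have hp0 : 0 < p := by linarith
  have hq0 : 0 < q := by linarith
  have hκ : 0 < q - 2 - q / p := by
    have e : q - 2 - q / p = q * (1 - (1 / p + 2 / q)) := by
      field_simp
      ring
    rw [e]
    exact mul_pos hq0 (by linarith)
  obtain ⟨e, hpe, C, hC, hL⟩ : ∃ e : ℝ, q < p * e ∧ ∃ C : ℝ≥0∞, C ≠ ∞ ∧
      ∀ (g : ℂ × ℂ → ℂ) (E : Set (ℂ × ℂ)) (h : ℝ≥0∞), h ≠ ∞ → AEStronglyMeasurable g volume →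
      MeasurableSet E → E ⊆ hbox → (∀ w, g w ≠ 0 → w ∈ E) → (∀ w, ‖g w‖ₑ ≤ h) →
      ∫⁻ z : ℂ × ℂ × ℂ, ‖EE g z.1 z.2‖ₑ ^ q ≤ C * (h ^ q * volume E ^ e) := by
    obtain ⟨ε, h1, h2, h3⟩ : ∃ ε : ℝ, 0 < ε ∧ ε ≤ 1 / 11 ∧ ε ≤ (q - 2 - q / p) / 11 :=
      ⟨min (1 / 11) ((q - 2 - q / p) / 11), by positivity, min_le_left _ _, min_le_right _ _⟩
    have hd : 0 < 5 / 11 - ε := by linarith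
    refine ⟨q - 11 / 3 + 11 / 3 / (5 / 11 - ε)⁻¹, ?_, ?_⟩
    · rw [div_inv_eq_mul]
      have : q / p < q - 11 / 3 + 11 / 3 * (5 / 11 - ε) := by linarith
      rwa [div_lt_iff₀' hp0] at this
    · refine exists_level_bound ?_ ?_ (by norm_num) (by norm_num) ?_ hq
      · rw [le_inv_comm₀ two_pos hd]; linarith
      · rw [inv_le_comm₀ hd (by norm_num)]; linarith
      · rw [one_div, inv_inv]; linarith
  have he : 0 < e := pos_of_mul_pos_right (hq0.trans hpe) hp0.le
  obtain ⟨δ, hδ⟩ : ∃ δ, δ = (p * e - q) / (2 * q) := ⟨_, rfl⟩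
  have hδ0 : 0 < δ := hδ ▸ div_pos (by linarith) (by linarith)
  have hδq : q - p * e + δ * q = -(δ * q) := by
    have : 2 * (δ * q) = p * e - q := by rw [hδ]; field_simp
    linarith
  obtain ⟨r, hr⟩ : ∃ r : ℝ≥0∞, r = 2 ^ (-δ) := ⟨_, rfl⟩
  have hr0 : r ≠ 0 := by simp [hr, ENNReal.rpow_eq_zero_iff]
  have hr1 : r < 1 := hr ▸ ENNReal.rpow_lt_one_of_one_lt_of_neg (by norm_num) (by linarith)
  have hrt : r ≠ ∞ := (hr1.trans ENNReal.one_lt_top).ne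
  obtain ⟨c, hc⟩ : ∃ c, c = 2 ^ p + volume hbox := ⟨_, rfl⟩
  have hct : c ≠ ∞ := hc ▸ ENNReal.add_ne_top.mpr
    ⟨ENNReal.rpow_ne_top_of_nonneg hp0.le (by finiteness), volume_hbox_ne_top⟩
  have hgeo : ∀ x : ℝ≥0∞, x < 1 → ∑' n, x ^ n ≠ ∞ := fun x hx => by
    rw [ENNReal.tsum_geometric]
    exact ENNReal.inv_ne_top.mpr (tsub_pos_of_lt hx).ne'
  refine ⟨(∑' n, r ^ n) ^ q * (C * c ^ e * ∑' n, (r ^ q) ^ n), ?_, fun f hfm hS hf hfi => ?_⟩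
  · have h1 := ENNReal.rpow_ne_top_of_nonneg hq0.le (hgeo r hr1)
    have h2 := hgeo (r ^ q) (ENNReal.rpow_lt_one hr1 hq0)
    have h3 := ENNReal.rpow_ne_top_of_nonneg he.le hct
    exact ENNReal.mul_ne_top h1 (ENNReal.mul_ne_top (ENNReal.mul_ne_top hC h3) h2)
  obtain ⟨P, hP⟩ : ∃ P, P = ∫⁻ w, ‖f w‖ₑ ^ p := ⟨_, rfl⟩
  have hPt : P ≠ ∞ := hP ▸ lintegral_rpow_ne_top hp0 hf
  rw [← hP]
  by_cases hP0 : P = 0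
  · rw [hP0, eq_comm, lintegral_eq_zero_iff (hfm.enorm.pow_const p)] at hP
    have h0 : f =ᵐ[volume] fun _ => 0 := by
      filter_upwards [hP] with w hw
      simpa [hp0, hp0.not_gt] using hw
    have : ∀ z : ℂ × ℂ × ℂ, EE f z.1 z.2 = 0 := fun z => by
      rw [EE_congr_ae h0]
      simp [EE]
    simp [this, hq0]
  obtain ⟨lam, hlam⟩ : ∃ x, x = P ^ (1 / p) := ⟨_, rfl⟩
  have hl0 : lam ≠ 0 := by simp [hlam, ENNReal.rpow_eq_zero_iff, hP0, hPt]
  have hlt : lam ≠ ∞ := hlam ▸ ENNReal.rpow_ne_top_of_nonneg (by positivity) hPt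
  have hlp : lam ^ p = P := by rw [hlam, ← ENNReal.rpow_mul, one_div_mul_cancel hp0.ne', ENNReal.rpow_one]
  have hlq : lam ^ q = P ^ (q / p) := by
    rw [hlam, ← ENNReal.rpow_mul]
    congr 1
    ring
  have hEm := measurableSet_levelSet hfm lam
  have hterm : ∀ n, ∫⁻ z : ℂ × ℂ × ℂ, (r⁻¹ ^ n * ‖EE ((levelSet f lam n).indicator f) z.1 z.2‖ₑ) ^ q ≤
      C * c ^ e * P ^ (q / p) * (r ^ q) ^ n := by
    intro n
    have h1 := hL ((levelSet f lam n).indicator f) (levelSet f lam n ∩ hbox) (lam * 2 ^ n) (by finiteness)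
      (hfm.indicator (hEm n)).aestronglyMeasurable ((hEm n).inter measurableSet_hbox)
      Set.inter_subset_right (fun w hw => ⟨(mem_of_indicator_ne_zero hw).1, hS w (mem_of_indicator_ne_zero hw).2⟩)
      (fun w => by
        by_cases hw : w ∈ levelSet f lam n
        · simpa [hw] using enorm_le_of_mem_levelSet hw
        · simp [hw])
    have h2 := volume_levelSet_le hfm hp0 hl0 hlt (hP.symm.trans hlp.symm).le n
    rw [← hc] at h2
    calc _ = (r⁻¹ ^ n) ^ q * ∫⁻ z : ℂ × ℂ × ℂ, ‖EE ((levelSet f lam n).indicator f) z.1 z.2‖ₑ ^ q := by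
          rw [← lintegral_const_mul' _ _ (ENNReal.rpow_ne_top_of_nonneg hq0.le
            (ENNReal.pow_ne_top (ENNReal.inv_ne_top.mpr hr0)))]
          exact lintegral_congr fun z => ENNReal.mul_rpow_of_nonneg _ _ hq0.le
      _ ≤ (r⁻¹ ^ n) ^ q * (C * ((lam * 2 ^ n) ^ q * (c * ((2 : ℝ≥0∞) ^ p)⁻¹ ^ n) ^ e)) := by
          refine mul_le_mul_right (h1.trans (mul_le_mul_right (mul_le_mul_right ?_ _) _)) _
          exact ENNReal.rpow_le_rpow h2 he.le
      _ = _ := by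
          have e1 : (r⁻¹ ^ n) ^ q = (2 : ℝ≥0∞) ^ (δ * n * q) := by
            rw [hr, ← ENNReal.rpow_neg, neg_neg, ← ENNReal.rpow_natCast, ← ENNReal.rpow_mul, ← ENNReal.rpow_mul, mul_assoc]
          have e2 : ((2 : ℝ≥0∞) ^ n) ^ q = (2 : ℝ≥0∞) ^ (n * q) := by
            rw [← ENNReal.rpow_natCast, ← ENNReal.rpow_mul]
          have e3 : (((2 : ℝ≥0∞) ^ p)⁻¹ ^ n) ^ e = (2 : ℝ≥0∞) ^ (-p * n * e) := by
            rw [← ENNReal.rpow_neg, ← ENNReal.rpow_natCast, ← ENNReal.rpow_mul, ← ENNReal.rpow_mul, mul_assoc]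
          have e4 : (r ^ q) ^ n = (2 : ℝ≥0∞) ^ (-δ * q * n) := by
            rw [hr, ← ENNReal.rpow_natCast, ← ENNReal.rpow_mul, ← ENNReal.rpow_mul, mul_assoc]
          have e5 : (2 : ℝ≥0∞) ^ (-δ * q * n) = (2 : ℝ≥0∞) ^ (δ * n * q) * (2 : ℝ≥0∞) ^ (n * q) *
              (2 : ℝ≥0∞) ^ (-p * n * e) := by
            rw [← ENNReal.rpow_add _ _ two_ne_zero (by finiteness), ← ENNReal.rpow_add _ _ two_ne_zero (by finiteness)]
            congr 1
            linear_combination -(n : ℝ) * hδq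
          rw [ENNReal.mul_rpow_of_nonneg _ _ hq0.le, ENNReal.mul_rpow_of_nonneg _ _ he.le, e1, e2, e3, e4, e5, hlq]
          ring
  calc _ ≤ ∫⁻ z : ℂ × ℂ × ℂ, (∑' n, r ^ n) ^ q *
        ∑' n, (r⁻¹ ^ n * ‖EE ((levelSet f lam n).indicator f) z.1 z.2‖ₑ) ^ q := by
        refine lintegral_mono fun z => ?_
        refine le_trans (ENNReal.rpow_le_rpow ?_ hq0.le) (tsum_rpow_le _ hr0 hrt hq0)
        rw [EE_eq_tsum hfi hEm (disjoint_disjointed _) (iUnion_levelSet f hl0 hlt)]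
        exact enorm_tsum_le_tsum_enorm
    _ = (∑' n, r ^ n) ^ q * ∑' n, ∫⁻ z : ℂ × ℂ × ℂ,
        (r⁻¹ ^ n * ‖EE ((levelSet f lam n).indicator f) z.1 z.2‖ₑ) ^ q := by
        rw [lintegral_const_mul' _ _ (ENNReal.rpow_ne_top_of_nonneg hq0.le (hgeo r hr1)), lintegral_tsum]
        intro n
        have hm : Measurable fun z : ℂ × ℂ × ℂ => ‖EE ((levelSet f lam n).indicator f) z.1 z.2‖ₑ :=
          (continuous_EE_comp (hfi.indicator (hEm n))).enorm.measurable
        exact ((hm.const_mul _).pow_const q).aemeasurable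
    _ ≤ (∑' n, r ^ n) ^ q * ∑' n, C * c ^ e * P ^ (q / p) * (r ^ q) ^ n :=
        mul_le_mul_right (ENNReal.tsum_le_tsum hterm) _
    _ = _ := by
        rw [ENNReal.tsum_mul_left]
        ring

/-- The linear estimate for functions on the unit box in the full range of exponents. -/
theorem exists_linear_unit_box {q p : ℝ} (hp : 1 ≤ p) (hq : 10 / 3 < q) (h : 1 / p + 2 / q < 1) :
    ∃ C : ℝ≥0∞, C ≠ ∞ ∧ ∀ f : ℂ × ℂ → ℂ, MemLp f (ENNReal.ofReal p) → (∀ w, f w ≠ 0 → w ∈ hbox) →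
      ∫⁻ z : ℂ × ℂ × ℂ, ‖EE f z.1 z.2‖ₑ ^ q ≤ C * (∫⁻ w, ‖f w‖ₑ ^ p) ^ (q / p) := by
  have hp0 : 0 < p := by linarith
  have hmono : ∀ (f : ℂ × ℂ → ℂ) (r : ℝ), r ≤ p → MemLp f (ENNReal.ofReal p) → (∀ w, f w ≠ 0 → w ∈ hbox) →
      MemLp f (ENNReal.ofReal r) := fun f r hr hf hS =>
    hf.mono_exponent_of_measure_support_ne_top (s := hbox) (fun w hw => by
      by_contra h'
      exact hw (hS w h')) volume_hbox_ne_top (ENNReal.ofReal_le_ofReal hr)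
  by_cases q4 : q < 4
  · have hp2 : 2 ≤ p := by
      have h1 : 1 / 2 < 2 / q := by
        rw [div_lt_div_iff₀ two_pos (by linarith)]
        linarith
      have h2 : 1 / p < 1 / 2 := by linarith
      exact ((one_div_lt_one_div hp0 two_pos).mp h2).le
    obtain ⟨r, hr⟩ : ∃ r, r = min p q := ⟨_, rfl⟩
    have hr2 : 2 ≤ r := hr ▸ le_min hp2 (by linarith)
    have hrp : r ≤ p := hr ▸ min_le_left _ _
    have hrq : r ≤ q := hr ▸ min_le_right _ _
    have hr1 : 1 / r + 2 / q < 1 := by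
      rcases min_choice p q with h' | h'
      · rwa [hr, h']
      · rw [hr, h', ← add_div, div_lt_one (by linarith)]
        linarith
    obtain ⟨C, hC, hL⟩ := exists_linear_hbox hr2 hrq hq q4 hr1
    refine ⟨C * ((volume hbox ^ (1 / r - 1 / p)) ^ r) ^ (q / r), ?_, fun f hf hS => ?_⟩
    · refine ENNReal.mul_ne_top hC (ENNReal.rpow_ne_top_of_nonneg (div_nonneg (by linarith) (by linarith))
        (ENNReal.rpow_ne_top_of_nonneg (by linarith) (ENNReal.rpow_ne_top_of_nonneg ?_ volume_hbox_ne_top)))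
      exact sub_nonneg.mpr (one_div_le_one_div_of_le (by linarith) hrp)
    · refine (hL f (hmono f r hrp hf hS) hS).trans ?_
      rw [mul_assoc]
      refine mul_le_mul_right ?_ C
      have hd : 0 ≤ q / r := div_nonneg (by linarith) (by linarith)
      refine (ENNReal.rpow_le_rpow (lintegral_rpow_le_of_support hf.1 hS (by linarith) hrp) hd).trans_eq ?_
      rw [ENNReal.mul_rpow_of_nonneg _ _ hd, ← ENNReal.rpow_mul _ (r / p)]
      congr 2
      field_simp
  · obtain ⟨C, hC, hL⟩ := exists_linear_hbox_large hp (not_lt.mp q4) h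
    refine ⟨C, hC, fun f hf hS => ?_⟩
    have hfg : f =ᵐ[volume] hbox.indicator (hf.1.mk f) := by
      filter_upwards [hf.1.ae_eq_mk] with w hw
      by_cases hb : w ∈ hbox
      · rw [Set.indicator_of_mem hb, hw]
      · rw [Set.indicator_of_notMem hb]
        by_contra h'
        exact hb (hS w h')
    have hSg : ∀ w, hbox.indicator (hf.1.mk f) w ≠ 0 → w ∈ hbox := fun w hw => (mem_of_indicator_ne_zero hw).1
    have hg := (memLp_congr_ae hfg).mp hf
    have hg1 := hmono _ 1 hp hg hSg
    rw [ENNReal.ofReal_one, memLp_one_iff_integrable] at hg1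
    have := hL _ (hf.1.stronglyMeasurable_mk.measurable.indicator measurableSet_hbox) hSg hg hg1
    calc _ = ∫⁻ z : ℂ × ℂ × ℂ, ‖EE (hbox.indicator (hf.1.mk f)) z.1 z.2‖ₑ ^ q :=
          lintegral_congr fun z => by rw [EE_congr_ae hfg]
      _ ≤ _ := this
      _ = _ := by
          congr 2
          refine lintegral_congr_ae ?_
          filter_upwards [hfg] with w hw
          rw [hw]

/-- The linear estimate for functions supported in a fixed ball. -/
theorem exists_linear_ball {q p : ℝ} (hp : 1 ≤ p) (hq : 10 / 3 < q) (h : 1 / p + 2 / q < 1) {R : ℝ} (hR : 0 < R) :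
    ∃ C : ℝ≥0∞, C ≠ ∞ ∧ ∀ f : ℂ × ℂ → ℂ, MemLp f (ENNReal.ofReal p) →
      (∀ w, f w ≠ 0 → w ∈ Metric.closedBall 0 R) →
      ∫⁻ z : ℂ × ℂ × ℂ, ‖EE f z.1 z.2‖ₑ ^ q ≤ C * (∫⁻ w, ‖f w‖ₑ ^ p) ^ (q / p) := by
  obtain ⟨C, hC, hL⟩ := exists_linear_unit_box hp hq h
  have hp0 : 0 < p := by linarith
  have hq0 : 0 < q := by linarith
  obtain ⟨σ, hσ⟩ : ∃ σ : ℂ, σ = ((8 * R : ℝ) : ℂ) := ⟨_, rfl⟩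
  obtain ⟨β, hβ⟩ : ∃ β : ℂ, β = ⟨-R, -R⟩ := ⟨_, rfl⟩
  have hσ0 : σ ≠ 0 := by
    rw [hσ, Complex.ofReal_ne_zero]
    positivity
  obtain ⟨k, hk⟩ : ∃ k : ℝ≥0∞, k = ‖σ‖ₑ⁻¹ := ⟨_, rfl⟩
  have hkt : k ≠ ∞ := hk ▸ enorm_inv_ne_top hσ0
  refine ⟨(‖σ‖ₑ ^ 2 * ‖σ‖ₑ ^ 2) ^ q * (k ^ 4 * k ^ 4) * (C * (k ^ 2 * k ^ 2) ^ (q / p)), ?_, fun f hf hS => ?_⟩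
  · have h1 : (‖σ‖ₑ ^ 2 * ‖σ‖ₑ ^ 2) ^ q ≠ ∞ := ENNReal.rpow_ne_top_of_nonneg hq0.le (by finiteness)
    have h2 : (k ^ 2 * k ^ 2) ^ (q / p) ≠ ∞ := ENNReal.rpow_ne_top_of_nonneg (by positivity) (by finiteness)
    finiteness
  have hsq_mem : ∀ u : ℂ, ‖β + σ * u‖ ≤ R → u ∈ hsq := by
    intro u hu
    have h1 := (abs_le.mp ((Complex.abs_re_le_norm _).trans hu))
    have h2 := (abs_le.mp ((Complex.abs_im_le_norm _).trans hu))
    simp only [hβ, hσ, Complex.add_re, Complex.add_im, Complex.re_ofReal_mul, Complex.im_ofReal_mul] at h1 h2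
    refine ⟨⟨?_, ?_⟩, ?_, ?_⟩ <;> nlinarith
  have hg := memLp_comp_aff (β, β) (s := (σ, σ)) hσ0 hσ0 hf
  have hSg : ∀ w, f (aff (β, β) (σ, σ) w) ≠ 0 → w ∈ hbox := by
    intro w hw
    have := hS _ hw
    rw [mem_closedBall_zero_iff, Prod.norm_def, max_le_iff] at this
    exact ⟨hsq_mem _ this.1, hsq_mem _ this.2⟩
  have hgi : Integrable fun w => f (aff (β, β) (σ, σ) w) := by
    rw [← memLp_one_iff_integrable]
    refine hg.mono_exponent_of_measure_support_ne_top (s := hbox) (fun w hw => ?_) volume_hbox_ne_top ?_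
    · by_contra h'
      exact hw (hSg w h')
    · rw [← ENNReal.ofReal_one]
      exact ENNReal.ofReal_le_ofReal hp
  obtain ⟨Φ, hΦ⟩ : ∃ Φ : ℂ × ℂ × ℂ → ℝ≥0∞, Φ = fun z => ‖EE (fun w => f (aff (β, β) (σ, σ) w)) z.1 z.2‖ₑ ^ q :=
    ⟨_, rfl⟩
  have hΦm : Measurable Φ := hΦ ▸ (continuous_EE_comp hgi).enorm.measurable.pow_const q
  calc _ = ∫⁻ z : ℂ × ℂ × ℂ, (‖σ‖ₑ ^ 2 * ‖σ‖ₑ ^ 2) ^ q * Φ (gal 0 (β, β) (σ, σ) z) := by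
        refine lintegral_congr fun z => ?_
        rw [enorm_EE_gal 0 (β, β) (s := (σ, σ)) hσ0 hσ0, ENNReal.mul_rpow_of_nonneg _ _ hq0.le, hΦ, modu_zero_eq]
    _ = (‖σ‖ₑ ^ 2 * ‖σ‖ₑ ^ 2) ^ q * (k ^ 4 * k ^ 4 * ∫⁻ z, Φ z) := by
        rw [lintegral_const_mul' _ _ (ENNReal.rpow_ne_top_of_nonneg hq0.le (by finiteness)),
          lintegral_comp_gal 0 (β, β) (s := (σ, σ)) hσ0 hσ0 hΦm, hk]
    _ ≤ (‖σ‖ₑ ^ 2 * ‖σ‖ₑ ^ 2) ^ q * (k ^ 4 * k ^ 4 * (C * (k ^ 2 * k ^ 2 * ∫⁻ w, ‖f w‖ₑ ^ p) ^ (q / p))) := by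
        have h1 := hL _ hg hSg
        rw [lintegral_comp_aff (β, β) (s := (σ, σ)) hσ0 hσ0 fun w => ‖f w‖ₑ ^ p, ← hk] at h1
        rw [hΦ]
        exact mul_le_mul_right (mul_le_mul_right h1 _) _
    _ = _ := by
        rw [ENNReal.mul_rpow_of_nonneg _ _ (by positivity : 0 ≤ q / p)]
        ring

theorem exists_quadD_eq_mul {D : Matrix (Fin 2) (Fin 2) ℝ} (hD : D.IsSymm) (hdet : IsUnit D.det) :
    ∃ a b c d : ℂ, a * d - b * c ≠ 0 ∧
      ∀ z : Fin 2 → ℂ, quadD 2 D z = (a * z 0 + b * z 1) * (c * z 0 + d * z 1) := by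
  have h01 : D 1 0 = D 0 1 := hD.apply 0 1
  have hdet0 : ((D 0 0 : ℂ) * D 1 1 - D 0 1 * D 0 1) ≠ 0 := by
    have := hdet.ne_zero
    rw [Matrix.det_fin_two, h01] at this
    exact_mod_cast this
  have hquad : ∀ z : Fin 2 → ℂ, quadD 2 D z =
      (1 / 2 : ℂ) * (D 0 0 * z 0 ^ 2 + 2 * D 0 1 * z 0 * z 1 + D 1 1 * z 1 ^ 2) := by
    intro z
    simp only [quadD, Fin.sum_univ_two, h01]
    ring
  simp only [hquad]
  generalize (D 0 0 : ℂ) = α at *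
  generalize (D 0 1 : ℂ) = β at *
  generalize (D 1 1 : ℂ) = δ at *
  by_cases hα : α = 0
  · subst hα
    refine ⟨0, 1, β, δ / 2, ?_, fun z => by ring⟩
    intro h
    apply hdet0
    linear_combination β * h
  · obtain ⟨μ, hμ⟩ := IsAlgClosed.exists_pow_nat_eq (β * β - α * δ) two_pos
    have hμ0 : μ ≠ 0 := by
      rintro rfl
      apply hdet0
      linear_combination hμ
    refine ⟨α / 2, (β + μ) / 2, 1, (β - μ) / α, ?_, fun z => ?_⟩
    · have : α / 2 * ((β - μ) / α) - (β + μ) / 2 * 1 = -μ := by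
        field_simp
        ring
      rw [this]
      exact neg_ne_zero.mpr hμ0
    · have h2 : (β + μ) * (β - μ) = α * δ := by linear_combination -hμ
      field_simp
      linear_combination (-(z 1) ^ 2) * h2

theorem exists_map_volume_eq_smul {E F : Type*} [NormedAddCommGroup E] [NormedSpace ℝ E] [FiniteDimensional ℝ E]
    [MeasureSpace E] [BorelSpace E] [(volume : Measure E).IsAddHaarMeasure] [NormedAddCommGroup F] [NormedSpace ℝ F]
    [FiniteDimensional ℝ F] [MeasureSpace F] [BorelSpace F] [(volume : Measure F).IsAddHaarMeasure] (T : E ≃L[ℝ] F) :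
    ∃ k : ℝ≥0∞, k ≠ 0 ∧ k ≠ ∞ ∧ (volume : Measure E).map T = k • (volume : Measure F) := by
  have : ((volume : Measure E).map T).IsAddHaarMeasure := T.isAddHaarMeasure_map volume
  have : SecondCountableTopology F := secondCountable_of_proper
  refine ⟨Measure.addHaarScalarFactor ((volume : Measure E).map T) (volume : Measure F), ?_, ENNReal.coe_ne_top,
    Measure.isAddLeftInvariant_eq_smul _ _⟩
  exact ENNReal.coe_ne_zero.mpr (Measure.addHaarScalarFactor_pos_of_isAddHaarMeasure _ _).ne'

section coordinates

variable (a b c d e : ℂ) (he : (a * d - b * c) * e = 1)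

/-- The linear coordinates `(a z₀ + b z₁, c z₀ + d z₁)`. -/
def linCoord : (Fin 2 → ℂ) ≃L[ℝ] ℂ × ℂ :=
  LinearEquiv.toContinuousLinearEquiv
    { toFun := fun z => (a * z 0 + b * z 1, c * z 0 + d * z 1)
      map_add' := fun z w => by ext1 <;> simp <;> ring
      map_smul' := fun t z => by ext1 <;> simp <;> ring
      invFun := fun u => ![(d * u.1 - b * u.2) * e, (a * u.2 - c * u.1) * e]
      left_inv := fun z => by
        ext i
        fin_cases i
        · simp only [Fin.zero_eta, cons_val_zero]
          linear_combination z 0 * he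
        · simp only [Fin.mk_one, cons_val_one, cons_val_zero]
          linear_combination z 1 * he
      right_inv := fun u => by
        ext1
        · simp only [cons_val_zero, cons_val_one]
          linear_combination u.1 * he
        · simp only [cons_val_zero, cons_val_one]
          linear_combination u.2 * he }

/-- The dual coordinates to `linCoord`, with the last variable conjugated. -/
def dualCoord : ((Fin 2 → ℂ) × ℂ) ≃L[ℝ] ℂ × ℂ × ℂ :=
  LinearEquiv.toContinuousLinearEquiv
    { toFun := fun w => (star w.2, (d * star (w.1 0) - c * star (w.1 1)) * e,
        (a * star (w.1 1) - b * star (w.1 0)) * e)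
      map_add' := fun z w => by
        refine Prod.ext ?_ (Prod.ext ?_ ?_) <;> simp <;> ring
      map_smul' := fun t z => by
        refine Prod.ext ?_ (Prod.ext ?_ ?_) <;> simp <;> ring
      invFun := fun y => (![star (a * y.2.1 + c * y.2.2), star (b * y.2.1 + d * y.2.2)], star y.1)
      left_inv := fun w => by
        refine Prod.ext ?_ (by simp)
        ext i
        apply star_injective
        fin_cases i
        · simp only [Fin.zero_eta, cons_val_zero, star_star]
          linear_combination star (w.1 0) * he
        · simp only [Fin.mk_one, cons_val_one, cons_val_zero, star_star]
          linear_combination star (w.1 1) * he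
      right_inv := fun u => by
        refine Prod.ext ?_ (Prod.ext ?_ ?_)
        · simp
        · simp only [cons_val_zero, cons_val_one, star_star]
          linear_combination u.2.1 * he
        · simp only [cons_val_zero, cons_val_one, star_star]
          linear_combination u.2.2 * he }

theorem ph_dualCoord (w : (Fin 2 → ℂ) × ℂ) (z : Fin 2 → ℂ) :
    ph (dualCoord a b c d e he w).1 (dualCoord a b c d e he w).2 (linCoord a b c d e he z) =
      odot 2 w.1 z + odot1 w.2 ((a * z 0 + b * z 1) * (c * z 0 + d * z 1)) := by
  have e1 : ∀ x y : ℂ, x.re * y.re + x.im * y.im = (star x * y).re := fun x y => by simp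
  rw [odot, odot1, Fin.sum_univ_two, e1, e1, e1, ← Complex.add_re, ← Complex.add_re, ph]
  congr 1
  change (d * star (w.1 0) - c * star (w.1 1)) * e * (a * z 0 + b * z 1) +
    (a * star (w.1 1) - b * star (w.1 0)) * e * (c * z 0 + d * z 1) +
    star w.2 * ((a * z 0 + b * z 1) * (c * z 0 + d * z 1)) = _
  linear_combination (star (w.1 0) * z 0 + star (w.1 1) * z 1) * he

end coordinates

theorem lintegral_comp_of_map_eq_smul {E F : Type*} [MeasureSpace E] [MeasureSpace F] {T : E → F}
    (hT : MeasurableEmbedding T) {k : ℝ≥0∞} (h : (volume : Measure E).map T = k • (volume : Measure F))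
    (g : F → ℝ≥0∞) : ∫⁻ x, g (T x) = k * ∫⁻ y, g y := by
  rw [← hT.lintegral_map, h, lintegral_smul_measure, smul_eq_mul]

theorem extGamma_eq_smul_EE {D : Matrix (Fin 2) (Fin 2) ℝ} {a b c d e : ℂ} (he : (a * d - b * c) * e = 1)
    (hD : ∀ z : Fin 2 → ℂ, quadD 2 D z = (a * z 0 + b * z 1) * (c * z 0 + d * z 1)) {k : ℝ≥0∞}
    (hk : (volume : Measure (Fin 2 → ℂ)).map (linCoord a b c d e he) = k • volume) (f : (Fin 2 → ℂ) → ℂ)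
    (w : (Fin 2 → ℂ) × ℂ) :
    extGamma 2 D f w = k.toReal • EE (fun u => f ((linCoord a b c d e he).symm u)) (dualCoord a b c d e he w).1
      (dualCoord a b c d e he w).2 := by
  have hT : MeasurableEmbedding (linCoord a b c d e he) :=
    (linCoord a b c d e he).toHomeomorph.measurableEmbedding
  rw [EE, ← integral_smul_measure, ← hk, hT.integral_map, extGamma]
  refine integral_congr_ae (Filter.Eventually.of_forall fun z => ?_)
  beta_reduce
  rw [ph_dualCoord, ContinuousLinearEquiv.symm_apply_apply, hD, ee]

theorem exists_extGamma_bound {D : Matrix (Fin 2) (Fin 2) ℝ} (hDsymm : D.IsSymm) (hDinv : IsUnit D.det) {q p : ℝ}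
    (hp : 1 ≤ p) (hq : 10 / 3 < q) (hpq : 1 / p + 2 / q < 1) {B : Set (Fin 2 → ℂ)} (hB : Bornology.IsBounded B) :
    ∃ C : ℝ≥0∞, C ≠ ∞ ∧ ∀ f : (Fin 2 → ℂ) → ℂ, Function.support f ⊆ B → MemLp f (ENNReal.ofReal p) →
      ∫⁻ w, ‖extGamma 2 D f w‖ₑ ^ q ≤ C * (∫⁻ z, ‖f z‖ₑ ^ p) ^ (q / p) := by
  have hp0 : 0 < p := by linarith
  have hq0 : 0 < q := by linarith
  obtain ⟨a, b, c, d, hd, hD⟩ := exists_quadD_eq_mul hDsymm hDinv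
  obtain ⟨e, he⟩ : ∃ e, (a * d - b * c) * e = 1 := ⟨_, mul_inv_cancel₀ hd⟩
  obtain ⟨k, -, hk, hkT⟩ := exists_map_volume_eq_smul (linCoord a b c d e he)
  obtain ⟨k', -, hk', hkT'⟩ := exists_map_volume_eq_smul (linCoord a b c d e he).symm
  have : (volume : Measure ((Fin 2 → ℂ) × ℂ)).IsAddHaarMeasure :=
    Measure.prod.instIsAddHaarMeasure (volume : Measure (Fin 2 → ℂ)) (volume : Measure ℂ)
  have : (volume : Measure (ℂ × ℂ × ℂ)).IsAddHaarMeasure :=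
    Measure.prod.instIsAddHaarMeasure (volume : Measure ℂ) (volume : Measure (ℂ × ℂ))
  obtain ⟨s, -, hs, hsS⟩ := exists_map_volume_eq_smul (dualCoord a b c d e he)
  have hT' : MeasurableEmbedding (linCoord a b c d e he).symm :=
    (linCoord a b c d e he).symm.toHomeomorph.measurableEmbedding
  have hS : MeasurableEmbedding (dualCoord a b c d e he) :=
    (dualCoord a b c d e he).toHomeomorph.measurableEmbedding
  obtain ⟨R, hR, hBR⟩ : ∃ R, 0 < R ∧ ∀ z ∈ B, linCoord a b c d e he z ∈ Metric.closedBall 0 R := by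
    have h1 := (linCoord a b c d e he).toContinuousLinearMap.lipschitz.isBounded_image hB
    obtain ⟨R, hR, h2⟩ := h1.subset_closedBall_lt 0 0
    exact ⟨R, hR, fun z hz => h2 (Set.mem_image_of_mem _ hz)⟩
  obtain ⟨C, hC, hL⟩ := exists_linear_ball hp hq hpq hR
  refine ⟨k ^ q * (s * (C * k' ^ (q / p))), ?_, fun f hf hfp => ?_⟩
  · have h1 := ENNReal.rpow_ne_top_of_nonneg hq0.le hk
    have h2 := ENNReal.rpow_ne_top_of_nonneg (by positivity : 0 ≤ q / p) hk'
    finiteness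
  have hg : MemLp (fun u => f ((linCoord a b c d e he).symm u)) (ENNReal.ofReal p) := by
    have := hfp.smul_measure hk'
    rw [← hkT'] at this
    exact hT'.memLp_map_measure_iff.mp this
  have h1 := hL _ hg fun u hu => by
    simpa using hBR _ (hf hu)
  rw [lintegral_comp_of_map_eq_smul hT' hkT' fun z => ‖f z‖ₑ ^ p] at h1
  calc _ = ∫⁻ w, k ^ q * ‖EE (fun u => f ((linCoord a b c d e he).symm u)) (dualCoord a b c d e he w).1
        (dualCoord a b c d e he w).2‖ₑ ^ q := by
        refine lintegral_congr fun w => ?_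
        rw [extGamma_eq_smul_EE he hD hkT, enorm_smul, ENNReal.mul_rpow_of_nonneg _ _ hq0.le,
          Real.enorm_of_nonneg ENNReal.toReal_nonneg, ENNReal.ofReal_toReal hk]
    _ = k ^ q * (s * ∫⁻ z : ℂ × ℂ × ℂ, ‖EE (fun u => f ((linCoord a b c d e he).symm u)) z.1 z.2‖ₑ ^ q) := by
        rw [lintegral_const_mul' _ _ (ENNReal.rpow_ne_top_of_nonneg hq0.le hk),
          lintegral_comp_of_map_eq_smul hS hsS fun z : ℂ × ℂ × ℂ =>
            ‖EE (fun u => f ((linCoord a b c d e he).symm u)) z.1 z.2‖ₑ ^ q]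
    _ ≤ k ^ q * (s * (C * (k' * ∫⁻ z, ‖f z‖ₑ ^ p) ^ (q / p))) :=
        mul_le_mul_right (mul_le_mul_right h1 _) _
    _ = _ := by
        rw [ENNReal.mul_rpow_of_nonneg _ _ (by positivity : 0 ≤ q / p)]
        ring

theorem extGamma_eq_zero_of_not_aestronglyMeasurable {n : ℕ} {D : Matrix (Fin n) (Fin n) ℝ} {f : (Fin n → ℂ) → ℂ}
    (hf : ¬ AEStronglyMeasurable f volume) (w : (Fin n → ℂ) × ℂ) : extGamma n D f w = 0 := by
  refine integral_undef fun h => hf ?_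
  obtain ⟨φ, hφ⟩ : ∃ φ : (Fin n → ℂ) → ℝ, φ = fun z => odot n w.1 z + odot1 w.2 (quadD n D z) := ⟨_, rfl⟩
  have hc : Continuous φ := by
    rw [hφ]
    unfold odot odot1 quadD
    fun_prop
  have hc' : Continuous fun z => Complex.exp (-(2 * Real.pi * Complex.I * (φ z : ℂ))) := by fun_prop
  have h1 := hc'.aestronglyMeasurable.mul h.1
  refine h1.congr (Filter.Eventually.of_forall fun z => ?_)
  simp only [hφ, Pi.mul_apply]
  rw [← mul_assoc, ← Complex.exp_add, neg_add_cancel, Complex.exp_zero, one_mul]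

/-- **Theorem (linear restriction estimate for complex quadratic surfaces in
`ℂ³`).** Let `D` be a nonsingular real symmetric `2 × 2` matrix. For every
`q > 10/3` and `p` with `1/p + 2/q < 1`, and every bounded set `B ⊆ ℂ²`,
there is a constant `C` such that `‖E_γ f‖_{L^q(ℂ³)} ≤ C ‖f‖_{L^p(ℂ²)}` for
every `f` supported in `B`. -/
theorem linear_restriction_complex
    (D : Matrix (Fin 2) (Fin 2) ℝ) (hDsymm : D.IsSymm) (hDinv : IsUnit D.det)
    (q p : ℝ) (hp : 1 ≤ p) (hq : (10 : ℝ) / 3 < q)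
    (hpq : 1 / p + 2 / q < 1)
    (B : Set (Fin 2 → ℂ)) (hB : Bornology.IsBounded B) :
    ∃ C : ℝ, ∀ f : (Fin 2 → ℂ) → ℂ, Function.support f ⊆ B →
      eLpNorm (extGamma 2 D f) (ENNReal.ofReal q) volume ≤
        ENNReal.ofReal C * eLpNorm f (ENNReal.ofReal p) volume := by
  have hp0 : 0 < p := by linarith
  have hq0 : 0 < q := by linarith
  obtain ⟨C, hC, hL⟩ := exists_extGamma_bound hDsymm hDinv hp hq hpq hB
  have hC' : C ^ (1 / q) ≠ ∞ := ENNReal.rpow_ne_top_of_nonneg (by positivity) hC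
  refine ⟨(C ^ (1 / q) + 1).toReal, fun f hf => ?_⟩
  rw [ENNReal.ofReal_toReal (by finiteness)]
  by_cases hm : AEStronglyMeasurable f volume
  swap
  · have : extGamma 2 D f = 0 := funext (extGamma_eq_zero_of_not_aestronglyMeasurable hm)
    simp [this]
  by_cases ht : eLpNorm f (ENNReal.ofReal p) volume = ∞
  · rw [ht, ENNReal.mul_top (by simp)]
    exact le_top
  rw [eLpNorm_ofReal_le_iff hq0]
  have h1 := hL f hf ⟨hm, lt_top_iff_ne_top.mpr ht⟩
  have h2 : ∫⁻ z, ‖f z‖ₑ ^ p ≤ eLpNorm f (ENNReal.ofReal p) volume ^ p := (eLpNorm_ofReal_le_iff hp0).mp le_rfl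
  calc _ ≤ C * (eLpNorm f (ENNReal.ofReal p) volume ^ p) ^ (q / p) :=
        h1.trans (mul_le_mul_right (ENNReal.rpow_le_rpow h2 (by positivity)) _)
    _ = (C ^ (1 / q) * eLpNorm f (ENNReal.ofReal p) volume) ^ q := by
        rw [ENNReal.mul_rpow_of_nonneg _ _ hq0.le, ← ENNReal.rpow_mul, ← ENNReal.rpow_mul,
          one_div_mul_cancel hq0.ne', ENNReal.rpow_one, mul_div_cancel₀ _ hp0.ne']
    _ ≤ _ := ENNReal.rpow_le_rpow (mul_le_mul_left le_self_add _) hq0.le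

end
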